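/- Fix a smooth function χ₁ : ℝ → [0,1] with χ₁ = 1 on [−1,1] and support contained in (−2,2). Let κ ↦ H(κ) be a function defined for large κ such that ρ(κ) := H_{C3}(κ) − H(κ) satisfies ρ(κ) > 0 for all large κ and ρ(κ) → 0 as κ → ∞. Then there exist constants α > 0 and C > 0 such that for every κ > C and every minimizer (ψ, A) of the Ginzburg–Landau energy at (κ, H(κ)), ∫_{{x ∈ Ω : dist(x,∂Ω) < t₀}} χ₁(κ^{1/4}·t(x))² · e^{2α·√κ·K(s(x))} · |ψ(x)|² dx ≤ C·e^{C·ρ(κ)·√κ} · ∫_Ω |ψ(x)|² dx, where K(s) = k_max − k(s). -/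

import Mathlib

open MeasureTheory Filter Set Topology

noncomputable section

namespace SC

/-- The plane `ℝ²`. -/
abbrev Plane := ℝ × ℝ

/-- Squared Euclidean norm on the plane. -/
def esq (v : Plane) : ℝ := v.1 ^ 2 + v.2 ^ 2

/-- Euclidean dot product on the plane. -/
def dot2 (v w : Plane) : ℝ := v.1 * w.1 + v.2 * w.2

/-- The reference vector potential `F₀(x) = (-x₂/2, x₁/2)`, with `curl F₀ = 1`. -/
def F0 : Plane → Plane := fun x => (-x.2 / 2, x.1 / 2)

/-- `u` is of class `Cⁿ` on a neighborhood of the closure of `Ω`. -/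
def CNearCl {E : Type*} [NormedAddCommGroup E] [NormedSpace ℝ E]
    (n : ℕ) (Ω : Set Plane) (u : Plane → E) : Prop :=
  ∃ U : Set Plane, IsOpen U ∧ closure Ω ⊆ U ∧ ContDiffOn ℝ n u U

/-- The pointwise squared magnetic gradient `|(-i∇ - B·A)u|²`. -/
def magSq (B : ℝ) (A : Plane → Plane) (u : Plane → ℂ) (x : Plane) : ℝ :=
  ‖(-Complex.I) * fderiv ℝ u x ((1 : ℝ), (0 : ℝ)) - ((B * (A x).1 : ℝ) : ℂ) * u x‖ ^ 2 +
  ‖(-Complex.I) * fderiv ℝ u x ((0 : ℝ), (1 : ℝ)) - ((B * (A x).2 : ℝ) : ℂ) * u x‖ ^ 2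

/-- `curl A = ∂₁A₂ - ∂₂A₁`. -/
def curl2 (A : Plane → Plane) (x : Plane) : ℝ :=
  fderiv ℝ (fun y => (A y).2) x ((1 : ℝ), (0 : ℝ)) -
    fderiv ℝ (fun y => (A y).1) x ((0 : ℝ), (1 : ℝ))

/-- The variational ground state energy `λ₁(B·A)` of the magnetic Neumann Laplacian. -/
def lam1A (Ω : Set Plane) (B : ℝ) (A : Plane → Plane) : ℝ :=
  sInf { r : ℝ | ∃ u : Plane → ℂ, CNearCl 1 Ω u ∧ (∫ x in Ω, ‖u x‖ ^ 2) ≠ 0 ∧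
    r = (∫ x in Ω, magSq B A u x) / (∫ x in Ω, ‖u x‖ ^ 2) }

/-- `λ₁(B) = λ₁(B·F₀)`. -/
def lam1 (Ω : Set Plane) (B : ℝ) : ℝ := lam1A Ω B F0

/-- The Ginzburg–Landau energy functional. -/
def GLenergy (Ω : Set Plane) (κ H : ℝ) (ψ : Plane → ℂ) (A : Plane → Plane) : ℝ :=
  ∫ x in Ω, (magSq (κ * H) A ψ x - κ ^ 2 * ‖ψ x‖ ^ 2 + κ ^ 2 / 2 * ‖ψ x‖ ^ 4
    + κ ^ 2 * H ^ 2 * (curl2 A x - 1) ^ 2)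

/-- Admissible Ginzburg–Landau configurations. -/
def GLadm (Ω : Set Plane) (ψ : Plane → ℂ) (A : Plane → Plane) : Prop :=
  CNearCl 1 Ω ψ ∧ CNearCl 1 Ω A

/-- The normal state is a minimizer at `(κ, H)`. -/
def NormalMin (Ω : Set Plane) (κ H : ℝ) : Prop :=
  ∀ ψ A, GLadm Ω ψ A → 0 ≤ GLenergy Ω κ H ψ A

/-- The normal state is the unique minimizer at `(κ, H)`. -/
def NormalUnique (Ω : Set Plane) (κ H : ℝ) : Prop :=
  NormalMin Ω κ H ∧
  ∀ ψ A, GLadm Ω ψ A → (∫ x in Ω, ‖ψ x‖ ^ 2) ≠ 0 → 0 < GLenergy Ω κ H ψ A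

/-- `(ψ, A)` is a minimizer of the Ginzburg–Landau energy at `(κ, H)`. -/
def IsGLMin (Ω : Set Plane) (κ H : ℝ) (ψ : Plane → ℂ) (A : Plane → Plane) : Prop :=
  GLadm Ω ψ A ∧ ∀ ψ' A', GLadm Ω ψ' A' → GLenergy Ω κ H ψ A ≤ GLenergy Ω κ H ψ' A'

/-- Lower global critical field. -/
def HC3low (Ω : Set Plane) (κ : ℝ) : ℝ := sInf {H : ℝ | 0 < H ∧ NormalMin Ω κ H}

/-- Upper global critical field. -/
def HC3up (Ω : Set Plane) (κ : ℝ) : ℝ :=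
  sInf {H : ℝ | 0 < H ∧ ∀ H', H < H' → NormalUnique Ω κ H'}

/-- Lower local critical field. -/
def HlocLow (Ω : Set Plane) (κ : ℝ) : ℝ :=
  sInf {H : ℝ | 0 < H ∧ κ ^ 2 ≤ lam1 Ω (κ * H)}

/-- Upper local critical field. -/
def HlocUp (Ω : Set Plane) (κ : ℝ) : ℝ :=
  sInf {H : ℝ | 0 < H ∧ ∀ H', H < H' → κ ^ 2 ≤ lam1 Ω (κ * H')}

/-- The inward unit normal `ν(s) = (-γ₂'(s), γ₁'(s))`. -/
def nuVec (γ : ℝ → Plane) (s : ℝ) : Plane := (-(deriv γ s).2, (deriv γ s).1)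

/-- The curvature `k(s) = ⟨γ''(s), ν(s)⟩`. -/
def curvOf (γ : ℝ → Plane) (s : ℝ) : ℝ := dot2 (deriv (deriv γ) s) (nuVec γ s)

/-- The maximal curvature. -/
def kmaxOf (γ : ℝ → Plane) : ℝ := sSup (Set.range (curvOf γ))

/-- A smooth counterclockwise arclength parametrization of the boundary of `Ω`. -/
structure BoundaryParam (Ω : Set Plane) where
  γ : ℝ → Plane
  L : ℝ
  L_pos : 0 < L
  smooth : ContDiff ℝ (⊤ : ℕ∞) γ
  periodic : Function.Periodic γ L
  unit_speed : ∀ s, esq (deriv γ s) = 1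
  injOn : Set.InjOn γ (Set.Ico 0 L)
  range_eq : Set.range γ = frontier Ω
  inward : ∀ s, ∃ ε > 0, ∀ t ∈ Set.Ioo (0 : ℝ) ε, γ s + t • nuVec γ s ∈ Ω

/-- The non-degeneracy assumption: finitely many points of maximal curvature,
all of them non-degenerate maxima. -/
def NonDegen {Ω : Set Plane} (P : BoundaryParam Ω) : Prop :=
  ∃ (N : ℕ) (s : Fin N → ℝ), 0 < N ∧ (∀ j, s j ∈ Set.Ico 0 P.L) ∧
    (∀ j, curvOf P.γ (s j) = kmaxOf P.γ) ∧
    (∀ t ∈ Set.Ico 0 P.L, (∀ j, t ≠ s j) → curvOf P.γ t < kmaxOf P.γ) ∧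
    (∀ j, deriv (deriv (curvOf P.γ)) (s j) < 0)

/-- The ground state energy `μ(ζ)` of the de Gennes half-line model operator. -/
def muGen (ζ : ℝ) : ℝ :=
  sInf { r : ℝ | ∃ φ : ℝ → ℝ, ContDiff ℝ 1 φ ∧ HasCompactSupport φ ∧
    (∃ τ, 0 < τ ∧ φ τ ≠ 0) ∧
    r = (∫ τ in Set.Ioi (0 : ℝ), ((deriv φ τ) ^ 2 + (τ + ζ) ^ 2 * (φ τ) ^ 2)) /
        (∫ τ in Set.Ioi (0 : ℝ), (φ τ) ^ 2) }

/-- The de Gennes constant `Θ₀`. -/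
def Theta0 : ℝ := sInf (Set.range muGen)

/-- Standard facts about the de Gennes constant, taken as hypotheses. -/
structure DeGennes where
  ξ₀ : ℝ
  u₀ : ℝ → ℝ
  theta_lb : 1 / 2 < Theta0
  theta_ub : Theta0 < 1
  ξ₀_mem : ξ₀ ∈ Set.Ioo (-1 : ℝ) 0
  ξ₀_min : muGen ξ₀ = Theta0
  ξ₀_uniq : ∀ ζ, muGen ζ = Theta0 → ζ = ξ₀
  ξ₀_sq : ξ₀ ^ 2 = Theta0
  u₀_pos : ∀ τ, 0 ≤ τ → 0 < u₀ τ
  u₀_smooth : ContDiffOn ℝ 2 u₀ (Set.Ici 0)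
  u₀_sq_int : IntegrableOn (fun τ => (u₀ τ) ^ 2) (Set.Ioi 0)
  u₀_normalized : (∫ τ in Set.Ioi (0 : ℝ), (u₀ τ) ^ 2) = 1
  u₀_neumann : derivWithin u₀ (Set.Ici 0) 0 = 0
  u₀_ode : ∀ τ ∈ Set.Ioi (0 : ℝ),
    -(deriv (deriv u₀) τ) + (τ + ξ₀) ^ 2 * u₀ τ = Theta0 * u₀ τ

/-- The universal constant `C₁ = u₀(0)²/3`. -/
def DeGennes.C1 (D : DeGennes) : ℝ := (D.u₀ 0) ^ 2 / 3

/-- Condition (★) on a vector field `A` at field strength `B` with constant `C₀`. -/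
def StarCond (Ω : Set Plane) (C₀ B : ℝ) (A : Plane → Plane) : Prop :=
  CNearCl 2 Ω A ∧
  (∀ x ∈ closure Ω, ‖A x‖ ≤ C₀) ∧
  (∀ x ∈ closure Ω, ‖fderiv ℝ A x‖ ≤ C₀) ∧
  (∀ x ∈ closure Ω, ‖fderiv ℝ (fderiv ℝ A) x‖ ≤ C₀) ∧
  (∀ x ∈ closure Ω, |curl2 A x - 1| ≤ C₀ * B ^ (-(1 : ℝ) / 4)) ∧
  (∀ x ∈ closure Ω, ‖fderiv ℝ (curl2 A) x‖ ≤ C₀ * B ^ (-(1 : ℝ) / 4)) ∧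
  (∀ x ∈ frontier Ω, curl2 A x = 1)

/-- The open unit disc. -/
def unitDisc : Set Plane := {x : Plane | x.1 ^ 2 + x.2 ^ 2 < 1}

/-- `Δ_B`: distance from `B/2 + ξ₀√B + δ₀` to the nearest integer. -/
def DeltaB (ξ₀ δ₀ B : ℝ) : ℝ :=
  sInf (Set.range (fun m : ℤ => |(m : ℝ) - B / 2 - ξ₀ * Real.sqrt B - δ₀|))

/-- Euclidean distance to the boundary of `Ω`. -/
def distBdry (Ω : Set Plane) (x : Plane) : ℝ :=
  sInf ((fun y => Real.sqrt (esq (x - y))) '' frontier Ω)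

end SC

namespace SC

/-- Integral representation of the parabolic cylinder functions. -/
def cylV (a x : ℝ) : ℝ := ∫ r in Ioi (0 : ℝ), r ^ a * Real.exp (-2 * x * r - r ^ 2)

lemma cyl_exp_le (x r : ℝ) : Real.exp (-2 * x * r - r ^ 2) ≤
    Real.exp (2 * x ^ 2) * Real.exp (-(1 / 2) * r ^ 2) := by
  rw [← Real.exp_add]
  apply Real.exp_le_exp.2
  nlinarith [sq_nonneg (r + 2 * x)]

lemma cyl_aesm (a x : ℝ) : AEStronglyMeasurable
    (fun r : ℝ => r ^ a * Real.exp (-2 * x * r - r ^ 2)) (volume.restrict (Ioi 0)) := by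
  apply Measurable.aestronglyMeasurable
  fun_prop

lemma cyl_int {a : ℝ} (ha : -1 < a) (x : ℝ) :
    IntegrableOn (fun r : ℝ => r ^ a * Real.exp (-2 * x * r - r ^ 2)) (Ioi 0) := by
  have h := (integrableOn_rpow_mul_exp_neg_mul_sq (b := 1 / 2) (by norm_num) ha).const_mul
    (Real.exp (2 * x ^ 2))
  refine Integrable.mono' h (cyl_aesm a x) ?_
  refine (ae_restrict_iff' measurableSet_Ioi).2 (ae_of_all _ fun r hr => ?_)
  have hr' : 0 ≤ r ^ a := Real.rpow_nonneg (le_of_lt hr) a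
  rw [Real.norm_of_nonneg (by positivity)]
  calc r ^ a * Real.exp (-2 * x * r - r ^ 2) ≤ r ^ a * (Real.exp (2 * x ^ 2) *
        Real.exp (-(1 / 2) * r ^ 2)) := mul_le_mul_of_nonneg_left (cyl_exp_le x r) hr'
    _ = _ := by ring

lemma cylV_pos {a : ℝ} (ha : -1 < a) (x : ℝ) : 0 < cylV a x := by
  unfold cylV
  rw [setIntegral_pos_iff_support_of_nonneg_ae _ (cyl_int ha x)]
  · have : (Function.support fun r : ℝ => r ^ a * Real.exp (-2 * x * r - r ^ 2)) ∩ Ioi 0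
        = Ioi 0 := by
      ext r
      simp only [mem_inter_iff, Function.mem_support, mem_Ioi, and_iff_right_iff_imp]
      intro hr
      have := Real.rpow_pos_of_pos hr a
      positivity
    rw [this]; simp
  · refine (ae_restrict_iff' measurableSet_Ioi).2 (ae_of_all _ fun r hr => ?_)
    have := Real.rpow_pos_of_pos hr a
    simp only [Pi.zero_apply]; positivity

lemma cylV_hasDerivAt {a : ℝ} (ha : -1 < a) (x : ℝ) :
    HasDerivAt (cylV a) (-2 * cylV (a + 1) x) x := by
  have key := hasDerivAt_integral_of_dominated_loc_of_deriv_le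
    (μ := volume.restrict (Ioi (0 : ℝ)))
    (F := fun x r => r ^ a * Real.exp (-2 * x * r - r ^ 2))
    (F' := fun x r => -2 * (r ^ (a + 1) * Real.exp (-2 * x * r - r ^ 2)))
    (bound := fun r => 2 * Real.exp (2 * (|x| + 1) ^ 2) *
      (r ^ (a + 1) * Real.exp (-(1 / 2) * r ^ 2)))
    (s := Metric.ball x 1) (x₀ := x) (Metric.ball_mem_nhds x one_pos)
    (Eventually.of_forall fun y => cyl_aesm a y) (cyl_int ha x)
    ((cyl_aesm (a + 1) x).const_mul (-2)) ?_ ?_ ?_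
  · have h2 := key.2
    rw [integral_const_mul] at h2
    exact h2
  · refine (ae_restrict_iff' measurableSet_Ioi).2 (ae_of_all _ fun r hr y hy => ?_)
    have hr' : 0 ≤ r ^ (a + 1) := Real.rpow_nonneg (le_of_lt hr) _
    rw [norm_mul, Real.norm_of_nonneg (r := r ^ (a + 1) * _) (by positivity)]
    have hy' : |y| ≤ |x| + 1 := by
      have h1 : |y - x| < 1 := by simpa [Real.dist_eq] using hy
      have h2 := abs_sub_abs_le_abs_sub y x
      linarith
    have h3 : Real.exp (2 * y ^ 2) ≤ Real.exp (2 * (|x| + 1) ^ 2) := by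
      apply Real.exp_le_exp.2
      have : |y| ^ 2 ≤ (|x| + 1) ^ 2 := by gcongr
      rw [sq_abs] at this; linarith
    have h4 := (cyl_exp_le y r).trans
      (mul_le_mul_of_nonneg_right h3 (Real.exp_pos (-(1 / 2) * r ^ 2)).le)
    have h5 := mul_le_mul_of_nonneg_left h4 hr'
    norm_num
    norm_num at h5
    linarith
  · have h := (integrableOn_rpow_mul_exp_neg_mul_sq (b := 1 / 2) (s := a + 1) (by norm_num)
      (by linarith)).const_mul (2 * Real.exp (2 * (|x| + 1) ^ 2))
    exact h
  · refine (ae_restrict_iff' measurableSet_Ioi).2 (ae_of_all _ fun r hr y _ => ?_)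
    have h1 : HasDerivAt (fun y : ℝ => -2 * y * r - r ^ 2) (-2 * r) y := by
      have := (((hasDerivAt_id y).const_mul (-2 : ℝ)).mul_const r).sub_const (r ^ 2)
      simpa using this
    have h2 := (h1.exp).const_mul (r ^ a)
    refine h2.congr_deriv ?_
    rw [Real.rpow_add_one (ne_of_gt hr)]; ring

lemma cylV_rec {a : ℝ} (ha : -1 < a) (x : ℝ) :
    2 * cylV (a + 2) x + 2 * x * cylV (a + 1) x = (a + 1) * cylV a x := by
  have hI1 := (cyl_int ha x).const_mul (a + 1)
  have hI2 := (cyl_int (a := a + 1) (by linarith) x).const_mul (-(2 * x))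
  have hI3 := (cyl_int (a := a + 2) (by linarith) x).const_mul (-2)
  have hI12 : IntegrableOn (fun r : ℝ => (a + 1) * (r ^ a * Real.exp (-2 * x * r - r ^ 2)) +
      (-(2 * x)) * (r ^ (a + 1) * Real.exp (-2 * x * r - r ^ 2))) (Ioi 0) := hI1.add hI2
  have hFTC := integral_Ioi_of_hasDerivAt_of_tendsto (a := (0 : ℝ)) (m := 0)
    (f := fun r => r ^ (a + 1) * Real.exp (-2 * x * r - r ^ 2))
    (f' := fun r => ((a + 1) * (r ^ a * Real.exp (-2 * x * r - r ^ 2)) +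
      (-(2 * x)) * (r ^ (a + 1) * Real.exp (-2 * x * r - r ^ 2))) +
      (-2) * (r ^ (a + 2) * Real.exp (-2 * x * r - r ^ 2))) ?_ ?_ (hI12.add hI3) ?_
  · rw [integral_add hI12 hI3, integral_add hI1 hI2, integral_const_mul,
      integral_const_mul, integral_const_mul, Real.zero_rpow (by linarith)] at hFTC
    unfold cylV
    linarith
  · apply ContinuousWithinAt.mul
    · exact (Real.continuousAt_rpow_const _ _ (Or.inr (by linarith))).continuousWithinAt
    · fun_prop
  · intro r hr
    have h1 : HasDerivAt (fun r : ℝ => -2 * x * r - r ^ 2) (-2 * x - 2 * r) r := by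
      have := ((hasDerivAt_id r).const_mul (-2 * x)).fun_sub (hasDerivAt_pow 2 r)
      simpa using this
    have h2 := (Real.hasDerivAt_rpow_const (x := r) (p := a + 1) (Or.inl (ne_of_gt hr))).fun_mul h1.exp
    refine h2.congr_deriv ?_
    have e1 : r ^ (a + 1) = r ^ a * r := Real.rpow_add_one (ne_of_gt hr) a
    have e2 : r ^ (a + 2) = r ^ a * r * r := by
      rw [show a + 2 = (a + 1) + 1 by ring, Real.rpow_add_one (ne_of_gt hr), e1]
    rw [e2, e1]; ring_nf
  · have h := tendsto_rpow_abs_mul_exp_neg_mul_sq_cocompact (a := 1 / 2) (by norm_num) (a + 1)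
    have h' : Tendsto (fun r : ℝ => Real.exp (2 * x ^ 2) * (|r| ^ (a + 1) *
        Real.exp (-(1 / 2) * r ^ 2))) atTop (𝓝 0) := by
      have := (h.mono_left atTop_le_cocompact).const_mul (Real.exp (2 * x ^ 2))
      simpa using this
    refine squeeze_zero' ?_ ?_ h'
    · filter_upwards [eventually_gt_atTop 0] with r hr
      have := Real.rpow_pos_of_pos hr (a + 1)
      positivity
    · filter_upwards [eventually_gt_atTop 0] with r hr
      have := Real.rpow_pos_of_pos hr (a + 1)
      rw [abs_of_pos hr]
      have := mul_le_mul_of_nonneg_left (cyl_exp_le x r) this.le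
      linarith

lemma cylV_logconvex {a : ℝ} (ha : -1 < a) (x : ℝ) :
    cylV (a + 1) x ^ 2 < cylV a x * cylV (a + 2) x := by
  set R := cylV (a + 1) x / cylV a x with hR
  have h0 := cylV_pos ha x
  have hI1 := (cyl_int ha x).const_mul (R ^ 2)
  have hI2 := (cyl_int (a := a + 1) (by linarith) x).const_mul (-(2 * R))
  have hI3 := (cyl_int (a := a + 2) (by linarith) x)
  have hI12 : IntegrableOn (fun r : ℝ => R ^ 2 * (r ^ a * Real.exp (-2 * x * r - r ^ 2)) +
      (-(2 * R)) * (r ^ (a + 1) * Real.exp (-2 * x * r - r ^ 2))) (Ioi 0) := hI1.add hI2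
  have hI3' : IntegrableOn (fun r : ℝ => (R ^ 2 * (r ^ a * Real.exp (-2 * x * r - r ^ 2)) +
      (-(2 * R)) * (r ^ (a + 1) * Real.exp (-2 * x * r - r ^ 2))) +
      r ^ (a + 2) * Real.exp (-2 * x * r - r ^ 2)) (Ioi 0) := hI12.add hI3
  have hpt : ∀ r ∈ Ioi (0 : ℝ), (R ^ 2 * (r ^ a * Real.exp (-2 * x * r - r ^ 2)) +
      (-(2 * R)) * (r ^ (a + 1) * Real.exp (-2 * x * r - r ^ 2))) +
      (r ^ (a + 2) * Real.exp (-2 * x * r - r ^ 2)) =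
      (r - R) ^ 2 * (r ^ a * Real.exp (-2 * x * r - r ^ 2)) := by
    intro r hr
    have e1 : r ^ (a + 1) = r ^ a * r := Real.rpow_add_one (ne_of_gt hr) a
    have e2 : r ^ (a + 2) = r ^ a * r * r := by
      rw [show a + 2 = (a + 1) + 1 by ring, Real.rpow_add_one (ne_of_gt hr), e1]
    rw [e2, e1]; ring
  have hpos : 0 < ∫ r in Ioi (0 : ℝ), ((R ^ 2 * (r ^ a * Real.exp (-2 * x * r - r ^ 2)) +
      (-(2 * R)) * (r ^ (a + 1) * Real.exp (-2 * x * r - r ^ 2))) +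
      (r ^ (a + 2) * Real.exp (-2 * x * r - r ^ 2))) := by
    rw [setIntegral_pos_iff_support_of_nonneg_ae _ hI3']
    · refine lt_of_lt_of_le ?_ (measure_mono (s := Ioo (max R 0) (max R 0 + 1)) ?_)
      · simp
      · intro r hr
        have h1 : R < r := lt_of_le_of_lt (le_max_left _ _) hr.1
        have h2 : 0 < r := lt_of_le_of_lt (le_max_right _ _) hr.1
        refine ⟨?_, h2⟩
        rw [Function.mem_support, hpt r h2]
        have := Real.rpow_pos_of_pos h2 a
        have : r - R ≠ 0 := (sub_pos.2 h1).ne'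
        positivity
    · refine (ae_restrict_iff' measurableSet_Ioi).2 (ae_of_all _ fun r hr => ?_)
      have := Real.rpow_pos_of_pos hr a
      simp only [Pi.zero_apply]
      rw [hpt r hr]; positivity
  rw [integral_add hI12 hI3, integral_add hI1 hI2, integral_const_mul,
      integral_const_mul] at hpos
  change 0 < R ^ 2 * cylV a x + -(2 * R) * cylV (a + 1) x + cylV (a + 2) x at hpos
  have h1 : cylV (a + 1) x = R * cylV a x := by rw [hR]; field_simp
  rw [h1] at hpos ⊢
  nlinarith

lemma rpow_le_add_rpow {a₀ a₁ a r : ℝ} (hr : 0 < r) (h0 : a₀ ≤ a) (h1 : a ≤ a₁) :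
    r ^ a ≤ r ^ a₀ + r ^ a₁ := by
  have p0 := Real.rpow_pos_of_pos hr a₀
  have p1 := Real.rpow_pos_of_pos hr a₁
  rcases le_total r 1 with h | h
  · have := Real.rpow_le_rpow_of_exponent_ge hr h h0; linarith
  · have := Real.rpow_le_rpow_of_exponent_le h h1; linarith

lemma cylV_continuousOn {a₀ a₁ : ℝ} (h0 : -1 < a₀) (h01 : a₀ ≤ a₁) (M : ℝ) :
    ContinuousOn (fun p : ℝ × ℝ => cylV p.1 p.2) (Icc a₀ a₁ ×ˢ Icc (-M) M) := by
  unfold cylV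
  refine continuousOn_of_dominated
    (bound := fun r => Real.exp (2 * M ^ 2) * (r ^ a₀ * Real.exp (-(1 / 2) * r ^ 2)) +
      Real.exp (2 * M ^ 2) * (r ^ a₁ * Real.exp (-(1 / 2) * r ^ 2)))
    (fun p _ => cyl_aesm p.1 p.2) ?_ ?_ ?_
  · rintro ⟨a, x⟩ ⟨ha, hx⟩
    refine (ae_restrict_iff' measurableSet_Ioi).2 (ae_of_all _ fun r hr => ?_)
    have hr' : 0 ≤ r ^ a := Real.rpow_nonneg (le_of_lt hr) a
    rw [Real.norm_of_nonneg (by positivity)]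
    have e1 := rpow_le_add_rpow hr ha.1 ha.2
    have e2 : Real.exp (2 * x ^ 2) ≤ Real.exp (2 * M ^ 2) := by
      apply Real.exp_le_exp.2
      have : x ^ 2 ≤ M ^ 2 := sq_le_sq' hx.1 hx.2
      linarith
    have e3 := (cyl_exp_le x r).trans
      (mul_le_mul_of_nonneg_right e2 (Real.exp_pos (-(1 / 2) * r ^ 2)).le)
    have := mul_le_mul e1 e3 (Real.exp_pos _).le (hr'.trans e1)
    dsimp only at this ⊢
    linarith
  · exact ((integrableOn_rpow_mul_exp_neg_mul_sq (by norm_num) h0).const_mul _).add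
      ((integrableOn_rpow_mul_exp_neg_mul_sq (by norm_num) (lt_of_lt_of_le h0 h01)).const_mul _)
  · refine (ae_restrict_iff' measurableSet_Ioi).2 (ae_of_all _ fun r hr => ?_)
    have : r ≠ 0 := ne_of_gt hr
    apply Continuous.continuousOn
    apply Continuous.mul
    · exact Continuous.rpow continuous_const continuous_fst (fun _ => Or.inl this)
    · fun_prop

lemma cylV_ge {a x : ℝ} (ha : -1 < a) (hx : x ≤ 0) : Real.exp (-1) / (a + 1) ≤ cylV a x := by
  have h1 : (∫ r in Ioc (0 : ℝ) 1, r ^ a * Real.exp (-1)) = Real.exp (-1) / (a + 1) := by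
    rw [integral_mul_const, ← intervalIntegral.integral_of_le zero_le_one,
      integral_rpow (Or.inl ha), Real.one_rpow, Real.zero_rpow (by linarith)]
    ring
  rw [← h1]
  have hi : IntegrableOn (fun r : ℝ => r ^ a * Real.exp (-1)) (Ioc 0 1) :=
    ((intervalIntegrable_iff_integrableOn_Ioc_of_le zero_le_one).1
      (intervalIntegral.intervalIntegrable_rpow' ha)).mul_const _
  have hsub : Ioc (0 : ℝ) 1 ⊆ Ioi 0 := fun r hr => hr.1
  calc _ ≤ ∫ r in Ioc (0 : ℝ) 1, r ^ a * Real.exp (-2 * x * r - r ^ 2) := by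
        refine setIntegral_mono_on hi ((cyl_int ha x).mono_set hsub) measurableSet_Ioc ?_
        intro r hr
        refine mul_le_mul_of_nonneg_left (Real.exp_le_exp.2 ?_) (Real.rpow_nonneg hr.1.le a)
        nlinarith [mul_nonneg (neg_nonneg.2 hx) hr.1.le, hr.2, hr.1]
    _ ≤ _ := by
        refine setIntegral_mono_set (cyl_int ha x) ?_ (Eventually.of_forall hsub)
        refine (ae_restrict_iff' measurableSet_Ioi).2 (ae_of_all _ fun r hr => ?_)
        have := Real.rpow_pos_of_pos hr a
        simp only [Pi.zero_apply]; positivity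

lemma cylV_le {a y : ℝ} (ha : 0 ≤ a) (ha1 : a ≤ 1) (hy1 : y ≤ 1) :
    cylV a (-y) ≤ cylV 0 (-1) + cylV 1 (-1) := by
  have i0 := cyl_int (a := 0) (by norm_num) (-1)
  have i1 := cyl_int (a := 1) (by norm_num) (-1)
  unfold cylV
  rw [← integral_add i0 i1]
  refine setIntegral_mono_on (cyl_int (by linarith) _) (i0.add i1) measurableSet_Ioi ?_
  intro r hr
  have e1 := rpow_le_add_rpow hr ha ha1
  have e2 : Real.exp (-2 * -y * r - r ^ 2) ≤ Real.exp (-2 * -1 * r - r ^ 2) := by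
    apply Real.exp_le_exp.2
    have : 0 < r := hr
    nlinarith
  have hr' : 0 ≤ r ^ a := Real.rpow_nonneg (le_of_lt hr) a
  have := mul_le_mul e1 e2 (Real.exp_pos _).le (hr'.trans e1)
  linarith

/-- Existence of the de Gennes constant `Θ = y²`, through the Neumann condition at `-y`. -/
lemma exists_deGennes : ∃ y ∈ Ioo (0 : ℝ) 1,
    y * cylV ((1 - y ^ 2) / 2 - 1) (-y) = 2 * cylV ((1 - y ^ 2) / 2) (-y) := by
  set K := cylV 0 (-1) + cylV 1 (-1) with hK
  have hK0 : 0 < K := add_pos (cylV_pos (by norm_num) _) (cylV_pos (by norm_num) _)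
  set b := min (1 / 4) (Real.exp (-1) / (5 * K)) with hb
  have hb0 : 0 < b := by rw [hb]; positivity
  have hb1 : b ≤ 1 / 4 := min_le_left _ _
  have hb2 : b * (5 * K) ≤ Real.exp (-1) := by
    have := min_le_right (1 / 4) (Real.exp (-1) / (5 * K))
    rw [← hb, le_div_iff₀ (by positivity)] at this
    exact this
  set y₁ := Real.sqrt (1 - 2 * b) with hy₁
  have hy₁sq : y₁ ^ 2 = 1 - 2 * b := Real.sq_sqrt (by linarith)
  have hy₁0 : 0 ≤ y₁ := Real.sqrt_nonneg _
  have hy₁h : 1 / 2 ≤ y₁ := by nlinarith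
  have hy₁1 : y₁ < 1 := by nlinarith
  set Ψ : ℝ → ℝ := fun y => y * cylV ((1 - y ^ 2) / 2 - 1) (-y) - 2 * cylV ((1 - y ^ 2) / 2) (-y)
  have hcont : ContinuousOn Ψ (Icc 0 y₁) := by
    have c1 := (cylV_continuousOn (a₀ := b - 1) (a₁ := 1) (by linarith) (by linarith) 1)
    have g1 : ContinuousOn (fun y : ℝ => cylV ((1 - y ^ 2) / 2 - 1) (-y)) (Icc 0 y₁) := by
      refine c1.comp (f := fun y : ℝ => ((1 - y ^ 2) / 2 - 1, -y)) (by fun_prop) ?_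
      intro y hy
      have : y ^ 2 ≤ y₁ ^ 2 := pow_le_pow_left₀ hy.1 hy.2 2
      refine ⟨⟨?_, ?_⟩, ?_, ?_⟩ <;> dsimp only <;> nlinarith [hy.1, hy.2]
    have g2 : ContinuousOn (fun y : ℝ => cylV ((1 - y ^ 2) / 2) (-y)) (Icc 0 y₁) := by
      refine c1.comp (f := fun y : ℝ => ((1 - y ^ 2) / 2, -y)) (by fun_prop) ?_
      intro y hy
      have : y ^ 2 ≤ y₁ ^ 2 := pow_le_pow_left₀ hy.1 hy.2 2
      refine ⟨⟨?_, ?_⟩, ?_, ?_⟩ <;> dsimp only <;> nlinarith [hy.1, hy.2]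
    exact (continuousOn_id.mul g1).sub (continuousOn_const.mul g2)
  have h0 : Ψ 0 < 0 := by
    have := cylV_pos (a := (1 - 0 ^ 2) / 2) (by norm_num) (-0)
    simp only [Ψ]; linarith
  have h1 : 0 < Ψ y₁ := by
    have e : (1 - y₁ ^ 2) / 2 = b := by rw [hy₁sq]; ring
    have l1 := cylV_ge (a := b - 1) (x := -y₁) (by linarith) (by linarith)
    have l2 := cylV_le (a := b) (y := y₁) hb0.le (by linarith) hy₁1.le
    have l3 : 5 * K ≤ Real.exp (-1) / (b - 1 + 1) := by
      rw [le_div_iff₀ (by linarith)]; linarith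
    have l4 : 1 / 2 * (5 * K) ≤ y₁ * cylV (b - 1) (-y₁) :=
      mul_le_mul hy₁h (l3.trans l1) (by positivity) hy₁0
    simp only [Ψ, e]; linarith
  obtain ⟨y, hy, hy0⟩ := intermediate_value_Ioo hy₁0 hcont ⟨h0, h1⟩
  exact ⟨y, ⟨hy.1, hy.2.trans hy₁1⟩, by simp only [Ψ] at hy0; linarith⟩

/-- Ratio of consecutive parabolic cylinder functions. -/
def cylR (b x : ℝ) : ℝ := cylV b x / cylV (b - 1) x

section ratio
variable {b : ℝ}

lemma cylR_pos (hb : 0 < b) (x : ℝ) : 0 < cylR b x :=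
  div_pos (cylV_pos (by linarith) x) (cylV_pos (by linarith) x)

lemma cylR_rec (hb : 0 < b) (x : ℝ) : 2 * cylR b x * (x + cylR (b + 1) x) = b := by
  have h := cylV_rec (a := b - 1) (by linarith) x
  have h0 := cylV_pos (a := b - 1) (by linarith) x
  have h1 := cylV_pos (a := b) (by linarith) x
  rw [show b - 1 + 2 = b + 1 by ring, show b - 1 + 1 = b by ring] at h
  unfold cylR
  rw [show b + 1 - 1 = b by ring]
  field_simp
  linarith

lemma cylR_lt (hb : 0 < b) (x : ℝ) : cylR b x < cylR (b + 1) x := by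
  have h := cylV_logconvex (a := b - 1) (by linarith) x
  have h0 := cylV_pos (a := b - 1) (by linarith) x
  have h1 := cylV_pos (a := b) (by linarith) x
  rw [show b - 1 + 2 = b + 1 by ring, show b - 1 + 1 = b by ring] at h
  unfold cylR
  rw [show b + 1 - 1 = b by ring, div_lt_div_iff₀ h0 h1]
  linarith

lemma cylR_hasDerivAt (hb : 0 < b) (x : ℝ) :
    HasDerivAt (cylR b) (2 * cylR b x ^ 2 + 2 * x * cylR b x - b) x := by
  have h0 := cylV_pos (a := b - 1) (by linarith) x
  have d0 := cylV_hasDerivAt (a := b - 1) (by linarith) x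
  have d1 := cylV_hasDerivAt (a := b) (by linarith) x
  refine (d1.div d0 h0.ne').congr_deriv ?_
  have h := cylV_rec (a := b - 1) (by linarith) x
  rw [show b - 1 + 2 = b + 1 by ring, show b - 1 + 1 = b by ring] at h
  rw [show b - 1 + 1 = b by ring]
  unfold cylR
  field_simp
  linear_combination (-cylV (b - 1) x) * h

lemma cylR_continuous (hb : 0 < b) : Continuous (cylR b) :=
  continuous_iff_continuousAt.2 fun x => (cylR_hasDerivAt hb x).continuousAt

lemma cylR_deriv_eq (hb : 0 < b) (x : ℝ) : 2 * cylR b x ^ 2 + 2 * x * cylR b x - b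
    = -2 * cylR b x * (cylR (b + 1) x - cylR b x) := by
  linear_combination cylR_rec hb x

lemma cylR_le (hb : 0 < b) {x : ℝ} (hx : 0 < x) : 2 * x * cylR b x ≤ b := by
  have h := cylR_rec hb x
  nlinarith [cylR_pos hb x, cylR_pos (b := b + 1) (by linarith) x]

lemma cylR_gap (hb : 0 < b) (hb2 : b < 1 / 2) {x : ℝ} (hx : 3 ≤ x) :
    b ≤ 10 * x ^ 2 * (cylR b x * (cylR (b + 1) x - cylR b x)) := by
  have x0 : 0 < x := by linarith
  have r1 := cylR_pos hb x
  have r2 := cylR_pos (b := b + 1) (by linarith) x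
  have r3 := cylR_pos (b := b + 1 + 1) (by linarith) x
  have e1 := cylR_rec hb x
  have e2 := cylR_rec (b := b + 1) (by linarith) x
  have l1 := cylR_le hb x0
  have l2 := cylR_le (b := b + 1) (by linarith) x0
  have l3 := cylR_le (b := b + 1 + 1) (by linarith) x0
  set R := cylR b x
  set R₂ := cylR (b + 1) x
  set R₃ := cylR (b + 1 + 1) x
  have h3 : R₃ ≤ 5 / 12 := by nlinarith
  have h3' : R₃ ≤ 5 / 36 * x := by linarith
  have h2 : R₂ ≤ 1 / 12 * x := by nlinarith
  have k2 : (b + 1) ≤ 2 * R₂ * (41 / 36 * x) := by rw [← e2]; gcongr; linarith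
  have k1 : b ≤ 2 * R * (13 / 12 * x) := by
    calc b = 2 * R * (x + R₂) := e1.symm
      _ ≤ _ := by gcongr; linarith
  have k3 : 0.37 ≤ x * (R₂ - R) := by nlinarith
  have k4 : 6 / 13 * b ≤ x * R := by linarith
  have := mul_le_mul k3 k4 (by positivity) (by linarith)
  nlinarith

end ratio

/-- A continuous function bounded near `+∞` is bounded on every half line. -/
lemma exists_bound_Ici {f : ℝ → ℝ} (hf : Continuous f) (x₀ : ℝ) {K : ℝ}
    (hK : ∀ x, x₀ ≤ x → f x ≤ K) (a : ℝ) : ∃ M > 0, ∀ x, a ≤ x → f x ≤ M := by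
  obtain ⟨M, hM⟩ := (isCompact_Icc (a := a) (b := x₀)).bddAbove_image hf.continuousOn
  refine ⟨max (max M K) 1, by positivity, fun x hx => ?_⟩
  rcases le_total x x₀ with h | h
  · exact (hM (mem_image_of_mem f ⟨hx, h⟩)).trans ((le_max_left _ _).trans (le_max_left _ _))
  · exact (hK x h).trans ((le_max_right _ _).trans (le_max_left _ _))

/-- The half-line model: the logarithmic derivative `p` of the ground state `u`, the corrector `r`
with its solvability constant `C₁`, and the bounds used in the lower bound. -/
structure Model where
  Θ : ℝ
  ξ : ℝ
  C₁ : ℝ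
  M : ℝ
  p : ℝ → ℝ
  r : ℝ → ℝ
  u : ℝ → ℝ
  Θ_pos : 0 < Θ
  Θ_lt : Θ < 1
  ξ_neg : ξ < 0
  ξ_sq : ξ ^ 2 = Θ
  C₁_pos : 0 < C₁
  M_pos : 0 < M
  p_zero : p 0 = 0
  r_zero : r 0 = 0
  u_pos : ∀ τ, 0 < u τ
  dp : ∀ τ, HasDerivAt p (-(Θ + p τ ^ 2 - (τ + ξ) ^ 2)) τ
  du : ∀ τ, HasDerivAt u (p τ * u τ) τ
  dr : ∀ τ, HasDerivAt r
    (C₁ + (p τ + (Θ + p τ ^ 2 - (τ + ξ) ^ 2) * (τ + ξ)) - 2 * p τ * r τ) τ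
  G_nonneg : ∀ τ, 0 ≤ τ → 0 ≤ Θ + p τ ^ 2 - (τ + ξ) ^ 2
  G_gap : ∀ τ, 0 ≤ τ → 1 ≤ M * (1 + τ) ^ 2 * (1 - (Θ + p τ ^ 2 - (τ + ξ) ^ 2))
  S_bound : ∀ τ, 0 ≤ τ → τ * |p τ + (Θ + p τ ^ 2 - (τ + ξ) ^ 2) * (τ + ξ)| ≤ M
  r_bound : ∀ τ, 0 ≤ τ → (1 + τ) * |r τ| ≤ M
  u_bound : ∀ τ, 0 ≤ τ → (1 + τ) ^ 4 * u τ ≤ M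

section build
variable {b : ℝ}

/-- Derivative of the ratio `cylR`. -/
def cylD (b x : ℝ) : ℝ := 2 * cylR b x ^ 2 + 2 * x * cylR b x - b

/-- Unnormalized model ground state. -/
def cylU (b x : ℝ) : ℝ := Real.exp (-x ^ 2 / 2) * cylV (b - 1) x

lemma cylD_neg (hb : 0 < b) (x : ℝ) : cylD b x < 0 := by
  unfold cylD
  rw [cylR_deriv_eq hb]
  have := mul_pos (cylR_pos hb x) (sub_pos.2 (cylR_lt hb x))
  linarith

lemma cylD_continuous (hb : 0 < b) : Continuous (cylD b) := by
  have := cylR_continuous hb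
  unfold cylD; fun_prop

lemma cylD_hasDerivAt (hb : 0 < b) (x : ℝ) :
    HasDerivAt (cylD b) ((4 * cylR b x + 2 * x) * cylD b x + 2 * cylR b x) x := by
  have h := cylR_hasDerivAt hb x
  have h2 := (((h.fun_pow 2).const_mul 2).fun_add
    (((hasDerivAt_id' x).const_mul 2).fun_mul h)).sub_const b
  refine h2.congr_deriv ?_
  unfold cylD; norm_num; ring

lemma cylU_pos (hb : 0 < b) (x : ℝ) : 0 < cylU b x :=
  mul_pos (Real.exp_pos _) (cylV_pos (by linarith) x)

lemma cylU_hasDerivAt (hb : 0 < b) (x : ℝ) :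
    HasDerivAt (cylU b) ((-x - 2 * cylR b x) * cylU b x) x := by
  have d0 := cylV_hasDerivAt (a := b - 1) (by linarith) x
  have h0 := cylV_pos (a := b - 1) (by linarith) x
  have h1 : HasDerivAt (fun x : ℝ => -x ^ 2 / 2) (-x) x := by
    have := ((hasDerivAt_pow 2 x).fun_neg).div_const 2
    refine this.congr_deriv ?_
    norm_num
    ring
  refine (h1.exp.fun_mul d0).congr_deriv ?_
  rw [show b - 1 + 1 = b by ring]
  unfold cylU cylR
  field_simp
  ring

lemma cylU_continuous (hb : 0 < b) : Continuous (cylU b) :=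
  continuous_iff_continuousAt.2 fun x => (cylU_hasDerivAt hb x).continuousAt

lemma cylV_antitone {a : ℝ} (ha : -1 < a) : Antitone (cylV a) :=
  antitone_of_deriv_nonpos (fun x => (cylV_hasDerivAt ha x).differentiableAt) fun x => by
    rw [(cylV_hasDerivAt ha x).deriv]
    linarith [cylV_pos (a := a + 1) (by linarith) x]

lemma cylU_sq_decay (hb : 0 < b) {x z : ℝ} (hz : x ≤ z) :
    cylU b z ^ 2 ≤ cylU b x ^ 2 * Real.exp (-2 * x * (z - x)) := by
  have h1 := cylV_antitone (a := b - 1) (by linarith) hz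
  have h2 := cylV_pos (a := b - 1) (by linarith) z
  have h3 : Real.exp (-z ^ 2 / 2) ^ 2 ≤ Real.exp (-x ^ 2 / 2) ^ 2 * Real.exp (-2 * x * (z - x)) := by
    rw [← Real.exp_nat_mul, ← Real.exp_nat_mul, ← Real.exp_add]
    apply Real.exp_le_exp.2
    push_cast
    nlinarith [sq_nonneg (z - x)]
  unfold cylU
  rw [mul_pow, mul_pow]
  calc _ ≤ (Real.exp (-x ^ 2 / 2) ^ 2 * Real.exp (-2 * x * (z - x))) * cylV (b - 1) x ^ 2 := by
        gcongr
    _ = _ := by ring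

lemma integrableOn_exp_neg_mul_sub {c x : ℝ} (hc : 0 < c) :
    IntegrableOn (fun z : ℝ => Real.exp (-c * (z - x))) (Ioi x) := by
  have h := (integrableOn_exp_mul_Ioi (a := -c) (by linarith) x).const_mul (Real.exp (c * x))
  refine IntegrableOn.congr_fun h (fun z _ => ?_) measurableSet_Ioi
  rw [← Real.exp_add]; ring_nf

lemma integral_exp_neg_mul_sub {c x : ℝ} (hc : 0 < c) :
    (∫ z in Ioi x, Real.exp (-c * (z - x))) = 1 / c := by
  have h := integral_exp_mul_Ioi (a := -c) (by linarith) x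
  have : (fun z : ℝ => Real.exp (-c * (z - x))) =
      fun z => Real.exp (c * x) * Real.exp (-c * z) := by
    funext z; rw [← Real.exp_add]; ring_nf
  rw [this, integral_const_mul, h]
  have e : Real.exp (c * x) * Real.exp (-(c * x)) = 1 := by
    rw [← Real.exp_add]; simp
  field_simp
  linear_combination e

lemma cylU_sq_int_one (hb : 0 < b) {x : ℝ} (hx : 1 ≤ x) :
    IntegrableOn (fun z => cylU b z ^ 2) (Ioi x) := by
  have h := (integrableOn_exp_neg_mul_sub (c := 2 * x) (x := x) (by linarith)).const_mul
    (cylU b x ^ 2)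
  refine Integrable.mono' h ((cylU_continuous hb).pow 2).aestronglyMeasurable ?_
  refine (ae_restrict_iff' measurableSet_Ioi).2 (ae_of_all _ fun z hz => ?_)
  rw [Real.norm_of_nonneg (by positivity)]
  have := cylU_sq_decay hb (le_of_lt hz)
  rwa [show -2 * x * (z - x) = -(2 * x) * (z - x) by ring] at this

lemma cylU_sq_int (hb : 0 < b) (x : ℝ) : IntegrableOn (fun z => cylU b z ^ 2) (Ioi x) := by
  have h1 := cylU_sq_int_one hb (x := max x 1) (le_max_right _ _)
  have h2 : IntegrableOn (fun z => cylU b z ^ 2) (Ioc x (max x 1)) :=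
    (((cylU_continuous hb).pow 2).continuousOn.integrableOn_Icc).mono_set Ioc_subset_Icc_self
  rw [← Ioc_union_Ioi_eq_Ioi (le_max_left x 1)]
  exact h2.union h1

/-- The function `p + G x` of the model. -/
def cylS (b x : ℝ) : ℝ := -2 * cylR b x + 2 * x * cylD b x

lemma cylS_continuous (hb : 0 < b) : Continuous (cylS b) := by
  have := cylR_continuous hb
  have := cylD_continuous hb
  unfold cylS; fun_prop

lemma cylS_neg (hb : 0 < b) {x : ℝ} (hx : 0 ≤ x) : cylS b x < 0 := by
  unfold cylS
  nlinarith [cylR_pos hb x, cylD_neg hb x]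

lemma cylS_abs_le (hb : 0 < b) (hb2 : b < 1 / 2) {x : ℝ} (hx : 1 ≤ x) :
    x * |cylS b x| ≤ 3 := by
  rw [abs_of_neg (cylS_neg hb (by linarith))]
  unfold cylS cylD
  rw [cylR_deriv_eq hb]
  have l1 := cylR_le hb (x := x) (by linarith)
  have l2 := cylR_le (b := b + 1) (by linarith) (x := x) (by linarith)
  have r1 := cylR_pos hb x
  have r2 := cylR_pos (b := b + 1) (by linarith) x
  set R := cylR b x
  set R₂ := cylR (b + 1) x
  have h1 : 0 ≤ x * R := by positivity
  have h2 : 0 ≤ x * R₂ := by positivity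
  have h3 : (x * R) * (x * R₂) ≤ (1 / 4) * (3 / 4) := by
    apply mul_le_mul <;> linarith
  nlinarith [mul_nonneg h1 h1]

variable {y : ℝ}

lemma cyl_pG_hasDeriv (hb : 0 < b) (x : ℝ) :
    HasDerivAt (fun z => cylU b z ^ 2 * (1 + 2 * cylD b z)) (-2 * x * cylU b x ^ 2) x := by
  refine (((cylU_hasDerivAt hb x).fun_pow 2).fun_mul
    (((cylD_hasDerivAt hb x).const_mul 2).const_add 1)).congr_deriv ?_
  norm_num
  ring

lemma cylG_nonneg (hb : b = (1 - y ^ 2) / 2) (hb0 : 0 < b) (hR : cylR b (-y) = y / 2)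
    {x : ℝ} (hx : -y ≤ x) : 0 ≤ 1 + 2 * cylD b x := by
  rcases le_total 0 x with h | h
  · have r1 := cylR_pos hb0 x
    unfold cylD
    nlinarith [mul_nonneg h r1.le, sq_nonneg y]
  · have hm : MonotoneOn (fun z => cylU b z ^ 2 * (1 + 2 * cylD b z)) (Icc (-y) 0) := by
      apply monotoneOn_of_deriv_nonneg (convex_Icc _ _)
      · exact fun z _ => (cyl_pG_hasDeriv hb0 z).continuousAt.continuousWithinAt
      · exact fun z _ => (cyl_pG_hasDeriv hb0 z).differentiableAt.differentiableWithinAt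
      · intro z hz
        rw [interior_Icc] at hz
        rw [(cyl_pG_hasDeriv hb0 z).deriv]
        have := hz.2
        nlinarith [sq_nonneg (cylU b z)]
    have h1 := hm ⟨le_rfl, hx.trans h⟩ ⟨hx, h⟩ hx
    have h2 : 1 + 2 * cylD b (-y) = 0 := by
      unfold cylD; rw [hR, hb]; ring
    simp only [h2, mul_zero] at h1
    exact nonneg_of_mul_nonneg_right h1 (pow_pos (cylU_pos hb0 x) 2)

lemma cylS_nonpos (hb : b = (1 - y ^ 2) / 2) (hb0 : 0 < b) (hR : cylR b (-y) = y / 2)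
    {x : ℝ} (hx : -y ≤ x) : cylS b x ≤ 0 := by
  rcases le_total 0 x with h | h
  · exact (cylS_neg hb0 h).le
  have hp : ∀ z, HasDerivAt (fun z => -z - 2 * cylR b z) (-(1 + 2 * cylD b z)) z := fun z => by
    refine ((hasDerivAt_id' z).fun_neg.fun_sub ((cylR_hasDerivAt hb0 z).const_mul 2)).congr_deriv ?_
    unfold cylD; ring
  have hpa : AntitoneOn (fun z => -z - 2 * cylR b z) (Icc (-y) 0) := by
    apply antitoneOn_of_deriv_nonpos (convex_Icc _ _)
    · exact fun z _ => (hp z).continuousAt.continuousWithinAt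
    · exact fun z _ => (hp z).differentiableAt.differentiableWithinAt
    · intro z hz
      rw [interior_Icc] at hz
      rw [(hp z).deriv]
      linarith [cylG_nonneg hb hb0 hR hz.1.le]
  have hpn : ∀ z ∈ Icc (-y) 0, -z - 2 * cylR b z ≤ 0 := fun z hz => by
    have := hpa ⟨le_rfl, hz.1.trans hz.2⟩ hz hz.1
    simp only [hR] at this
    linarith
  have hs : ∀ z, HasDerivAt (cylS b)
      (z * (-2 * (z + (1 + 2 * cylD b z) * (-z - 2 * cylR b z)))) z := fun z => by
    refine (((cylR_hasDerivAt hb0 z).const_mul (-2)).fun_add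
      (((hasDerivAt_id' z).const_mul 2).fun_mul (cylD_hasDerivAt hb0 z))).congr_deriv ?_
    unfold cylD; ring
  have hsa : AntitoneOn (cylS b) (Icc (-y) 0) := by
    apply antitoneOn_of_deriv_nonpos (convex_Icc _ _)
    · exact fun z _ => (hs z).continuousAt.continuousWithinAt
    · exact fun z _ => (hs z).differentiableAt.differentiableWithinAt
    · intro z hz
      rw [interior_Icc] at hz
      rw [(hs z).deriv]
      have h1 := mul_nonneg (cylG_nonneg hb hb0 hR hz.1.le)
        (neg_nonneg.2 (hpn z ⟨hz.1.le, hz.2.le⟩))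
      have h2 := hz.2
      nlinarith
  have := hsa ⟨le_rfl, hx.trans h⟩ ⟨hx, h⟩ hx
  have h0 : cylS b (-y) = 0 := by
    unfold cylS cylD; rw [hR, hb]; ring
  linarith

end build

section build
variable {b : ℝ}

lemma cylS_bounded (hb0 : 0 < b) (hb2 : b < 1 / 2) (a : ℝ) :
    ∃ K > 0, ∀ x, a ≤ x → |cylS b x| ≤ K :=
  exists_bound_Ici (cylS_continuous hb0).abs 1 (K := 3) (fun x hx => by
    have := cylS_abs_le hb0 hb2 hx
    nlinarith [abs_nonneg (cylS b x)]) a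

lemma cylUS_int (hb0 : 0 < b) (hb2 : b < 1 / 2) (x : ℝ) :
    IntegrableOn (fun z => cylU b z ^ 2 * cylS b z) (Ioi x) := by
  obtain ⟨K, -, hK⟩ := cylS_bounded hb0 hb2 x
  have h := (cylU_sq_int hb0 x).mul_const K
  refine Integrable.mono' h
    (((cylU_continuous hb0).pow 2).mul (cylS_continuous hb0)).aestronglyMeasurable ?_
  refine (ae_restrict_iff' measurableSet_Ioi).2 (ae_of_all _ fun z hz => ?_)
  rw [norm_mul, Real.norm_of_nonneg (by positivity), Real.norm_eq_abs]
  exact mul_le_mul_of_nonneg_left (hK z (le_of_lt hz)) (by positivity)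

/-- The solvability constant of the first-order corrector. -/
def cylC (b y : ℝ) : ℝ := -(∫ z in Ioi (-y), cylU b z ^ 2 * cylS b z) / ∫ z in Ioi (-y), cylU b z ^ 2

/-- The first-order corrector. -/
def cylr (b y x : ℝ) : ℝ := (∫ z in (-y)..x, cylU b z ^ 2 * (cylC b y + cylS b z)) / cylU b x ^ 2

variable {y : ℝ}

lemma cylU_sq_integral_pos (hb0 : 0 < b) (x : ℝ) : 0 < ∫ z in Ioi x, cylU b z ^ 2 := by
  rw [setIntegral_pos_iff_support_of_nonneg_ae _ (cylU_sq_int hb0 x)]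
  · have : (Function.support fun z => cylU b z ^ 2) = univ := by
      ext z; simp [(cylU_pos hb0 z).ne']
    rw [this]; simp
  · exact ae_of_all _ fun z => by simp only [Pi.zero_apply]; positivity

lemma cylC_pos (hb : b = (1 - y ^ 2) / 2) (hb0 : 0 < b) (hb2 : b < 1 / 2)
    (hR : cylR b (-y) = y / 2) : 0 < cylC b y := by
  refine div_pos ?_ (cylU_sq_integral_pos hb0 _)
  have hi : IntegrableOn (fun z => -(cylU b z ^ 2 * cylS b z)) (Ioi (-y)) :=
    (cylUS_int hb0 hb2 _).neg
  rw [← integral_neg, setIntegral_pos_iff_support_of_nonneg_ae _ hi]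
  · refine lt_of_lt_of_le ?_ (measure_mono (s := Ioo (max 0 (-y)) (max 0 (-y) + 1)) ?_)
    · simp
    · intro z hz
      have h1 : 0 < z := lt_of_le_of_lt (le_max_left _ _) hz.1
      have h2 : -y < z := lt_of_le_of_lt (le_max_right _ _) hz.1
      refine ⟨?_, h2⟩
      have := cylS_neg hb0 h1.le
      have := (cylU_pos hb0 z).ne'
      simp only [Function.mem_support, ne_eq, neg_eq_zero, mul_eq_zero, not_or]
      exact ⟨by positivity, (cylS_neg hb0 h1.le).ne⟩
  · refine (ae_restrict_iff' measurableSet_Ioi).2 (ae_of_all _ fun z hz => ?_)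
    have := cylS_nonpos hb hb0 hR (le_of_lt hz)
    simp only [Pi.zero_apply]
    nlinarith [sq_nonneg (cylU b z)]

lemma cylCS_int (hb0 : 0 < b) (hb2 : b < 1 / 2) (x : ℝ) :
    IntegrableOn (fun z => cylU b z ^ 2 * (cylC b y + cylS b z)) (Ioi x) := by
  simp only [mul_add]
  exact ((cylU_sq_int hb0 x).mul_const _).add (cylUS_int hb0 hb2 x)

lemma cylC_solv (hb0 : 0 < b) (hb2 : b < 1 / 2) :
    ∫ z in Ioi (-y), cylU b z ^ 2 * (cylC b y + cylS b z) = 0 := by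
  have h1 := (cylU_sq_integral_pos hb0 (-y)).ne'
  simp only [mul_add]
  rw [integral_add ((cylU_sq_int hb0 _).mul_const _) (cylUS_int hb0 hb2 _), integral_mul_const]
  unfold cylC
  field_simp
  ring

lemma cylr_hasDerivAt (hb0 : 0 < b) (x : ℝ) :
    HasDerivAt (cylr b y) (cylC b y + cylS b x - 2 * (-x - 2 * cylR b x) * cylr b y x) x := by
  have hc : Continuous fun z => cylU b z ^ 2 * (cylC b y + cylS b z) :=
    ((cylU_continuous hb0).pow 2).mul (continuous_const.add (cylS_continuous hb0))
  have h1 := intervalIntegral.integral_hasDerivAt_right (hc.intervalIntegrable (-y) x)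
    hc.stronglyMeasurable.stronglyMeasurableAtFilter hc.continuousAt
  have hu := (cylU_pos hb0 x).ne'
  refine (h1.fun_div ((cylU_hasDerivAt hb0 x).fun_pow 2) (by positivity)).congr_deriv ?_
  unfold cylr
  field_simp
  norm_num
  ring

lemma cylr_bound (hb : b = (1 - y ^ 2) / 2) (hb0 : 0 < b) (hb2 : b < 1 / 2)
    (hR : cylR b (-y) = y / 2) (hy : y ∈ Ioo (0 : ℝ) 1) :
    ∃ K, ∀ x, 1 ≤ x → x * |cylr b y x| ≤ K := by
  obtain ⟨K, hK0, hK⟩ := cylS_bounded hb0 hb2 (-y)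
  refine ⟨(cylC b y + K) / 2, fun x hx => ?_⟩
  have hyx : -y ≤ x := by linarith [hy.1]
  have hCp := cylC_pos hb hb0 hb2 hR
  have hu := cylU_pos hb0 x
  have e1 : (∫ z in (-y)..x, cylU b z ^ 2 * (cylC b y + cylS b z)) =
      -∫ z in Ioi x, cylU b z ^ 2 * (cylC b y + cylS b z) := by
    have h := cylC_solv (y := y) hb0 hb2
    rw [← Ioc_union_Ioi_eq_Ioi hyx, setIntegral_union Ioc_disjoint_Ioi_same measurableSet_Ioi
      ((cylCS_int hb0 hb2 _).mono_set Ioc_subset_Ioi_self) (cylCS_int hb0 hb2 x)] at h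
    rw [intervalIntegral.integral_of_le hyx]
    linarith
  have e2 : |∫ z in Ioi x, cylU b z ^ 2 * (cylC b y + cylS b z)| ≤
      ∫ z in Ioi x, (cylU b x ^ 2 * (cylC b y + K)) * Real.exp (-(2 * x) * (z - x)) := by
    rw [← Real.norm_eq_abs]
    refine norm_integral_le_of_norm_le ((integrableOn_exp_neg_mul_sub (by linarith)).const_mul _) ?_
    refine (ae_restrict_iff' measurableSet_Ioi).2 (ae_of_all _ fun z hz => ?_)
    have hz' : x ≤ z := le_of_lt hz
    rw [norm_mul, Real.norm_of_nonneg (by positivity), Real.norm_eq_abs]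
    have h1 := cylU_sq_decay hb0 hz'
    rw [show -2 * x * (z - x) = -(2 * x) * (z - x) by ring] at h1
    have h2 : |cylC b y + cylS b z| ≤ cylC b y + K :=
      (abs_add_le _ _).trans (add_le_add (abs_of_pos hCp).le (hK z (hyx.trans hz')))
    calc _ ≤ (cylU b x ^ 2 * Real.exp (-(2 * x) * (z - x))) * (cylC b y + K) := by gcongr
      _ = _ := by ring
  rw [integral_const_mul, integral_exp_neg_mul_sub (by linarith)] at e2
  unfold cylr
  rw [e1, abs_div, abs_neg, abs_of_pos (pow_pos hu 2), mul_div_assoc', div_le_iff₀ (by positivity)]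
  have h0 : 0 < x := by linarith
  calc _ ≤ x * (cylU b x ^ 2 * (cylC b y + K) * (1 / (2 * x))) := by gcongr
    _ = _ := by field_simp

lemma exists_model : Nonempty Model := by
  obtain ⟨y, hy, hyV⟩ := exists_deGennes
  obtain ⟨hy0, hy1⟩ := hy
  set b := (1 - y ^ 2) / 2 with hb
  have hb0 : 0 < b := by rw [hb]; nlinarith
  have hb2 : b < 1 / 2 := by rw [hb]; nlinarith
  have hR : cylR b (-y) = y / 2 := by
    have := cylV_pos (a := b - 1) (by linarith) (-y)
    unfold cylR
    field_simp
    linarith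
  have Rc := cylR_continuous hb0
  have R2c := cylR_continuous (b := b + 1) (by linarith)
  obtain ⟨M₁, hM₁, h1⟩ := exists_bound_Ici
    (f := fun x => 1 / ((1 + (x + y) ^ 2) * (4 * (cylR b x * (cylR (b + 1) x - cylR b x)))))
    (by
      refine continuous_const.div (by fun_prop) fun x => ?_
      have := mul_pos (cylR_pos hb0 x) (sub_pos.2 (cylR_lt hb0 x))
      positivity) 3 (K := 10 / (4 * b)) (fun x hx => by
      have h0 := mul_pos (cylR_pos hb0 x) (sub_pos.2 (cylR_lt hb0 x))
      have h1 := cylR_gap hb0 hb2 hx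
      rw [div_le_div_iff₀ (by positivity) (by positivity)]
      set Q := cylR b x * (cylR (b + 1) x - cylR b x)
      have h2 : x ^ 2 ≤ 1 + (x + y) ^ 2 := by nlinarith
      have := mul_le_mul_of_nonneg_right h2 h0.le
      nlinarith) (-y)
  obtain ⟨M₂, hM₂, h2⟩ := exists_bound_Ici (f := fun x => (x + y) * |cylS b x|)
    (by have := cylS_continuous hb0; fun_prop) 1 (K := 6) (fun x hx => by
      have := cylS_abs_le hb0 hb2 hx
      nlinarith [abs_nonneg (cylS b x)]) (-y)
  obtain ⟨K, hK⟩ := cylr_bound hb hb0 hb2 hR ⟨hy0, hy1⟩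
  have rc : Continuous (cylr b y) :=
    continuous_iff_continuousAt.2 fun x => (cylr_hasDerivAt hb0 x).continuousAt
  obtain ⟨M₃, hM₃, h3⟩ := exists_bound_Ici (f := fun x => (1 + (x + y)) * |cylr b y x|)
    (by fun_prop) 1 (K := 3 * K) (fun x hx => by
      have := hK x hx
      nlinarith [abs_nonneg (cylr b y x)]) (-y)
  obtain ⟨M₄, hM₄, h4⟩ := exists_bound_Ici (f := fun x => (1 + (x + y)) ^ 4 * cylU b x)
    (by have := cylU_continuous hb0; fun_prop) 1 (K := 648 * cylV (b - 1) (-y)) (fun x hx => by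
      have e1 : (1 + (x + y)) ^ 4 ≤ (3 * x) ^ 4 := by
        apply pow_le_pow_left₀ <;> linarith
      have e2 := cylV_antitone (a := b - 1) (by linarith) (show -y ≤ x by linarith)
      have e3 := Real.quadratic_le_exp_of_nonneg (show 0 ≤ x ^ 2 / 2 by positivity)
      have e4 : x ^ 4 * Real.exp (-x ^ 2 / 2) ≤ 8 := by
        have : Real.exp (-x ^ 2 / 2) = (Real.exp (x ^ 2 / 2))⁻¹ := by
          rw [← Real.exp_neg]; ring_nf
        rw [this, mul_inv_le_iff₀ (Real.exp_pos _)]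
        nlinarith
      have e5 := cylV_pos (a := b - 1) (by linarith) x
      unfold cylU
      calc _ ≤ (3 * x) ^ 4 * (Real.exp (-x ^ 2 / 2) * cylV (b - 1) x) := by gcongr
        _ = 81 * (x ^ 4 * Real.exp (-x ^ 2 / 2)) * cylV (b - 1) x := by ring
        _ ≤ 81 * 8 * cylV (b - 1) (-y) := by gcongr
        _ = _ := by ring) (-y)
  set M := M₁ + M₂ + M₃ + M₄ with hM
  have key : ∀ τ : ℝ, y ^ 2 + (-(τ - y) - 2 * cylR b (τ - y)) ^ 2 - (τ + -y) ^ 2 =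
      1 + 2 * cylD b (τ - y) := fun τ => by
    unfold cylD; rw [hb]; ring
  have keyS : ∀ τ : ℝ, -(τ - y) - 2 * cylR b (τ - y) + (1 + 2 * cylD b (τ - y)) * (τ + -y) =
      cylS b (τ - y) := fun τ => by
    unfold cylS; ring
  refine ⟨{ Θ := y ^ 2, ξ := -y, C₁ := cylC b y, M := M
            p := fun τ => -(τ - y) - 2 * cylR b (τ - y)
            r := fun τ => cylr b y (τ - y)
            u := fun τ => cylU b (τ - y)
            Θ_pos := by positivity
            Θ_lt := by nlinarith
            ξ_neg := by linarith
            ξ_sq := by ring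
            C₁_pos := cylC_pos hb hb0 hb2 hR
            M_pos := by positivity
            p_zero := by simp only [zero_sub, hR]; ring
            r_zero := by simp [cylr]
            u_pos := fun τ => cylU_pos hb0 _
            dp := fun τ => ?_
            du := fun τ => ?_
            dr := fun τ => ?_
            G_nonneg := fun τ hτ => ?_
            G_gap := fun τ hτ => ?_
            S_bound := fun τ hτ => ?_
            r_bound := fun τ hτ => ?_
            u_bound := fun τ hτ => ?_ }⟩
  · have := ((hasDerivAt_id' (τ - y)).fun_neg.fun_sub
      ((cylR_hasDerivAt hb0 (τ - y)).const_mul 2)).comp_sub_const τ y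
    refine this.congr_deriv ?_
    rw [key]; unfold cylD; ring
  · exact (cylU_hasDerivAt hb0 (τ - y)).comp_sub_const τ y
  · refine ((cylr_hasDerivAt (y := y) hb0 (τ - y)).comp_sub_const τ y).congr_deriv ?_
    rw [key, keyS]
  · simp only [key]
    exact cylG_nonneg hb hb0 hR (by linarith)
  · simp only [key]
    have h := h1 (τ - y) (by linarith)
    have h0 := mul_pos (cylR_pos hb0 (τ - y)) (sub_pos.2 (cylR_lt hb0 (τ - y)))
    have e := cylR_deriv_eq hb0 (τ - y)
    change cylD b (τ - y) = _ at e
    rw [e]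
    rw [div_le_iff₀ (by positivity), show τ - y + y = τ by ring] at h
    set Q := cylR b (τ - y) * (cylR (b + 1) (τ - y) - cylR b (τ - y))
    have e2 : 1 - (1 + 2 * (-2 * cylR b (τ - y) * (cylR (b + 1) (τ - y) - cylR b (τ - y))))
        = 4 * Q := by ring
    rw [e2]
    calc 1 ≤ M₁ * ((1 + τ ^ 2) * (4 * Q)) := h
      _ ≤ M * ((1 + τ) ^ 2 * (4 * Q)) := by
        gcongr
        · linarith
        · nlinarith
      _ = _ := by ring
  · simp only [key, keyS]
    have h := h2 (τ - y) (by linarith)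
    simp only [show τ - y + y = τ by ring] at h
    linarith
  · have h := h3 (τ - y) (by linarith)
    simp only [show τ - y + y = τ by ring] at h
    linarith
  · have h := h4 (τ - y) (by linarith)
    simp only [show τ - y + y = τ by ring] at h
    linarith

end build

section partials
variable {E : Type*} [NormedAddCommGroup E] [NormedSpace ℝ E]

/-- First partial derivative. -/
def d1 (f : Plane → E) (x : Plane) : E := fderiv ℝ f x ((1 : ℝ), (0 : ℝ))

/-- Second partial derivative. -/
def d2 (f : Plane → E) (x : Plane) : E := fderiv ℝ f x ((0 : ℝ), (1 : ℝ))

lemma fderiv_eq_d (f : Plane → E) (x v : Plane) :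
    fderiv ℝ f x v = v.1 • d1 f x + v.2 • d2 f x := by
  unfold d1 d2
  rw [← map_smul, ← map_smul, ← map_add]
  simp

lemma d1_cont {f : Plane → E} (hf : ContDiff ℝ 1 f) : Continuous (d1 f) :=
  (hf.continuous_fderiv one_ne_zero).clm_apply continuous_const

lemma d2_cont {f : Plane → E} (hf : ContDiff ℝ 1 f) : Continuous (d2 f) :=
  (hf.continuous_fderiv one_ne_zero).clm_apply continuous_const

lemma cdAt {f : Plane → E} (hf : ContDiff ℝ 1 f) (x : Plane) : DifferentiableAt ℝ f x :=
  hf.contDiffAt.differentiableAt one_ne_zero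

lemma d1_congr {f g : Plane → E} {x : Plane} (h : f =ᶠ[𝓝 x] g) : d1 f x = d1 g x := by
  unfold d1; rw [h.fderiv_eq]

lemma d2_congr {f g : Plane → E} {x : Plane} (h : f =ᶠ[𝓝 x] g) : d2 f x = d2 g x := by
  unfold d2; rw [h.fderiv_eq]

lemma d1_add {f g : Plane → E} {x : Plane} (hf : DifferentiableAt ℝ f x)
    (hg : DifferentiableAt ℝ g x) : d1 (fun y => f y + g y) x = d1 f x + d1 g x := by
  unfold d1; rw [fderiv_fun_add hf hg]; rfl

lemma d2_add {f g : Plane → E} {x : Plane} (hf : DifferentiableAt ℝ f x)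
    (hg : DifferentiableAt ℝ g x) : d2 (fun y => f y + g y) x = d2 f x + d2 g x := by
  unfold d2; rw [fderiv_fun_add hf hg]; rfl

lemma d1_sub {f g : Plane → E} {x : Plane} (hf : DifferentiableAt ℝ f x)
    (hg : DifferentiableAt ℝ g x) : d1 (fun y => f y - g y) x = d1 f x - d1 g x := by
  unfold d1; rw [fderiv_fun_sub hf hg]; rfl

lemma d2_sub {f g : Plane → E} {x : Plane} (hf : DifferentiableAt ℝ f x)
    (hg : DifferentiableAt ℝ g x) : d2 (fun y => f y - g y) x = d2 f x - d2 g x := by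
  unfold d2; rw [fderiv_fun_sub hf hg]; rfl

lemma d1_smul {f : Plane → ℝ} {g : Plane → E} {x : Plane} (hf : DifferentiableAt ℝ f x)
    (hg : DifferentiableAt ℝ g x) :
    d1 (fun y => f y • g y) x = f x • d1 g x + d1 f x • g x := by
  unfold d1; rw [fderiv_fun_smul hf hg]; rfl

lemma d2_smul {f : Plane → ℝ} {g : Plane → E} {x : Plane} (hf : DifferentiableAt ℝ f x)
    (hg : DifferentiableAt ℝ g x) :
    d2 (fun y => f y • g y) x = f x • d2 g x + d2 f x • g x := by
  unfold d2; rw [fderiv_fun_smul hf hg]; rfl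

lemma d1_mul {f g : Plane → ℝ} {x : Plane} (hf : DifferentiableAt ℝ f x)
    (hg : DifferentiableAt ℝ g x) :
    d1 (fun y => f y * g y) x = f x * d1 g x + d1 f x * g x := d1_smul hf hg

lemma d2_mul {f g : Plane → ℝ} {x : Plane} (hf : DifferentiableAt ℝ f x)
    (hg : DifferentiableAt ℝ g x) :
    d2 (fun y => f y * g y) x = f x * d2 g x + d2 f x * g x := d2_smul hf hg

lemma d1_const (c : E) (x : Plane) : d1 (fun _ => c) x = 0 := by simp [d1]

lemma d2_const (c : E) (x : Plane) : d2 (fun _ => c) x = 0 := by simp [d2]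

lemma d2_neg (f : Plane → E) (x : Plane) : d2 (fun y => -f y) x = -d2 f x := by
  unfold d2; rw [fderiv_fun_neg]; rfl

lemma d1_comp {φ : ℝ → ℝ} {φ' : ℝ} {f : Plane → ℝ} {x : Plane} (hφ : HasDerivAt φ φ' (f x))
    (hf : DifferentiableAt ℝ f x) : d1 (fun y => φ (f y)) x = φ' * d1 f x := by
  unfold d1
  have h : HasFDerivAt (fun y => φ (f y)) (φ' • fderiv ℝ f x) x :=
    hφ.comp_hasFDerivAt x hf.hasFDerivAt
  rw [h.fderiv]; rfl

lemma d2_comp {φ : ℝ → ℝ} {φ' : ℝ} {f : Plane → ℝ} {x : Plane} (hφ : HasDerivAt φ φ' (f x))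
    (hf : DifferentiableAt ℝ f x) : d2 (fun y => φ (f y)) x = φ' * d2 f x := by
  unfold d2
  have h : HasFDerivAt (fun y => φ (f y)) (φ' • fderiv ℝ f x) x :=
    hφ.comp_hasFDerivAt x hf.hasFDerivAt
  rw [h.fderiv]; rfl

end partials

lemma integral_fderiv_eq_zero {g : Plane → ℝ} (hg : ContDiff ℝ 1 g) (hc : HasCompactSupport g)
    (v : Plane) : ∫ x, fderiv ℝ g x v = 0 := by
  have hi : Integrable (fun x => fderiv ℝ g x v) :=
    ((hg.continuous_fderiv one_ne_zero).clm_apply continuous_const).integrable_of_hasCompactSupport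
      (hc.fderiv_apply (𝕜 := ℝ) v)
  have h := integral_mul_fderiv_eq_neg_fderiv_mul_of_integrable (μ := volume)
    (f := fun _ : Plane => (1 : ℝ)) (g := g) (v := v) (by simp) (by simpa using hi)
    (by simpa using hg.continuous.integrable_of_hasCompactSupport hc)
    (fun x _ => by fun_prop) (fun x _ => cdAt hg x)
  simpa using h

lemma integral_mul_fderiv_symm {f g : Plane → ℝ} (hf : ContDiff ℝ 1 f) (hg : ContDiff ℝ 1 g)
    (hfc : HasCompactSupport f) (v : Plane) :
    ∫ x, f x * fderiv ℝ g x v = -∫ x, fderiv ℝ f x v * g x := by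
  have cf := (hf.continuous_fderiv one_ne_zero).clm_apply (continuous_const (y := v))
  have cg := (hg.continuous_fderiv one_ne_zero).clm_apply (continuous_const (y := v))
  exact integral_mul_fderiv_eq_neg_fderiv_mul_of_integrable
    ((cf.mul hg.continuous).integrable_of_hasCompactSupport ((hfc.fderiv_apply (𝕜 := ℝ) v).mul_right))
    ((hf.continuous.mul cg).integrable_of_hasCompactSupport hfc.mul_right)
    ((hf.continuous.mul hg.continuous).integrable_of_hasCompactSupport hfc.mul_right)
    (fun x _ => cdAt hf x) (fun x _ => cdAt hg x)

/-- Difference quotients of a `C¹` function of compact support converge to the derivative under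
the integral sign. -/
lemma tendsto_integral_diffQuot {g w : Plane → ℝ} (hg : ContDiff ℝ 1 g) (hc : HasCompactSupport g)
    (hw : Integrable w) (v : Plane) :
    Tendsto (fun t : ℝ => ∫ x, t⁻¹ * (g (x + t • v) - g x) * w x) (𝓝[≠] 0)
      (𝓝 (∫ x, fderiv ℝ g x v * w x)) := by
  obtain ⟨C, hC⟩ := hg.lipschitzWith_of_hasCompactSupport hc one_ne_zero
  refine tendsto_integral_filter_of_dominated_convergence (fun x => C * ‖v‖ * ‖w x‖) ?_ ?_ ?_ ?_
  · refine Eventually.of_forall fun t => ?_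
    have := hg.continuous
    exact (Continuous.aestronglyMeasurable (by fun_prop)).mul hw.aestronglyMeasurable
  · filter_upwards [self_mem_nhdsWithin] with t ht
    refine ae_of_all _ fun x => ?_
    have ht' : 0 < |t| := abs_pos.2 ht
    rw [norm_mul, norm_mul]
    refine mul_le_mul_of_nonneg_right ?_ (norm_nonneg _)
    have h := hC.dist_le_mul (x + t • v) x
    rw [dist_eq_norm, dist_eq_norm, add_sub_cancel_left, norm_smul, Real.norm_eq_abs t] at h
    rw [norm_inv, Real.norm_eq_abs t, inv_mul_le_iff₀ ht']
    calc _ ≤ _ := h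
      _ = _ := by ring
  · exact hw.norm.const_mul _
  · refine ae_of_all _ fun x => ?_
    have h : HasDerivAt (fun t : ℝ => g (x + t • v)) (fderiv ℝ g x v) 0 := by
      have h1 : HasDerivAt (fun t : ℝ => x + t • v) v 0 := by
        simpa using ((hasDerivAt_id (0 : ℝ)).smul_const v).const_add x
      have h2 : HasFDerivAt g (fderiv ℝ g x) (x + (0 : ℝ) • v) := by
        simpa using (cdAt hg x).hasFDerivAt
      exact h2.comp_hasDerivAt 0 h1
    have h2 := hasDerivAt_iff_tendsto_slope_zero.1 h
    simp only [zero_add, zero_smul, add_zero, smul_eq_mul] at h2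
    exact h2.mul_const _

/-- Null Lagrangian identity for compactly supported `C¹` functions. -/
lemma integral_jacobian {g b : Plane → ℝ} (hg : ContDiff ℝ 1 g) (hgc : HasCompactSupport g)
    (hb : ContDiff ℝ 1 b) (hbc : HasCompactSupport b) :
    ∫ x, (d1 g x * d2 b x - d2 g x * d1 b x) = 0 := by
  have i2 : ∀ {f : Plane → ℝ}, ContDiff ℝ 1 f → HasCompactSupport f → ∀ v : Plane,
      Integrable (fun x => fderiv ℝ f x v) := fun hf hc v =>
    ((hf.continuous_fderiv one_ne_zero).clm_apply continuous_const).integrable_of_hasCompactSupport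
      (hc.fderiv_apply (𝕜 := ℝ) v)
  have t1 := tendsto_integral_diffQuot hg hgc (i2 hb hbc (0, 1)) (1, 0)
  have t2 := tendsto_integral_diffQuot hb hbc (i2 hg hgc (0, 1)) (-1, 0)
  have key : ∀ t : ℝ, ∫ x, t⁻¹ * (g (x + t • ((1 : ℝ), (0 : ℝ))) - g x) * fderiv ℝ b x (0, 1) =
      ∫ x, t⁻¹ * (b (x + t • ((-1 : ℝ), (0 : ℝ))) - b x) * fderiv ℝ g x (0, 1) * (-1) := by
    intro t
    have e0 : ∀ x : Plane, x + t • ((1 : ℝ), (0 : ℝ)) + t • ((-1 : ℝ), (0 : ℝ)) = x := by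
      intro x; ext <;> simp
    set v : Plane := t • ((1 : ℝ), (0 : ℝ)) with hv
    set gt : Plane → ℝ := fun x => g (x + v) with hgt
    have hgtd : ContDiff ℝ 1 gt := hg.comp (contDiff_id.add contDiff_const)
    have hgtc : HasCompactSupport gt := hgc.comp_homeomorph (Homeomorph.addRight v)
    have hft : ∀ x, fderiv ℝ gt x = fderiv ℝ g (x + v) := fun x => fderiv_comp_add_right v
    have b1 := integral_mul_fderiv_symm hgtd hb hgtc (0, 1)
    have b2 := integral_mul_fderiv_symm hg hb hgc (0, 1)
    simp only [hft] at b1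
    have b3 : ∫ x, fderiv ℝ g (x + v) (0, 1) * b x =
        ∫ x, fderiv ℝ g x (0, 1) * b (x + t • ((-1 : ℝ), (0 : ℝ))) := by
      rw [← integral_add_right_eq_self
        (fun x => fderiv ℝ g x (0, 1) * b (x + t • ((-1 : ℝ), (0 : ℝ)))) v]
      simp only [e0]
    rw [b3] at b1
    have j1 : Integrable fun x => gt x * fderiv ℝ b x (0, 1) :=
      (hgtd.continuous.mul ((hb.continuous_fderiv one_ne_zero).clm_apply
        continuous_const)).integrable_of_hasCompactSupport hgtc.mul_right
    have j2 : Integrable fun x => g x * fderiv ℝ b x (0, 1) :=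
      (hg.continuous.mul ((hb.continuous_fderiv one_ne_zero).clm_apply
        continuous_const)).integrable_of_hasCompactSupport hgc.mul_right
    have cb : Continuous fun x => b (x + t • ((-1 : ℝ), (0 : ℝ))) := by
      have := hb.continuous; fun_prop
    have j3 : Integrable fun x => fderiv ℝ g x (0, 1) * b (x + t • ((-1 : ℝ), (0 : ℝ))) :=
      (((hg.continuous_fderiv one_ne_zero).clm_apply continuous_const).mul
        cb).integrable_of_hasCompactSupport (hgc.fderiv_apply (𝕜 := ℝ) _).mul_right
    have j4 : Integrable fun x => fderiv ℝ g x (0, 1) * b x :=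
      (((hg.continuous_fderiv one_ne_zero).clm_apply continuous_const).mul
        hb.continuous).integrable_of_hasCompactSupport (hgc.fderiv_apply (𝕜 := ℝ) _).mul_right
    have l1 : ∀ x, t⁻¹ * (g (x + v) - g x) * fderiv ℝ b x (0, 1) =
        t⁻¹ * (gt x * fderiv ℝ b x (0, 1) - g x * fderiv ℝ b x (0, 1)) := fun x => by
      simp only [hgt]; ring
    have l2 : ∀ x, t⁻¹ * (b (x + t • ((-1 : ℝ), (0 : ℝ))) - b x) * fderiv ℝ g x (0, 1) * (-1) =
        t⁻¹ * (fderiv ℝ g x (0, 1) * b x -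
          fderiv ℝ g x (0, 1) * b (x + t • ((-1 : ℝ), (0 : ℝ)))) := fun x => by
      ring
    simp only [l1, l2]
    rw [integral_const_mul, integral_const_mul, integral_sub j1 j2, integral_sub j4 j3, b1, b2]
    ring
  simp only [key, integral_mul_const] at t1
  have h := tendsto_nhds_unique t1 (t2.mul_const (-1))
  have e : ∀ x, fderiv ℝ b x (-1, 0) = -d1 b x := fun x => by
    rw [fderiv_eq_d]; simp
  simp only [e] at h
  rw [integral_sub]
  · change ∫ x, fderiv ℝ g x (1, 0) * fderiv ℝ b x (0, 1) = _ at h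
    simp only [neg_mul, integral_neg, mul_neg, neg_neg, mul_one] at h
    unfold d1 d2 at *
    rw [h, sub_eq_zero]
    refine integral_congr_ae (ae_of_all _ fun x => ?_)
    ring
  · exact ((d1_cont hg).mul (d2_cont hb)).integrable_of_hasCompactSupport
      (hgc.fderiv_apply (𝕜 := ℝ) _).mul_right
  · exact ((d2_cont hg).mul (d1_cont hb)).integrable_of_hasCompactSupport
      (hgc.fderiv_apply (𝕜 := ℝ) _).mul_right

/-- A bounded open set with a `C¹` function positive inside and vanishing on the boundary. -/
structure Wall (Ω : Set Plane) (T : Plane → ℝ) : Prop where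
  isOpen : IsOpen Ω
  bdd : Bornology.IsBounded Ω
  smooth : ContDiff ℝ 1 T
  pos : ∀ x ∈ Ω, 0 < T x
  zero : ∀ x ∈ frontier Ω, T x = 0

/-- A smooth step, `0` for `s ≤ 1` and `1` for `2 ≤ s`. -/
def step (s : ℝ) : ℝ := Real.smoothTransition (s - 1)

lemma step_contDiff {n : ℕ∞} : ContDiff ℝ n step :=
  Real.smoothTransition.contDiff.comp (contDiff_id.sub contDiff_const)

lemma step_zero {s : ℝ} (h : s ≤ 1) : step s = 0 :=
  Real.smoothTransition.zero_of_nonpos (by linarith)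

lemma step_one {s : ℝ} (h : 2 ≤ s) : step s = 1 :=
  Real.smoothTransition.one_of_one_le (by linarith)

lemma step_nonneg (s : ℝ) : 0 ≤ step s := Real.smoothTransition.nonneg _

lemma step_le_one (s : ℝ) : step s ≤ 1 := Real.smoothTransition.le_one _

lemma step_hasDerivAt (s : ℝ) : HasDerivAt step (deriv step s) s :=
  ((step_contDiff (n := 1)).contDiffAt.differentiableAt one_ne_zero).hasDerivAt

lemma step_deriv_cont : Continuous (deriv step) :=
  (step_contDiff (n := 1)).continuous_deriv le_rfl

lemma step_deriv_zero_left {s : ℝ} (h : s < 1) : deriv step s = 0 := by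
  have : step =ᶠ[𝓝 s] fun _ => 0 := by
    filter_upwards [Iio_mem_nhds h] with z hz using step_zero (le_of_lt hz)
  rw [this.deriv_eq]; simp

lemma step_deriv_zero_right {s : ℝ} (h : 2 < s) : deriv step s = 0 := by
  have : step =ᶠ[𝓝 s] fun _ => 1 := by
    filter_upwards [Ioi_mem_nhds h] with z hz using step_one (le_of_lt hz)
  rw [this.deriv_eq]; simp

lemma step_deriv_nonneg (s : ℝ) : 0 ≤ deriv step s := by
  have : Monotone step := fun a b h => Real.smoothTransition.monotone (by linarith)
  exact this.deriv_nonneg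

lemma step_deriv_bound : ∃ K > 0, ∀ s, |deriv step s| ≤ K := by
  obtain ⟨M, hM⟩ := (isCompact_Icc (a := (1 : ℝ)) (b := 2)).bddAbove_image
    step_deriv_cont.abs.continuousOn
  refine ⟨max M 1, by positivity, fun s => ?_⟩
  by_cases h : s ∈ Icc (1 : ℝ) 2
  · exact (hM (mem_image_of_mem _ h)).trans (le_max_left _ _)
  · have : deriv step s = 0 := by
      rcases not_and_or.1 h with h | h
      · exact step_deriv_zero_left (not_le.1 h)
      · exact step_deriv_zero_right (not_le.1 h)
    rw [this, abs_zero]; positivity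

lemma intOn_of_cont {Ω : Set Plane} (hb : Bornology.IsBounded Ω) {E : Type*}
    [NormedAddCommGroup E] {f : Plane → E} (hf : Continuous f) : IntegrableOn f Ω :=
  (hf.continuousOn.integrableOn_compact hb.isCompact_closure).mono_set subset_closure

lemma bound_of_cont {Ω : Set Plane} (hb : Bornology.IsBounded Ω) {f : Plane → ℝ}
    (hf : Continuous f) : ∃ K > 0, ∀ x ∈ closure Ω, |f x| ≤ K := by
  obtain ⟨M, hM⟩ := hb.isCompact_closure.bddAbove_image hf.abs.continuousOn
  exact ⟨max M 1, by positivity, fun x hx => (hM (mem_image_of_mem _ hx)).trans (le_max_left _ _)⟩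

namespace Wall
variable {Ω : Set Plane} {T : Plane → ℝ}

/-- Boundary cut-off. -/
def cut (Ω : Set Plane) (T : Plane → ℝ) (ε : ℝ) (x : Plane) : ℝ :=
  open Classical in if x ∈ Ω then step (T x / ε) else 0

lemma cut_of_mem {ε : ℝ} {x : Plane} (hx : x ∈ Ω) : cut Ω T ε x = step (T x / ε) := by
  simp [cut, hx]

lemma cut_eq_nhds (W : Wall Ω T) {ε : ℝ} {x : Plane} (hx : x ∈ Ω) :
    cut Ω T ε =ᶠ[𝓝 x] fun y => step (T y / ε) := by
  filter_upwards [W.isOpen.mem_nhds hx] with y hy using cut_of_mem hy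

lemma cut_nhds_zero (W : Wall Ω T) {ε : ℝ} (hε : 0 < ε) {x : Plane} (hx : x ∉ Ω) :
    cut Ω T ε =ᶠ[𝓝 x] fun _ => 0 := by
  have key : ∀ y, T y < ε → cut Ω T ε y = 0 := fun y hy => by
    unfold cut
    split_ifs
    · exact step_zero ((div_le_one hε).2 hy.le)
    · rfl
  by_cases h : x ∈ closure Ω
  · have hf : x ∈ frontier Ω := ⟨h, by rwa [W.isOpen.interior_eq]⟩
    have := W.smooth.continuous.continuousAt.eventually_lt (g := fun _ => ε) (x₀ := x)
      continuousAt_const (by rw [W.zero x hf]; exact hε)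
    filter_upwards [this] with y hy using key y hy
  · filter_upwards [isClosed_closure.isOpen_compl.mem_nhds h] with y hy
    have h2 : y ∉ Ω := fun h' => hy (subset_closure h')
    simp [cut, h2]

lemma cut_contDiff (W : Wall Ω T) {ε : ℝ} (hε : 0 < ε) : ContDiff ℝ 1 (cut Ω T ε) := by
  rw [contDiff_iff_contDiffAt]
  intro x
  by_cases hx : x ∈ Ω
  · refine ContDiffAt.congr_of_eventuallyEq ?_ (W.cut_eq_nhds hx)
    exact (step_contDiff (n := 1)).contDiffAt.comp x (W.smooth.contDiffAt.div_const ε)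
  · exact contDiffAt_const.congr_of_eventuallyEq (W.cut_nhds_zero hε hx)

lemma cut_hasCompactSupport (W : Wall Ω T) (ε : ℝ) : HasCompactSupport (cut Ω T ε) := by
  refine HasCompactSupport.of_support_subset_isCompact W.bdd.isCompact_closure fun x hx => ?_
  by_contra h
  have h2 : x ∉ Ω := fun h' => h (subset_closure h')
  exact hx (by simp [cut, h2])

lemma cut_d1 (W : Wall Ω T) {ε : ℝ} {x : Plane} (hx : x ∈ Ω) :
    d1 (cut Ω T ε) x = deriv step (T x / ε) / ε * d1 T x := by
  rw [d1_congr (W.cut_eq_nhds hx)]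
  have h : HasDerivAt (fun t => step (t / ε)) (deriv step (T x / ε) / ε) (T x) := by
    have := (step_hasDerivAt (T x / ε)).comp (T x) ((hasDerivAt_id (T x)).div_const ε)
    refine this.congr_deriv ?_
    ring
  exact d1_comp h (cdAt W.smooth x)

lemma cut_d2 (W : Wall Ω T) {ε : ℝ} {x : Plane} (hx : x ∈ Ω) :
    d2 (cut Ω T ε) x = deriv step (T x / ε) / ε * d2 T x := by
  rw [d2_congr (W.cut_eq_nhds hx)]
  have h : HasDerivAt (fun t => step (t / ε)) (deriv step (T x / ε) / ε) (T x) := by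
    have := (step_hasDerivAt (T x / ε)).comp (T x) ((hasDerivAt_id (T x)).div_const ε)
    refine this.congr_deriv ?_
    ring
  exact d2_comp h (cdAt W.smooth x)

/-- Limit of cut-off integrals: if `Q` is dominated by the wall function, then the boundary
layer contributes nothing. -/
lemma tendsto_cut (W : Wall Ω T) {F Q : Plane → ℝ} (hF : Continuous F)
    (hQ : Continuous Q) {C : ℝ} (hC : ∀ x ∈ Ω, |Q x| ≤ C * T x)
    (h0 : ∀ ε > 0, ∫ x in Ω, (cut Ω T ε x * F x + deriv step (T x / ε) / ε * Q x) = 0) :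
    ∫ x in Ω, F x = 0 := by
  obtain ⟨K, hK0, hK⟩ := step_deriv_bound
  obtain ⟨M, hM0, hM⟩ := bound_of_cont W.bdd hF
  have hfin : IsFiniteMeasure (volume.restrict Ω) :=
    ⟨by simpa using W.bdd.measure_lt_top⟩
  have hpos : ∀ n : ℕ, (0 : ℝ) < 1 / ((n : ℝ) + 1) := fun n => Nat.one_div_pos_of_nat
  have ht : Tendsto (fun n : ℕ => ∫ x in Ω, (cut Ω T (1 / ((n : ℝ) + 1)) x * F x +
      deriv step (T x / (1 / ((n : ℝ) + 1))) / (1 / ((n : ℝ) + 1)) * Q x)) atTop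
      (𝓝 (∫ x in Ω, F x)) := by
    refine tendsto_integral_of_dominated_convergence (fun _ => M + K * (2 * |C|)) ?_
      (integrable_const _) ?_ ?_
    · intro n
      have h1 := (W.cut_contDiff (hpos n)).continuous
      have h2 := W.smooth.continuous
      have h3 := step_deriv_cont
      exact Continuous.aestronglyMeasurable (by fun_prop)
    · intro n
      refine (ae_restrict_iff' W.isOpen.measurableSet).2 (ae_of_all _ fun x hx => ?_)
      set ε := 1 / ((n : ℝ) + 1)
      have hε : 0 < ε := hpos n
      have e1 : |cut Ω T ε x * F x| ≤ M := by
        rw [cut_of_mem hx, abs_mul, abs_of_nonneg (step_nonneg _)]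
        have := hM x (subset_closure hx)
        nlinarith [step_le_one (T x / ε), step_nonneg (T x / ε), abs_nonneg (F x)]
      have e2 : |deriv step (T x / ε) / ε * Q x| ≤ K * (2 * |C|) := by
        by_cases h : 2 < T x / ε
        · rw [step_deriv_zero_right h]; simp; positivity
        · rw [not_lt, div_le_iff₀ hε] at h
          rw [abs_mul, abs_div, abs_of_pos hε]
          have hT := W.pos x hx
          have : |Q x| ≤ 2 * |C| * ε :=
            (hC x hx).trans (by nlinarith [le_abs_self C, abs_nonneg C])
          calc _ ≤ K / ε * (2 * |C| * ε) := by gcongr; exact hK _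
            _ = _ := by field_simp
      exact (norm_add_le _ _).trans (add_le_add e1 e2)
    · refine (ae_restrict_iff' W.isOpen.measurableSet).2 (ae_of_all _ fun x hx => ?_)
      have hT := W.pos x hx
      apply tendsto_const_nhds.congr'
      have : ∀ᶠ n : ℕ in atTop, 2 / T x < (n : ℝ) :=
        (tendsto_natCast_atTop_atTop (R := ℝ)).eventually (eventually_gt_atTop _)
      filter_upwards [this] with n hn
      rw [div_lt_iff₀ hT] at hn
      have h2 : 2 < T x / (1 / ((n : ℝ) + 1)) := by
        rw [div_div_eq_mul_div, div_one]; nlinarith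
      rw [cut_of_mem hx, step_one h2.le, step_deriv_zero_right h2]
      simp
  exact tendsto_nhds_unique ht (by simp only [h0 _ (hpos _)]; exact tendsto_const_nhds)

/-- Divergence theorem for vector fields cut off near the wall. -/
lemma cut_div (W : Wall Ω T) {V₁ V₂ : Plane → ℝ} (h1 : ContDiff ℝ 1 V₁)
    (h2 : ContDiff ℝ 1 V₂) {ε : ℝ} (hε : 0 < ε) :
    ∫ x in Ω, (cut Ω T ε x * (d1 V₁ x + d2 V₂ x) +
      deriv step (T x / ε) / ε * (V₁ x * d1 T x + V₂ x * d2 T x)) = 0 := by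
  have hc := W.cut_contDiff hε
  have hcs := W.cut_hasCompactSupport ε
  have i1 := integral_fderiv_eq_zero (hc.mul h1) hcs.mul_right (1, 0)
  have i2 := integral_fderiv_eq_zero (hc.mul h2) hcs.mul_right (0, 1)
  have int1 : Integrable (fun x => d1 (fun y => cut Ω T ε y * V₁ y) x) :=
    (d1_cont (hc.mul h1)).integrable_of_hasCompactSupport (hcs.mul_right.fderiv_apply (𝕜 := ℝ) _)
  have int2 : Integrable (fun x => d2 (fun y => cut Ω T ε y * V₂ y) x) :=
    (d2_cont (hc.mul h2)).integrable_of_hasCompactSupport (hcs.mul_right.fderiv_apply (𝕜 := ℝ) _)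
  have hsum : ∫ x, (d1 (fun y => cut Ω T ε y * V₁ y) x + d2 (fun y => cut Ω T ε y * V₂ y) x) = 0 := by
    rw [integral_add int1 int2]
    change (∫ x, fderiv ℝ (fun y => cut Ω T ε y * V₁ y) x (1, 0)) +
      (∫ x, fderiv ℝ (fun y => cut Ω T ε y * V₂ y) x (0, 1)) = 0
    rw [i1, i2, add_zero]
  have hset := setIntegral_eq_integral_of_forall_compl_eq_zero (s := Ω) (μ := volume)
    (f := fun x => d1 (fun y => cut Ω T ε y * V₁ y) x + d2 (fun y => cut Ω T ε y * V₂ y) x) ?_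
  · rw [hsum] at hset
    rw [← hset]
    refine setIntegral_congr_fun W.isOpen.measurableSet fun x hx => ?_
    rw [d1_mul (cdAt hc x) (cdAt h1 x), d2_mul (cdAt hc x) (cdAt h2 x), W.cut_d1 hx, W.cut_d2 hx]
    ring
  · intro x hx
    have h0 := W.cut_nhds_zero hε hx
    have e : ∀ V : Plane → ℝ, (fun y => cut Ω T ε y * V y) =ᶠ[𝓝 x] fun _ => 0 := fun V => by
      filter_upwards [h0] with y hy
      rw [hy, zero_mul]
    rw [d1_congr (e V₁), d2_congr (e V₂), d1_const, d2_const, add_zero]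

/-- Divergence theorem for vector fields tangent to the wall. -/
lemma integral_div (W : Wall Ω T) {V₁ V₂ : Plane → ℝ} (h1 : ContDiff ℝ 1 V₁)
    (h2 : ContDiff ℝ 1 V₂) {C : ℝ}
    (hC : ∀ x ∈ Ω, |V₁ x * d1 T x + V₂ x * d2 T x| ≤ C * T x) :
    ∫ x in Ω, (d1 V₁ x + d2 V₂ x) = 0 :=
  W.tendsto_cut (Q := fun x => V₁ x * d1 T x + V₂ x * d2 T x)
    ((d1_cont h1).add (d2_cont h2))
    ((h1.continuous.mul (d1_cont W.smooth)).add (h2.continuous.mul (d2_cont W.smooth))) hC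
    fun _ hε => W.cut_div h1 h2 hε

/-- Null Lagrangian identity on `Ω`, when the first function vanishes on the wall. -/
lemma integral_jac (W : Wall Ω T) {g b : Plane → ℝ} (hg : ContDiff ℝ 1 g)
    (hb : ContDiff ℝ 1 b) (hbc : HasCompactSupport b) {C : ℝ} (hC : ∀ x ∈ Ω, |g x| ≤ C * T x) :
    ∫ x in Ω, (d1 g x * d2 b x - d2 g x * d1 b x) = 0 := by
  have cT := W.smooth
  obtain ⟨K, hK0, hK⟩ := bound_of_cont W.bdd
    (((d1_cont cT).mul (d2_cont hb)).sub ((d2_cont cT).mul (d1_cont hb)))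
  refine W.tendsto_cut (Q := fun x => g x * (d1 T x * d2 b x - d2 T x * d1 b x))
    (C := C * K) (((d1_cont hg).mul (d2_cont hb)).sub ((d2_cont hg).mul (d1_cont hb)))
    (hg.continuous.mul (((d1_cont cT).mul (d2_cont hb)).sub ((d2_cont cT).mul (d1_cont hb))))
    ?_ ?_
  · intro x hx
    rw [abs_mul]
    have h1 := hC x hx
    have h2 := hK x (subset_closure hx)
    calc _ ≤ (C * T x) * K := mul_le_mul h1 h2 (abs_nonneg _) ((abs_nonneg _).trans h1)
      _ = _ := by ring
  intro ε hε
  have hc := W.cut_contDiff hε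
  have hcs := W.cut_hasCompactSupport ε
  have hj := integral_jacobian (hc.mul hg) hcs.mul_right hb hbc
  have hset := setIntegral_eq_integral_of_forall_compl_eq_zero (s := Ω) (μ := volume)
    (f := fun x => d1 (fun y => cut Ω T ε y * g y) x * d2 b x -
      d2 (fun y => cut Ω T ε y * g y) x * d1 b x) ?_
  · rw [← hj]
    refine Eq.trans ?_ hset
    refine setIntegral_congr_fun W.isOpen.measurableSet fun x hx => ?_
    rw [d1_mul (cdAt hc x) (cdAt hg x), d2_mul (cdAt hc x) (cdAt hg x), W.cut_d1 hx, W.cut_d2 hx]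
    ring
  · intro x hx
    have h0 := W.cut_nhds_zero hε hx
    have e : (fun y => cut Ω T ε y * g y) =ᶠ[𝓝 x] fun _ => 0 := by
      filter_upwards [h0] with y hy
      rw [hy, zero_mul]
    rw [d1_congr e, d2_congr e, d1_const, d2_const]; ring

end Wall

/-- A function of class `Cⁿ` near a compact set has a global compactly supported extension. -/
lemma exists_extension {E : Type*} [NormedAddCommGroup E] [NormedSpace ℝ E] {n : ℕ}
    {Ω : Set Plane} (hb : Bornology.IsBounded Ω) {u : Plane → E} (hu : CNearCl n Ω u) :
    ∃ v : Plane → E, ContDiff ℝ n v ∧ HasCompactSupport v ∧ ∀ x ∈ closure Ω, v =ᶠ[𝓝 x] u := by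
  obtain ⟨U, hU, hΩU, hc⟩ := hu
  obtain ⟨K, hK, hΩK, hKU⟩ := exists_compact_between hb.isCompact_closure hU hΩU
  obtain ⟨f, hf1, hf0, -⟩ := exists_contMDiffMap_one_nhds_of_subset_interior
    (I := modelWithCornersSelf ℝ Plane) (n := n) isClosed_closure hΩK
  have hfs : ContDiff ℝ n f := f.contMDiff.contDiff
  refine ⟨fun x => f x • u x, ?_, ?_, ?_⟩
  · rw [contDiff_iff_contDiffAt]
    intro x
    by_cases hx : x ∈ K
    · exact hfs.contDiffAt.smul (hc.contDiffAt (hU.mem_nhds (hKU hx)))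
    · refine contDiffAt_const (c := (0 : E)) |>.congr_of_eventuallyEq ?_
      filter_upwards [hK.isClosed.isOpen_compl.mem_nhds hx] with y hy
      rw [hf0 y hy, zero_smul]
  · refine HasCompactSupport.of_support_subset_isCompact hK fun x hx => ?_
    by_contra h
    exact hx (by simp [hf0 x h])
  · intro x hx
    filter_upwards [(mem_nhdsSet_iff_forall.1 hf1) x hx] with y hy
    rw [hy, one_smul]

/-- Integrable functions with vanishing integral. -/
structure Null (Ω : Set Plane) (f : Plane → ℝ) : Prop where
  int : IntegrableOn f Ω
  zero : ∫ x in Ω, f x = 0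

namespace Null
variable {Ω : Set Plane} {f g : Plane → ℝ}

lemma sub (hf : Null Ω f) (hg : Null Ω g) : Null Ω fun x => f x - g x :=
  ⟨hf.int.sub hg.int, by rw [integral_sub hf.int hg.int, hf.zero, hg.zero, sub_zero]⟩

lemma const_mul (hf : Null Ω f) (c : ℝ) : Null Ω fun x => c * f x :=
  ⟨hf.int.const_mul c, by rw [integral_const_mul, hf.zero, mul_zero]⟩

lemma congr (hf : Null Ω f) (hΩ : MeasurableSet Ω) (h : ∀ x ∈ Ω, g x = f x) : Null Ω g :=
  ⟨IntegrableOn.congr_fun hf.int (fun x hx => (h x hx).symm) hΩ,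
    by rw [setIntegral_congr_fun hΩ h, hf.zero]⟩

end Null

/-- Bulk magnetic identity. -/
lemma Wall.integral_curl {Ω : Set Plane} {T : Plane → ℝ} (W : Wall Ω T) {g a b A₁ A₂ : Plane → ℝ}
    (hg : ContDiff ℝ 1 g) (ha : ContDiff ℝ 1 a) (hb : ContDiff ℝ 1 b)
    (hac : HasCompactSupport a) (hbc : HasCompactSupport b)
    (h1 : ContDiff ℝ 1 A₁) (h2 : ContDiff ℝ 1 A₂) (B : ℝ) {C : ℝ}
    (hCa : ∀ x ∈ Ω, |g x * a x| ≤ C * T x) (hCb : ∀ x ∈ Ω, |g x * b x| ≤ C * T x) :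
    Null Ω fun x => (2 * g x * ((d1 a x + B * A₁ x * b x) * (d2 b x - B * A₂ x * a x) -
        (d1 b x - B * A₁ x * a x) * (d2 a x + B * A₂ x * b x))
      - B * g x * (d1 A₂ x - d2 A₁ x) * (a x ^ 2 + b x ^ 2)
      - (d2 g x * (a x * (d1 b x - B * A₁ x * a x) - b x * (d1 a x + B * A₁ x * b x))
        - d1 g x * (a x * (d2 b x - B * A₂ x * a x) - b x * (d2 a x + B * A₂ x * b x)))) := by
  have cT := W.smooth
  have j1 := W.integral_jac (hg.mul ha) hb hbc hCa
  have j2 := W.integral_jac (hg.mul hb) ha hac hCb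
  obtain ⟨K1, hK1, hK1'⟩ := bound_of_cont W.bdd
    (f := fun x => a x * (A₂ x * d1 T x - A₁ x * d2 T x))
    (ha.continuous.mul ((h2.continuous.mul (d1_cont cT)).sub (h1.continuous.mul (d2_cont cT))))
  obtain ⟨K2, hK2, hK2'⟩ := bound_of_cont W.bdd
    (f := fun x => b x * (A₂ x * d1 T x - A₁ x * d2 T x))
    (hb.continuous.mul ((h2.continuous.mul (d1_cont cT)).sub (h1.continuous.mul (d2_cont cT))))
  have hm : ContDiff ℝ 1 fun x => g x * (a x * a x + b x * b x) :=
    hg.mul ((ha.mul ha).add (hb.mul hb))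
  have j3 := W.integral_div (V₁ := fun x => g x * (a x * a x + b x * b x) * A₂ x)
    (V₂ := fun x => -(g x * (a x * a x + b x * b x) * A₁ x)) (hm.mul h2) (hm.mul h1).neg
    (C := C * (K1 + K2)) (by
      intro x hx
      have e : g x * (a x * a x + b x * b x) * A₂ x * d1 T x +
          -(g x * (a x * a x + b x * b x) * A₁ x) * d2 T x =
          (g x * a x) * (a x * (A₂ x * d1 T x - A₁ x * d2 T x)) +
          (g x * b x) * (b x * (A₂ x * d1 T x - A₁ x * d2 T x)) := by ring
      rw [e]
      refine (abs_add_le _ _).trans ?_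
      rw [abs_mul (g x * a x), abs_mul (g x * b x)]
      have q1 := mul_le_mul (hCa x hx) (hK1' x (subset_closure hx)) (abs_nonneg _)
        ((abs_nonneg _).trans (hCa x hx))
      have q2 := mul_le_mul (hCb x hx) (hK2' x (subset_closure hx)) (abs_nonneg _)
        ((abs_nonneg _).trans (hCb x hx))
      calc _ ≤ _ := add_le_add q1 q2
        _ = _ := by ring)
  have c := fun {f : Plane → ℝ} (h : ContDiff ℝ 1 f) => d1_cont h
  have c' := fun {f : Plane → ℝ} (h : ContDiff ℝ 1 f) => d2_cont h
  have i1 := intOn_of_cont W.bdd (((c (hg.mul ha)).mul (c' hb)).sub ((c' (hg.mul ha)).mul (c hb)))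
  have i2 := intOn_of_cont W.bdd (((c (hg.mul hb)).mul (c' ha)).sub ((c' (hg.mul hb)).mul (c ha)))
  have i3 := intOn_of_cont W.bdd ((c (hm.mul h2)).add (c' (hm.mul h1).neg))
  have n1 : Null Ω _ := ⟨i1, j1⟩
  have n2 : Null Ω _ := ⟨i2, j2⟩
  have n3 : Null Ω _ := ⟨i3, j3⟩
  refine ((n1.sub n2).sub (n3.const_mul B)).congr W.isOpen.measurableSet fun x _ => ?_
  have dg := cdAt hg x
  have da := cdAt ha x
  have db := cdAt hb x
  have dA := cdAt h1 x
  have dm : DifferentiableAt ℝ (fun y => a y * a y + b y * b y) x := (da.mul da).add (db.mul db)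
  have dA' := cdAt h2 x
  simp only [Pi.sub_apply, Pi.mul_apply, Pi.add_apply]
  rw [d1_mul dg da, d2_mul dg da, d1_mul dg db, d2_mul dg db, d1_mul (cdAt hm x) dA', d2_neg,
    d2_mul (cdAt hm x) dA, d1_mul dg dm,
    d2_mul dg dm, d1_add (da.fun_mul da) (db.fun_mul db),
    d2_add (da.fun_mul da) (db.fun_mul db), d1_mul da da, d1_mul db db, d2_mul da da, d2_mul db db]
  ring

/-- Boundary coordinates in analytic form: `T` extends the distance to the boundary and `k` extends
the curvature of the nearest boundary point; their defining relations hold where `T < t₁`. -/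
structure Geo (Ω : Set Plane) where
  T : Plane → ℝ
  k : Plane → ℝ
  t₁ : ℝ
  km : ℝ
  Ck : ℝ
  wall : Wall Ω T
  T_smooth : ContDiff ℝ 2 T
  k_smooth : ContDiff ℝ 1 k
  t₁_pos : 0 < t₁
  Ck_pos : 0 < Ck
  grad : ∀ x ∈ Ω, T x < t₁ → d1 T x ^ 2 + d2 T x ^ 2 = 1
  orth : ∀ x ∈ Ω, T x < t₁ → d1 k x * d1 T x + d2 k x * d2 T x = 0
  lap : ∀ x ∈ Ω, T x < t₁ → d1 (d1 T) x + d2 (d2 T) x = -k x / (1 - T x * k x)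
  Tk : ∀ x ∈ Ω, T x < t₁ → |T x * k x| ≤ 1 / 2
  k_le : ∀ x ∈ Ω, T x < t₁ → k x ≤ km
  dk : ∀ x ∈ Ω, T x < t₁ → d1 k x ^ 2 + d2 k x ^ 2 ≤ Ck * (km - k x)

namespace Model
variable (m : Model)

/-- The weight `G`. -/
def G (τ : ℝ) : ℝ := m.Θ + m.p τ ^ 2 - (τ + m.ξ) ^ 2

/-- The function `S = p + G (τ + ξ)`. -/
def S (τ : ℝ) : ℝ := m.p τ + m.G τ * (τ + m.ξ)

lemma hasDerivAt_G (τ : ℝ) : HasDerivAt m.G (-2 * m.p τ * m.G τ - 2 * (τ + m.ξ)) τ := by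
  have h := ((m.dp τ).fun_pow 2).const_add m.Θ |>.fun_sub
    (((hasDerivAt_id τ).add_const m.ξ).fun_pow 2)
  refine h.congr_deriv ?_
  simp only [G, id]; push_cast; ring

lemma hasDerivAt_S (τ : ℝ) :
    HasDerivAt m.S (-2 * (τ + m.ξ + m.G τ * m.p τ) * (τ + m.ξ)) τ := by
  have h := (m.dp τ).fun_add ((m.hasDerivAt_G τ).fun_mul ((hasDerivAt_id τ).add_const m.ξ))
  refine h.congr_deriv ?_
  simp only [G, id]; ring

lemma hasDerivAt_r (τ : ℝ) : HasDerivAt m.r (m.C₁ + m.S τ - 2 * m.p τ * m.r τ) τ :=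
  (m.dr τ).congr_deriv (by simp only [S, G])

lemma _root_.SC.contDiff_one_of_hasDerivAt {f f' : ℝ → ℝ} (h : ∀ x, HasDerivAt f (f' x) x)
    (hc : Continuous f') : ContDiff ℝ 1 f := by
  refine contDiff_one_iff_deriv.2 ⟨fun x => (h x).differentiableAt, ?_⟩
  have : deriv f = f' := funext fun x => (h x).deriv
  rwa [this]

lemma p_cont : Continuous m.p := continuous_iff_continuousAt.2 fun τ => (m.dp τ).continuousAt
lemma r_cont : Continuous m.r := continuous_iff_continuousAt.2 fun τ => (m.dr τ).continuousAt
lemma G_cont : Continuous m.G :=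
  continuous_iff_continuousAt.2 fun τ => (m.hasDerivAt_G τ).continuousAt
lemma S_cont : Continuous m.S :=
  continuous_iff_continuousAt.2 fun τ => (m.hasDerivAt_S τ).continuousAt

lemma G_smooth : ContDiff ℝ 1 m.G :=
  contDiff_one_of_hasDerivAt m.hasDerivAt_G (by have := m.p_cont; have := m.G_cont; fun_prop)
lemma S_smooth : ContDiff ℝ 1 m.S :=
  contDiff_one_of_hasDerivAt m.hasDerivAt_S (by have := m.p_cont; have := m.G_cont; fun_prop)
lemma r_smooth : ContDiff ℝ 1 m.r :=
  contDiff_one_of_hasDerivAt m.hasDerivAt_r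
    (by have := m.p_cont; have := m.S_cont; have := m.r_cont; fun_prop)

lemma G_zero : m.G 0 = 0 := by simp [G, m.p_zero, m.ξ_sq]
lemma S_zero : m.S 0 = 0 := by simp [S, m.p_zero, m.G_zero]

lemma G_pos (τ : ℝ) (h : 0 ≤ τ) : 0 ≤ m.G τ := m.G_nonneg τ h

lemma one_sub_G_pos (τ : ℝ) (h : 0 ≤ τ) : 0 < 1 - m.G τ := by
  have h1 := m.G_gap τ h
  have h2 := m.M_pos
  by_contra h3
  have : m.M * (1 + τ) ^ 2 * (1 - (m.Θ + m.p τ ^ 2 - (τ + m.ξ) ^ 2)) ≤ 0 :=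
    mul_nonpos_of_nonneg_of_nonpos (by positivity) (by simpa [G] using h3)
  linarith

/-- `r² / (1 - G²)` is bounded. -/
lemma rsq_bound (τ : ℝ) (h : 0 ≤ τ) : m.r τ ^ 2 / (1 - m.G τ ^ 2) ≤ m.M ^ 3 := by
  have h0 := m.one_sub_G_pos τ h
  have hG := m.G_pos τ h
  have h1 : 1 ≤ m.M * (1 + τ) ^ 2 * (1 - m.G τ) := m.G_gap τ h
  have h2 := m.r_bound τ h
  have h3 : 0 < 1 - m.G τ ^ 2 := by nlinarith
  rw [div_le_iff₀ h3]
  have h4 : (1 + τ) ^ 2 * m.r τ ^ 2 ≤ m.M ^ 2 := by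
    rw [← sq_abs (m.r τ), ← mul_pow]
    exact pow_le_pow_left₀ (by positivity) h2 2
  have hM := m.M_pos
  have h5 : 1 - m.G τ ≤ 1 - m.G τ ^ 2 := by nlinarith
  calc m.r τ ^ 2 ≤ m.r τ ^ 2 * (m.M * (1 + τ) ^ 2 * (1 - m.G τ)) :=
        le_mul_of_one_le_right (sq_nonneg _) h1
    _ = m.M * (1 - m.G τ) * ((1 + τ) ^ 2 * m.r τ ^ 2) := by ring
    _ ≤ m.M * (1 - m.G τ ^ 2) * m.M ^ 2 := by gcongr
    _ = _ := by ring

end Model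

/-- Pointwise form of the ground-state substitution near the boundary. -/
lemma substitution_identity {P1 Q1 P2 Q2 a b n1 n2 k1 k2 s T k κ p q G r r1 S G' S' r' C c F f1 f2 Θ
    : ℝ} (hn : n1 ^ 2 + n2 ^ 2 = 1) (ho : k1 * n1 + k2 * n2 = 0)
    (hκ : κ - T * k * κ = k) (hG : G = Θ + p ^ 2 - q ^ 2)
    (hS : S = p + G * q) (hr : r = r1 * (1 - G ^ 2)) (hG' : G' = -2 * p * G - 2 * q)
    (hS' : S' = -2 * (q + G * p) * q) (hr' : r' = C + S - 2 * p * r)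
    (hF : F = s * S + k * r) (hf1 : f1 = s * (S' * (s * n1)) + (k1 * r + k * (r' * (s * n1))))
    (hf2 : f2 = s * (S' * (s * n2)) + (k2 * r + k * (r' * (s * n2)))) :
    (P1 ^ 2 + Q1 ^ 2 + P2 ^ 2 + Q2 ^ 2)
      - (2 * G * (P1 * Q2 - Q1 * P2) - s ^ 2 * G * c * (a ^ 2 + b ^ 2)
        - (G' * (s * n2) * (a * Q1 - b * P1) - G' * (s * n1) * (a * Q2 - b * P2)))
      - ((f1 * n1 + f2 * n2 + F * -κ) * (a ^ 2 + b ^ 2)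
        + F * (2 * (n1 * (a * P1 + b * Q1) + n2 * (a * P2 + b * Q2)))) =
    (n2 * P1 - n1 * P2 + (s * q - G * (k * r1)) * b) ^ 2
      + (n2 * Q1 - n1 * Q2 - (s * q - G * (k * r1)) * a) ^ 2
      + (n1 * P1 + n2 * P2 - (s * p + k * r1) * a) ^ 2
      + (n1 * Q1 + n2 * Q2 - (s * p + k * r1) * b) ^ 2
      - 2 * G * ((n2 * P1 - n1 * P2 + (s * q - G * (k * r1)) * b) *
          (n1 * Q1 + n2 * Q2 - (s * p + k * r1) * b) -
          (n2 * Q1 - n1 * Q2 - (s * q - G * (k * r1)) * a) *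
          (n1 * P1 + n2 * P2 - (s * p + k * r1) * a))
      + (Θ * s ^ 2 - C * s * k + s ^ 2 * G * (c - 1)
        + (k * κ * (s * T) * S - k ^ 2 * r * r1 + κ * k * r)) * (a ^ 2 + b ^ 2) := by
  have hΘ : Θ = G - p ^ 2 + q ^ 2 := by rw [hG]; ring
  clear hG
  subst hF hf1 hf2 hr' hS' hG' hr hS hΘ
  linear_combination (-(P1 ^ 2 + Q1 ^ 2 + P2 ^ 2 + Q2 ^ 2 - 2 * G * (P1 * Q2 - Q1 * P2))
    - (a ^ 2 + b ^ 2) * (s ^ 2 * (-2 * (q + G * p) * q) + k * s *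
      (C + (p + G * q) - 2 * p * (r1 * (1 - G ^ 2))))) * hn
    - (a ^ 2 + b ^ 2) * (r1 * (1 - G ^ 2)) * ho + s * (p + G * q) * (a ^ 2 + b ^ 2) * hκ

/-- `|D v|²` for `v = a + i b`, `D = ∇ - i B A`. -/
def dsq (B : ℝ) (A₁ A₂ a b : Plane → ℝ) (x : Plane) : ℝ :=
  (d1 a x + B * A₁ x * b x) ^ 2 + (d1 b x - B * A₁ x * a x) ^ 2 +
    (d2 a x + B * A₂ x * b x) ^ 2 + (d2 b x - B * A₂ x * a x) ^ 2

/-- `curl A`. -/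
def curlf (A₁ A₂ : Plane → ℝ) (x : Plane) : ℝ := d1 A₂ x - d2 A₁ x

lemma dsq_cont {B : ℝ} {A₁ A₂ a b : Plane → ℝ} (h1 : ContDiff ℝ 1 A₁) (h2 : ContDiff ℝ 1 A₂)
    (ha : ContDiff ℝ 1 a) (hb : ContDiff ℝ 1 b) : Continuous (dsq B A₁ A₂ a b) := by
  have := d1_cont ha; have := d2_cont ha; have := d1_cont hb; have := d2_cont hb
  have := ha.continuous; have := hb.continuous; have := h1.continuous; have := h2.continuous
  unfold dsq; fun_prop

lemma curlf_cont {A₁ A₂ : Plane → ℝ} (h1 : ContDiff ℝ 1 A₁) (h2 : ContDiff ℝ 1 A₂) :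
    Continuous (curlf A₁ A₂) := (d1_cont h2).sub (d2_cont h1)

lemma dsq_nonneg (B : ℝ) (A₁ A₂ a b : Plane → ℝ) (x : Plane) : 0 ≤ dsq B A₁ A₂ a b x := by
  unfold dsq; positivity

lemma form_bounds {G u v w z : ℝ} (h0 : 0 ≤ G) (h1 : G ≤ 1) :
    0 ≤ u ^ 2 + v ^ 2 + w ^ 2 + z ^ 2 - 2 * G * (u * z - v * w) ∧
    u ^ 2 + v ^ 2 + w ^ 2 + z ^ 2 - 2 * G * (u * z - v * w) ≤
      2 * (u ^ 2 + v ^ 2 + w ^ 2 + z ^ 2) := by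
  have e1 : 2 * (u * z - v * w) ≤ u ^ 2 + v ^ 2 + w ^ 2 + z ^ 2 := by
    nlinarith [sq_nonneg (u - z), sq_nonneg (v + w)]
  have e2 : -(2 * (u * z - v * w)) ≤ u ^ 2 + v ^ 2 + w ^ 2 + z ^ 2 := by
    nlinarith [sq_nonneg (u + z), sq_nonneg (v - w)]
  have e0 : 0 ≤ u ^ 2 + v ^ 2 + w ^ 2 + z ^ 2 := by positivity
  constructor <;> nlinarith [mul_le_mul_of_nonneg_left e1 h0, mul_le_mul_of_nonneg_left e2 h0]

lemma error_bound {k κ τ S r r1 K M : ℝ} (hk : |k| ≤ K) (hκK : |κ| ≤ 2 * K) (hS : |τ * S| ≤ M)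
    (hr : |r| ≤ M) (hrr : |r * r1| ≤ M ^ 3) (hK0 : 0 ≤ K) :
    |k * κ * τ * S - k ^ 2 * r * r1 + κ * k * r| ≤ K ^ 2 * (4 * M + M ^ 3) := by
  have hkκ : |k * κ| ≤ K * (2 * K) := by
    rw [abs_mul]; exact mul_le_mul hk hκK (abs_nonneg _) hK0
  have e1 : |(k * κ) * (τ * S)| ≤ K * (2 * K) * M := by
    rw [abs_mul]; exact mul_le_mul hkκ hS (abs_nonneg _) (by positivity)
  have e2 : |k ^ 2 * (r * r1)| ≤ K ^ 2 * M ^ 3 := by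
    rw [abs_mul, abs_pow]
    exact mul_le_mul (pow_le_pow_left₀ (abs_nonneg _) hk 2) hrr (abs_nonneg _) (by positivity)
  have e3 : |(k * κ) * r| ≤ K * (2 * K) * M := by
    rw [abs_mul]; exact mul_le_mul hkκ hr (abs_nonneg _) (by positivity)
  have e : k * κ * τ * S - k ^ 2 * r * r1 + κ * k * r =
      (k * κ) * (τ * S) - k ^ 2 * (r * r1) + (k * κ) * r := by ring
  rw [e]
  calc _ ≤ |(k * κ) * (τ * S)| + |k ^ 2 * (r * r1)| + |(k * κ) * r| :=
        (abs_add_le _ _).trans (add_le_add_left (abs_sub _ _) _)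
    _ ≤ K * (2 * K) * M + K ^ 2 * M ^ 3 + K * (2 * K) * M := add_le_add (add_le_add e1 e2) e3
    _ = _ := by ring

namespace Model
variable (m : Model)

lemma r_abs (τ : ℝ) (hτ : 0 ≤ τ) : |m.r τ| ≤ m.M := by
  have := m.r_bound τ hτ
  nlinarith [abs_nonneg (m.r τ)]

lemma r_mul_bound (τ : ℝ) (hτ : 0 ≤ τ) :
    |m.r τ * (m.r τ / (1 - m.G τ ^ 2))| ≤ m.M ^ 3 := by
  have hG0 := m.G_pos τ hτ
  have hG1 := m.one_sub_G_pos τ hτ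
  have e : m.r τ * (m.r τ / (1 - m.G τ ^ 2)) = m.r τ ^ 2 / (1 - m.G τ ^ 2) := by ring
  rw [e, abs_of_nonneg (div_nonneg (sq_nonneg _) (by nlinarith))]
  exact m.rsq_bound τ hτ

end Model

namespace Geo
variable {Ω : Set Plane} (g : Geo Ω) (m : Model)

/-- Squared norm of `D v - X v`, where `X` is the logarithmic gradient of the boundary profile. -/
def wsq (s : ℝ) (A₁ A₂ a b : Plane → ℝ) (x : Plane) : ℝ :=
  let r1 := m.r (s * g.T x) / (1 - m.G (s * g.T x) ^ 2)
  let X := s * (s * g.T x + m.ξ) - m.G (s * g.T x) * (g.k x * r1)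
  let Y := s * m.p (s * g.T x) + g.k x * r1
  let P1 := d1 a x + s ^ 2 * A₁ x * b x
  let Q1 := d1 b x - s ^ 2 * A₁ x * a x
  let P2 := d2 a x + s ^ 2 * A₂ x * b x
  let Q2 := d2 b x - s ^ 2 * A₂ x * a x
  (d2 g.T x * P1 - d1 g.T x * P2 + X * b x) ^ 2 + (d2 g.T x * Q1 - d1 g.T x * Q2 - X * a x) ^ 2 +
    (d1 g.T x * P1 + d2 g.T x * P2 - Y * a x) ^ 2 + (d1 g.T x * Q1 + d2 g.T x * Q2 - Y * b x) ^ 2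

/-- The effective potential near the boundary. -/
def pot (s : ℝ) (c : Plane → ℝ) (x : Plane) : ℝ :=
  m.Θ * s ^ 2 - m.C₁ * s * g.k x + s ^ 2 * m.G (s * g.T x) * (c x - 1)

lemma T1 : ContDiff ℝ 1 g.T := g.wall.smooth
lemma dT1 : ContDiff ℝ 1 (d1 g.T) := by
  have := g.T_smooth.fderiv_right (m := 1) (by norm_num)
  exact this.clm_apply contDiff_const
lemma dT2 : ContDiff ℝ 1 (d2 g.T) := by
  have := g.T_smooth.fderiv_right (m := 1) (by norm_num)
  exact this.clm_apply contDiff_const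

/-- The field strength of the drift. -/
def drift (s : ℝ) (x : Plane) : ℝ := s * m.S (s * g.T x) + g.k x * m.r (s * g.T x)

lemma sT (s : ℝ) : ContDiff ℝ 1 fun x => s * g.T x := contDiff_const.mul g.T1

lemma drift_smooth (s : ℝ) : ContDiff ℝ 1 (g.drift m s) :=
  (contDiff_const.mul (m.S_smooth.comp (g.sT s))).add (g.k_smooth.mul (m.r_smooth.comp (g.sT s)))

lemma comp_d {φ : ℝ → ℝ} {φ' : ℝ} (s : ℝ) {x : Plane} (h : HasDerivAt φ φ' (s * g.T x)) :
    d1 (fun y => φ (s * g.T y)) x = φ' * (s * d1 g.T x) ∧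
    d2 (fun y => φ (s * g.T y)) x = φ' * (s * d2 g.T x) := by
  have hx := cdAt (g.sT s) x
  have dT := cdAt g.T1 x
  rw [d1_comp h hx, d2_comp h hx, d1_mul (differentiableAt_const _) dT,
    d2_mul (differentiableAt_const _) dT, d1_const, d2_const]
  simp

lemma drift_d (s : ℝ) (x : Plane) :
    d1 (g.drift m s) x = s * ((-2 * (s * g.T x + m.ξ + m.G (s * g.T x) * m.p (s * g.T x)) *
        (s * g.T x + m.ξ)) * (s * d1 g.T x)) + (d1 g.k x * m.r (s * g.T x) + g.k x *
        ((m.C₁ + m.S (s * g.T x) - 2 * m.p (s * g.T x) * m.r (s * g.T x)) * (s * d1 g.T x))) ∧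
    d2 (g.drift m s) x = s * ((-2 * (s * g.T x + m.ξ + m.G (s * g.T x) * m.p (s * g.T x)) *
        (s * g.T x + m.ξ)) * (s * d2 g.T x)) + (d2 g.k x * m.r (s * g.T x) + g.k x *
        ((m.C₁ + m.S (s * g.T x) - 2 * m.p (s * g.T x) * m.r (s * g.T x)) * (s * d2 g.T x))) := by
  have hS := g.comp_d s (m.hasDerivAt_S (s * g.T x))
  have hr := g.comp_d s (m.hasDerivAt_r (s * g.T x))
  have dS := cdAt (m.S_smooth.comp (g.sT s)) x
  have dr := cdAt (m.r_smooth.comp (g.sT s)) x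
  have dk := cdAt g.k_smooth x
  have c : DifferentiableAt ℝ (fun _ : Plane => s) x := differentiableAt_const _
  simp only [Function.comp_def] at dS dr
  unfold drift
  constructor
  · rw [d1_add (c.fun_mul dS) (dk.fun_mul dr), d1_mul c dS, d1_mul dk dr, d1_const, hS.1, hr.1]; ring
  · rw [d2_add (c.fun_mul dS) (dk.fun_mul dr), d2_mul c dS, d2_mul dk dr, d2_const, hS.2, hr.2]; ring

/-- The divergence term of the substitution. -/
def divTerm (s : ℝ) (a b : Plane → ℝ) (x : Plane) : ℝ :=
  d1 (fun y => g.drift m s y * (a y * a y + b y * b y) * d1 g.T y) x +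
  d2 (fun y => g.drift m s y * (a y * a y + b y * b y) * d2 g.T y) x

lemma divTerm_eq (s : ℝ) {a b : Plane → ℝ} (ha : ContDiff ℝ 1 a) (hb : ContDiff ℝ 1 b) (x : Plane) :
    g.divTerm m s a b x =
      (d1 (g.drift m s) x * d1 g.T x + d2 (g.drift m s) x * d2 g.T x + g.drift m s x *
        (d1 (d1 g.T) x + d2 (d2 g.T) x)) * (a x ^ 2 + b x ^ 2) + g.drift m s x *
        (2 * (d1 g.T x * (a x * d1 a x + b x * d1 b x) +
          d2 g.T x * (a x * d2 a x + b x * d2 b x))) := by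
  have da := cdAt ha x
  have db := cdAt hb x
  have dF := cdAt (g.drift_smooth m s) x
  have dm : DifferentiableAt ℝ (fun y => a y * a y + b y * b y) x :=
    (da.fun_mul da).fun_add (db.fun_mul db)
  unfold divTerm
  rw [d1_mul (dF.fun_mul dm) (cdAt g.dT1 x), d2_mul (dF.fun_mul dm) (cdAt g.dT2 x), d1_mul dF dm,
    d2_mul dF dm, d1_add (da.fun_mul da) (db.fun_mul db), d2_add (da.fun_mul da) (db.fun_mul db),
    d1_mul da da, d1_mul db db, d2_mul da da, d2_mul db db]
  ring

/-- The curl term of the substitution. -/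
def curlTerm (s : ℝ) (A₁ A₂ a b : Plane → ℝ) (x : Plane) : ℝ :=
  2 * m.G (s * g.T x) * ((d1 a x + s ^ 2 * A₁ x * b x) * (d2 b x - s ^ 2 * A₂ x * a x) -
        (d1 b x - s ^ 2 * A₁ x * a x) * (d2 a x + s ^ 2 * A₂ x * b x))
      - s ^ 2 * m.G (s * g.T x) * (d1 A₂ x - d2 A₁ x) * (a x ^ 2 + b x ^ 2)
      - (d2 (fun y => m.G (s * g.T y)) x *
          (a x * (d1 b x - s ^ 2 * A₁ x * a x) - b x * (d1 a x + s ^ 2 * A₁ x * b x))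
        - d1 (fun y => m.G (s * g.T y)) x *
          (a x * (d2 b x - s ^ 2 * A₂ x * a x) - b x * (d2 a x + s ^ 2 * A₂ x * b x)))

lemma curvature_bound : ∃ K > 0, ∀ x ∈ closure Ω, |g.k x| ≤ K :=
  bound_of_cont g.wall.bdd g.k_smooth.continuous

set_option maxHeartbeats 1000000 in
/-- Pointwise two-sided bound in the boundary strip. -/
lemma strip_bounds {K : ℝ} (hK : ∀ x ∈ closure Ω, |g.k x| ≤ K) {s : ℝ} (hs : 0 < s)
    {A₁ A₂ a b : Plane → ℝ} (ha : ContDiff ℝ 1 a) (hb : ContDiff ℝ 1 b) {x : Plane}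
    (hx : x ∈ Ω) (hxt : g.T x < g.t₁) :
    (g.pot m s (curlf A₁ A₂) x - K ^ 2 * (4 * m.M + m.M ^ 3)) * (a x ^ 2 + b x ^ 2) ≤
      dsq (s ^ 2) A₁ A₂ a b x - g.curlTerm m s A₁ A₂ a b x - g.divTerm m s a b x ∧
    dsq (s ^ 2) A₁ A₂ a b x - g.curlTerm m s A₁ A₂ a b x - g.divTerm m s a b x ≤
      (g.pot m s (curlf A₁ A₂) x + K ^ 2 * (4 * m.M + m.M ^ 3)) * (a x ^ 2 + b x ^ 2) +
        2 * g.wsq m s A₁ A₂ a b x := by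
  have hT := g.wall.pos x hx
  have hτ : 0 ≤ s * g.T x := by positivity
  set τ := s * g.T x with hτdef
  have hG0 := m.G_pos τ hτ
  have hG1 := m.one_sub_G_pos τ hτ
  have hD : 1 - m.G τ ^ 2 ≠ 0 := by nlinarith
  have hTk := abs_le.1 (g.Tk x hx hxt)
  have hden : 1 / 2 ≤ 1 - g.T x * g.k x := by linarith
  have hk := hK x (subset_closure hx)
  have hM := m.M_pos
  have hK0 : 0 ≤ K := (abs_nonneg _).trans hk
  set κ := g.k x / (1 - g.T x * g.k x) with hκdef
  have hκ : κ - g.T x * g.k x * κ = g.k x := by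
    have h0 : 1 - g.T x * g.k x ≠ 0 := by linarith
    calc κ - g.T x * g.k x * κ = κ * (1 - g.T x * g.k x) := by ring
      _ = _ := div_mul_cancel₀ _ h0
  have hκK : |κ| ≤ 2 * K := by
    rw [hκdef, abs_div, abs_of_pos (by linarith : 0 < 1 - g.T x * g.k x),
      div_le_iff₀ (by linarith)]
    nlinarith
  set r1 := m.r τ / (1 - m.G τ ^ 2) with hr1
  have hid := substitution_identity (P1 := d1 a x + s ^ 2 * A₁ x * b x)
    (Q1 := d1 b x - s ^ 2 * A₁ x * a x) (P2 := d2 a x + s ^ 2 * A₂ x * b x)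
    (Q2 := d2 b x - s ^ 2 * A₂ x * a x) (a := a x) (b := b x) (c := curlf A₁ A₂ x)
    (p := m.p τ) (q := τ + m.ξ) (G := m.G τ) (r1 := r1) (S := m.S τ)
    (g.grad x hx hxt) (g.orth x hx hxt) hκ rfl rfl (div_mul_cancel₀ _ hD).symm rfl rfl rfl
    (rfl : g.drift m s x = _) (g.drift_d m s x).1 (g.drift_d m s x).2
  have hcurl := g.comp_d s (m.hasDerivAt_G (s * g.T x))
  have hlap : d1 (d1 g.T) x + d2 (d2 g.T) x = -κ := by rw [g.lap x hx hxt, hκdef, neg_div]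
  have hfb := form_bounds (u := d2 g.T x * (d1 a x + s ^ 2 * A₁ x * b x) - d1 g.T x *
      (d2 a x + s ^ 2 * A₂ x * b x) + (s * (τ + m.ξ) - m.G τ * (g.k x * r1)) * b x)
    (v := d2 g.T x * (d1 b x - s ^ 2 * A₁ x * a x) - d1 g.T x *
      (d2 b x - s ^ 2 * A₂ x * a x) - (s * (τ + m.ξ) - m.G τ * (g.k x * r1)) * a x)
    (w := d1 g.T x * (d1 a x + s ^ 2 * A₁ x * b x) + d2 g.T x *
      (d2 a x + s ^ 2 * A₂ x * b x) - (s * m.p τ + g.k x * r1) * a x)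
    (z := d1 g.T x * (d1 b x - s ^ 2 * A₁ x * a x) + d2 g.T x *
      (d2 b x - s ^ 2 * A₂ x * a x) - (s * m.p τ + g.k x * r1) * b x) hG0 (by linarith)
  have hE : |g.k x * κ * τ * m.S τ - g.k x ^ 2 * m.r τ * r1 + κ * g.k x * m.r τ| ≤
      K ^ 2 * (4 * m.M + m.M ^ 3) := by
    have hS : |τ * m.S τ| ≤ m.M := by rw [abs_mul, abs_of_nonneg hτ]; exact m.S_bound τ hτ
    exact error_bound hk hκK hS (m.r_abs τ hτ) (m.r_mul_bound τ hτ) hK0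
  have hE' := abs_le.1 hE
  have hm : 0 ≤ a x ^ 2 + b x ^ 2 := by positivity
  have key : dsq (s ^ 2) A₁ A₂ a b x - g.curlTerm m s A₁ A₂ a b x - g.divTerm m s a b x =
      ((d2 g.T x * (d1 a x + s ^ 2 * A₁ x * b x) - d1 g.T x *
        (d2 a x + s ^ 2 * A₂ x * b x) + (s * (τ + m.ξ) - m.G τ * (g.k x * r1)) * b x) ^ 2
      + (d2 g.T x * (d1 b x - s ^ 2 * A₁ x * a x) - d1 g.T x *
        (d2 b x - s ^ 2 * A₂ x * a x) - (s * (τ + m.ξ) - m.G τ * (g.k x * r1)) * a x) ^ 2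
      + (d1 g.T x * (d1 a x + s ^ 2 * A₁ x * b x) + d2 g.T x *
        (d2 a x + s ^ 2 * A₂ x * b x) - (s * m.p τ + g.k x * r1) * a x) ^ 2
      + (d1 g.T x * (d1 b x - s ^ 2 * A₁ x * a x) + d2 g.T x *
        (d2 b x - s ^ 2 * A₂ x * a x) - (s * m.p τ + g.k x * r1) * b x) ^ 2
      - 2 * m.G τ * ((d2 g.T x * (d1 a x + s ^ 2 * A₁ x * b x) - d1 g.T x *
          (d2 a x + s ^ 2 * A₂ x * b x) + (s * (τ + m.ξ) - m.G τ * (g.k x * r1)) * b x) *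
        (d1 g.T x * (d1 b x - s ^ 2 * A₁ x * a x) + d2 g.T x *
          (d2 b x - s ^ 2 * A₂ x * a x) - (s * m.p τ + g.k x * r1) * b x) -
        (d2 g.T x * (d1 b x - s ^ 2 * A₁ x * a x) - d1 g.T x *
          (d2 b x - s ^ 2 * A₂ x * a x) - (s * (τ + m.ξ) - m.G τ * (g.k x * r1)) * a x) *
        (d1 g.T x * (d1 a x + s ^ 2 * A₁ x * b x) + d2 g.T x *
          (d2 a x + s ^ 2 * A₂ x * b x) - (s * m.p τ + g.k x * r1) * a x)))
      + (g.pot m s (curlf A₁ A₂) x + (g.k x * κ * τ * m.S τ - g.k x ^ 2 * m.r τ * r1 +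
          κ * g.k x * m.r τ)) * (a x ^ 2 + b x ^ 2) := by
    rw [divTerm_eq g m s ha hb x, hlap, curlTerm, hcurl.1, hcurl.2]
    unfold dsq pot curlf at *
    clear hr1 hκdef
    clear_value κ r1
    clear_value τ
    subst hτdef
    linear_combination hid
  rw [key]
  refine ⟨le_add_of_nonneg_of_le hfb.1 (mul_le_mul_of_nonneg_right (by linarith) hm), ?_⟩
  rw [add_comm]
  exact add_le_add (mul_le_mul_of_nonneg_right (by linarith) hm) hfb.2

end Geo

lemma exists_lin_bound {φ : ℝ → ℝ} (h : ContDiff ℝ 1 φ) (h0 : φ 0 = 0) (R : ℝ) :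
    ∃ K ≥ 0, ∀ τ ∈ Icc 0 R, |φ τ| ≤ K * τ := by
  obtain ⟨M, hM⟩ := (isCompact_Icc (a := (0 : ℝ)) (b := R)).bddAbove_image
    (h.continuous_deriv le_rfl).abs.continuousOn
  refine ⟨max M 0, le_max_right _ _, fun τ hτ => ?_⟩
  have := (convex_Icc (0 : ℝ) R).norm_image_sub_le_of_norm_deriv_le (f := φ) (C := max M 0)
    (fun x _ => h.contDiffAt.differentiableAt one_ne_zero)
    (fun x hx => (hM (mem_image_of_mem _ hx)).trans (le_max_left _ _))
    (left_mem_Icc.2 (hτ.1.trans hτ.2)) hτ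
  rwa [h0, sub_zero, sub_zero, Real.norm_eq_abs, Real.norm_eq_abs, abs_of_nonneg hτ.1] at this

namespace Geo
variable {Ω : Set Plane} (g : Geo Ω) (m : Model)

/-- A `C¹` function of `s T` vanishing at `0` is dominated by `T`. -/
lemma comp_lin {φ : ℝ → ℝ} (h : ContDiff ℝ 1 φ) (h0 : φ 0 = 0) {s : ℝ} (hs : 0 < s) :
    ∃ K ≥ 0, ∀ x ∈ Ω, |φ (s * g.T x)| ≤ K * g.T x := by
  obtain ⟨R, hR0, hR⟩ := bound_of_cont g.wall.bdd g.T1.continuous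
  obtain ⟨K, hK0, hK⟩ := exists_lin_bound h h0 (s * R)
  refine ⟨K * s, by positivity, fun x hx => ?_⟩
  have hT := g.wall.pos x hx
  have := hK (s * g.T x) ⟨by positivity, mul_le_mul_of_nonneg_left
    ((le_abs_self _).trans (hR x (subset_closure hx))) hs.le⟩
  linarith

lemma mul_lin {f h : Plane → ℝ} {K : ℝ} (hf : ∀ x ∈ Ω, |f x| ≤ K * g.T x) (hh : Continuous h) :
    ∃ C, ∀ x ∈ Ω, |f x * h x| ≤ C * g.T x := by
  obtain ⟨R, hR0, hR⟩ := bound_of_cont g.wall.bdd hh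
  refine ⟨K * R, fun x hx => ?_⟩
  rw [abs_mul]
  calc _ ≤ (K * g.T x) * R := mul_le_mul (hf x hx) (hR x (subset_closure hx)) (abs_nonneg _)
        ((abs_nonneg _).trans (hf x hx))
    _ = _ := by ring

lemma null_divTerm {s : ℝ} (hs : 0 < s) {a b : Plane → ℝ} (ha : ContDiff ℝ 1 a)
    (hb : ContDiff ℝ 1 b) : Null Ω (g.divTerm m s a b) := by
  have hm : ContDiff ℝ 1 fun y => g.drift m s y * (a y * a y + b y * b y) :=
    (g.drift_smooth m s).mul ((ha.mul ha).add (hb.mul hb))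
  obtain ⟨K1, h1, hK1⟩ := g.comp_lin m.S_smooth m.S_zero hs
  obtain ⟨K2, h2, hK2⟩ := g.comp_lin m.r_smooth m.r_zero hs
  obtain ⟨K3, h3, hK3⟩ := g.curvature_bound
  have hF : ∀ x ∈ Ω, |g.drift m s x| ≤ (s * K1 + K3 * K2) * g.T x := by
    intro x hx
    unfold drift
    refine (abs_add_le _ _).trans ?_
    rw [abs_mul, abs_mul, abs_of_pos hs]
    have e1 := mul_le_mul_of_nonneg_left (hK1 x hx) hs.le
    have e2 := mul_le_mul (hK3 x (subset_closure hx)) (hK2 x hx) (abs_nonneg _) h3.le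
    linarith
  obtain ⟨C, hC⟩ := g.mul_lin hF (h := fun x => (a x * a x + b x * b x) *
    (d1 g.T x * d1 g.T x + d2 g.T x * d2 g.T x))
    (((ha.mul ha).add (hb.mul hb)).continuous.mul
      ((g.dT1.mul g.dT1).add (g.dT2.mul g.dT2)).continuous)
  refine ⟨intOn_of_cont g.wall.bdd ((d1_cont (hm.mul g.dT1)).add (d2_cont (hm.mul g.dT2))),
    g.wall.integral_div (hm.mul g.dT1) (hm.mul g.dT2) (C := C) fun x hx => ?_⟩
  refine le_trans (le_of_eq ?_) (hC x hx)
  congr 1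
  ring

lemma null_curlTerm {s : ℝ} (hs : 0 < s) {a b A₁ A₂ : Plane → ℝ} (ha : ContDiff ℝ 1 a)
    (hb : ContDiff ℝ 1 b) (hac : HasCompactSupport a) (hbc : HasCompactSupport b)
    (h1 : ContDiff ℝ 1 A₁) (h2 : ContDiff ℝ 1 A₂) : Null Ω (g.curlTerm m s A₁ A₂ a b) := by
  obtain ⟨K, _, hK⟩ := g.comp_lin m.G_smooth m.G_zero hs
  obtain ⟨C1, hC1⟩ := g.mul_lin hK ha.continuous
  obtain ⟨C2, hC2⟩ := g.mul_lin hK hb.continuous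
  refine g.wall.integral_curl (g := fun x => m.G (s * g.T x)) (m.G_smooth.comp (g.sT s)) ha hb hac
    hbc h1 h2 (s ^ 2) (C := max C1 C2) (fun x hx => ?_) fun x hx => ?_
  · exact (hC1 x hx).trans (mul_le_mul_of_nonneg_right (le_max_left _ _) (g.wall.pos x hx).le)
  · exact (hC2 x hx).trans (mul_le_mul_of_nonneg_right (le_max_right _ _) (g.wall.pos x hx).le)

/-- Away from the strip all terms of the substitution vanish. -/
lemma terms_zero {s : ℝ} {a b A₁ A₂ : Plane → ℝ}
    (h0 : ∀ x ∈ Ω, g.t₁ / 2 ≤ g.T x → a x = 0 ∧ b x = 0) {x : Plane} (hx : x ∈ Ω)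
    (hxt : g.t₁ ≤ g.T x) :
    a x = 0 ∧ b x = 0 ∧ dsq (s ^ 2) A₁ A₂ a b x = 0 ∧ g.curlTerm m s A₁ A₂ a b x = 0 ∧
      g.divTerm m s a b x = 0 := by
  have hpos := g.t₁_pos
  have hev : ∀ᶠ y in 𝓝 x, y ∈ Ω ∧ g.t₁ / 2 < g.T y :=
    (show ∀ᶠ y in 𝓝 x, y ∈ Ω from g.wall.isOpen.mem_nhds hx).and
      (g.T1.continuous.continuousAt.eventually (lt_mem_nhds (by linarith)))
  have ea : a =ᶠ[𝓝 x] fun _ => 0 := hev.mono fun y hy => (h0 y hy.1 hy.2.le).1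
  have eb : b =ᶠ[𝓝 x] fun _ => 0 := hev.mono fun y hy => (h0 y hy.1 hy.2.le).2
  have e : ∀ h : Plane → ℝ, (fun y => g.drift m s y * (a y * a y + b y * b y) * h y) =ᶠ[𝓝 x]
      fun _ => 0 := fun h => by
    filter_upwards [ea, eb] with y h1 h2
    rw [h1, h2]; ring
  have a0 := ea.eq_of_nhds
  have b0 := eb.eq_of_nhds
  refine ⟨a0, b0, ?_, ?_, ?_⟩
  · unfold dsq
    rw [d1_congr ea, d2_congr ea, d1_congr eb, d2_congr eb, a0, b0, d1_const, d2_const]; ring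
  · unfold curlTerm
    rw [d1_congr ea, d2_congr ea, d1_congr eb, d2_congr eb, a0, b0, d1_const, d2_const]; ring
  · unfold divTerm
    rw [d1_congr (e _), d2_congr (e _), d1_const, d2_const, add_zero]

lemma pot_cont {s : ℝ} {c : Plane → ℝ} (hc : Continuous c) : Continuous (g.pot m s c) := by
  have := g.k_smooth.continuous
  have := (m.G_smooth.comp (g.sT s)).continuous
  simp only [Function.comp_def] at this
  unfold pot; fun_prop

/-- The magnetic energy in the boundary strip: lower bound, and upper bound up to the substitution
defect. -/
theorem strip_energy : ∃ C > 0, ∀ s > 0, ∀ a b A₁ A₂ : Plane → ℝ, ContDiff ℝ 1 a →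
    ContDiff ℝ 1 b → HasCompactSupport a → HasCompactSupport b → ContDiff ℝ 1 A₁ →
    ContDiff ℝ 1 A₂ → (∀ x ∈ Ω, g.t₁ / 2 ≤ g.T x → a x = 0 ∧ b x = 0) →
    (∫ x in Ω, (g.pot m s (curlf A₁ A₂) x - C) * (a x ^ 2 + b x ^ 2)) ≤
      (∫ x in Ω, dsq (s ^ 2) A₁ A₂ a b x) ∧
    ∀ w : Plane → ℝ, IntegrableOn w Ω → (∀ x ∈ Ω, 0 ≤ w x) →
      (∀ x ∈ Ω, g.T x < g.t₁ → g.wsq m s A₁ A₂ a b x ≤ w x) →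
      (∫ x in Ω, dsq (s ^ 2) A₁ A₂ a b x) ≤
        (∫ x in Ω, (g.pot m s (curlf A₁ A₂) x + C) * (a x ^ 2 + b x ^ 2)) + 2 * ∫ x in Ω, w x := by
  obtain ⟨K, hK0, hK⟩ := g.curvature_bound
  have hM := m.M_pos
  refine ⟨K ^ 2 * (4 * m.M + m.M ^ 3), by positivity, ?_⟩
  intro s hs a b A₁ A₂ ha hb hac hbc h1 h2 h0
  have nd := g.null_divTerm m hs ha hb
  have nc := g.null_curlTerm m hs ha hb hac hbc h1 h2
  have idsq : IntegrableOn (dsq (s ^ 2) A₁ A₂ a b) Ω :=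
    intOn_of_cont g.wall.bdd (dsq_cont h1 h2 ha hb)
  have cp := g.pot_cont m (s := s) (curlf_cont h1 h2)
  have ca := ha.continuous
  have cb := hb.continuous
  have hint := (idsq.sub nc.int).sub nd.int
  have heq : ∫ x in Ω, (dsq (s ^ 2) A₁ A₂ a b x - g.curlTerm m s A₁ A₂ a b x -
      g.divTerm m s a b x) = ∫ x in Ω, dsq (s ^ 2) A₁ A₂ a b x := by
    have e1 := integral_sub (idsq.sub nc.int) nd.int
    have e2 := integral_sub idsq nc.int
    simp only [Pi.sub_apply] at e1 e2
    rw [e1, e2, nd.zero, nc.zero, sub_zero, sub_zero]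
  constructor
  · rw [← heq]
    refine setIntegral_mono_on (intOn_of_cont g.wall.bdd (by fun_prop)) hint
      g.wall.isOpen.measurableSet fun x hx => ?_
    rcases lt_or_ge (g.T x) g.t₁ with hxt | hxt
    · exact (g.strip_bounds m hK hs ha hb hx hxt).1
    · obtain ⟨e1, e2, e3, e4, e5⟩ := g.terms_zero (A₁ := A₁) (A₂ := A₂) (s := s) m h0 hx hxt
      rw [e1, e2, e3, e4, e5]; simp
  · intro w hw hw0 hle
    rw [← heq, ← integral_const_mul]
    have i1 : IntegrableOn (fun x => (g.pot m s (curlf A₁ A₂) x + K ^ 2 * (4 * m.M + m.M ^ 3)) *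
        (a x ^ 2 + b x ^ 2)) Ω := intOn_of_cont g.wall.bdd (by fun_prop)
    have i2 : IntegrableOn (fun x => 2 * w x) Ω := hw.const_mul 2
    rw [← integral_add i1 i2]
    refine setIntegral_mono_on hint (i1.add i2) g.wall.isOpen.measurableSet fun x hx => ?_
    rcases lt_or_ge (g.T x) g.t₁ with hxt | hxt
    · have := (g.strip_bounds (A₁ := A₁) (A₂ := A₂) m hK hs ha hb hx hxt).2
      have := hle x hx hxt
      linarith
    · obtain ⟨e1, e2, e3, e4, e5⟩ := g.terms_zero (A₁ := A₁) (A₂ := A₂) (s := s) m h0 hx hxt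
      rw [e1, e2, e3, e4, e5]
      have := hw0 x hx
      simp; linarith

end Geo

/-- Magnetic lower bound by the field for functions vanishing on the wall. -/
lemma Wall.curl_le {Ω : Set Plane} {T : Plane → ℝ} (W : Wall Ω T) {a b A₁ A₂ : Plane → ℝ}
    (ha : ContDiff ℝ 1 a) (hb : ContDiff ℝ 1 b)
    (hac : HasCompactSupport a) (hbc : HasCompactSupport b)
    (h1 : ContDiff ℝ 1 A₁) (h2 : ContDiff ℝ 1 A₂) (B : ℝ) {C : ℝ}
    (hCa : ∀ x ∈ Ω, |a x| ≤ C * T x) (hCb : ∀ x ∈ Ω, |b x| ≤ C * T x) :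
    ∫ x in Ω, B * curlf A₁ A₂ x * (a x ^ 2 + b x ^ 2) ≤ ∫ x in Ω, dsq B A₁ A₂ a b x := by
  have hn := W.integral_curl (g := fun _ => 1) contDiff_const ha hb hac hbc h1 h2 B (C := C)
    (by simpa using hCa) (by simpa using hCb)
  have idsq : IntegrableOn (dsq B A₁ A₂ a b) Ω := intOn_of_cont W.bdd (dsq_cont h1 h2 ha hb)
  have cc := curlf_cont h1 h2
  have ca := ha.continuous
  have cb := hb.continuous
  have ic : IntegrableOn (fun x => B * curlf A₁ A₂ x * (a x ^ 2 + b x ^ 2)) Ω :=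
    intOn_of_cont W.bdd (by fun_prop)
  rw [← sub_nonneg, ← integral_sub idsq ic, ← hn.zero]
  refine setIntegral_mono_on hn.int (idsq.sub ic) W.isOpen.measurableSet fun x _ => ?_
  simp only [d1_const, d2_const, dsq, curlf]
  nlinarith [sq_nonneg ((d1 a x + B * A₁ x * b x) - (d2 b x - B * A₂ x * a x)),
    sq_nonneg ((d1 b x - B * A₁ x * a x) + (d2 a x + B * A₂ x * b x))]

lemma dsq_mul (B : ℝ) {θ a b A₁ A₂ : Plane → ℝ} {x : Plane} (hθ : DifferentiableAt ℝ θ x)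
    (ha : DifferentiableAt ℝ a x) (hb : DifferentiableAt ℝ b x) :
    dsq B A₁ A₂ (fun y => θ y * a y) (fun y => θ y * b y) x =
      θ x ^ 2 * dsq B A₁ A₂ a b x + (d1 θ x ^ 2 + d2 θ x ^ 2) * (a x ^ 2 + b x ^ 2) +
      2 * θ x * (d1 θ x * (a x * d1 a x + b x * d1 b x) +
        d2 θ x * (a x * d2 a x + b x * d2 b x)) := by
  unfold dsq
  rw [d1_mul hθ ha, d2_mul hθ ha, d1_mul hθ hb, d2_mul hθ hb]
  ring

namespace Geo
variable {Ω : Set Plane} (g : Geo Ω) (m : Model)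

/-- The angle of the partition of unity separating the strip from the bulk. -/
def angle (t : ℝ) : ℝ := Real.pi / 2 * step (4 / g.t₁ * t)

lemma angle_smooth : ContDiff ℝ 1 g.angle :=
  contDiff_const.mul ((step_contDiff (n := 1)).comp (contDiff_const.mul contDiff_id))

lemma angle_zero {t : ℝ} (h : t ≤ g.t₁ / 4) : g.angle t = 0 := by
  have := g.t₁_pos
  rw [angle, step_zero, mul_zero]
  rw [div_mul_eq_mul_div, div_le_one this]; linarith

lemma angle_one {t : ℝ} (h : g.t₁ / 2 ≤ t) : g.angle t = Real.pi / 2 := by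
  have := g.t₁_pos
  rw [angle, step_one, mul_one]
  rw [div_mul_eq_mul_div, le_div_iff₀ this]; linarith

/-- Partition function of the strip. -/
def th1 (x : Plane) : ℝ := Real.cos (g.angle (g.T x))

/-- Partition function of the bulk. -/
def th2 (x : Plane) : ℝ := Real.sin (g.angle (g.T x))

lemma th_sq (x : Plane) : g.th1 x ^ 2 + g.th2 x ^ 2 = 1 := Real.cos_sq_add_sin_sq _

lemma th1_smooth : ContDiff ℝ 1 g.th1 := Real.contDiff_cos.comp (g.angle_smooth.comp g.T1)
lemma th2_smooth : ContDiff ℝ 1 g.th2 := Real.contDiff_sin.comp (g.angle_smooth.comp g.T1)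

lemma th1_zero {x : Plane} (h : g.t₁ / 2 ≤ g.T x) : g.th1 x = 0 := by
  rw [th1, g.angle_one h, Real.cos_pi_div_two]

lemma th_d (x : Plane) : d1 g.th1 x = -g.th2 x * d1 (fun y => g.angle (g.T y)) x ∧
    d2 g.th1 x = -g.th2 x * d2 (fun y => g.angle (g.T y)) x ∧
    d1 g.th2 x = g.th1 x * d1 (fun y => g.angle (g.T y)) x ∧
    d2 g.th2 x = g.th1 x * d2 (fun y => g.angle (g.T y)) x := by
  have h := cdAt (g.angle_smooth.comp g.T1) x
  simp only [Function.comp_def] at h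
  exact ⟨d1_comp (Real.hasDerivAt_cos _) h, d2_comp (Real.hasDerivAt_cos _) h,
    d1_comp (Real.hasDerivAt_sin _) h, d2_comp (Real.hasDerivAt_sin _) h⟩

/-- The localized weight in front of the field defect. -/
def Gt (s : ℝ) (x : Plane) : ℝ := g.th1 x ^ 2 * m.G (s * g.T x) + g.th2 x ^ 2

lemma Gt_cont (s : ℝ) : Continuous (g.Gt m s) := by
  have := (m.G_smooth.comp (g.sT s)).continuous
  have := g.th1_smooth.continuous
  have := g.th2_smooth.continuous
  simp only [Function.comp_def] at *
  unfold Gt; fun_prop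

lemma Gt_mem {s : ℝ} (hs : 0 < s) {x : Plane} (hx : x ∈ Ω) : 0 ≤ g.Gt m s x ∧ g.Gt m s x ≤ 1 := by
  have hT : 0 ≤ s * g.T x := mul_nonneg hs.le (g.wall.pos x hx).le
  have h1 := m.G_pos _ hT
  have h2 := m.one_sub_G_pos _ hT
  have h3 := g.th_sq x
  unfold Gt
  constructor
  · positivity
  · nlinarith [sq_nonneg (g.th1 x)]

/-- The global effective potential. -/
def glob (s : ℝ) (c : Plane → ℝ) (x : Plane) : ℝ :=
  g.th1 x ^ 2 * (m.Θ * s ^ 2 - m.C₁ * s * g.k x) + g.th2 x ^ 2 * s ^ 2 +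
    s ^ 2 * g.Gt m s x * (c x - 1)

/-- Global lower bound of the magnetic energy. -/
theorem global_lower : ∃ C > 0, ∀ s > 0, ∀ a b A₁ A₂ : Plane → ℝ, ContDiff ℝ 1 a →
    ContDiff ℝ 1 b → HasCompactSupport a → HasCompactSupport b → ContDiff ℝ 1 A₁ →
    ContDiff ℝ 1 A₂ →
    (∫ x in Ω, (g.glob m s (curlf A₁ A₂) x - C) * (a x ^ 2 + b x ^ 2)) ≤
      ∫ x in Ω, dsq (s ^ 2) A₁ A₂ a b x := by
  obtain ⟨C, hC0, hC⟩ := g.strip_energy m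
  have han := g.angle_smooth.comp g.T1
  simp only [Function.comp_def] at han
  obtain ⟨K, hK0, hK⟩ := bound_of_cont g.wall.bdd
    (f := fun x => d1 (fun y => g.angle (g.T y)) x ^ 2 + d2 (fun y => g.angle (g.T y)) x ^ 2)
    (((d1_cont han).pow 2).add ((d2_cont han).pow 2))
  refine ⟨C + K, by positivity, fun s hs a b A₁ A₂ ha hb hac hbc h1 h2 => ?_⟩
  have t1 := g.th1_smooth
  have t2 := g.th2_smooth
  have L1 := (hC s hs (fun y => g.th1 y * a y) (fun y => g.th1 y * b y) A₁ A₂ (t1.mul ha)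
    (t1.mul hb) hac.mul_left hbc.mul_left h1 h2 (fun x hx hT => by
      rw [g.th1_zero hT]; simp)).1
  obtain ⟨R, hR0, hR⟩ := g.comp_lin (φ := fun t => Real.sin (g.angle t))
    (Real.contDiff_sin.comp g.angle_smooth)
    (by rw [g.angle_zero (by linarith [g.t₁_pos]), Real.sin_zero]) one_pos
  simp only [one_mul] at hR
  obtain ⟨Ca, hCa⟩ := g.mul_lin (f := g.th2) hR ha.continuous
  obtain ⟨Cb, hCb⟩ := g.mul_lin (f := g.th2) hR hb.continuous
  have L2 := g.wall.curl_le (t2.mul ha) (t2.mul hb) hac.mul_left hbc.mul_left h1 h2 (s ^ 2)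
    (C := max Ca Cb) (fun x hx => (hCa x hx).trans
      (mul_le_mul_of_nonneg_right (le_max_left _ _) (g.wall.pos x hx).le))
    (fun x hx => (hCb x hx).trans
      (mul_le_mul_of_nonneg_right (le_max_right _ _) (g.wall.pos x hx).le))
  have ca := ha.continuous
  have cb := hb.continuous
  have c1 := t1.continuous
  have c2 := t2.continuous
  have cp := g.pot_cont m (s := s) (curlf_cont h1 h2)
  have cc := curlf_cont h1 h2
  have cG := g.Gt_cont m s
  have ck := g.k_smooth.continuous
  have hΩ := g.wall.isOpen.measurableSet
  have i1 : IntegrableOn (fun x => (g.pot m s (curlf A₁ A₂) x - C) *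
      ((g.th1 x * a x) ^ 2 + (g.th1 x * b x) ^ 2)) Ω := intOn_of_cont g.wall.bdd (by fun_prop)
  have i2 : IntegrableOn (fun x => s ^ 2 * curlf A₁ A₂ x *
      ((g.th2 x * a x) ^ 2 + (g.th2 x * b x) ^ 2)) Ω := intOn_of_cont g.wall.bdd (by fun_prop)
  have i3 : IntegrableOn (fun x => K * (a x ^ 2 + b x ^ 2)) Ω :=
    intOn_of_cont g.wall.bdd (by fun_prop)
  have j1 : IntegrableOn (dsq (s ^ 2) A₁ A₂ (fun y => g.th1 y * a y) (fun y => g.th1 y * b y)) Ω :=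
    intOn_of_cont g.wall.bdd (dsq_cont h1 h2 (t1.mul ha) (t1.mul hb))
  have j2 : IntegrableOn (dsq (s ^ 2) A₁ A₂ (fun y => g.th2 y * a y) (fun y => g.th2 y * b y)) Ω :=
    intOn_of_cont g.wall.bdd (dsq_cont h1 h2 (t2.mul ha) (t2.mul hb))
  have j3 : IntegrableOn (dsq (s ^ 2) A₁ A₂ a b) Ω :=
    intOn_of_cont g.wall.bdd (dsq_cont h1 h2 ha hb)
  have U : (∫ x in Ω, dsq (s ^ 2) A₁ A₂ (fun y => g.th1 y * a y) (fun y => g.th1 y * b y) x) +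
      (∫ x in Ω, dsq (s ^ 2) A₁ A₂ (fun y => g.th2 y * a y) (fun y => g.th2 y * b y) x) ≤
      (∫ x in Ω, dsq (s ^ 2) A₁ A₂ a b x) + ∫ x in Ω, K * (a x ^ 2 + b x ^ 2) := by
    rw [← integral_add j1 j2, ← integral_add j3 i3]
    refine setIntegral_mono_on (j1.add j2) (j3.add i3) hΩ fun x hx => ?_
    rw [dsq_mul _ (cdAt t1 x) (cdAt ha x) (cdAt hb x),
      dsq_mul _ (cdAt t2 x) (cdAt ha x) (cdAt hb x)]
    obtain ⟨e1, e2, e3, e4⟩ := g.th_d x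
    have hk := (le_abs_self _).trans (hK x (subset_closure hx))
    have hsq := g.th_sq x
    rw [e1, e2, e3, e4]
    have := mul_le_mul_of_nonneg_right hk (by positivity : 0 ≤ a x ^ 2 + b x ^ 2)
    refine le_trans (le_of_eq ?_) (add_le_add_right this _)
    linear_combination (dsq (s ^ 2) A₁ A₂ a b x +
      (d1 (fun y => g.angle (g.T y)) x ^ 2 + d2 (fun y => g.angle (g.T y)) x ^ 2) *
        (a x ^ 2 + b x ^ 2)) * hsq
  have V : (∫ x in Ω, (g.glob m s (curlf A₁ A₂) x - (C + K)) * (a x ^ 2 + b x ^ 2)) ≤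
      (∫ x in Ω, (g.pot m s (curlf A₁ A₂) x - C) *
      ((g.th1 x * a x) ^ 2 + (g.th1 x * b x) ^ 2)) + (∫ x in Ω, s ^ 2 * curlf A₁ A₂ x *
      ((g.th2 x * a x) ^ 2 + (g.th2 x * b x) ^ 2)) - ∫ x in Ω, K * (a x ^ 2 + b x ^ 2) := by
    have e := integral_sub (i1.add i2) i3
    simp only [Pi.add_apply] at e
    rw [← integral_add i1 i2, ← e]
    refine setIntegral_mono_on (intOn_of_cont g.wall.bdd (by unfold glob; fun_prop))
      ((i1.add i2).sub i3) hΩ fun x hx => ?_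
    have hsq := g.th_sq x
    have : 0 ≤ C * (g.th2 x ^ 2 * (a x ^ 2 + b x ^ 2)) := by positivity
    simp only [glob, pot, Gt]
    have e : g.th1 x ^ 2 = 1 - g.th2 x ^ 2 := by linarith
    simp only [mul_pow, e]
    linarith
  linarith
end Geo

/-- A bounded planar domain with smooth boundary and boundary tubular coordinates. -/
structure Tube (Ω : Set Plane) where
  P : BoundaryParam Ω
  t₀ : ℝ
  isOpen : IsOpen Ω
  bdd : Bornology.IsBounded Ω
  t₀_pos : 0 < t₀
  inj : Set.InjOn (fun p : ℝ × ℝ => P.γ p.1 + p.2 • nuVec P.γ p.1) (Ico 0 P.L ×ˢ Ico 0 t₀)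
  image : (fun p : ℝ × ℝ => P.γ p.1 + p.2 • nuVec P.γ p.1) '' (Ico 0 P.L ×ˢ Ico 0 t₀) =
    {x ∈ closure Ω | distBdry Ω x < t₀}
  dist : ∀ p ∈ Ico (0 : ℝ) P.L ×ˢ Ico (0 : ℝ) t₀,
    distBdry Ω (P.γ p.1 + p.2 • nuVec P.γ p.1) = p.2

namespace BoundaryParam
variable {Ω : Set Plane} (P : BoundaryParam Ω)

lemma deriv_smooth : ContDiff ℝ (⊤ : ℕ∞) (deriv P.γ) :=
  (contDiff_infty_iff_deriv.1 P.smooth).2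

lemma deriv2_smooth : ContDiff ℝ (⊤ : ℕ∞) (deriv (deriv P.γ)) :=
  (contDiff_infty_iff_deriv.1 P.deriv_smooth).2

lemma _root_.SC.hasDerivAt_fst {f : ℝ → Plane} {f' : Plane} {s : ℝ} (h : HasDerivAt f f' s) :
    HasDerivAt (fun y => (f y).1) f'.1 s := (hasFDerivAt_fst (𝕜 := ℝ) (E := ℝ) (F := ℝ) (p := f s)).comp_hasDerivAt s h

lemma _root_.SC.hasDerivAt_snd {f : ℝ → Plane} {f' : Plane} {s : ℝ} (h : HasDerivAt f f' s) :
    HasDerivAt (fun y => (f y).2) f'.2 s := (hasFDerivAt_snd (𝕜 := ℝ) (E := ℝ) (F := ℝ) (p := f s)).comp_hasDerivAt s h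

lemma hasDerivAt (s : ℝ) : HasDerivAt P.γ (deriv P.γ s) s :=
  ((P.smooth.differentiable (by simp)) s).hasDerivAt

lemma hasDerivAt2 (s : ℝ) : HasDerivAt (deriv P.γ) (deriv (deriv P.γ) s) s :=
  ((P.deriv_smooth.differentiable (by simp)) s).hasDerivAt

lemma unit (s : ℝ) : (deriv P.γ s).1 ^ 2 + (deriv P.γ s).2 ^ 2 = 1 := P.unit_speed s

lemma frenet (s : ℝ) : (deriv (deriv P.γ) s).1 = -curvOf P.γ s * (deriv P.γ s).2 ∧
    (deriv (deriv P.γ) s).2 = curvOf P.γ s * (deriv P.γ s).1 := by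
  have h := P.hasDerivAt2 s
  have h1 := ((hasDerivAt_fst h).fun_pow 2).fun_add ((hasDerivAt_snd h).fun_pow 2)
  have e : (fun s => (deriv P.γ s).1 ^ 2 + (deriv P.γ s).2 ^ 2) = fun _ => (1 : ℝ) := funext P.unit
  rw [e] at h1
  have h0 := h1.unique (hasDerivAt_const s (1 : ℝ))
  norm_num at h0
  have u := P.unit s
  simp only [curvOf, dot2, nuVec]
  constructor
  · linear_combination (-(deriv (deriv P.γ) s).1) * u + (deriv P.γ s).1 / 2 * h0
  · linear_combination (-(deriv (deriv P.γ) s).2) * u + (deriv P.γ s).2 / 2 * h0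

lemma nu_smooth : ContDiff ℝ (⊤ : ℕ∞) (nuVec P.γ) :=
  P.deriv_smooth.snd.neg.prodMk P.deriv_smooth.fst

lemma nu_hasDerivAt (s : ℝ) :
    HasDerivAt (nuVec P.γ) (-(curvOf P.γ s * (deriv P.γ s).1), -(curvOf P.γ s * (deriv P.γ s).2)) s := by
  have h := P.hasDerivAt2 s
  obtain ⟨f1, f2⟩ := P.frenet s
  refine HasDerivAt.congr_deriv (HasDerivAt.prodMk (hasDerivAt_snd h).fun_neg (hasDerivAt_fst h)) ?_
  rw [f1, f2, neg_mul]

lemma curv_smooth : ContDiff ℝ (⊤ : ℕ∞) (curvOf P.γ) :=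
  (P.deriv2_smooth.fst.mul P.nu_smooth.fst).add (P.deriv2_smooth.snd.mul P.nu_smooth.snd)

lemma _root_.SC.periodic_deriv {E : Type*} [NormedAddCommGroup E] [NormedSpace ℝ E] {f : ℝ → E}
    {L : ℝ} (h : Function.Periodic f L) : Function.Periodic (deriv f) L := fun s => by
  rw [← deriv_comp_add_const]
  congr 1
  exact funext h

lemma deriv_periodic : Function.Periodic (deriv P.γ) P.L := periodic_deriv P.periodic

lemma nu_periodic : Function.Periodic (nuVec P.γ) P.L := fun s => by
  simp only [nuVec, P.deriv_periodic s]

lemma curv_periodic : Function.Periodic (curvOf P.γ) P.L := fun s => by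
  simp only [curvOf, P.nu_periodic s, periodic_deriv P.deriv_periodic s]

lemma _root_.SC.periodic_bound {f : ℝ → ℝ} {L : ℝ} (h : Function.Periodic f L) (hL : 0 < L)
    (hf : Continuous f) : ∃ K > 0, ∀ s, |f s| ≤ K := by
  obtain ⟨K, hK⟩ := (isCompact_Icc (a := (0 : ℝ)) (b := L)).exists_bound_of_continuousOn
    hf.continuousOn
  refine ⟨max K 1, by positivity, fun s => ?_⟩
  obtain ⟨y, hy, he⟩ := h.exists_mem_Ico₀ hL s
  rw [he]
  exact (hK y (Ico_subset_Icc_self hy)).trans (le_max_left _ _)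

lemma exists_curv_max : ∃ s₀, curvOf P.γ s₀ = kmaxOf P.γ ∧ ∀ s, curvOf P.γ s ≤ kmaxOf P.γ := by
  obtain ⟨s₀, _, h⟩ := (isCompact_Icc (a := (0 : ℝ)) (b := P.L)).exists_isMaxOn
    (nonempty_Icc.2 P.L_pos.le) P.curv_smooth.continuous.continuousOn
  have hmax : ∀ s, curvOf P.γ s ≤ curvOf P.γ s₀ := fun s => by
    obtain ⟨y, hy, he⟩ := P.curv_periodic.exists_mem_Ico₀ P.L_pos s
    rw [he]
    exact h (Ico_subset_Icc_self hy)
  have hg : IsGreatest (range (curvOf P.γ)) (curvOf P.γ s₀) :=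
    ⟨mem_range_self _, by rintro _ ⟨s, rfl⟩; exact hmax s⟩
  have e : kmaxOf P.γ = curvOf P.γ s₀ := hg.csSup_eq
  exact ⟨s₀, e.symm, by rwa [e]⟩

/-- A nonnegative function with bounded second derivative controls the square of its derivative. -/
lemma _root_.SC.sq_deriv_le {f : ℝ → ℝ} (hf : ContDiff ℝ 2 f) (h0 : ∀ s, 0 ≤ f s) {K : ℝ}
    (hK0 : 0 < K) (hK : ∀ s, |deriv (deriv f) s| ≤ K) (s : ℝ) : deriv f s ^ 2 ≤ 4 * K * f s := by
  have hd1 : ContDiff ℝ 1 (deriv f) :=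
    ((contDiff_succ_iff_deriv (n := 1) (𝕜 := ℝ)).1 (by rw [one_add_one_eq_two]; exact hf)).2.2
  have hlip : ∀ y, |deriv f y - deriv f s| ≤ K * |y - s| := fun y => by
    have := convex_univ.norm_image_sub_le_of_norm_deriv_le (f := deriv f) (C := K)
      (fun x _ => (hd1.differentiable one_ne_zero) x) (fun x _ => hK x) (mem_univ s) (mem_univ y)
    rwa [Real.norm_eq_abs, Real.norm_eq_abs] at this
  have hd : Differentiable ℝ f := hf.differentiable (by norm_num)
  set d := deriv f s with hd0
  set h := d / (2 * K) with hh
  have hval : f (s - h) ≤ f s - d * h + K * |h| * |h| := by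
    have := (convex_uIcc s (s - h)).norm_image_sub_le_of_norm_hasDerivWithin_le
      (f := fun y => f y - d * y) (f' := fun y => deriv f y - d) (C := K * |h|)
      (fun x _ => HasDerivAt.hasDerivWithinAt (((hd x).hasDerivAt.fun_sub
        ((hasDerivAt_id x).const_mul d)).congr_deriv (by simp)))
      (fun x hx => (hlip x).trans (by
        have := abs_sub_left_of_mem_uIcc hx
        rw [sub_sub_cancel_left, abs_neg] at this
        exact mul_le_mul_of_nonneg_left this hK0.le)) left_mem_uIcc right_mem_uIcc
    have h1 := (le_abs_self _).trans this
    rw [Real.norm_eq_abs, sub_sub_cancel_left, abs_neg] at h1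
    linarith
  have e : K * |h| * |h| = d ^ 2 / (4 * K) := by
    rw [mul_assoc, abs_mul_abs_self, hh]; field_simp; norm_num
  have e2 : d * h = d ^ 2 / (2 * K) := by rw [hh]; ring
  have h1 := (h0 (s - h)).trans hval
  rw [e, e2] at h1
  have e3 : d ^ 2 / (2 * K) = 2 * (d ^ 2 / (4 * K)) := by field_simp; norm_num
  have : d ^ 2 / (4 * K) ≤ f s := by linarith
  rw [div_le_iff₀ (by positivity)] at this
  linarith

lemma curv_deriv_sq : ∃ C > 0, ∀ s, deriv (curvOf P.γ) s ^ 2 ≤ C * (kmaxOf P.γ - curvOf P.γ s) := by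
  have c2 : ContDiff ℝ (⊤ : ℕ∞) (deriv (deriv (curvOf P.γ))) :=
    (contDiff_infty_iff_deriv.1 (contDiff_infty_iff_deriv.1 P.curv_smooth).2).2
  obtain ⟨K, hK0, hK⟩ := periodic_bound (periodic_deriv (periodic_deriv P.curv_periodic)) P.L_pos
    c2.continuous
  obtain ⟨s₀, _, hmax⟩ := P.exists_curv_max
  refine ⟨4 * K, by positivity, fun s => ?_⟩
  have e : deriv (fun y => kmaxOf P.γ - curvOf P.γ y) = fun y => -deriv (curvOf P.γ) y :=
    funext fun y => by rw [deriv_const_sub]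
  have := sq_deriv_le (f := fun y => kmaxOf P.γ - curvOf P.γ y) (K := K)
    (contDiff_infty.1 (contDiff_const.sub P.curv_smooth) 2)
    (fun y => sub_nonneg.2 (hmax y)) hK0 (fun y => by
      rw [e, deriv.fun_neg, abs_neg]; exact hK y) s
  rwa [e, neg_sq] at this

/-- Tubular coordinates. -/
def Phi (p : ℝ × ℝ) : Plane := P.γ p.1 + p.2 • nuVec P.γ p.1

lemma Phi_smooth : ContDiff ℝ (⊤ : ℕ∞) P.Phi :=
  (P.smooth.comp contDiff_fst).add (contDiff_snd.smul (P.nu_smooth.comp contDiff_fst))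

/-- The derivative of the tubular coordinates. -/
def dPhi (p : ℝ × ℝ) : ℝ × ℝ →L[ℝ] Plane :=
  (ContinuousLinearMap.fst ℝ ℝ ℝ).smulRight ((1 - p.2 * curvOf P.γ p.1) • deriv P.γ p.1) +
    (ContinuousLinearMap.snd ℝ ℝ ℝ).smulRight (nuVec P.γ p.1)

lemma Phi_hasFDerivAt (p : ℝ × ℝ) : HasFDerivAt P.Phi (P.dPhi p) p := by
  have h1 := (P.hasDerivAt p.1).hasFDerivAt.comp p hasFDerivAt_fst
  have h2 := (P.nu_hasDerivAt p.1).hasFDerivAt.comp p hasFDerivAt_fst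
  have h := h1.add (hasFDerivAt_snd.smul h2)
  refine h.congr_fderiv ?_
  ext <;> simp [dPhi] <;> ring

/-- The inverse of `dPhi` where the Jacobian does not vanish. -/
def dPhiEquiv (p : ℝ × ℝ) (h : 1 - p.2 * curvOf P.γ p.1 ≠ 0) : (ℝ × ℝ) ≃L[ℝ] Plane :=
  ContinuousLinearEquiv.equivOfInverse (P.dPhi p)
    (((1 - p.2 * curvOf P.γ p.1)⁻¹ • ((deriv P.γ p.1).1 • ContinuousLinearMap.fst ℝ ℝ ℝ +
      (deriv P.γ p.1).2 • ContinuousLinearMap.snd ℝ ℝ ℝ)).prod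
      (-(deriv P.γ p.1).2 • ContinuousLinearMap.fst ℝ ℝ ℝ +
      (deriv P.γ p.1).1 • ContinuousLinearMap.snd ℝ ℝ ℝ))
    (fun v => by
      have u := P.unit p.1
      ext
      · simp [dPhi, nuVec]
        field_simp
        linear_combination (v.1 * (1 - p.2 * curvOf P.γ p.1)) * u
      · simp [dPhi, nuVec]
        linear_combination v.2 * u)
    (fun v => by
      have u := P.unit p.1
      ext
      · simp [dPhi, nuVec]
        field_simp
        linear_combination v.1 * u
      · simp [dPhi, nuVec]
        field_simp
        linear_combination v.2 * u)

end BoundaryParam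

lemma distBdry_le {Ω : Set Plane} {x y : Plane} (hy : y ∈ frontier Ω) :
    distBdry Ω x ≤ Real.sqrt (esq (x - y)) :=
  csInf_le ⟨0, by rintro _ ⟨z, _, rfl⟩; exact Real.sqrt_nonneg _⟩ (mem_image_of_mem _ hy)

namespace BoundaryParam
variable {Ω : Set Plane} (P : BoundaryParam Ω)

lemma Phi_add (s t : ℝ) (n : ℤ) : P.Phi (s + n * P.L, t) = P.Phi (s, t) := by
  have h1 := P.periodic.int_mul n s
  have h2 := P.nu_periodic.int_mul n s
  simp only [Phi, h1, h2]

lemma Phi_zero (s : ℝ) : P.Phi (s, 0) = P.γ s := by simp [Phi]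

lemma exists_shift (c s : ℝ) : ∃ n : ℤ, s + n * P.L ∈ Ico c (c + P.L) := by
  refine ⟨-toIcoDiv P.L_pos c s, ?_⟩
  have := toIcoMod_mem_Ico P.L_pos c s
  rw [toIcoMod] at this
  convert this using 1
  push_cast; rw [zsmul_eq_mul]; ring

/-- A local inverse of the tubular coordinates. -/
lemma exists_local_inverse {p : ℝ × ℝ} (hp : 1 - p.2 * curvOf P.γ p.1 ≠ 0) :
    ∃ e : OpenPartialHomeomorph (ℝ × ℝ) Plane, p ∈ e.source ∧ (∀ q, e q = P.Phi q) ∧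
      ∀ q ∈ e.source, 1 - q.2 * curvOf P.γ q.1 ≠ 0 := by
  have h1 : HasFDerivAt P.Phi (P.dPhiEquiv p hp : ℝ × ℝ →L[ℝ] Plane) p := P.Phi_hasFDerivAt p
  have hn : ((⊤ : ℕ∞) : WithTop ℕ∞) ≠ 0 := by simp
  set e := P.Phi_smooth.contDiffAt.toOpenPartialHomeomorph P.Phi h1 hn
  have ho : IsOpen {q : ℝ × ℝ | 1 - q.2 * curvOf P.γ q.1 ≠ 0} := by
    have := P.curv_smooth.continuous
    exact isOpen_ne_fun (by fun_prop) continuous_const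
  refine ⟨e.restrOpen _ ho, ⟨P.Phi_smooth.contDiffAt.mem_toOpenPartialHomeomorph_source h1 hn, hp⟩,
    fun q => rfl, fun q hq => hq.2⟩

lemma symm_smooth {e : OpenPartialHomeomorph (ℝ × ℝ) Plane} (he : ∀ q, e q = P.Phi q)
    (hs : ∀ q ∈ e.source, 1 - q.2 * curvOf P.γ q.1 ≠ 0) {x : Plane} (hx : x ∈ e.target) :
    ContDiffAt ℝ (⊤ : ℕ∞) e.symm x := by
  have e' : ⇑e = P.Phi := funext he
  have hm := e.map_target hx
  refine e.contDiffAt_symm (f₀' := P.dPhiEquiv _ (hs _ hm)) hx ?_ ?_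
  · rw [e']; exact P.Phi_hasFDerivAt _
  · rw [e']; exact P.Phi_smooth.contDiffAt

/-- Gradients of the inverse tubular coordinates. -/
lemma symm_hasFDerivAt {e : OpenPartialHomeomorph (ℝ × ℝ) Plane} (he : ∀ q, e q = P.Phi q)
    (hs : ∀ q ∈ e.source, 1 - q.2 * curvOf P.γ q.1 ≠ 0) {x : Plane} (hx : x ∈ e.target) :
    HasFDerivAt e.symm ((P.dPhiEquiv _ (hs _ (e.map_target hx))).symm : Plane →L[ℝ] ℝ × ℝ) x := by
  have e' : ⇑e = P.Phi := funext he
  refine e.hasFDerivAt_symm hx ?_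
  rw [e']; exact P.Phi_hasFDerivAt _

lemma symm_d {e : OpenPartialHomeomorph (ℝ × ℝ) Plane} (he : ∀ q, e q = P.Phi q)
    (hs : ∀ q ∈ e.source, 1 - q.2 * curvOf P.γ q.1 ≠ 0) {x : Plane} (hx : x ∈ e.target) :
    d1 (fun y => (e.symm y).1) x = (1 - (e.symm x).2 * curvOf P.γ (e.symm x).1)⁻¹ *
      (deriv P.γ (e.symm x).1).1 ∧
    d2 (fun y => (e.symm y).1) x = (1 - (e.symm x).2 * curvOf P.γ (e.symm x).1)⁻¹ *
      (deriv P.γ (e.symm x).1).2 ∧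
    d1 (fun y => (e.symm y).2) x = -(deriv P.γ (e.symm x).1).2 ∧
    d2 (fun y => (e.symm y).2) x = (deriv P.γ (e.symm x).1).1 := by
  have h := P.symm_hasFDerivAt he hs hx
  have h1 := (hasFDerivAt_fst (𝕜 := ℝ) (E := ℝ) (F := ℝ) (p := e.symm x)).comp x h
  have h2 := (hasFDerivAt_snd (𝕜 := ℝ) (E := ℝ) (F := ℝ) (p := e.symm x)).comp x h
  simp only [Function.comp_def] at h1 h2
  unfold d1 d2
  rw [h1.fderiv, h2.fderiv]
  refine ⟨?_, ?_, ?_, ?_⟩ <;> simp [dPhiEquiv]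

end BoundaryParam

namespace Tube
variable {Ω : Set Plane} (Q : Tube Ω)

lemma exists_coord {x : Plane} (hx : x ∈ closure Ω) (hd : distBdry Ω x < Q.t₀) :
    0 ≤ distBdry Ω x ∧ ∃ s ∈ Ico 0 Q.P.L, Q.P.Phi (s, distBdry Ω x) = x := by
  have h : x ∈ {x ∈ closure Ω | distBdry Ω x < Q.t₀} := ⟨hx, hd⟩
  rw [← Q.image] at h
  obtain ⟨⟨s, t⟩, hp, he⟩ := h
  have := Q.dist _ hp
  simp only at he this
  rw [he] at this
  exact ⟨by rw [this]; exact hp.2.1, s, hp.1, by rw [this]; exact he⟩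

lemma dist_Phi {t : ℝ} (ht : t ∈ Ico 0 Q.t₀) (s : ℝ) : distBdry Ω (Q.P.Phi (s, t)) = t := by
  obtain ⟨n, hn⟩ := Q.P.exists_shift 0 s
  rw [zero_add] at hn
  rw [← Q.P.Phi_add s t n]
  exact Q.dist (s + n * Q.P.L, t) ⟨hn, ht⟩

lemma Phi_mem {t : ℝ} (ht : t ∈ Ico 0 Q.t₀) (s : ℝ) : Q.P.Phi (s, t) ∈ closure Ω := by
  obtain ⟨n, hn⟩ := Q.P.exists_shift 0 s
  rw [zero_add] at hn
  rw [← Q.P.Phi_add s t n]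
  have : Q.P.Phi (s + n * Q.P.L, t) ∈ {x ∈ closure Ω | distBdry Ω x < Q.t₀} := by
    rw [← Q.image]; exact ⟨_, ⟨hn, ht⟩, rfl⟩
  exact this.1

lemma inj_mod {s s' t t' : ℝ} (ht : t ∈ Ico 0 Q.t₀) (ht' : t' ∈ Ico 0 Q.t₀)
    (h : Q.P.Phi (s, t) = Q.P.Phi (s', t')) : t = t' ∧ ∃ n : ℤ, s' = s + n * Q.P.L := by
  obtain ⟨n, hn⟩ := Q.P.exists_shift 0 s
  obtain ⟨n', hn'⟩ := Q.P.exists_shift 0 s'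
  rw [zero_add] at hn hn'
  rw [← Q.P.Phi_add s t n, ← Q.P.Phi_add s' t' n'] at h
  have : ((s + n * Q.P.L, t) : ℝ × ℝ) = (s' + n' * Q.P.L, t') := Q.inj ⟨hn, ht⟩ ⟨hn', ht'⟩ h
  rw [Prod.mk.injEq] at this
  exact ⟨this.2, n - n', by push_cast; linarith [this.1]⟩

lemma curv_congr {s s' t t' : ℝ} (ht : t ∈ Ico 0 Q.t₀) (ht' : t' ∈ Ico 0 Q.t₀)
    (h : Q.P.Phi (s, t) = Q.P.Phi (s', t')) : curvOf Q.P.γ s = curvOf Q.P.γ s' := by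
  obtain ⟨_, n, rfl⟩ := Q.inj_mod ht ht' h
  exact (Q.P.curv_periodic.int_mul n s).symm

lemma frontier_dist (Q : Tube Ω) {x : Plane} (hx : x ∈ frontier Ω) : distBdry Ω x = 0 := by
  rw [← Q.P.range_eq] at hx
  obtain ⟨s, rfl⟩ := hx
  rw [← Q.P.Phi_zero]
  exact Q.dist_Phi ⟨le_rfl, Q.t₀_pos⟩ s

lemma dist_pos {x : Plane} (hx : x ∈ Ω) (hd : distBdry Ω x < Q.t₀) : 0 < distBdry Ω x := by
  obtain ⟨h0, s, hs, he⟩ := Q.exists_coord (subset_closure hx) hd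
  refine lt_of_le_of_ne h0 fun h => ?_
  rw [← h, Q.P.Phi_zero] at he
  have : x ∈ frontier Ω := by rw [← Q.P.range_eq]; exact ⟨s, he⟩
  rw [Q.isOpen.frontier_eq] at this
  exact this.2 hx

lemma Phi_mem_open {t : ℝ} (ht : t ∈ Ioo 0 Q.t₀) (s : ℝ) : Q.P.Phi (s, t) ∈ Ω := by
  have h := Q.Phi_mem ⟨ht.1.le, ht.2⟩ s
  by_contra hc
  have hf : Q.P.Phi (s, t) ∈ frontier Ω := by rw [Q.isOpen.frontier_eq]; exact ⟨h, hc⟩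
  have := Q.frontier_dist hf
  rw [Q.dist_Phi ⟨ht.1.le, ht.2⟩] at this
  exact ht.1.ne' this

lemma eventually_dist_gt {x : Plane} {t : ℝ} (ht : t < Q.t₀) (hd : t < distBdry Ω x) :
    ∀ᶠ y in 𝓝 x, y ∈ closure Ω → t < distBdry Ω y := by
  have hK : IsCompact (Q.P.Phi '' (Icc 0 Q.P.L ×ˢ Icc 0 t)) :=
    (isCompact_Icc.prod isCompact_Icc).image Q.P.Phi_smooth.continuous
  have hx : x ∉ Q.P.Phi '' (Icc 0 Q.P.L ×ˢ Icc 0 t) := by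
    rintro ⟨⟨s, r⟩, ⟨_, hr⟩, rfl⟩
    rw [Q.dist_Phi ⟨hr.1, hr.2.trans_lt ht⟩] at hd
    exact absurd hr.2 (not_le.2 hd)
  filter_upwards [hK.isClosed.isOpen_compl.mem_nhds hx] with y hy hyc
  by_contra! hle
  obtain ⟨h0, s, hs, he⟩ := Q.exists_coord hyc (hle.trans_lt ht)
  exact hy ⟨(s, distBdry Ω y), ⟨Ico_subset_Icc_self hs, h0, hle⟩, he⟩

/-- Local charts given by the tubular coordinates. -/
lemma exists_chart {p : ℝ × ℝ} (ht : p.2 ∈ Ico 0 Q.t₀) (hp : 1 - p.2 * curvOf Q.P.γ p.1 ≠ 0) :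
    ∃ e : OpenPartialHomeomorph (ℝ × ℝ) Plane, p ∈ e.source ∧ (∀ q, e q = Q.P.Phi q) ∧
      (∀ q ∈ e.source, 1 - q.2 * curvOf Q.P.γ q.1 ≠ 0) ∧
      ∀ x ∈ e.target, x ∈ closure Ω → distBdry Ω x = (e.symm x).2 ∧ distBdry Ω x < Q.t₀ := by
  obtain ⟨e, hpe, he, hs⟩ := Q.P.exists_local_inverse hp
  have hL := Q.P.L_pos
  set t' := (p.2 + Q.t₀) / 2 with ht'
  have ht1 : p.2 < t' := by linarith [ht.2]
  have ht2 : t' < Q.t₀ := by linarith [ht.2]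
  have hK : IsCompact (Q.P.Phi '' ((Icc (p.1 - Q.P.L / 2) (p.1 + Q.P.L / 2) ×ˢ Icc 0 t') \ e.source)) :=
    ((isCompact_Icc.prod isCompact_Icc).diff e.open_source).image Q.P.Phi_smooth.continuous
  have hx : Q.P.Phi p ∉
      Q.P.Phi '' ((Icc (p.1 - Q.P.L / 2) (p.1 + Q.P.L / 2) ×ˢ Icc 0 t') \ e.source) := by
    rintro ⟨⟨s, r⟩, ⟨⟨hs1, hr⟩, hne⟩, hq⟩
    obtain ⟨h1, n, h2⟩ := Q.inj_mod ⟨hr.1, hr.2.trans_lt ht2⟩ ht hq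
    have hn : n = 0 := by
      simp only [mem_Icc] at hs1
      have a1 : (n : ℝ) * Q.P.L < 1 * Q.P.L := by linarith
      have a2 : (-1 : ℝ) * Q.P.L < n * Q.P.L := by linarith
      have b1 := lt_of_mul_lt_mul_right a1 hL.le
      have b2 := lt_of_mul_lt_mul_right a2 hL.le
      have c1 : n < 1 := by exact_mod_cast b1
      have c2 : -1 < n := by exact_mod_cast b2
      omega
    rw [hn, Int.cast_zero, zero_mul, add_zero] at h2
    apply hne
    have : ((s, r) : ℝ × ℝ) = p := Prod.ext h2.symm h1
    rw [this]
    exact hpe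
  have hd : ∀ᶠ x in 𝓝 (Q.P.Phi p), Real.sqrt (esq (x - Q.P.γ p.1)) < t' := by
    have hc : Continuous fun x : Plane => Real.sqrt (esq (x - Q.P.γ p.1)) := by
      unfold esq; fun_prop
    refine hc.continuousAt.eventually_lt continuousAt_const ?_
    have : esq (Q.P.Phi p - Q.P.γ p.1) = p.2 ^ 2 := by
      have := Q.P.unit p.1
      simp only [esq, BoundaryParam.Phi, nuVec, add_sub_cancel_left, Prod.smul_fst, Prod.smul_snd,
        smul_eq_mul]
      linear_combination p.2 ^ 2 * this
    rw [this, Real.sqrt_sq ht.1]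
    exact ht1
  obtain ⟨V, hV, hVo, hpV⟩ := eventually_nhds_iff.1
    ((show ∀ᶠ x in 𝓝 (Q.P.Phi p), x ∈ (Q.P.Phi '' ((Icc (p.1 - Q.P.L / 2) (p.1 + Q.P.L / 2) ×ˢ
      Icc 0 t') \ e.source))ᶜ from hK.isClosed.isOpen_compl.mem_nhds hx).and hd)
  refine ⟨e.restrOpen (Q.P.Phi ⁻¹' V) (hVo.preimage Q.P.Phi_smooth.continuous), ⟨hpe, hpV⟩,
    he, fun q hq => hs q hq.1, fun x hxt hxc => ?_⟩
  have hmt := (e.restrOpen (Q.P.Phi ⁻¹' V) (hVo.preimage Q.P.Phi_smooth.continuous)).map_target hxt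
  have hxt' : x ∈ e.target := hxt.1
  have hxV : x ∈ V := by
    have := hmt.2
    have h3 : Q.P.Phi (e.symm x) ∈ V := this
    rwa [← he, e.right_inv hxt'] at h3
  obtain ⟨g1, g2⟩ := hV x hxV
  have hlt : distBdry Ω x < t' := (distBdry_le (by rw [← Q.P.range_eq]; exact mem_range_self _)).trans_lt g2
  obtain ⟨h0, s, _, hsx⟩ := Q.exists_coord hxc (hlt.trans ht2)
  obtain ⟨n, hn⟩ := Q.P.exists_shift (p.1 - Q.P.L / 2) s
  rw [← Q.P.Phi_add s _ n] at hsx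
  have hsrc : (s + n * Q.P.L, distBdry Ω x) ∈ e.source := by
    by_contra hc
    exact g1 ⟨_, ⟨⟨⟨hn.1, by linarith [hn.2]⟩, h0, hlt.le⟩, hc⟩, hsx⟩
  have : e.symm x = (s + n * Q.P.L, distBdry Ω x) := by
    rw [← hsx, ← he, e.left_inv hsrc, he, hsx]
  refine ⟨?_, hlt.trans ht2⟩
  change _ = (e.symm x).2
  rw [this]

end Tube

/-- Gluing of local `C²` representatives of a function on the closure of `Ω`. -/
lemma exists_glue {Ω : Set Plane} (F : Plane → ℝ)
    (h : ∀ x ∈ closure Ω, ∃ g : Plane → ℝ, ContDiffAt ℝ 2 g x ∧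
      ∀ᶠ y in 𝓝 x, y ∈ closure Ω → F y = g y) :
    ∃ G : Plane → ℝ, ContDiff ℝ 2 G ∧ ∀ x ∈ closure Ω, G x = F x := by
  obtain ⟨g, hg⟩ := exists_contMDiffMap_forall_mem_convex_of_local
    (I := modelWithCornersSelf ℝ Plane) (n := 2) (F := ℝ)
    (t := fun x => {v : ℝ | x ∈ closure Ω → v = F x})
    (fun x => by
      by_cases hx : x ∈ closure Ω
      · simp [hx]
      · simp [hx, convex_univ]) (fun x => by
      by_cases hx : x ∈ closure Ω
      · obtain ⟨g, hg, he⟩ := h x hx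
        obtain ⟨u, hu, hgu⟩ := hg.contDiffOn (m := 2) le_rfl (by simp)
        refine ⟨u ∩ {y | y ∈ closure Ω → F y = g y}, inter_mem hu he, g,
          (hgu.mono inter_subset_left).contMDiffOn, fun y hy hyc => (hy.2 hyc).symm⟩
      · exact ⟨(closure Ω)ᶜ, isClosed_closure.isOpen_compl.mem_nhds hx, fun _ => 0,
          contMDiffOn_const, fun y hy hyc => absurd hyc hy⟩)
  exact ⟨g, g.contMDiff.contDiff, fun x hx => hg x hx⟩

namespace Tube
variable {Ω : Set Plane} (Q : Tube Ω)

open Classical in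
/-- The tangential coordinate of a point. -/
def foot (x : Plane) : ℝ :=
  if h : ∃ s, Q.P.Phi (s, distBdry Ω x) = x then h.choose else 0

lemma Phi_foot {x : Plane} (hx : x ∈ closure Ω) (hd : distBdry Ω x < Q.t₀) :
    Q.P.Phi (Q.foot x, distBdry Ω x) = x := by
  obtain ⟨_, s, _, hs⟩ := Q.exists_coord hx hd
  have h : ∃ s, Q.P.Phi (s, distBdry Ω x) = x := ⟨s, hs⟩
  rw [foot, dif_pos h]
  exact h.choose_spec

lemma curv_foot {s t : ℝ} (ht : t ∈ Ico 0 Q.t₀) :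
    curvOf Q.P.γ (Q.foot (Q.P.Phi (s, t))) = curvOf Q.P.γ s := by
  have hd := Q.dist_Phi ht s
  have := Q.Phi_foot (Q.Phi_mem ht s) (by rw [hd]; exact ht.2)
  rw [hd] at this
  exact Q.curv_congr ht ht this

/-- Charts around points of the closed tubular neighborhood, in terms of `foot`. -/
lemma exists_chart_at {x : Plane} (hx : x ∈ closure Ω) (hd : distBdry Ω x < Q.t₀)
    (hp : 1 - distBdry Ω x * curvOf Q.P.γ (Q.foot x) ≠ 0) :
    ∃ e : OpenPartialHomeomorph (ℝ × ℝ) Plane, x ∈ e.target ∧ (∀ q, e q = Q.P.Phi q) ∧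
      (∀ q ∈ e.source, 1 - q.2 * curvOf Q.P.γ q.1 ≠ 0) ∧
      ∀ y ∈ e.target, y ∈ closure Ω → distBdry Ω y = (e.symm y).2 ∧
        curvOf Q.P.γ (Q.foot y) = curvOf Q.P.γ (e.symm y).1 := by
  have h0 := (Q.exists_coord hx hd).1
  obtain ⟨e, hpe, he, hs, hc⟩ := Q.exists_chart (p := (Q.foot x, distBdry Ω x)) ⟨h0, hd⟩ hp
  refine ⟨e, ?_, he, hs, fun y hy hyc => ?_⟩
  · rw [← Q.Phi_foot hx hd, ← he]; exact e.map_source hpe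
  · obtain ⟨h1, h2⟩ := hc y hy hyc
    refine ⟨h1, ?_⟩
    have h3 : Q.P.Phi ((e.symm y).1, (e.symm y).2) = y := by rw [← he]; exact e.right_inv hy
    have h4 : (e.symm y).2 ∈ Ico 0 Q.t₀ := by
      rw [← h1]; exact ⟨(Q.exists_coord hyc h2).1, h2⟩
    conv_lhs => rw [← h3]
    exact Q.curv_foot h4

/-- The distance to the boundary, flattened beyond the tubular neighborhood. -/
def flat (t₁ t : ℝ) : ℝ := t * (1 - step (t / t₁)) + 2 * t₁ * step (t / t₁)

lemma flat_smooth (t₁ : ℝ) : ContDiff ℝ 2 (flat t₁) := by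
  have : ContDiff ℝ 2 fun t : ℝ => step (t / t₁) :=
    (step_contDiff (n := 2)).comp (contDiff_id.div_const t₁)
  unfold flat; fun_prop

lemma flat_of_le {t₁ t : ℝ} (h : 0 < t₁) (ht : t ≤ t₁) : flat t₁ t = t := by
  rw [flat, step_zero ((div_le_one h).2 ht)]; ring

lemma flat_of_ge {t₁ t : ℝ} (h : 0 < t₁) (ht : 2 * t₁ ≤ t) : flat t₁ t = 2 * t₁ := by
  rw [flat, step_one ((le_div_iff₀ h).2 ht)]; ring

lemma flat_ge {t₁ t : ℝ} (h : 0 < t₁) (ht : t₁ ≤ t) : t₁ ≤ flat t₁ t := by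
  unfold flat
  have := step_nonneg (t / t₁)
  have := step_le_one (t / t₁)
  nlinarith

lemma exists_functions {t₁ : ℝ} (h1 : 0 < t₁) (h2 : 3 * t₁ < Q.t₀)
    (hK : ∀ s, 3 * t₁ * |curvOf Q.P.γ s| ≤ 1 / 2) :
    ∃ T k : Plane → ℝ, ContDiff ℝ 2 T ∧ ContDiff ℝ 2 k ∧
      (∀ x ∈ closure Ω, T x = flat t₁ (distBdry Ω x)) ∧
      ∀ x ∈ closure Ω, distBdry Ω x ≤ t₁ → k x = curvOf Q.P.γ (Q.foot x) := by
  have key : ∀ (f : ℝ → ℝ → ℝ), ContDiff ℝ 2 (fun q : ℝ × ℝ => f q.1 q.2) →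
      (∃ c, ∀ a t, 2 * t₁ ≤ t → f a t = c) → ∃ G : Plane → ℝ, ContDiff ℝ 2 G ∧ ∀ x ∈ closure Ω,
        G x = f (curvOf Q.P.γ (Q.foot x)) (distBdry Ω x) := by
    rintro f hf ⟨c, hc⟩
    refine exists_glue _ fun x hx => ?_
    by_cases hd : distBdry Ω x < 3 * t₁
    · have hd0 := hd.trans h2
      have h0 := (Q.exists_coord hx hd0).1
      have hne : 1 - distBdry Ω x * curvOf Q.P.γ (Q.foot x) ≠ 0 := by
        have := hK (Q.foot x)
        have a1 : distBdry Ω x * |curvOf Q.P.γ (Q.foot x)| ≤ 3 * t₁ * |curvOf Q.P.γ (Q.foot x)| :=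
          mul_le_mul_of_nonneg_right hd.le (abs_nonneg _)
        have a2 := mul_le_mul_of_nonneg_left (le_abs_self (curvOf Q.P.γ (Q.foot x))) h0
        intro; linarith
      obtain ⟨e, hxe, he, hs, hc'⟩ := Q.exists_chart_at hx hd0 hne
      have hsm := contDiffAt_infty.1 (Q.P.symm_smooth he hs hxe) 2
      refine ⟨fun y => f (curvOf Q.P.γ (e.symm y).1) (e.symm y).2, ?_, ?_⟩
      · have hcv : ContDiff ℝ 2 (curvOf Q.P.γ) := contDiff_infty.1 Q.P.curv_smooth 2
        exact hf.contDiffAt.comp x ((hcv.contDiffAt.comp x hsm.fst).prodMk hsm.snd)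
      · filter_upwards [e.open_target.mem_nhds hxe] with y hy hyc
        rw [(hc' y hy hyc).1, (hc' y hy hyc).2]
    · refine ⟨fun _ => c, contDiffAt_const, ?_⟩
      filter_upwards [Q.eventually_dist_gt (x := x) (t := 2 * t₁) (by linarith) (by linarith)]
        with y hy hyc
      exact hc _ _ (hy hyc).le
  obtain ⟨T, hT, hT'⟩ := key (fun _ t => flat t₁ t) ((flat_smooth t₁).comp contDiff_snd)
    ⟨2 * t₁, fun _ t ht => flat_of_ge h1 ht⟩
  obtain ⟨k, hk, hk'⟩ := key (fun a t => (1 - step (t / t₁)) * a) (by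
    have : ContDiff ℝ 2 fun q : ℝ × ℝ => step (q.2 / t₁) :=
      (step_contDiff (n := 2)).comp (contDiff_snd.div_const t₁)
    fun_prop) ⟨0, fun a t ht => by rw [step_one ((le_div_iff₀ h1).2 ht)]; ring⟩
  refine ⟨T, k, hT, hk, hT', fun x hx hd => ?_⟩
  rw [hk' x hx, step_zero ((div_le_one h1).2 hd)]; ring

/-- The boundary geometry in analytic form. -/
lemma exists_geo : ∃ g : Geo Ω, g.km = kmaxOf Q.P.γ ∧ 3 * g.t₁ < Q.t₀ ∧
    (∀ s, 3 * g.t₁ * |curvOf Q.P.γ s| ≤ 1 / 2) ∧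
    (∀ x ∈ closure Ω, g.T x = flat g.t₁ (distBdry Ω x)) ∧
    ∀ x ∈ closure Ω, distBdry Ω x ≤ g.t₁ → g.k x = curvOf Q.P.γ (Q.foot x) := by
  obtain ⟨K, hK0, hK⟩ := periodic_bound Q.P.curv_periodic Q.P.L_pos Q.P.curv_smooth.continuous
  obtain ⟨Ck, hCk, hCk'⟩ := Q.P.curv_deriv_sq
  obtain ⟨s₀, _, hmax⟩ := Q.P.exists_curv_max
  obtain ⟨t₁, h1, h2⟩ : ∃ t₁ > 0, t₁ < Q.t₀ / 3 ∧ t₁ ≤ 1 / (6 * K) := by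
    have := Q.t₀_pos
    refine ⟨min (Q.t₀ / 4) (1 / (6 * K)), by positivity, ?_, min_le_right _ _⟩
    exact (min_le_left _ _).trans_lt (by linarith)
  have h3 : ∀ s, 3 * t₁ * |curvOf Q.P.γ s| ≤ 1 / 2 := fun s => by
    have a := mul_le_mul_of_nonneg_left (hK s) (by positivity : 0 ≤ 3 * t₁)
    have b := h2.2
    rw [le_div_iff₀ (by positivity)] at b
    linarith
  obtain ⟨T, k, hT, hk, hT', hk'⟩ := Q.exists_functions h1 (by linarith [h2.1]) h3
  have hd_lt : ∀ x ∈ closure Ω, T x < t₁ → distBdry Ω x < t₁ := fun x hx h => by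
    by_contra! hc
    rw [hT' x hx] at h
    exact absurd (flat_ge h1 hc) (not_le.2 h)
  have loc : ∀ x ∈ Ω, T x < t₁ → T x = distBdry Ω x ∧ 0 ≤ T x ∧
      k x = curvOf Q.P.γ (Q.foot x) ∧
      |T x * k x| ≤ 1 / 2 ∧ ∃ e : OpenPartialHomeomorph (ℝ × ℝ) Plane, x ∈ e.target ∧
      (∀ q, e q = Q.P.Phi q) ∧ (∀ q ∈ e.source, 1 - q.2 * curvOf Q.P.γ q.1 ≠ 0) ∧
      (T =ᶠ[𝓝 x] fun y => (e.symm y).2) ∧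
      (k =ᶠ[𝓝 x] fun y => curvOf Q.P.γ (e.symm y).1) := fun x hx h => by
    have hxc := subset_closure hx
    have hd := hd_lt x hxc h
    have hd0 : distBdry Ω x < Q.t₀ := by linarith [h2.1]
    have h0 := (Q.exists_coord hxc hd0).1
    have eT : T x = distBdry Ω x := by rw [hT' x hxc, flat_of_le h1 hd.le]
    have ek := hk' x hxc hd.le
    have hb : |T x * k x| ≤ 1 / 2 := by
      rw [abs_mul, eT, abs_of_nonneg h0, ek]
      have a1 : distBdry Ω x * |curvOf Q.P.γ (Q.foot x)| ≤ 3 * t₁ * |curvOf Q.P.γ (Q.foot x)| :=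
        mul_le_mul_of_nonneg_right (by linarith) (abs_nonneg _)
      exact a1.trans (h3 _)
    have hne : 1 - distBdry Ω x * curvOf Q.P.γ (Q.foot x) ≠ 0 := by
      rw [← eT, ← ek]
      have := le_abs_self (T x * k x)
      intro; linarith
    obtain ⟨e, hxe, he, hs, hc'⟩ := Q.exists_chart_at hxc hd0 hne
    have hev : ∀ᶠ y in 𝓝 x, y ∈ e.target ∧ y ∈ Ω ∧ T y < t₁ :=
      (show ∀ᶠ y in 𝓝 x, y ∈ e.target from e.open_target.mem_nhds hxe).and
        ((show ∀ᶠ y in 𝓝 x, y ∈ Ω from Q.isOpen.mem_nhds hx).and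
          (hT.continuous.continuousAt.eventually_lt continuousAt_const h))
    refine ⟨eT, by rw [eT]; exact h0, ek, hb, e, hxe, he, hs, ?_, ?_⟩
    · filter_upwards [hev] with y hy
      have hyc := subset_closure hy.2.1
      rw [hT' y hyc, flat_of_le h1 (hd_lt y hyc hy.2.2).le]
      exact (hc' y hy.1 hyc).1
    · filter_upwards [hev] with y hy
      have hyc := subset_closure hy.2.1
      rw [hk' y hyc (hd_lt y hyc hy.2.2).le]
      exact (hc' y hy.1 hyc).2
  have comp : ∀ (f : ℝ → ℝ) (e : OpenPartialHomeomorph (ℝ × ℝ) Plane) (x : Plane), ContDiff ℝ 1 f →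
      x ∈ e.target → (∀ q, e q = Q.P.Phi q) →
      (∀ q ∈ e.source, 1 - q.2 * curvOf Q.P.γ q.1 ≠ 0) →
      d1 (fun y => f (e.symm y).1) x = deriv f (e.symm x).1 * d1 (fun y => (e.symm y).1) x ∧
      d2 (fun y => f (e.symm y).1) x = deriv f (e.symm x).1 * d2 (fun y => (e.symm y).1) x := by
    intro f e x hf hx he hs
    have hsm := ((Q.P.symm_smooth he hs hx).fst).differentiableAt (by simp)
    have hfd := ((hf.contDiffAt (x := (e.symm x).1)).differentiableAt one_ne_zero).hasDerivAt
    have := hfd.comp_hasFDerivAt x hsm.hasFDerivAt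
    have h := this.fderiv
    simp only [Function.comp_def] at h
    unfold d1 d2
    rw [h]
    exact ⟨rfl, rfl⟩
  have hdg1 : ContDiff ℝ 1 fun s => (deriv Q.P.γ s).1 := contDiff_infty.1 Q.P.deriv_smooth.fst 1
  have hdg2 : ContDiff ℝ 1 fun s => (deriv Q.P.γ s).2 := contDiff_infty.1 Q.P.deriv_smooth.snd 1
  have hcv : ContDiff ℝ 1 (curvOf Q.P.γ) := contDiff_infty.1 Q.P.curv_smooth 1
  have hgrad : ∀ x ∈ Ω, T x < t₁ → ∃ e : OpenPartialHomeomorph (ℝ × ℝ) Plane, x ∈ e.target ∧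
      (∀ q, e q = Q.P.Phi q) ∧ (∀ q ∈ e.source, 1 - q.2 * curvOf Q.P.γ q.1 ≠ 0) ∧
      T x = (e.symm x).2 ∧ k x = curvOf Q.P.γ (e.symm x).1 ∧
      d1 T x = -(deriv Q.P.γ (e.symm x).1).2 ∧ d2 T x = (deriv Q.P.γ (e.symm x).1).1 ∧
      d1 k x = deriv (curvOf Q.P.γ) (e.symm x).1 * d1 (fun y => (e.symm y).1) x ∧
      d2 k x = deriv (curvOf Q.P.γ) (e.symm x).1 * d2 (fun y => (e.symm y).1) x ∧
      d1 (d1 T) x = -((deriv (deriv Q.P.γ) (e.symm x).1).2 * d1 (fun y => (e.symm y).1) x) ∧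
      d2 (d2 T) x = (deriv (deriv Q.P.γ) (e.symm x).1).1 * d2 (fun y => (e.symm y).1) x := by
    intro x hx h
    obtain ⟨_, _, _, _, e, hxe, he, hs, heT, hek⟩ := loc x hx h
    have c := comp _ e x hcv hxe he hs
    have e1 : d1 T =ᶠ[𝓝 x] fun y => -(deriv Q.P.γ (e.symm y).1).2 := by
      filter_upwards [heT.eventuallyEq_nhds, e.open_target.mem_nhds hxe] with y hy hye
      rw [d1_congr hy, (Q.P.symm_d he hs hye).2.2.1]
    have e2 : d2 T =ᶠ[𝓝 x] fun y => (deriv Q.P.γ (e.symm y).1).1 := by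
      filter_upwards [heT.eventuallyEq_nhds, e.open_target.mem_nhds hxe] with y hy hye
      rw [d2_congr hy, (Q.P.symm_d he hs hye).2.2.2]
    refine ⟨e, hxe, he, hs, heT.eq_of_nhds, hek.eq_of_nhds, e1.eq_of_nhds, e2.eq_of_nhds, ?_, ?_,
      ?_, ?_⟩
    · rw [d1_congr hek, c.1]
    · rw [d2_congr hek, c.2]
    · rw [d1_congr e1, (comp (fun s => -(deriv Q.P.γ s).2) e x hdg2.neg hxe he hs).1,
        (hasDerivAt_snd (Q.P.hasDerivAt2 (e.symm x).1)).fun_neg.deriv]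
      ring
    · rw [d2_congr e2, (comp _ e x hdg1 hxe he hs).2,
        (hasDerivAt_fst (Q.P.hasDerivAt2 (e.symm x).1)).deriv]
  refine ⟨⟨T, k, t₁, kmaxOf Q.P.γ, 4 * Ck, ⟨Q.isOpen, Q.bdd, hT.of_le (by norm_num), ?_, ?_⟩, hT,
    hk.of_le (by norm_num), h1, by positivity, ?_, ?_, ?_, ?_, ?_, ?_⟩, rfl, by
      show 3 * t₁ < Q.t₀
      linarith [h2.1], h3, hT', hk'⟩
  · intro x hx
    by_cases h : T x < t₁
    · obtain ⟨e, h0, _⟩ := loc x hx h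
      rw [e]
      exact Q.dist_pos hx (by linarith [h2.1])
    · linarith
  · intro x hx
    rw [hT' x (frontier_subset_closure hx), Q.frontier_dist hx, flat_of_le h1 h1.le]
  · intro x hx h
    obtain ⟨e, hxe, he, hs, _, _, e1, e2, _⟩ := hgrad x hx h
    have := Q.P.unit (e.symm x).1
    rw [e1, e2]; linarith
  · intro x hx h
    obtain ⟨e, hxe, he, hs, _, _, e1, e2, e3, e4, _⟩ := hgrad x hx h
    obtain ⟨s1, s2, _⟩ := Q.P.symm_d he hs hxe
    rw [e1, e2, e3, e4, s1, s2]; ring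
  · intro x hx h
    obtain ⟨e, hxe, he, hs, eT, ek, e1, e2, e3, e4, e5, e6⟩ := hgrad x hx h
    obtain ⟨s1, s2, _⟩ := Q.P.symm_d he hs hxe
    have u := Q.P.unit (e.symm x).1
    obtain ⟨f1, f2⟩ := Q.P.frenet (e.symm x).1
    rw [e5, e6, eT, ek, s1, s2, f1, f2, div_eq_mul_inv]
    linear_combination (-curvOf Q.P.γ (e.symm x).1 *
      (1 - (e.symm x).2 * curvOf Q.P.γ (e.symm x).1)⁻¹) * u
  · exact fun x hx h => (loc x hx h).2.2.2.1
  · intro x hx h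
    rw [(loc x hx h).2.2.1]; exact hmax _
  · intro x hx h
    obtain ⟨e, hxe, he, hs, eT, ek, e1, e2, e3, e4, e5, e6⟩ := hgrad x hx h
    obtain ⟨s1, s2, _⟩ := Q.P.symm_d he hs hxe
    have u := Q.P.unit (e.symm x).1
    have hb := (loc x hx h).2.2.2.1
    rw [eT, ek] at hb
    rw [e3, e4, ek, s1, s2]
    have hJ : 1 / 2 ≤ 1 - (e.symm x).2 * curvOf Q.P.γ (e.symm x).1 := by
      linarith [le_abs_self ((e.symm x).2 * curvOf Q.P.γ (e.symm x).1)]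
    have hJ2 : (1 - (e.symm x).2 * curvOf Q.P.γ (e.symm x).1)⁻¹ ≤ 2 := by
      rw [inv_le_comm₀ (by linarith) two_pos]; linarith
    have hJ3 : 0 ≤ (1 - (e.symm x).2 * curvOf Q.P.γ (e.symm x).1)⁻¹ := inv_nonneg.2 (by linarith)
    have hJ4 : (1 - (e.symm x).2 * curvOf Q.P.γ (e.symm x).1)⁻¹ ^ 2 ≤ 4 := by
      calc _ ≤ (2 : ℝ) ^ 2 := pow_le_pow_left₀ hJ3 hJ2 2
        _ = 4 := by norm_num
    calc _ = deriv (curvOf Q.P.γ) (e.symm x).1 ^ 2 *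
          (1 - (e.symm x).2 * curvOf Q.P.γ (e.symm x).1)⁻¹ ^ 2 := by
          linear_combination deriv (curvOf Q.P.γ) (e.symm x).1 ^ 2 *
            (1 - (e.symm x).2 * curvOf Q.P.γ (e.symm x).1)⁻¹ ^ 2 * u
      _ ≤ (Ck * (kmaxOf Q.P.γ - curvOf Q.P.γ (e.symm x).1)) * 4 := by
          refine mul_le_mul (hCk' _) hJ4 (sq_nonneg _) ?_
          exact mul_nonneg hCk.le (sub_nonneg.2 (hmax _))
      _ = _ := by ring

end Tube

lemma d1_d2_symm {φ : Plane → ℝ} (h : ContDiff ℝ 2 φ) (x : Plane) : d1 (d2 φ) x = d2 (d1 φ) x := by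
  have hs : IsSymmSndFDerivAt ℝ φ x := h.contDiffAt.isSymmSndFDerivAt (by simp)
  have hd : DifferentiableAt ℝ (fderiv ℝ φ) x :=
    (h.fderiv_right (m := 1) (by norm_num [one_add_one_eq_two])).contDiffAt.differentiableAt one_ne_zero
  have e1 : d1 (d2 φ) x = fderiv ℝ (fderiv ℝ φ) x (1, 0) (0, 1) := by
    unfold d1 d2
    rw [fderiv_clm_apply hd (by fun_prop)]
    simp
  have e2 : d2 (d1 φ) x = fderiv ℝ (fderiv ℝ φ) x (0, 1) (1, 0) := by
    unfold d1 d2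
    rw [fderiv_clm_apply hd (by fun_prop)]
    simp
  rw [e1, e2, hs.eq]

/-- Push-forward of a function supported in the source of a smooth chart. -/
lemma exists_pushforward {n : ℕ} {e : OpenPartialHomeomorph (ℝ × ℝ) Plane}
    (hsm : ∀ x ∈ e.target, ContDiffAt ℝ n e.symm x) {w : ℝ × ℝ → ℝ} (hw : ContDiff ℝ n w)
    {K : Set (ℝ × ℝ)} (hK : IsCompact K) (hKe : K ⊆ e.source) (hwK : ∀ q ∉ K, w q = 0) :
    ∃ a : Plane → ℝ, ContDiff ℝ n a ∧ HasCompactSupport a ∧ (∀ x ∈ e.target, a x = w (e.symm x)) ∧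
      ∀ x ∉ e '' K, a x = 0 := by
  classical
  have hc : IsCompact (e '' K) := hK.image_of_continuousOn (e.continuousOn.mono hKe)
  have h0 : ∀ x ∉ e '' K, (if x ∈ e.target then w (e.symm x) else 0) = 0 := fun x hx => by
    split_ifs with h
    · exact hwK _ fun hq => hx ⟨_, hq, e.right_inv h⟩
    · rfl
  refine ⟨fun x => if x ∈ e.target then w (e.symm x) else 0, ?_, ?_, fun x hx => if_pos hx, h0⟩
  · rw [contDiff_iff_contDiffAt]
    intro x
    by_cases hx : x ∈ e.target
    · refine (hw.contDiffAt.comp x (hsm x hx)).congr_of_eventuallyEq ?_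
      filter_upwards [e.open_target.mem_nhds hx] with y hy using if_pos hy
    · refine contDiffAt_const (c := (0 : ℝ)) |>.congr_of_eventuallyEq ?_
      have : x ∉ e '' K := fun ⟨q, hq, h⟩ => hx (h ▸ e.map_source (hKe hq))
      filter_upwards [hc.isClosed.isOpen_compl.mem_nhds this] with y hy using h0 y hy
  · refine HasCompactSupport.of_support_subset_isCompact hc fun x hx => ?_
    by_contra h
    exact hx (h0 x h)

lemma comp_symm_d {e : OpenPartialHomeomorph (ℝ × ℝ) Plane} {w : ℝ × ℝ → ℝ} {x : Plane}
    (hw : DifferentiableAt ℝ w (e.symm x)) (hsm : DifferentiableAt ℝ e.symm x) :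
    d1 (fun y => w (e.symm y)) x =
      fderiv ℝ w (e.symm x) (1, 0) * d1 (fun y => (e.symm y).1) x +
      fderiv ℝ w (e.symm x) (0, 1) * d1 (fun y => (e.symm y).2) x ∧
    d2 (fun y => w (e.symm y)) x =
      fderiv ℝ w (e.symm x) (1, 0) * d2 (fun y => (e.symm y).1) x +
      fderiv ℝ w (e.symm x) (0, 1) * d2 (fun y => (e.symm y).2) x := by
  have h := hw.hasFDerivAt.comp x hsm.hasFDerivAt
  have h1 := (hasFDerivAt_fst (𝕜 := ℝ) (E := ℝ) (F := ℝ) (p := e.symm x)).comp x hsm.hasFDerivAt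
  have h2 := (hasFDerivAt_snd (𝕜 := ℝ) (E := ℝ) (F := ℝ) (p := e.symm x)).comp x hsm.hasFDerivAt
  simp only [Function.comp_def] at h h1 h2
  have lin : ∀ v : ℝ × ℝ, fderiv ℝ w (e.symm x) v =
      fderiv ℝ w (e.symm x) (1, 0) * v.1 + fderiv ℝ w (e.symm x) (0, 1) * v.2 := fun v => by
    have : v = v.1 • ((1 : ℝ), (0 : ℝ)) + v.2 • ((0 : ℝ), (1 : ℝ)) := by ext <;> simp
    conv_lhs => rw [this]
    rw [map_add, map_smul, map_smul, smul_eq_mul, smul_eq_mul]; ring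
  unfold d1 d2
  rw [h.fderiv, h1.fderiv, h2.fderiv]
  exact ⟨lin _, lin _⟩

namespace BoundaryParam
variable {Ω : Set Plane} (P : BoundaryParam Ω)

/-- A vector potential of the unit magnetic field which is tangential on a chart. -/
lemma exists_gauge {e : OpenPartialHomeomorph (ℝ × ℝ) Plane} (he : ∀ q, e q = P.Phi q)
    (hs : ∀ q ∈ e.source, 1 - q.2 * curvOf P.γ q.1 ≠ 0) {K : Set (ℝ × ℝ)} (hK : IsCompact K)
    (hKe : K ⊆ e.source) (c₀ : ℝ) : ∃ A₁ A₂ : Plane → ℝ, ContDiff ℝ 1 A₁ ∧ ContDiff ℝ 1 A₂ ∧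
      (∀ x, curlf A₁ A₂ x = 1) ∧ ∀ q ∈ K,
        A₁ (P.Phi q) = (-(q.2 - q.2 ^ 2 * curvOf P.γ q.1 / 2) - c₀) *
          ((1 - q.2 * curvOf P.γ q.1)⁻¹ * (deriv P.γ q.1).1) ∧
        A₂ (P.Phi q) = (-(q.2 - q.2 ^ 2 * curvOf P.γ q.1 / 2) - c₀) *
          ((1 - q.2 * curvOf P.γ q.1)⁻¹ * (deriv P.γ q.1).2) := by
  have g1 := P.smooth.fst
  have g2 := P.smooth.snd
  have d1' := P.deriv_smooth.fst
  have d2' := P.deriv_smooth.snd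
  set f : ℝ → ℝ := fun σ => -(1 / 2) * (-(P.γ σ).1 * (deriv P.γ σ).2 + (P.γ σ).2 * (deriv P.γ σ).1) + c₀
    with hf
  have hfs : ContDiff ℝ (⊤ : ℕ∞) f :=
    (contDiff_const.mul ((g1.neg.mul d2').add (g2.mul d1'))).add contDiff_const
  set c : ℝ → ℝ := fun σ => ∫ y in (0 : ℝ)..σ, f y with hc
  have hcd : ∀ σ, HasDerivAt c (f σ) σ := fun σ =>
    intervalIntegral.integral_hasDerivAt_right (hfs.continuous.intervalIntegrable _ _)
      (hfs.continuous.stronglyMeasurableAtFilter _ _) hfs.continuous.continuousAt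
  have hcs : ContDiff ℝ (⊤ : ℕ∞) c := by
    refine contDiff_infty_iff_deriv.2 ⟨fun σ => (hcd σ).differentiableAt, ?_⟩
    rw [show deriv c = f from funext fun σ => (hcd σ).deriv]; exact hfs
  set φ : ℝ × ℝ → ℝ := fun q => q.2 * (1 / 2 * ((P.γ q.1).1 * (deriv P.γ q.1).1 +
    (P.γ q.1).2 * (deriv P.γ q.1).2)) + c q.1 with hφ
  have hφs : ContDiff ℝ (⊤ : ℕ∞) φ :=
    (contDiff_snd.mul (contDiff_const.mul ((g1.comp contDiff_fst |>.mul (d1'.comp contDiff_fst)).add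
      ((g2.comp contDiff_fst).mul (d2'.comp contDiff_fst))))).add (hcs.comp contDiff_fst)
  have hcomp : IsCompact (e '' K) := hK.image_of_continuousOn (e.continuousOn.mono hKe)
  obtain ⟨v, hv, -, hve⟩ := exists_extension (n := 2) (Ω := e '' K) (u := fun x => φ (e.symm x))
    hcomp.isBounded ⟨e.target, e.open_target, by
      rw [hcomp.isClosed.closure_eq]
      rintro _ ⟨q, hq, rfl⟩; exact e.map_source (hKe hq), fun x hx =>
      ((contDiff_infty.1 hφs 2).contDiffAt.comp x
        (contDiffAt_infty.1 (P.symm_smooth he hs hx) 2)).contDiffWithinAt⟩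
  have hv2 : ContDiff ℝ 2 v := hv
  have hv1 : ContDiff ℝ 1 (fderiv ℝ v) := hv2.fderiv_right (by norm_num [one_add_one_eq_two])
  have hd1 : ContDiff ℝ 1 (d1 v) := hv1.clm_apply contDiff_const
  have hd2 : ContDiff ℝ 1 (d2 v) := hv1.clm_apply contDiff_const
  refine ⟨fun x => -x.2 / 2 - d1 v x, fun x => x.1 / 2 - d2 v x,
    (contDiff_snd.neg.div_const 2).sub hd1, (contDiff_fst.div_const 2).sub hd2, fun x => ?_,
    fun q hq => ?_⟩
  · have e1 : d1 (fun x : Plane => x.1 / 2 - d2 v x) x = 1 / 2 - d1 (d2 v) x := by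
      rw [d1_sub (by fun_prop) (cdAt hd2 x)]
      congr 1
      have : HasFDerivAt (fun x : Plane => x.1 / 2) ((2 : ℝ)⁻¹ • ContinuousLinearMap.fst ℝ ℝ ℝ) x := by
        have := (hasFDerivAt_fst (𝕜 := ℝ) (E := ℝ) (F := ℝ) (p := x)).const_smul (2 : ℝ)⁻¹
        refine this.congr_of_eventuallyEq (Eventually.of_forall fun y => ?_)
        simp [div_eq_mul_inv, mul_comm]
      rw [d1, this.fderiv]; simp
    have e2 : d2 (fun x : Plane => -x.2 / 2 - d1 v x) x = -(1 / 2) - d2 (d1 v) x := by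
      rw [d2_sub (by fun_prop) (cdAt hd1 x)]
      congr 1
      have : HasFDerivAt (fun x : Plane => -x.2 / 2) (-(2 : ℝ)⁻¹ • ContinuousLinearMap.snd ℝ ℝ ℝ) x := by
        have := (hasFDerivAt_snd (𝕜 := ℝ) (E := ℝ) (F := ℝ) (p := x)).const_smul (-(2 : ℝ)⁻¹)
        refine this.congr_of_eventuallyEq (Eventually.of_forall fun y => ?_)
        simp [div_eq_mul_inv, mul_comm]
      rw [d2, this.fderiv]; simp
    rw [curlf, e1, e2, d1_d2_symm hv2]; ring
  · have hqs := hKe hq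
    have hxt : P.Phi q ∈ e.target := by rw [← he]; exact e.map_source hqs
    have hes : e.symm (P.Phi q) = q := by rw [← he]; exact e.left_inv hqs
    have hev : v =ᶠ[𝓝 (P.Phi q)] fun x => φ (e.symm x) :=
      hve _ (subset_closure ⟨q, hq, he q⟩)
    have hsd := (P.symm_smooth he hs hxt).differentiableAt (by simp)
    obtain ⟨c1, c2⟩ := comp_symm_d (e := e) (x := P.Phi q)
      ((hφs.contDiffAt (x := e.symm (P.Phi q))).differentiableAt (by simp)) hsd
    obtain ⟨s1, s2, s3, s4⟩ := P.symm_d he hs hxt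
    obtain ⟨f1, f2⟩ := P.frenet q.1
    have hJ := hs q hqs
    have u := P.unit q.1
    have hγ1 := hasDerivAt_fst (P.hasDerivAt q.1)
    have hγ2 := hasDerivAt_snd (P.hasDerivAt q.1)
    have hγ3 := hasDerivAt_fst (P.hasDerivAt2 q.1)
    have hγ4 := hasDerivAt_snd (P.hasDerivAt2 q.1)
    have p1 : fderiv ℝ φ q (0, 1) = 1 / 2 * ((P.γ q.1).1 * (deriv P.γ q.1).1 +
        (P.γ q.1).2 * (deriv P.γ q.1).2) := by
      have hl : HasDerivAt (fun t : ℝ => φ (q.1, t)) (1 / 2 * ((P.γ q.1).1 * (deriv P.γ q.1).1 +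
        (P.γ q.1).2 * (deriv P.γ q.1).2)) q.2 := by
        simpa [hφ] using ((hasDerivAt_id q.2).mul_const (1 / 2 * ((P.γ q.1).1 * (deriv P.γ q.1).1 +
          (P.γ q.1).2 * (deriv P.γ q.1).2))).add_const (c q.1)
      have hr := ((hφs.contDiffAt (x := q)).differentiableAt (by simp)).hasFDerivAt.comp_hasDerivAt
        q.2 (HasDerivAt.prodMk (hasDerivAt_const q.2 q.1) (hasDerivAt_id q.2))
      exact hr.unique hl
    have p2 : fderiv ℝ φ q (1, 0) = q.2 * (1 / 2 * (((deriv P.γ q.1).1 * (deriv P.γ q.1).1 +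
        (P.γ q.1).1 * (deriv (deriv P.γ) q.1).1) + ((deriv P.γ q.1).2 * (deriv P.γ q.1).2 +
        (P.γ q.1).2 * (deriv (deriv P.γ) q.1).2))) + f q.1 := by
      have hl := ((((hγ1.fun_mul hγ3).fun_add (hγ2.fun_mul hγ4)).const_mul (1 / 2)).const_mul
        q.2).fun_add (hcd q.1)
      have hr := ((hφs.contDiffAt (x := q)).differentiableAt (by simp)).hasFDerivAt.comp_hasDerivAt
        q.1 (HasDerivAt.prodMk (hasDerivAt_id q.1) (hasDerivAt_const q.1 q.2))
      exact hr.unique hl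
    rw [hes] at c1 c2 s1 s2 s3 s4
    have hP1 : (P.Phi q).1 = (P.γ q.1).1 - q.2 * (deriv P.γ q.1).2 := by
      simp [Phi, nuVec, sub_eq_add_neg]
    have hP2 : (P.Phi q).2 = (P.γ q.1).2 + q.2 * (deriv P.γ q.1).1 := by
      simp [Phi, nuVec]
    have m1 : d1 v (P.Phi q) = _ := (d1_congr hev).trans c1
    have m2 : d2 v (P.Phi q) = _ := (d2_congr hev).trans c2
    simp only []
    rw [m1, m2, s1, s2, s3, s4, p1, p2, f1, f2, hP1, hP2]
    simp only [hf]
    clear_value φ c f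
    clear m1 m2 s1 s2 s3 s4 p1 p2 f1 f2 hP1 hP2 c1 c2 hγ1 hγ2 hγ3 hγ4 hf hφ hc
    generalize curvOf P.γ q.1 = k at *
    generalize (deriv P.γ q.1).1 = g₁ at *
    generalize (deriv P.γ q.1).2 = g₂ at *
    generalize (P.γ q.1).1 = x₁ at *
    generalize (P.γ q.1).2 = x₂ at *
    generalize q.2 = t at *
    have hJ' : (1 - t * k) * (1 - t * k)⁻¹ = 1 := mul_inv_cancel₀ hJ
    generalize (1 - t * k)⁻¹ = j at *
    constructor
    · linear_combination (-(t / 2) * j * g₁ + x₂ / 2) * u +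
        (1 / 2 * (-x₁ * g₂ + x₂ * g₁) * g₁ + t / 2 * g₁) * hJ'
    · linear_combination (-(t / 2) * j * g₂ - x₁ / 2) * u +
        (1 / 2 * (-x₁ * g₂ + x₂ * g₁) * g₂ + t / 2 * g₂) * hJ'

end BoundaryParam

/-- The geometry `g` is the boundary geometry of the tube `Q`. -/
structure Fit {Ω : Set Plane} (Q : Tube Ω) (g : Geo Ω) : Prop where
  km : g.km = kmaxOf Q.P.γ
  t₁_lt : 3 * g.t₁ < Q.t₀
  curv : ∀ s, 3 * g.t₁ * |curvOf Q.P.γ s| ≤ 1 / 2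
  T_eq : ∀ x ∈ closure Ω, g.T x = Tube.flat g.t₁ (distBdry Ω x)
  k_eq : ∀ x ∈ closure Ω, distBdry Ω x ≤ g.t₁ → g.k x = curvOf Q.P.γ (Q.foot x)

lemma Tube.exists_fit {Ω : Set Plane} (Q : Tube Ω) : ∃ g : Geo Ω, Fit Q g := by
  obtain ⟨g, h1, h2, h3, h4, h5⟩ := Q.exists_geo
  exact ⟨g, h1, h2, h3, h4, h5⟩

namespace Fit
variable {Ω : Set Plane} {Q : Tube Ω} {g : Geo Ω}

lemma T_of_lt (F : Fit Q g) {x : Plane} (hx : x ∈ closure Ω) (h : distBdry Ω x ≤ g.t₁) :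
    g.T x = distBdry Ω x := by
  rw [F.T_eq x hx, Tube.flat_of_le g.t₁_pos h]

/-- A boundary chart adapted to the analytic geometry. -/
lemma exists_box (F : Fit Q g) (s₀ : ℝ) : ∃ (e : OpenPartialHomeomorph (ℝ × ℝ) Plane) (δ : ℝ),
    0 < δ ∧ δ < g.t₁ / 2 ∧ (∀ q, e q = Q.P.Phi q) ∧
    (∀ q ∈ e.source, 1 - q.2 * curvOf Q.P.γ q.1 ≠ 0) ∧
    Icc (s₀ - δ) (s₀ + δ) ×ˢ Icc (-δ) δ ⊆ e.source ∧
    ∀ q ∈ Icc (s₀ - δ) (s₀ + δ) ×ˢ Icc (-δ) δ, Q.P.Phi q ∈ Ω →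
      0 ≤ q.2 ∧ g.T (Q.P.Phi q) = q.2 ∧ g.k (Q.P.Phi q) = curvOf Q.P.γ q.1 ∧
      d1 g.T (Q.P.Phi q) = -(deriv Q.P.γ q.1).2 ∧ d2 g.T (Q.P.Phi q) = (deriv Q.P.γ q.1).1 := by
  have ht1 := g.t₁_pos
  obtain ⟨e, hpe, he, hs, hc⟩ := Q.exists_chart (p := (s₀, 0)) ⟨le_rfl, Q.t₀_pos⟩ (by simp)
  obtain ⟨ε, hε, hball⟩ := Metric.isOpen_iff.1 e.open_source _ hpe
  refine ⟨e, min (ε / 2) (g.t₁ / 4), by positivity, ?_, he, hs, fun q hq => hball ?_, ?_⟩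
  · exact (min_le_right _ _).trans_lt (by linarith)
  · rw [Metric.mem_ball, Prod.dist_eq]
    have h1 := hq.1; have h2 := hq.2
    have hm := min_le_left (ε / 2) (g.t₁ / 4)
    refine max_lt ?_ ?_
    · rw [Real.dist_eq, abs_lt]; constructor <;> linarith [h1.1, h1.2]
    · rw [Real.dist_eq, abs_lt]; constructor <;> linarith [h2.1, h2.2]
  · intro q hq hx
    have hqs : q ∈ e.source := hball (by
      rw [Metric.mem_ball, Prod.dist_eq]
      have h1 := hq.1; have h2 := hq.2
      have hm := min_le_left (ε / 2) (g.t₁ / 4)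
      refine max_lt ?_ ?_
      · rw [Real.dist_eq, abs_lt]; constructor <;> linarith [h1.1, h1.2]
      · rw [Real.dist_eq, abs_lt]; constructor <;> linarith [h2.1, h2.2])
    have hxt : Q.P.Phi q ∈ e.target := by rw [← he]; exact e.map_source hqs
    have hes : e.symm (Q.P.Phi q) = q := by rw [← he]; exact e.left_inv hqs
    have hxc := subset_closure hx
    obtain ⟨a1, a2⟩ := hc _ hxt hxc
    rw [hes] at a1
    have h0 := (Q.exists_coord hxc a2).1
    have hq2 : q.2 ≤ g.t₁ / 4 := hq.2.2.trans (min_le_right _ _)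
    have hd1 : distBdry Ω (Q.P.Phi q) ≤ g.t₁ := by rw [a1]; linarith
    have hT : g.T (Q.P.Phi q) = q.2 := by rw [F.T_of_lt hxc hd1, a1]
    have hq0 : 0 ≤ q.2 := by rw [← a1]; exact h0
    have hev : g.T =ᶠ[𝓝 (Q.P.Phi q)] fun y => (e.symm y).2 := by
      have hcs : ContinuousAt (fun y => (e.symm y).2) (Q.P.Phi q) :=
        continuousAt_snd.comp (e.symm.continuousAt hxt)
      have hlt : ∀ᶠ y in 𝓝 (Q.P.Phi q), (e.symm y).2 < g.t₁ :=
        hcs.eventually_lt continuousAt_const (by simp only [hes]; linarith)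
      filter_upwards [hlt, e.open_target.mem_nhds hxt, Q.isOpen.mem_nhds hx] with y h1 h2 h3
      have := (hc y h2 (subset_closure h3)).1
      rw [F.T_of_lt (subset_closure h3) (by rw [this]; exact h1.le), this]
    obtain ⟨-, -, s3, s4⟩ := Q.P.symm_d he hs hxt
    refine ⟨hq0, hT, ?_, ?_, ?_⟩
    · rw [F.k_eq _ hxc hd1]
      exact Q.curv_foot (s := q.1) (t := q.2) ⟨hq0, by linarith [F.t₁_lt]⟩
    · rw [d1_congr hev, s3, hes]
    · rw [d2_congr hev, s4, hes]

end Fit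

namespace Model
variable (m : Model)

lemma u_smooth : ContDiff ℝ 1 m.u :=
  contDiff_one_of_hasDerivAt m.du (m.p_cont.mul
    (continuous_iff_continuousAt.2 fun τ => (m.du τ).continuousAt))

lemma r_div_bound {y : ℝ} (hy : 0 ≤ y) : |m.r y / (1 - m.G y ^ 2)| ≤ m.M ^ 2 * (1 + y) := by
  have h0 := m.one_sub_G_pos y hy
  have hG := m.G_pos y hy
  have h1 : 1 ≤ m.M * (1 + y) ^ 2 * (1 - m.G y) := m.G_gap y hy
  have h2 := m.r_bound y hy
  have h3 : 0 < 1 - m.G y ^ 2 := by nlinarith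
  have hM := m.M_pos
  have h5 : 1 - m.G y ≤ 1 - m.G y ^ 2 := by nlinarith
  rw [abs_div, abs_of_pos h3, div_le_iff₀ h3]
  calc |m.r y| ≤ |m.r y| * (m.M * (1 + y) ^ 2 * (1 - m.G y)) :=
        le_mul_of_one_le_right (abs_nonneg _) h1
    _ = m.M * (1 - m.G y) * (1 + y) * ((1 + y) * |m.r y|) := by ring
    _ ≤ m.M * (1 - m.G y ^ 2) * (1 + y) * m.M := by gcongr
    _ = _ := by ring

lemma u_sq_bound {y : ℝ} (hy : 0 ≤ y) : (1 + y) ^ 4 * m.u y ^ 2 ≤ m.M ^ 2 / (1 + y) ^ 2 := by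
  have h := m.u_bound y hy
  have hu := m.u_pos y
  have hM := m.M_pos
  rw [le_div_iff₀ (by positivity)]
  have h1 : (1 : ℝ) ≤ (1 + y) ^ 2 := one_le_pow₀ (by linarith)
  have h2 : (0 : ℝ) ≤ (1 + y) ^ 4 * m.u y := by positivity
  calc (1 + y) ^ 4 * m.u y ^ 2 * (1 + y) ^ 2 ≤
        (1 + y) ^ 4 * m.u y ^ 2 * (1 + y) ^ 2 * (1 + y) ^ 2 := le_mul_of_one_le_right (by positivity) h1
    _ = ((1 + y) ^ 4 * m.u y) ^ 2 := by ring
    _ ≤ m.M ^ 2 := pow_le_pow_left₀ h2 h 2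

end Model

lemma sq_le_of_abs_le {a b : ℝ} (h : |a| ≤ b) : a ^ 2 ≤ b ^ 2 := by
  rw [← sq_abs]; exact pow_le_pow_left₀ (abs_nonneg _) h 2

lemma trial_bound {y k K j G r1 ξ M u c c' h h' l K₁ K₂ : ℝ} (hy : 0 ≤ y) (hk : |k| ≤ K)
    (hj : |j| ≤ 2) (hG : |G| ≤ 1) (hr : |r1| ≤ M ^ 2 * (1 + y)) (hξ : |ξ| ≤ 1) (hu : 0 ≤ u)
    (hc : |c| ≤ 1) (hh : |h| ≤ 1) (hc' : |c'| ≤ K₂) (hh' : |h'| ≤ K₁) (hl : 1 ≤ l) :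
    (j * (u * c * (l * h'))) ^ 2 + ((j * k * (-y ^ 2 / 2 - y * ξ) - G * (k * r1)) * (u * c * h)) ^ 2 +
      (u * c' * h - k * r1 * (u * c * h)) ^ 2 ≤
    (4 * K₁ ^ 2 + (2 * K + K * M ^ 2) ^ 2 + (K₂ + K * M ^ 2) ^ 2) * (l ^ 2 * ((1 + y) ^ 4 * u ^ 2)) := by
  have hK : 0 ≤ K := (abs_nonneg _).trans hk
  have hK1 : 0 ≤ K₁ := (abs_nonneg _).trans hh'
  have hK2 : 0 ≤ K₂ := (abs_nonneg _).trans hc'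
  have y1 : (1 : ℝ) ≤ (1 + y) ^ 2 := one_le_pow₀ (by linarith)
  have y2 : 1 + y ≤ (1 + y) ^ 2 := by nlinarith
  have hl0 : 0 ≤ l := by linarith
  have hkr : |k * r1| ≤ K * (M ^ 2 * (1 + y)) := by
    rw [abs_mul]; exact mul_le_mul hk hr (abs_nonneg _) hK
  have hkr' : |k * r1| ≤ K * M ^ 2 * (1 + y) ^ 2 := hkr.trans (by
    rw [mul_assoc]; gcongr)
  have hval : |u * c * h| ≤ u := by
    rw [abs_mul, abs_mul, abs_of_nonneg hu]
    calc u * |c| * |h| ≤ u * 1 * 1 := by gcongr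
      _ = u := by ring
  have t1 : |j * (u * c * (l * h'))| ≤ 2 * K₁ * (l * ((1 + y) ^ 2 * u)) := by
    rw [abs_mul, abs_mul, abs_mul, abs_mul, abs_of_nonneg hu, abs_of_nonneg hl0]
    calc |j| * (u * |c| * (l * |h'|)) ≤ 2 * (u * 1 * (l * K₁)) := by gcongr
      _ = 2 * K₁ * (l * (1 * u)) := by ring
      _ ≤ _ := by gcongr
  have t2 : |(j * k * (-y ^ 2 / 2 - y * ξ) - G * (k * r1)) * (u * c * h)| ≤
      (2 * K + K * M ^ 2) * (l * ((1 + y) ^ 2 * u)) := by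
    have a1 : |-y ^ 2 / 2 - y * ξ| ≤ (1 + y) ^ 2 := by
      have := abs_le.1 hξ
      rw [abs_le]; constructor <;> nlinarith [this.1, this.2, mul_nonneg hy (by linarith : 0 ≤ ξ + 1),
        mul_nonneg hy (by linarith : 0 ≤ 1 - ξ)]
    have a2 : |j * k * (-y ^ 2 / 2 - y * ξ) - G * (k * r1)| ≤ (2 * K + K * M ^ 2) * (1 + y) ^ 2 := by
      refine (abs_sub _ _).trans ?_
      have b1 : |j * k * (-y ^ 2 / 2 - y * ξ)| ≤ 2 * K * (1 + y) ^ 2 := by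
        rw [abs_mul, abs_mul]; gcongr
      have b2 : |G * (k * r1)| ≤ 1 * (K * M ^ 2 * (1 + y) ^ 2) := by
        rw [abs_mul]; exact mul_le_mul hG hkr' (abs_nonneg _) zero_le_one
      linarith
    rw [abs_mul]
    calc _ ≤ ((2 * K + K * M ^ 2) * (1 + y) ^ 2) * u := by gcongr
      _ = (2 * K + K * M ^ 2) * (1 * ((1 + y) ^ 2 * u)) := by ring
      _ ≤ _ := by gcongr
  have t3 : |u * c' * h - k * r1 * (u * c * h)| ≤ (K₂ + K * M ^ 2) * (l * ((1 + y) ^ 2 * u)) := by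
    refine (abs_sub _ _).trans ?_
    have b1 : |u * c' * h| ≤ K₂ * (l * ((1 + y) ^ 2 * u)) := by
      rw [abs_mul, abs_mul, abs_of_nonneg hu]
      calc u * |c'| * |h| ≤ u * K₂ * 1 := by gcongr
        _ = K₂ * (1 * (1 * u)) := by ring
        _ ≤ _ := by gcongr
    have b2 : |k * r1 * (u * c * h)| ≤ K * M ^ 2 * (l * ((1 + y) ^ 2 * u)) := by
      rw [abs_mul]
      calc _ ≤ (K * M ^ 2 * (1 + y) ^ 2) * u := by gcongr
        _ = K * M ^ 2 * (1 * ((1 + y) ^ 2 * u)) := by ring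
        _ ≤ _ := by gcongr
    linarith
  have := sq_le_of_abs_le t1
  have := sq_le_of_abs_le t2
  have := sq_le_of_abs_le t3
  linarith

/-- A fixed smooth bump function, equal to `1` near zero and vanishing off `(-1,1)`. -/
def bmp (y : ℝ) : ℝ := 1 - step (2 * y ^ 2)

lemma bmp_smooth {n : ℕ∞} : ContDiff ℝ n bmp :=
  contDiff_const.sub (step_contDiff.comp (contDiff_const.mul (contDiff_id.pow 2)))

lemma bmp_abs (y : ℝ) : |bmp y| ≤ 1 := by
  have h1 := step_nonneg (2 * y ^ 2)
  have h2 := step_le_one (2 * y ^ 2)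
  rw [bmp, abs_le]; constructor <;> linarith

lemma bmp_one {y : ℝ} (h : |y| ≤ 1 / 2) : bmp y = 1 := by
  have := sq_le_of_abs_le h
  rw [bmp, step_zero (by linarith), sub_zero]

lemma bmp_zero {y : ℝ} (h : 1 ≤ |y|) : bmp y = 0 := by
  have : 1 ≤ y ^ 2 := by rw [← sq_abs]; nlinarith
  rw [bmp, step_one (by linarith), sub_self]

lemma bmp_hasDerivAt (y : ℝ) : HasDerivAt bmp (deriv bmp y) y :=
  ((bmp_smooth (n := 1)).contDiffAt.differentiableAt one_ne_zero).hasDerivAt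

lemma bmp_deriv_bound : ∃ K > 0, ∀ y, |deriv bmp y| ≤ K := by
  have hc : Continuous (deriv bmp) := (bmp_smooth (n := 1)).continuous_deriv le_rfl
  obtain ⟨K, hK⟩ := (isCompact_Icc (a := (-1 : ℝ)) (b := 1)).exists_bound_of_continuousOn
    hc.continuousOn
  refine ⟨max K 1, by positivity, fun y => ?_⟩
  by_cases h : |y| ≤ 1
  · exact (hK y (abs_le.1 h)).trans (le_max_left _ _)
  · have : bmp =ᶠ[𝓝 y] fun _ => 0 := by
      filter_upwards [continuous_abs.continuousAt.eventually (lt_mem_nhds (not_le.1 h))] with z hz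
        using bmp_zero hz.le
    rw [this.deriv_eq]; simp

lemma det_plane (f : ℝ × ℝ →L[ℝ] ℝ × ℝ) :
    f.det = (f (1, 0)).1 * (f (0, 1)).2 - (f (0, 1)).1 * (f (1, 0)).2 := by
  rw [ContinuousLinearMap.det, ← LinearMap.det_toMatrix (Module.Basis.finTwoProd ℝ), Matrix.det_fin_two]
  simp [LinearMap.toMatrix_apply]

namespace BoundaryParam
variable {Ω : Set Plane} (P : BoundaryParam Ω)

lemma dPhi_det (q : ℝ × ℝ) : (P.dPhi q).det = 1 - q.2 * curvOf P.γ q.1 := by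
  rw [det_plane]
  have := P.unit q.1
  simp [dPhi, nuVec]
  linear_combination (1 - q.2 * curvOf P.γ q.1) * this

/-- Integration in tubular coordinates. -/
lemma integral_Phi {R : Set (ℝ × ℝ)} (hR : MeasurableSet R) (hinj : InjOn P.Phi R) (f : Plane → ℝ) :
    ∫ x in P.Phi '' R, f x = ∫ q in R, |1 - q.2 * curvOf P.γ q.1| * f (P.Phi q) := by
  have := integral_image_eq_integral_abs_det_fderiv_smul (μ := volume) hR
    (fun q _ => (P.Phi_hasFDerivAt q).hasFDerivWithinAt) hinj f
  rw [this]
  simp [dPhi_det]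

lemma curv_quadratic {s₀ : ℝ} (h0 : curvOf P.γ s₀ = kmaxOf P.γ) : ∃ K > 0, ∀ s,
    kmaxOf P.γ - curvOf P.γ s ≤ K * (s - s₀) ^ 2 := by
  have c1 : ContDiff ℝ (⊤ : ℕ∞) (deriv (curvOf P.γ)) := (contDiff_infty_iff_deriv.1 P.curv_smooth).2
  have c2 := (contDiff_infty_iff_deriv.1 c1).2
  obtain ⟨K, hK0, hK⟩ := periodic_bound (periodic_deriv (periodic_deriv P.curv_periodic)) P.L_pos
    c2.continuous
  obtain ⟨_, _, hmax⟩ := P.exists_curv_max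
  have hd0 : deriv (curvOf P.γ) s₀ = 0 :=
    IsLocalMax.deriv_eq_zero (Eventually.of_forall fun s => by rw [h0]; exact hmax s)
  have b1 : ∀ s, |deriv (curvOf P.γ) s| ≤ K * |s - s₀| := fun s => by
    have := convex_univ.norm_image_sub_le_of_norm_deriv_le (f := deriv (curvOf P.γ)) (C := K)
      (fun x _ => c1.differentiable (by simp) x) (fun x _ => hK x) (mem_univ s₀) (mem_univ s)
    simpa [hd0] using this
  refine ⟨K, hK0, fun s => ?_⟩
  have := (convex_uIcc s₀ s).norm_image_sub_le_of_norm_deriv_le (f := curvOf P.γ) (C := K * |s - s₀|)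
    (fun x _ => P.curv_smooth.differentiable (by simp) x)
    (fun x hx => (b1 x).trans (mul_le_mul_of_nonneg_left (abs_sub_left_of_mem_uIcc hx) hK0.le)) left_mem_uIcc right_mem_uIcc
  rw [Real.norm_eq_abs, Real.norm_eq_abs, h0, mul_assoc, abs_mul_abs_self] at this
  have := (abs_le.1 this).1
  nlinarith

end BoundaryParam

lemma integral_inv_sq_le {s δ : ℝ} (hs : 0 < s) (hδ : 0 ≤ δ) :
    ∫ t in Icc 0 δ, 1 / (1 + s * t) ^ 2 ≤ 1 / s := by
  have hp : ∀ t ∈ uIcc 0 δ, 0 < 1 + s * t := fun t ht => by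
    rw [uIcc_of_le hδ] at ht
    have := mul_nonneg hs.le ht.1
    linarith
  rw [integral_Icc_eq_integral_Ioc, ← intervalIntegral.integral_of_le hδ,
    intervalIntegral.integral_eq_sub_of_hasDerivAt (f := fun t => -(1 / s) * (1 + s * t)⁻¹)]
  · have := hp δ right_mem_uIcc
    have : 0 ≤ 1 / s * (1 + s * δ)⁻¹ := by positivity
    simp; simp at this; linarith
  · intro t ht
    have h := hp t ht
    have := (((hasDerivAt_id t).const_mul s).const_add 1).fun_inv h.ne'
    refine (this.const_mul (-(1 / s))).congr_deriv ?_
    simp only [id_eq]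
    field_simp
  · refine (ContinuousOn.div continuousOn_const (by fun_prop) fun t ht => ?_).intervalIntegrable
    exact (pow_pos (hp t ht) 2).ne'

/-- The trial function in tubular coordinates. -/
def Model.trial (m : Model) (s l δ s₀ : ℝ) (q : ℝ × ℝ) : ℝ :=
  m.u (s * q.2) * bmp (δ⁻¹ * q.2) * bmp (l * (q.1 - s₀))

namespace Model
variable (m : Model) (s l δ s₀ : ℝ)

lemma trial_smooth : ContDiff ℝ 1 (m.trial s l δ s₀) :=
  ((m.u_smooth.comp (contDiff_const.mul contDiff_snd)).mul
    ((bmp_smooth (n := 1)).comp (contDiff_const.mul contDiff_snd))).mul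
    ((bmp_smooth (n := 1)).comp (contDiff_const.mul (contDiff_fst.sub contDiff_const)))

lemma trial_d (q : ℝ × ℝ) :
    fderiv ℝ (m.trial s l δ s₀) q (1, 0) =
      m.u (s * q.2) * bmp (δ⁻¹ * q.2) * (l * deriv bmp (l * (q.1 - s₀))) ∧
    fderiv ℝ (m.trial s l δ s₀) q (0, 1) =
      m.u (s * q.2) * (δ⁻¹ * deriv bmp (δ⁻¹ * q.2)) * bmp (l * (q.1 - s₀)) +
        s * m.p (s * q.2) * m.trial s l δ s₀ q := by
  have hd := (m.trial_smooth s l δ s₀).differentiable one_ne_zero q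
  constructor
  · have h1 : HasDerivAt (fun x : ℝ => ((x, q.2) : ℝ × ℝ)) (1, 0) q.1 :=
      (hasDerivAt_id q.1).prodMk (hasDerivAt_const q.1 q.2)
    have h2 := HasFDerivAt.comp_hasDerivAt (f := fun x : ℝ => ((x, q.2) : ℝ × ℝ)) q.1
      (l := m.trial s l δ s₀) hd.hasFDerivAt h1
    have h3 := ((bmp_hasDerivAt (l * (q.1 - s₀))).comp q.1
      (((hasDerivAt_id q.1).sub_const s₀).const_mul l)).const_mul (m.u (s * q.2) * bmp (δ⁻¹ * q.2))
    rw [h2.unique h3]; ring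
  · have h1 : HasDerivAt (fun x : ℝ => ((q.1, x) : ℝ × ℝ)) (0, 1) q.2 :=
      (hasDerivAt_const q.2 q.1).prodMk (hasDerivAt_id q.2)
    have h2 := HasFDerivAt.comp_hasDerivAt (f := fun x : ℝ => ((q.1, x) : ℝ × ℝ)) q.2
      (l := m.trial s l δ s₀) hd.hasFDerivAt h1
    have h3 := (((m.du (s * q.2)).comp q.2 ((hasDerivAt_id q.2).const_mul s)).fun_mul
      ((bmp_hasDerivAt (δ⁻¹ * q.2)).comp q.2 ((hasDerivAt_id q.2).const_mul δ⁻¹))).mul_const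
      (bmp (l * (q.1 - s₀)))
    rw [h2.unique h3]
    simp only [Function.comp_apply, trial]; ring

variable {s l δ s₀}

lemma trial_zero (hl : 0 < l) (hδ : 0 < δ) {q : ℝ × ℝ}
    (hq : q ∉ Icc (s₀ - l⁻¹) (s₀ + l⁻¹) ×ˢ Icc (-δ) δ) : m.trial s l δ s₀ q = 0 := by
  rw [trial]
  by_contra h
  simp only [mul_eq_zero, not_or] at h
  have h1 : |δ⁻¹ * q.2| < 1 := by by_contra hc; exact h.1.2 (bmp_zero (not_lt.1 hc))
  have h2 : |l * (q.1 - s₀)| < 1 := by by_contra hc; exact h.2 (bmp_zero (not_lt.1 hc))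
  rw [abs_mul, abs_of_pos (inv_pos.2 hδ), inv_mul_lt_iff₀ hδ, mul_one, abs_lt] at h1
  rw [abs_mul, abs_of_pos hl, ← lt_inv_mul_iff₀ hl, mul_one, abs_lt] at h2
  exact hq ⟨⟨by linarith [h2.1], by linarith [h2.2]⟩, ⟨h1.1.le, h1.2.le⟩⟩

lemma trial_core (hδ : 0 < δ) (hl : 0 < l) {q : ℝ × ℝ} (h1 : |q.1 - s₀| ≤ l⁻¹ / 2)
    (h2 : |q.2| ≤ δ / 2) : m.trial s l δ s₀ q = m.u (s * q.2) := by
  rw [trial, bmp_one, bmp_one, mul_one, mul_one]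
  · rw [abs_mul, abs_of_pos hl]
    calc l * |q.1 - s₀| ≤ l * (l⁻¹ / 2) := by gcongr
      _ = 1 / 2 := by field_simp
  · rw [abs_mul, abs_of_pos (inv_pos.2 hδ)]
    calc δ⁻¹ * |q.2| ≤ δ⁻¹ * (δ / 2) := by gcongr
      _ = 1 / 2 := by field_simp

end Model

namespace Fit
variable {Ω : Set Plane} {Q : Tube Ω} {g : Geo Ω}

lemma jac_bounds (F : Fit Q g) {q : ℝ × ℝ} (h : |q.2| ≤ g.t₁) :
    1 / 2 ≤ 1 - q.2 * curvOf Q.P.γ q.1 ∧ 1 - q.2 * curvOf Q.P.γ q.1 ≤ 3 / 2 := by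
  have h1 := F.curv q.1
  have h2 : |q.2 * curvOf Q.P.γ q.1| ≤ 1 / 2 := by
    rw [abs_mul]
    have := mul_le_mul_of_nonneg_right h (abs_nonneg (curvOf Q.P.γ q.1))
    have := mul_nonneg g.t₁_pos.le (abs_nonneg (curvOf Q.P.γ q.1))
    linarith
  have := abs_le.1 h2
  constructor <;> linarith [this.1, this.2]

/-- Upper bound for integrals of functions concentrated near a boundary piece. -/
lemma integral_profile_le (F : Fit Q g) {R : Set (ℝ × ℝ)} {c ℓ δ s : ℝ} (hs : 0 < s) (hℓ : 0 ≤ ℓ)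
    (hδ : 0 ≤ δ) (hδ1 : δ ≤ g.t₁) (hR : R ⊆ Icc (c - ℓ) (c + ℓ) ×ˢ Icc 0 δ) (hRm : MeasurableSet R)
    (hinj : InjOn Q.P.Phi R) (hT : ∀ q ∈ R, g.T (Q.P.Phi q) = q.2) :
    ∫ x in Q.P.Phi '' R, 1 / (1 + s * g.T x) ^ 2 ≤ 3 * ℓ / s := by
  rw [Q.P.integral_Phi hRm hinj]
  have hcont : ContinuousOn (fun q : ℝ × ℝ => 3 / 2 * (1 / (1 + s * q.2) ^ 2))
      (Icc (c - ℓ) (c + ℓ) ×ˢ Icc 0 δ) := by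
    refine continuousOn_const.mul (ContinuousOn.div continuousOn_const (by fun_prop) fun q hq => ?_)
    have := mul_nonneg hs.le hq.2.1
    positivity
  have hint : IntegrableOn (fun q : ℝ × ℝ => 3 / 2 * (1 / (1 + s * q.2) ^ 2))
      (Icc (c - ℓ) (c + ℓ) ×ˢ Icc 0 δ) :=
    hcont.integrableOn_compact (isCompact_Icc.prod isCompact_Icc)
  calc _ ≤ ∫ q in R, 3 / 2 * (1 / (1 + s * q.2) ^ 2) := by
        refine integral_mono_of_nonneg (ae_of_all _ fun q => by positivity) (hint.mono_set hR) ?_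
        refine (ae_restrict_iff' hRm).2 (ae_of_all _ fun q hq => ?_)
        have hq' := hR hq
        have := F.jac_bounds (q := q) (by
          rw [abs_of_nonneg hq'.2.1]; exact hq'.2.2.trans hδ1)
        simp only [hT q hq]
        refine mul_le_mul_of_nonneg_right ?_ (by positivity)
        rw [abs_le]; constructor <;> linarith [this.1, this.2]
    _ ≤ ∫ q in Icc (c - ℓ) (c + ℓ) ×ˢ Icc 0 δ, 3 / 2 * (1 / (1 + s * q.2) ^ 2) :=
        setIntegral_mono_set hint (ae_of_all _ fun q => by
          simp only [Pi.zero_apply]; positivity) (LE.le.eventuallyLE hR)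
    _ = (∫ _ in Icc (c - ℓ) (c + ℓ), (3 / 2 : ℝ)) * ∫ t in Icc 0 δ, 1 / (1 + s * t) ^ 2 := by
        rw [← setIntegral_prod_mul (μ := volume) (ν := volume)]; rfl
    _ ≤ (3 * ℓ) * (1 / s) := by
        have : (∫ _ in Icc (c - ℓ) (c + ℓ), (3 / 2 : ℝ)) = 3 * ℓ := by
          simp; rw [max_eq_left (by linarith)]; ring
        rw [this]
        exact mul_le_mul_of_nonneg_left (integral_inv_sq_le hs hδ) (by linarith)
    _ = _ := by ring

/-- Lower bound for integrals over a boundary piece. -/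
lemma le_integral_piece (F : Fit Q g) {c ℓ d v : ℝ} (hℓ : 0 ≤ ℓ) (hd : 0 ≤ d) (hd1 : d ≤ g.t₁)
    (hv : 0 ≤ v) (hinj : InjOn Q.P.Phi (Icc (c - ℓ) (c + ℓ) ×ˢ Ioo 0 d)) {f : Plane → ℝ}
    (hf : Continuous f) (hf0 : ∀ x, 0 ≤ f x)
    (hfv : ∀ q ∈ Icc (c - ℓ) (c + ℓ) ×ˢ Ioo 0 d, v ≤ f (Q.P.Phi q)) :
    ℓ * d * v ≤ ∫ x in Ω, f x := by
  have hRm : MeasurableSet (Icc (c - ℓ) (c + ℓ) ×ˢ Ioo 0 d) := measurableSet_Icc.prod measurableSet_Ioo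
  have hsub : Q.P.Phi '' (Icc (c - ℓ) (c + ℓ) ×ˢ Ioo 0 d) ⊆ Ω := by
    rintro _ ⟨q, hq, rfl⟩
    exact Q.Phi_mem_open ⟨hq.2.1, by linarith [hq.2.2, F.t₁_lt, g.t₁_pos]⟩ q.1
  have hcP : Continuous fun q : ℝ × ℝ => |1 - q.2 * curvOf Q.P.γ q.1| * f (Q.P.Phi q) :=
    ((continuous_const.sub (continuous_snd.mul (Q.P.curv_smooth.continuous.comp continuous_fst))).abs).mul
      (hf.comp Q.P.Phi_smooth.continuous)
  have hint : IntegrableOn (fun q : ℝ × ℝ => |1 - q.2 * curvOf Q.P.γ q.1| * f (Q.P.Phi q))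
      (Icc (c - ℓ) (c + ℓ) ×ˢ Ioo 0 d) :=
    (hcP.continuousOn.integrableOn_compact (isCompact_Icc.prod (isCompact_Icc (a := 0) (b := d)))).mono_set
      (prod_mono le_rfl Ioo_subset_Icc_self)
  calc ℓ * d * v = ∫ _ in Icc (c - ℓ) (c + ℓ) ×ˢ Ioo 0 d, 1 / 2 * v := by
        rw [setIntegral_const, Measure.volume_eq_prod, measureReal_prod_prod]
        simp; rw [max_eq_left (by linarith), max_eq_left hd]; ring
    _ ≤ ∫ q in Icc (c - ℓ) (c + ℓ) ×ˢ Ioo 0 d, |1 - q.2 * curvOf Q.P.γ q.1| * f (Q.P.Phi q) := by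
        refine setIntegral_mono_on (integrableOn_const (by
          rw [Measure.volume_eq_prod, Measure.prod_prod]
          simp [ENNReal.mul_eq_top])) hint hRm fun q hq => ?_
        have := F.jac_bounds (q := q) (by
          rw [abs_of_nonneg hq.2.1.le]; exact hq.2.2.le.trans hd1)
        rw [abs_of_pos (by linarith [this.1])]
        exact mul_le_mul this.1 (hfv q hq) hv (by linarith [this.1])
    _ = ∫ x in Q.P.Phi '' (Icc (c - ℓ) (c + ℓ) ×ˢ Ioo 0 d), f x := (Q.P.integral_Phi hRm hinj f).symm
    _ ≤ ∫ x in Ω, f x := setIntegral_mono_set (intOn_of_cont Q.bdd hf)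
        (ae_of_all _ hf0) (LE.le.eventuallyLE hsub)

end Fit

lemma Geo.wsq_tangential {Ω : Set Plane} (g : Geo Ω) (m : Model) {s t k n1 n2 J v ws wt c : ℝ}
    {A₁ A₂ a : Plane → ℝ} {x : Plane} (hs : s ≠ 0) (hT : g.T x = t) (hk : g.k x = k)
    (e1 : d1 g.T x = -n2) (e2 : d2 g.T x = n1) (hn : n1 ^ 2 + n2 ^ 2 = 1) (hJ : J = 1 - t * k)
    (hJ0 : J ≠ 0) (ha : a x = v) (ha1 : d1 a x = ws * (J⁻¹ * n1) + wt * -n2)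
    (ha2 : d2 a x = ws * (J⁻¹ * n2) + wt * n1)
    (hA1 : A₁ x = (-(t - t ^ 2 * k / 2) - m.ξ / s) * (J⁻¹ * n1))
    (hA2 : A₂ x = (-(t - t ^ 2 * k / 2) - m.ξ / s) * (J⁻¹ * n2))
    (hwt : wt = c + s * m.p (s * t) * v) :
    g.wsq m s A₁ A₂ a (fun _ => 0) x = (J⁻¹ * ws) ^ 2 +
      ((J⁻¹ * k * (-(s * t) ^ 2 / 2 - s * t * m.ξ) -
        m.G (s * t) * (k * (m.r (s * t) / (1 - m.G (s * t) ^ 2)))) * v) ^ 2 +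
      (c - k * (m.r (s * t) / (1 - m.G (s * t) ^ 2)) * v) ^ 2 := by
  have z1 : d1 (fun _ : Plane => (0 : ℝ)) x = 0 := d1_const _ _
  have z2 : d2 (fun _ : Plane => (0 : ℝ)) x = 0 := d2_const _ _
  simp only [Geo.wsq, hT, hk, e1, e2, ha, ha1, ha2, hA1, hA2, z1, z2, hwt]
  generalize m.r (s * t) / (1 - m.G (s * t) ^ 2) = r1
  generalize m.G (s * t) = G
  generalize m.p (s * t) = p
  have i1 : J⁻¹ * J = 1 := inv_mul_cancel₀ hJ0
  generalize J⁻¹ = j at *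
  have X : n1 * (0 - s ^ 2 * ((-(t - t ^ 2 * k / 2) - m.ξ / s) * (j * n1)) * v) -
      -n2 * (0 - s ^ 2 * ((-(t - t ^ 2 * k / 2) - m.ξ / s) * (j * n2)) * v) -
      (s * (s * t + m.ξ) - G * (k * r1)) * v =
      -((j * k * (-(s * t) ^ 2 / 2 - s * t * m.ξ) - G * (k * r1)) * v) := by
    have h1 : s ^ 2 * (m.ξ / s) = s * m.ξ := by field_simp
    have h2 : j * (1 - t * k) = 1 := by rw [← hJ]; exact i1
    linear_combination (s ^ 2 * (t - t ^ 2 * k / 2) * j * v + s * m.ξ * j * v) * hn +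
      (j * v * (n1 ^ 2 + n2 ^ 2)) * h1 + (s ^ 2 * t + s * m.ξ) * v * h2
  rw [X]
  have Y1 : n1 * (ws * (j * n1) + (c + s * p * v) * -n2 +
      s ^ 2 * ((-(t - t ^ 2 * k / 2) - m.ξ / s) * (j * n1)) * 0) -
      -n2 * (ws * (j * n2) + (c + s * p * v) * n1 +
      s ^ 2 * ((-(t - t ^ 2 * k / 2) - m.ξ / s) * (j * n2)) * 0) +
      (s * (s * t + m.ξ) - G * (k * r1)) * 0 = j * ws := by
    linear_combination (ws * j) * hn
  have Y2 : -n2 * (ws * (j * n1) + (c + s * p * v) * -n2 +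
      s ^ 2 * ((-(t - t ^ 2 * k / 2) - m.ξ / s) * (j * n1)) * 0) +
      n1 * (ws * (j * n2) + (c + s * p * v) * n1 +
      s ^ 2 * ((-(t - t ^ 2 * k / 2) - m.ξ / s) * (j * n2)) * 0) -
      (s * p + k * r1) * v = c - k * r1 * v := by
    linear_combination (c + s * p * v) * hn
  rw [Y1, Y2]
  ring

lemma exists_pos_lower {f : ℝ → ℝ} (hf : Continuous f) (hp : ∀ x, 0 < f x) :
    ∃ v > 0, ∀ y ∈ Icc (0 : ℝ) 1, v ≤ f y := by
  obtain ⟨y, -, hy⟩ := (isCompact_Icc (a := (0 : ℝ)) (b := 1)).exists_isMinOn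
    (nonempty_Icc.2 zero_le_one) hf.continuousOn
  exact ⟨f y, hp y, fun z hz => hy hz⟩

/-- A trial state with boundary concentration near a point of maximal curvature. -/
theorem Fit.exists_trial {Ω : Set Plane} {Q : Tube Ω} {g : Geo Ω} (F : Fit Q g) (m : Model) :
    ∃ C > 0, ∃ S : ℝ, 1 ≤ S ∧ ∀ s ≥ S, ∃ a A₁ A₂ : Plane → ℝ, ContDiff ℝ 1 a ∧ HasCompactSupport a ∧
      ContDiff ℝ 1 A₁ ∧ ContDiff ℝ 1 A₂ ∧ (∀ x, curlf A₁ A₂ x = 1) ∧ 0 < (∫ x in Ω, a x ^ 2) ∧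
      (∫ x in Ω, dsq (s ^ 2) A₁ A₂ a (fun _ => 0) x) ≤
        (m.Θ * s ^ 2 - m.C₁ * s * g.km + C * √s) * ∫ x in Ω, a x ^ 2 := by
  obtain ⟨s₀, hs₀, hmax⟩ := Q.P.exists_curv_max
  obtain ⟨e, δ, hδ, hδ1, he, hJ, hbox, hgeo⟩ := F.exists_box s₀
  obtain ⟨K, hK0, hK⟩ := periodic_bound Q.P.curv_periodic Q.P.L_pos Q.P.curv_smooth.continuous
  obtain ⟨K₁, hK₁0, hK₁⟩ := bmp_deriv_bound
  obtain ⟨K₃, hK₃0, hK₃⟩ := Q.P.curv_quadratic hs₀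
  obtain ⟨v, hv0, hv⟩ := exists_pos_lower (m.u_smooth.continuous.pow 2) fun x => pow_pos (m.u_pos x) 2
  obtain ⟨C, hC0, hC⟩ := g.strip_energy m
  have ht1 := g.t₁_pos
  have hC1 := m.C₁_pos
  have hM := m.M_pos
  set D : ℝ := (4 * K₁ ^ 2 + (2 * K + K * m.M ^ 2) ^ 2 + (δ⁻¹ * K₁ + K * m.M ^ 2) ^ 2) * m.M ^ 2 with hD
  have hD0 : 0 < D := by positivity
  clear_value D
  refine ⟨m.C₁ * K₃ + C + 2 * (D * 6 / v), by positivity, max 1 (max (2 / δ) (δ⁻¹ ^ 4)),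
    le_max_left _ _, fun s hs => ?_⟩
  have hs1 : 1 ≤ s := (le_max_left _ _).trans hs
  have hs2 : 2 / δ ≤ s := ((le_max_left _ _).trans (le_max_right _ _)).trans hs
  have hs3 : δ⁻¹ ^ 4 ≤ s := ((le_max_right _ _).trans (le_max_right _ _)).trans hs
  have hs0 : 0 < s := by linarith
  have hsd : 1 / s ≤ δ / 2 := by
    rw [div_le_div_iff₀ hs0 two_pos]; rw [div_le_iff₀ hδ] at hs2; linarith
  set l : ℝ := √(√s) with hl
  have hl2 : l ^ 2 = √s := Real.sq_sqrt (Real.sqrt_nonneg _)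
  have hs4 : √s ^ 2 = s := Real.sq_sqrt hs0.le
  have hrs1 : 1 ≤ √s := Real.one_le_sqrt.2 hs1
  have hl1 : 1 ≤ l := Real.one_le_sqrt.2 hrs1
  have hl0 : 0 < l := by linarith
  have hlδ : l⁻¹ ≤ δ := by
    rw [inv_le_comm₀ hl0 hδ]
    refine le_of_pow_le_pow_left₀ (n := 4) (by norm_num) hl0.le ?_
    calc δ⁻¹ ^ 4 ≤ s := hs3
      _ = l ^ 4 := by rw [show l ^ 4 = (l ^ 2) ^ 2 by ring, hl2, hs4]
  clear_value l
  have hKl : IsCompact (Icc (s₀ - l⁻¹) (s₀ + l⁻¹) ×ˢ Icc (-δ) δ) := isCompact_Icc.prod isCompact_Icc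
  have hKB : Icc (s₀ - l⁻¹) (s₀ + l⁻¹) ×ˢ Icc (-δ) δ ⊆ Icc (s₀ - δ) (s₀ + δ) ×ˢ Icc (-δ) δ :=
    prod_mono (Icc_subset_Icc (by linarith) (by linarith)) le_rfl
  set Kl := Icc (s₀ - l⁻¹) (s₀ + l⁻¹) ×ˢ Icc (-δ) δ with hKldef
  obtain ⟨a, ha, hac, hat, ha0⟩ := exists_pushforward (n := 1) (e := e)
    (fun x hx => contDiffAt_infty.1 (Q.P.symm_smooth he hJ hx) 1) (m.trial_smooth s l δ s₀) hKl
    (hKB.trans hbox) fun q hq => m.trial_zero hl0 hδ hq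
  obtain ⟨A₁, A₂, hA₁, hA₂, hcurl, hA⟩ := Q.P.exists_gauge he hJ (isCompact_Icc.prod isCompact_Icc) hbox
    (m.ξ / s)
  have hmem : ∀ q ∈ e.source, Q.P.Phi q ∈ e.target ∧ e.symm (Q.P.Phi q) = q := fun q hq => by
    rw [← he]; exact ⟨e.map_source hq, e.left_inv hq⟩
  have hinj : InjOn Q.P.Phi e.source := fun q hq q' hq' h => by
    rw [← (hmem q hq).2, h, (hmem q' hq').2]
  have hnot : ∀ x, x ∉ Q.P.Phi '' Kl → x ∉ e '' Kl := fun x hx ⟨q, hq, h⟩ => hx ⟨q, hq, by rw [← he, h]⟩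
  have hcl : IsClosed (e '' Kl) :=
    (hKl.image_of_continuousOn (e.continuousOn.mono (hKB.trans hbox))).isClosed
  refine ⟨a, A₁, A₂, ha, hac, hA₁, hA₂, hcurl, ?_⟩
  have haΦ : ∀ q ∈ e.source, a (Q.P.Phi q) = m.trial s l δ s₀ q := fun q hq => by
    rw [hat _ (hmem q hq).1, (hmem q hq).2]
  -- lower bound for the mass
  have hlow : l⁻¹ / 2 * (1 / s) * v ≤ ∫ x in Ω, a x ^ 2 := by
    have hsub : Icc (s₀ - l⁻¹ / 2) (s₀ + l⁻¹ / 2) ×ˢ Ioo 0 (1 / s) ⊆ Kl := by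
      have : 0 < l⁻¹ := inv_pos.2 hl0
      exact prod_mono (Icc_subset_Icc (by linarith) (by linarith))
        (Ioo_subset_Icc_self.trans (Icc_subset_Icc (by linarith) (by linarith)))
    refine F.le_integral_piece (c := s₀) (by positivity) (by positivity) (by linarith) hv0.le
      (hinj.mono (hsub.trans (hKB.trans hbox))) (f := fun x => a x ^ 2) (ha.continuous.pow 2)
      (fun x => sq_nonneg _) fun q hq => ?_
    rw [haΦ q (hbox (hKB (hsub hq))), m.trial_core hδ hl0]
    · refine hv _ ⟨mul_nonneg hs0.le hq.2.1.le, ?_⟩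
      have := mul_le_mul_of_nonneg_left hq.2.2.le hs0.le
      rwa [mul_one_div_cancel hs0.ne'] at this
    · rw [abs_le]; constructor <;> linarith [hq.1.1, hq.1.2]
    · rw [abs_of_nonneg hq.2.1.le]; linarith [hq.2.2]
  have hpos : 0 < l⁻¹ / 2 * (1 / s) * v := by positivity
  refine ⟨hpos.trans_le hlow, ?_⟩
  -- the defect
  set R : Set (ℝ × ℝ) := Kl ∩ Q.P.Phi ⁻¹' Ω with hR
  have hRm : MeasurableSet R := hKl.measurableSet.inter (Q.P.Phi_smooth.continuous.measurable
    Q.isOpen.measurableSet)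
  have hRi : Q.P.Phi '' R = e '' Kl ∩ Ω := by
    rw [hR, image_inter_preimage]; congr 1; exact image_congr fun q _ => (he q).symm
  have hRim : MeasurableSet (Q.P.Phi '' R) := by
    rw [hRi]; exact hcl.measurableSet.inter Q.isOpen.measurableSet
  have hTΩ : ∀ x ∈ closure Ω, 0 ≤ g.T x := fun x hx =>
    closure_minimal (fun y hy => (g.wall.pos y hy).le : Ω ⊆ {y | 0 ≤ g.T y})
      (isClosed_le continuous_const g.wall.smooth.continuous) hx
  set W : Plane → ℝ := (Q.P.Phi '' R).indicator fun x => D * l ^ 2 * (1 / (1 + s * g.T x) ^ 2) with hW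
  have hWint0 : IntegrableOn (fun x => D * l ^ 2 * (1 / (1 + s * g.T x) ^ 2)) Ω := by
    refine IntegrableOn.mono_set (t := closure Ω) ?_ subset_closure
    refine ContinuousOn.integrableOn_compact Q.bdd.isCompact_closure ?_
    refine continuousOn_const.mul (ContinuousOn.div continuousOn_const
      (by have := g.wall.smooth.continuous; fun_prop) fun x hx => ?_)
    have := mul_nonneg hs0.le (hTΩ x hx)
    positivity
  have hWint : IntegrableOn W Ω := hWint0.indicator hRim
  have hWnn : ∀ x ∈ Ω, 0 ≤ W x := fun x _ => indicator_nonneg (fun y _ => by positivity) x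
  have hWle : ∫ x in Ω, W x ≤ D * l ^ 2 * (3 * l⁻¹ / s) := by
    rw [hW, setIntegral_indicator hRim, inter_eq_right.2 (by rw [hRi]; exact inter_subset_right),
      integral_const_mul]
    refine mul_le_mul_of_nonneg_left ?_ (by positivity)
    refine F.integral_profile_le (c := s₀) (ℓ := l⁻¹) (δ := δ) hs0 (by positivity) hδ.le (by linarith) ?_ hRm
      (hinj.mono (inter_subset_left.trans (hKB.trans hbox))) fun q hq => (hgeo q (hKB hq.1) hq.2).2.1
    intro q hq
    exact ⟨hq.1.1, (hgeo q (hKB hq.1) hq.2).1, hq.1.2.2⟩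
  have hpt : ∀ x ∈ Ω, g.T x < g.t₁ → g.wsq m s A₁ A₂ a (fun _ => 0) x ≤ W x := by
    intro x hx _
    by_cases hxR : x ∈ Q.P.Phi '' R
    · rw [hW, indicator_of_mem hxR]
      obtain ⟨q, ⟨hq, -⟩, rfl⟩ := hxR
      have hqs := hbox (hKB hq)
      obtain ⟨g0, gT, gk, gd1, gd2⟩ := hgeo q (hKB hq) hx
      obtain ⟨hxt, hes⟩ := hmem q hqs
      obtain ⟨s1, s2, s3, s4⟩ := Q.P.symm_d he hJ hxt
      obtain ⟨c1, c2⟩ := comp_symm_d (e := e) (w := m.trial s l δ s₀) (x := Q.P.Phi q)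
        ((m.trial_smooth s l δ s₀).differentiable one_ne_zero _)
        ((Q.P.symm_smooth he hJ hxt).differentiableAt (by simp))
      rw [s1, s3, hes] at c1
      rw [s2, s4, hes] at c2
      have hev : a =ᶠ[𝓝 (Q.P.Phi q)] fun y => m.trial s l δ s₀ (e.symm y) := by
        filter_upwards [e.open_target.mem_nhds hxt] with y hy using hat y hy
      obtain ⟨A1, A2⟩ := hA q (hKB hq)
      obtain ⟨w1, w2⟩ := m.trial_d s l δ s₀ q
      rw [g.wsq_tangential m hs0.ne' gT gk gd1 gd2 (Q.P.unit q.1) rfl (hJ q hqs) (haΦ q hqs)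
        ((d1_congr hev).trans c1) ((d2_congr hev).trans c2) A1 A2 w2, w1, gT]
      have hy : 0 ≤ s * q.2 := mul_nonneg hs0.le g0
      have jb := (F.jac_bounds (q := q) (by rw [abs_of_nonneg g0]; linarith [hq.2.2])).1
      have hG0 := m.G_pos _ hy
      have hG1 := m.one_sub_G_pos _ hy
      have hξ : |m.ξ| ≤ 1 := by
        rw [← sq_le_one_iff_abs_le_one, m.ξ_sq]; exact m.Θ_lt.le
      have hb := trial_bound (k := curvOf Q.P.γ q.1) (j := (1 - q.2 * curvOf Q.P.γ q.1)⁻¹)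
        (G := m.G (s * q.2)) (u := m.u (s * q.2)) (c := bmp (δ⁻¹ * q.2)) (c' := δ⁻¹ * deriv bmp (δ⁻¹ * q.2))
        (h := bmp (l * (q.1 - s₀))) (h' := deriv bmp (l * (q.1 - s₀))) (l := l) (K₂ := δ⁻¹ * K₁) hy (hK q.1)
        (by rw [abs_inv, abs_of_pos (by linarith)]; exact inv_le_of_inv_le₀ (by norm_num) (by linarith))
        (by rw [abs_of_nonneg hG0]; linarith) (m.r_div_bound hy) hξ (m.u_pos _).le (bmp_abs _) (bmp_abs _)
        (by rw [abs_mul, abs_of_pos (inv_pos.2 hδ)]; exact mul_le_mul_of_nonneg_left (hK₁ _) (by positivity))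
        (hK₁ _) hl1
      refine hb.trans ?_
      rw [hD]
      have := m.u_sq_bound hy
      calc _ ≤ (4 * K₁ ^ 2 + (2 * K + K * m.M ^ 2) ^ 2 + (δ⁻¹ * K₁ + K * m.M ^ 2) ^ 2) *
            (l ^ 2 * (m.M ^ 2 / (1 + s * q.2) ^ 2)) := by gcongr
        _ = _ := by ring
    · rw [hW, indicator_of_notMem hxR]
      have hx' : x ∉ e '' Kl := fun h => hxR (by rw [hRi]; exact ⟨h, hx⟩)
      have hev : a =ᶠ[𝓝 x] fun _ => 0 := by
        filter_upwards [hcl.isOpen_compl.mem_nhds hx'] with y hy using ha0 y hy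
      have z1 : d1 (fun _ : Plane => (0 : ℝ)) x = 0 := d1_const _ _
      have z2 : d2 (fun _ : Plane => (0 : ℝ)) x = 0 := d2_const _ _
      simp [Geo.wsq, d1_congr hev, d2_congr hev, hev.self_of_nhds, z1, z2]
  have hstrip := (hC s hs0 a (fun _ => 0) A₁ A₂ ha contDiff_const hac HasCompactSupport.zero hA₁ hA₂
    (fun x hx hT => ⟨by
      by_contra h
      have : x ∈ e '' Kl := by by_contra h'; exact h (ha0 x h')
      obtain ⟨q, hq, rfl⟩ := this
      rw [he] at hx hT
      have := (hgeo q (hKB hq) hx).2.1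
      linarith [hq.2.2], rfl⟩)).2 W hWint hWnn hpt
  have hpot : ∫ x in Ω, (g.pot m s (curlf A₁ A₂) x + C) * (a x ^ 2 + (0 : ℝ) ^ 2) ≤
      (m.Θ * s ^ 2 - m.C₁ * s * g.km + (m.C₁ * K₃ + C) * √s) * ∫ x in Ω, a x ^ 2 := by
    rw [← integral_const_mul]
    refine setIntegral_mono_on (intOn_of_cont Q.bdd ?_) (intOn_of_cont Q.bdd ?_) Q.isOpen.measurableSet ?_
    · exact ((g.pot_cont m (curlf_cont hA₁ hA₂)).add continuous_const).mul
        ((ha.continuous.pow 2).add continuous_const)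
    · exact continuous_const.mul (ha.continuous.pow 2)
    intro x hx
    by_cases hx' : x ∈ e '' Kl
    · obtain ⟨q, hq, rfl⟩ := hx'
      rw [he] at hx ⊢
      obtain ⟨g0, gT, gk, -, -⟩ := hgeo q (hKB hq) hx
      have h1 := hK₃ q.1
      have h2 : |q.1 - s₀| ≤ l⁻¹ := by
        rw [abs_le]; constructor <;> linarith [hq.1.1, hq.1.2]
      have h3 := sq_le_of_abs_le h2
      have h4 : s * l⁻¹ ^ 2 = √s := by
        rw [inv_pow, hl2]; nth_rw 1 [← hs4]; field_simp
      have h5 : m.C₁ * s * (g.km - curvOf Q.P.γ q.1) ≤ m.C₁ * K₃ * √s := by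
        calc _ ≤ m.C₁ * s * (K₃ * l⁻¹ ^ 2) := by
              rw [F.km]; gcongr; exact h1.trans (by gcongr)
          _ = m.C₁ * K₃ * (s * l⁻¹ ^ 2) := by ring
          _ = _ := by rw [h4]
      have h6 : C ≤ C * √s := le_mul_of_one_le_right hC0.le hrs1
      rw [Geo.pot, hcurl, gk, sub_self, mul_zero, add_zero, zero_pow two_ne_zero, add_zero]
      refine mul_le_mul_of_nonneg_right ?_ (sq_nonneg _)
      linarith
    · rw [ha0 x hx']; simp
  have hfin : 2 * (D * l ^ 2 * (3 * l⁻¹ / s)) ≤ 2 * (D * 6 / v) * √s * ∫ x in Ω, a x ^ 2 := by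
    calc 2 * (D * l ^ 2 * (3 * l⁻¹ / s)) = 2 * (D * 6 / v) * √s * (l⁻¹ / 2 * (1 / s) * v) := by
          rw [hl2]; field_simp; norm_num
      _ ≤ _ := by gcongr
  calc _ ≤ _ := hstrip
    _ ≤ _ := add_le_add hpot ((mul_le_mul_of_nonneg_left hWle zero_le_two).trans hfin)
    _ = _ := by ring

/-- The density of the Ginzburg–Landau energy in real coordinates. -/
def enDens (κ H : ℝ) (A₁ A₂ a b : Plane → ℝ) (x : Plane) : ℝ :=
  dsq (κ * H) A₁ A₂ a b x - κ ^ 2 * (a x ^ 2 + b x ^ 2) + κ ^ 2 / 2 * (a x ^ 2 + b x ^ 2) ^ 2 +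
    κ ^ 2 * H ^ 2 * (curlf A₁ A₂ x - 1) ^ 2

/-- The Ginzburg–Landau energy in real coordinates. -/
def En (Ω : Set Plane) (κ H : ℝ) (A₁ A₂ a b : Plane → ℝ) : ℝ := ∫ x in Ω, enDens κ H A₁ A₂ a b x

lemma magSq_eq_dsq {ψ : Plane → ℂ} {A : Plane → Plane} {a b A₁ A₂ : Plane → ℝ} {x : Plane}
    (hψ : DifferentiableAt ℝ ψ x) (ha : a =ᶠ[𝓝 x] fun y => (ψ y).re) (hb : b =ᶠ[𝓝 x] fun y => (ψ y).im)
    (h1 : A₁ x = (A x).1) (h2 : A₂ x = (A x).2) (B : ℝ) : magSq B A ψ x = dsq B A₁ A₂ a b x := by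
  have hr := Complex.reCLM.hasFDerivAt.comp x hψ.hasFDerivAt
  have hi := Complex.imCLM.hasFDerivAt.comp x hψ.hasFDerivAt
  have ea : fderiv ℝ a x = Complex.reCLM.comp (fderiv ℝ ψ x) := by
    rw [ha.fderiv_eq]; exact hr.fderiv
  have eb : fderiv ℝ b x = Complex.imCLM.comp (fderiv ℝ ψ x) := by
    rw [hb.fderiv_eq]; exact hi.fderiv
  have e0 := ha.self_of_nhds
  have e1 := hb.self_of_nhds
  simp only [magSq, dsq, d1, d2, ea, eb, e0, e1, h1, h2, ← Complex.normSq_eq_norm_sq, Complex.normSq_apply]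
  simp
  ring

lemma norm_sq_eq {z : ℂ} : ‖z‖ ^ 2 = z.re ^ 2 + z.im ^ 2 := by
  rw [← Complex.normSq_eq_norm_sq, Complex.normSq_apply]; ring

lemma dens_eq {κ H : ℝ} {ψ : Plane → ℂ} {A : Plane → Plane} {a b A₁ A₂ : Plane → ℝ} {x : Plane}
    (hψ : DifferentiableAt ℝ ψ x) (ha : a =ᶠ[𝓝 x] fun y => (ψ y).re) (hb : b =ᶠ[𝓝 x] fun y => (ψ y).im)
    (h1 : A₁ =ᶠ[𝓝 x] fun y => (A y).1) (h2 : A₂ =ᶠ[𝓝 x] fun y => (A y).2) :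
    magSq (κ * H) A ψ x - κ ^ 2 * ‖ψ x‖ ^ 2 + κ ^ 2 / 2 * ‖ψ x‖ ^ 4 + κ ^ 2 * H ^ 2 * (curl2 A x - 1) ^ 2 =
      enDens κ H A₁ A₂ a b x := by
  rw [magSq_eq_dsq hψ ha hb h1.self_of_nhds h2.self_of_nhds, enDens,
    show ‖ψ x‖ ^ 4 = (‖ψ x‖ ^ 2) ^ 2 by ring, norm_sq_eq, curl2, curlf, d1, d2, h1.fderiv_eq,
    h2.fderiv_eq, ha.self_of_nhds, hb.self_of_nhds]

/-- Every admissible configuration has globally defined real components. -/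
lemma exists_components {Ω : Set Plane} (ho : IsOpen Ω) (hb : Bornology.IsBounded Ω) {ψ : Plane → ℂ}
    {A : Plane → Plane} (h : GLadm Ω ψ A) : ∃ a b A₁ A₂ : Plane → ℝ, ContDiff ℝ 1 a ∧ ContDiff ℝ 1 b ∧
      HasCompactSupport a ∧ HasCompactSupport b ∧ ContDiff ℝ 1 A₁ ∧ ContDiff ℝ 1 A₂ ∧
      (∀ x ∈ Ω, ‖ψ x‖ ^ 2 = a x ^ 2 + b x ^ 2) ∧ ∀ κ H, GLenergy Ω κ H ψ A = En Ω κ H A₁ A₂ a b := by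
  obtain ⟨v, hv, hvc, hve⟩ := exists_extension hb h.1
  obtain ⟨V, hV, -, hVe⟩ := exists_extension hb h.2
  have hv1 : ContDiff ℝ 1 v := hv
  have hV1 : ContDiff ℝ 1 V := hV
  refine ⟨fun x => (v x).re, fun x => (v x).im, fun x => (V x).1, fun x => (V x).2,
    Complex.reCLM.contDiff.comp hv1, Complex.imCLM.contDiff.comp hv1,
    hvc.comp_left (g := Complex.re) rfl, hvc.comp_left (g := Complex.im) rfl, hV1.fst, hV1.snd, ?_, ?_⟩
  · intro x hx
    have := (hve x (subset_closure hx)).self_of_nhds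
    simp only [this, norm_sq_eq]
  · intro κ H
    refine setIntegral_congr_fun ho.measurableSet fun x hx => ?_
    have e1 := hve x (subset_closure hx)
    have e2 := hVe x (subset_closure hx)
    refine dens_eq ((hv1.differentiable one_ne_zero x).congr_of_eventuallyEq e1.symm) ?_ ?_ ?_ ?_
    · filter_upwards [e1] with y hy; rw [hy]
    · filter_upwards [e1] with y hy; rw [hy]
    · filter_upwards [e2] with y hy; rw [hy]
    · filter_upwards [e2] with y hy; rw [hy]

lemma exists_config {Ω : Set Plane} {a b A₁ A₂ : Plane → ℝ} (ha : ContDiff ℝ 1 a) (hb : ContDiff ℝ 1 b)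
    (h1 : ContDiff ℝ 1 A₁) (h2 : ContDiff ℝ 1 A₂) : ∃ ψ A, GLadm Ω ψ A ∧
      ∀ κ H, GLenergy Ω κ H ψ A = En Ω κ H A₁ A₂ a b := by
  have hψ : ContDiff ℝ 1 fun x => Complex.equivRealProdCLM.symm (a x, b x) :=
    Complex.equivRealProdCLM.symm.contDiff.comp (ha.prodMk hb)
  refine ⟨fun x => Complex.equivRealProdCLM.symm (a x, b x), fun x => (A₁ x, A₂ x),
    ⟨⟨univ, isOpen_univ, subset_univ _, hψ.contDiffOn⟩,
      ⟨univ, isOpen_univ, subset_univ _, (h1.prodMk h2).contDiffOn⟩⟩, fun κ H => ?_⟩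
  refine integral_congr_ae (ae_of_all _ fun x => ?_)
  exact dens_eq (hψ.differentiable one_ne_zero x) (Eventually.of_forall fun y => by simp)
    (Eventually.of_forall fun y => by simp) (Eventually.of_forall fun y => rfl)
    (Eventually.of_forall fun y => rfl)

lemma NormalMin.En_nonneg {Ω : Set Plane} {κ H : ℝ} (h : NormalMin Ω κ H) {a b A₁ A₂ : Plane → ℝ}
    (ha : ContDiff ℝ 1 a) (hb : ContDiff ℝ 1 b) (h1 : ContDiff ℝ 1 A₁) (h2 : ContDiff ℝ 1 A₂) :
    0 ≤ En Ω κ H A₁ A₂ a b := by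
  obtain ⟨ψ, A, hA, he⟩ := exists_config (Ω := Ω) ha hb h1 h2
  rw [← he]; exact h ψ A hA

/-- A minimizer of the Ginzburg–Landau energy in real coordinates. -/
structure RMin (Ω : Set Plane) (κ H : ℝ) (A₁ A₂ a b : Plane → ℝ) : Prop where
  a_smooth : ContDiff ℝ 1 a
  b_smooth : ContDiff ℝ 1 b
  a_supp : HasCompactSupport a
  b_supp : HasCompactSupport b
  A₁_smooth : ContDiff ℝ 1 A₁
  A₂_smooth : ContDiff ℝ 1 A₂
  min : ∀ a' b' A₁' A₂' : Plane → ℝ, ContDiff ℝ 1 a' → ContDiff ℝ 1 b' → ContDiff ℝ 1 A₁' →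
    ContDiff ℝ 1 A₂' → En Ω κ H A₁ A₂ a b ≤ En Ω κ H A₁' A₂' a' b'

lemma IsGLMin.exists_RMin {Ω : Set Plane} (ho : IsOpen Ω) (hb : Bornology.IsBounded Ω) {κ H : ℝ}
    {ψ : Plane → ℂ} {A : Plane → Plane} (h : IsGLMin Ω κ H ψ A) : ∃ A₁ A₂ a b : Plane → ℝ,
      RMin Ω κ H A₁ A₂ a b ∧ ∀ x ∈ Ω, ‖ψ x‖ ^ 2 = a x ^ 2 + b x ^ 2 := by
  obtain ⟨a, b, A₁, A₂, ha, hb, hac, hbc, h1, h2, hn, he⟩ := exists_components ho hb h.1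
  refine ⟨A₁, A₂, a, b, ⟨ha, hb, hac, hbc, h1, h2, fun a' b' A₁' A₂' ha' hb' h1' h2' => ?_⟩, hn⟩
  obtain ⟨ψ', A', hA, he'⟩ := exists_config (Ω := Ω) ha' hb' h1' h2'
  rw [← he, ← he']; exact h.2 _ _ hA

lemma enDens_cont {κ H : ℝ} {A₁ A₂ a b : Plane → ℝ} (ha : ContDiff ℝ 1 a) (hb : ContDiff ℝ 1 b)
    (h1 : ContDiff ℝ 1 A₁) (h2 : ContDiff ℝ 1 A₂) : Continuous (enDens κ H A₁ A₂ a b) := by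
  have := dsq_cont (B := κ * H) h1 h2 ha hb
  have := curlf_cont h1 h2
  have := ha.continuous
  have := hb.continuous
  unfold enDens; fun_prop

/-- A pointwise lower bound for the global potential. -/
lemma Geo.glob_ge {Ω : Set Plane} (g : Geo Ω) (m : Model) : ∃ K > 0, ∀ s > 0, ∀ c : Plane → ℝ,
    ∀ x ∈ Ω, m.Θ * s ^ 2 - K * s - s ^ 2 * |c x - 1| ≤ g.glob m s c x := by
  obtain ⟨K, hK0, hK⟩ := bound_of_cont g.wall.bdd g.k_smooth.continuous
  have hC1 := m.C₁_pos
  refine ⟨m.C₁ * K, by positivity, fun s hs c x hx => ?_⟩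
  have hG := g.Gt_mem m hs hx
  have hth := g.th_sq x
  have h1 : m.C₁ * s * g.k x ≤ m.C₁ * K * s := by
    have := (le_abs_self _).trans (hK x (subset_closure hx))
    calc _ = m.C₁ * s * g.k x := rfl
      _ ≤ m.C₁ * s * K := by gcongr
      _ = _ := by ring
  have h2 : -|c x - 1| ≤ g.Gt m s x * (c x - 1) := by
    have h3 : |g.Gt m s x * (c x - 1)| ≤ 1 * |c x - 1| := by
      rw [abs_mul, abs_of_nonneg hG.1]; exact mul_le_mul_of_nonneg_right hG.2 (abs_nonneg _)
    linarith [neg_abs_le (g.Gt m s x * (c x - 1))]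
  have h3 := mul_le_mul_of_nonneg_left h2 (sq_nonneg s)
  have h4 : m.Θ * s ^ 2 - m.C₁ * K * s ≤
      g.th1 x ^ 2 * (m.Θ * s ^ 2 - m.C₁ * s * g.k x) + g.th2 x ^ 2 * s ^ 2 := by
    have a1 : m.Θ * s ^ 2 - m.C₁ * K * s ≤ m.Θ * s ^ 2 - m.C₁ * s * g.k x := by linarith
    have a2 : m.Θ * s ^ 2 - m.C₁ * K * s ≤ s ^ 2 := by
      have := mul_le_mul_of_nonneg_right m.Θ_lt.le (sq_nonneg s)
      have : 0 ≤ m.C₁ * K * s := by positivity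
      linarith
    calc _ = g.th1 x ^ 2 * (m.Θ * s ^ 2 - m.C₁ * K * s) + g.th2 x ^ 2 * (m.Θ * s ^ 2 - m.C₁ * K * s) := by
          rw [← add_mul, hth, one_mul]
      _ ≤ _ := add_le_add (mul_le_mul_of_nonneg_left a1 (sq_nonneg _))
          (mul_le_mul_of_nonneg_left a2 (sq_nonneg _))
  rw [Geo.glob]
  linarith

lemma Geo.glob_cont {Ω : Set Plane} (g : Geo Ω) (m : Model) {s : ℝ} {c : Plane → ℝ} (hc : Continuous c) :
    Continuous (g.glob m s c) := by
  have := g.Gt_cont m s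
  have := g.th1_smooth.continuous
  have := g.th2_smooth.continuous
  have := g.k_smooth.continuous
  unfold Geo.glob; fun_prop

/-- For strong fields the normal state is a minimizer. -/
lemma Geo.normalMin_large {Ω : Set Plane} (g : Geo Ω) (m : Model) :
    ∃ κ₀ > 0, ∀ κ ≥ κ₀, NormalMin Ω κ (2 * κ / m.Θ) := by
  obtain ⟨C, hC0, hC⟩ := g.global_lower m
  obtain ⟨K, hK0, hK⟩ := g.glob_ge m
  have hΘ := m.Θ_pos
  set r : ℝ := √(2 / m.Θ) with hr
  have hr0 : 0 < r := by positivity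
  have hr2 : r ^ 2 = 2 / m.Θ := Real.sq_sqrt (by positivity)
  clear_value r
  refine ⟨K * r + C + 1, by positivity, fun κ hκ ψ A hA => ?_⟩
  obtain ⟨a, b, A₁, A₂, ha, hb, hac, hbc, h1, h2, -, he⟩ := exists_components g.wall.isOpen g.wall.bdd hA
  have hκ1 : 1 ≤ κ := by have : 0 < K * r := by positivity
                         linarith
  rw [he]
  have hB : κ * (2 * κ / m.Θ) = (r * κ) ^ 2 := by rw [mul_pow, hr2]; ring
  have hs : 0 < r * κ := by positivity
  have hg := hC (r * κ) hs a b A₁ A₂ ha hb hac hbc h1 h2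
  have ca := ha.continuous
  have cb := hb.continuous
  have cc := curlf_cont h1 h2
  have cd := dsq_cont (B := (r * κ) ^ 2) h1 h2 ha hb
  have cg := g.glob_cont m (s := r * κ) cc
  have i0 := intOn_of_cont g.wall.bdd (enDens_cont (κ := κ) (H := 2 * κ / m.Θ) ha hb h1 h2)
  have i1 := intOn_of_cont g.wall.bdd cd
  have i2 : IntegrableOn (fun x => (g.glob m (r * κ) (curlf A₁ A₂) x - C) * (a x ^ 2 + b x ^ 2)) Ω :=
    intOn_of_cont g.wall.bdd ((cg.sub continuous_const).mul ((ca.pow 2).add (cb.pow 2)))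
  have hnn : 0 ≤ ∫ x in Ω, (enDens κ (2 * κ / m.Θ) A₁ A₂ a b x - dsq ((r * κ) ^ 2) A₁ A₂ a b x +
      (g.glob m (r * κ) (curlf A₁ A₂) x - C) * (a x ^ 2 + b x ^ 2)) := by
    refine setIntegral_nonneg g.wall.isOpen.measurableSet fun x hx => ?_
    have h3 := hK (r * κ) hs (curlf A₁ A₂) x hx
    rw [enDens, ← mul_pow, hB]
    have h4 : 0 ≤ a x ^ 2 + b x ^ 2 := by positivity
    generalize a x ^ 2 + b x ^ 2 = p at *
    have hβ := sq_abs (curlf A₁ A₂ x - 1)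
    generalize |curlf A₁ A₂ x - 1| = β at *
    rw [← hβ]
    have h5 : m.Θ * (r * κ) ^ 2 = 2 * κ ^ 2 := by rw [mul_pow, hr2]; field_simp
    have h6 := mul_le_mul_of_nonneg_right h3 h4
    rw [h5] at h6
    have h7 : (r * κ) ^ 2 * β * p ≤ ((r * κ) ^ 2) ^ 2 * β ^ 2 + p ^ 2 / 4 := by
      have := sq_nonneg ((r * κ) ^ 2 * β - p / 2)
      nlinarith
    have h8 : p ^ 2 / 4 ≤ κ ^ 2 / 2 * p ^ 2 := by
      have : 1 ≤ κ ^ 2 := one_le_pow₀ hκ1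
      have := mul_le_mul_of_nonneg_right this (sq_nonneg p)
      nlinarith [sq_nonneg p]
    have h9 : 0 ≤ (κ ^ 2 - K * (r * κ) - C) * p := by
      refine mul_nonneg ?_ h4
      have := mul_le_mul_of_nonneg_right hκ (by linarith : 0 ≤ κ)
      nlinarith
    generalize (r * κ) ^ 2 = B at *
    nlinarith
  have e := integral_add (i0.sub i1) i2
  simp only [Pi.sub_apply] at e
  rw [e, integral_sub i0 i1] at hnn
  show 0 ≤ En Ω κ (2 * κ / m.Θ) A₁ A₂ a b
  unfold En
  linarith

/-- Linear consequence of stability of the normal state. -/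
lemma NormalMin.linear {Ω : Set Plane} (hbd : Bornology.IsBounded Ω) {κ H : ℝ} (h : NormalMin Ω κ H)
    {a A₁ A₂ : Plane → ℝ} (ha : ContDiff ℝ 1 a)
    (h1 : ContDiff ℝ 1 A₁) (h2 : ContDiff ℝ 1 A₂) (hc : ∀ x, curlf A₁ A₂ x = 1) :
    κ ^ 2 * ∫ x in Ω, a x ^ 2 ≤ ∫ x in Ω, dsq (κ * H) A₁ A₂ a (fun _ => 0) x := by
  have ca := ha.continuous
  have cd := dsq_cont (B := κ * H) h1 h2 ha (b := fun _ => 0) contDiff_const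
  have i1 := intOn_of_cont hbd cd
  have i2 : IntegrableOn (fun x => a x ^ 2) Ω := intOn_of_cont hbd (ca.pow 2)
  have i3 : IntegrableOn (fun x => a x ^ 4) Ω := intOn_of_cont hbd (ca.pow 4)
  set X := (∫ x in Ω, dsq (κ * H) A₁ A₂ a (fun _ => 0) x) - κ ^ 2 * ∫ x in Ω, a x ^ 2 with hX
  set Y := κ ^ 2 / 2 * ∫ x in Ω, a x ^ 4 with hY
  have key : ∀ ε : ℝ, 0 ≤ ε ^ 2 * X + ε ^ 4 * Y := fun ε => by
    have := h.En_nonneg (a := fun x => ε * a x) (b := fun _ => 0) (contDiff_const.mul ha) contDiff_const h1 h2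
    have e : En Ω κ H A₁ A₂ (fun x => ε * a x) (fun _ => 0) = ∫ x in Ω,
        (ε ^ 2 * (dsq (κ * H) A₁ A₂ a (fun _ => 0) x - κ ^ 2 * a x ^ 2) + ε ^ 4 * (κ ^ 2 / 2 * a x ^ 4)) := by
      refine integral_congr_ae (ae_of_all _ fun x => ?_)
      have z1 : d1 (fun _ : Plane => (0 : ℝ)) x = 0 := d1_const _ _
      have z2 : d2 (fun _ : Plane => (0 : ℝ)) x = 0 := d2_const _ _
      have z3 : d1 (fun y => ε * a y) x = ε * d1 a x := by
        rw [d1_mul (by fun_prop) (cdAt ha x), d1_const]; ring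
      have z4 : d2 (fun y => ε * a y) x = ε * d2 a x := by
        rw [d2_mul (by fun_prop) (cdAt ha x), d2_const]; ring
      simp only [enDens, hc, dsq, z1, z2, z3, z4]
      ring
    have e2 := integral_add ((i1.sub (i2.const_mul (κ ^ 2))).const_mul (ε ^ 2))
      ((i3.const_mul (κ ^ 2 / 2)).const_mul (ε ^ 4))
    simp only [Pi.sub_apply] at e2
    rw [e, e2, integral_const_mul, integral_const_mul, integral_const_mul,
      integral_sub i1 (i2.const_mul _), integral_const_mul] at this
    exact this
  have hX0 : 0 ≤ X := by
    have hlim : Tendsto (fun ε : ℝ => X + ε ^ 2 * Y) (𝓝[>] 0) (𝓝 X) := by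
      have : Continuous fun ε : ℝ => X + ε ^ 2 * Y := by fun_prop
      have := this.tendsto 0
      simp only [ne_eq, OfNat.ofNat_ne_zero, not_false_eq_true, zero_pow, zero_mul, add_zero] at this
      exact this.mono_left nhdsWithin_le_nhds
    refine ge_of_tendsto hlim ?_
    filter_upwards [self_mem_nhdsWithin] with ε hε
    have hε : 0 < ε := hε
    have h4 : 0 ≤ ε ^ 2 * (X + ε ^ 2 * Y) := by linarith [key ε]
    exact nonneg_of_mul_nonneg_right h4 (by positivity)
  linarith

set_option maxHeartbeats 1000000 in
lemma field_arith {Θ A M C K : ℝ} (hΘ : 0 < Θ) (hΘ1 : Θ < 1) (hA : |A| ≤ M) (hC : 0 < C) (hK : 1 ≤ K) :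
    ∃ C' > 0, ∃ c > 0, ∃ κ₀ > 0, ∀ κ ≥ κ₀, ∀ ρ, 0 < ρ → ρ ≤ 1 → ∀ s' B : ℝ, 1 ≤ s' →
      κ ^ 2 ≤ Θ * s' ^ 2 - A * s' + C * √s' → s' ≤ K * κ → s' ^ 2 - 2 * κ * ρ ≤ B → B ≤ s' ^ 2 →
      ∃ s > 0, B = s ^ 2 ∧ c * κ ≤ s ∧ s ≤ C' * κ ∧
        κ ^ 2 ≤ Θ * s ^ 2 - A * s + C' * √κ + C' * (κ * ρ) ∧ c * κ ^ 2 ≤ s ^ 2 - κ ^ 2 := by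
  have hM : 0 ≤ M := (abs_nonneg A).trans hA
  set c₁ := 1 / (1 + M + C) with hc₁
  have hc₁0 : 0 < c₁ := by positivity
  have hc₁1 : c₁ ≤ 1 := by rw [hc₁, div_le_one (by positivity)]; linarith
  have hc₁e : c₁ * (1 + M + C) = 1 := by rw [hc₁]; field_simp
  set D := M * K + C * K + 2 + 2 * M / c₁ with hD
  have hD0 : 0 < D := by positivity
  clear_value c₁
  have hCK : C * K ≤ D := by
    have := mul_nonneg hM (by linarith : (0:ℝ) ≤ K)
    have : 0 ≤ 2 * M / c₁ := by positivity
    linarith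
  have hMc : 2 + 2 * M / c₁ ≤ D := by
    have := mul_nonneg hM (by linarith : (0:ℝ) ≤ K)
    have := mul_nonneg hC.le (by linarith : (0:ℝ) ≤ K)
    linarith
  refine ⟨K + D, by positivity, min (c₁ / 2) ((1 - Θ) / 2), lt_min (by positivity) (by linarith),
    1 + 4 / c₁ ^ 2 + 2 * D / (1 - Θ), ?_, ?_⟩
  · have : 0 < 2 * D / (1 - Θ) := div_pos (by positivity) (by linarith)
    positivity
  intro κ hκ ρ hρ hρ1 s' B hs' h1 h2 h3 h4
  have hp1 : 0 < 4 / c₁ ^ 2 := by positivity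
  have hp2 : 0 < 2 * D / (1 - Θ) := div_pos (by positivity) (by linarith)
  have hκ1 : 1 ≤ κ := by linarith
  have hκ2 : 4 ≤ κ * c₁ ^ 2 := by
    have : 4 / c₁ ^ 2 ≤ κ := by linarith
    exact (div_le_iff₀ (by positivity)).1 this
  have hκ3 : 2 * D ≤ κ * (1 - Θ) := by
    have : 2 * D / (1 - Θ) ≤ κ := by linarith
    exact (div_le_iff₀ (by linarith)).1 this
  have hAs : ∀ t : ℝ, 0 ≤ t → -(A * t) ≤ M * t := fun t ht => by
    have := mul_le_mul_of_nonneg_right (neg_le_of_abs_le hA) ht; linarith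
  have hsq : √s' ≤ s' := Real.sqrt_le_iff.2 ⟨by linarith, by nlinarith⟩
  have hs2 : s' ≤ s' ^ 2 := by nlinarith
  have hlow : c₁ * κ ≤ s' := by
    have e1 : κ ^ 2 ≤ (1 + M + C) * s' ^ 2 := by
      have a1 := hAs s' (by linarith)
      have a2 := mul_le_mul_of_nonneg_left hs2 hM
      have a3 := mul_le_mul_of_nonneg_left (hsq.trans hs2) hC.le
      have a4 := mul_le_mul_of_nonneg_right hΘ1.le (sq_nonneg s')
      linarith
    refine le_of_sq_le_sq ?_ (by linarith)
    have e2 := mul_le_mul_of_nonneg_left e1 (sq_nonneg c₁)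
    have e3 : c₁ ^ 2 * ((1 + M + C) * s' ^ 2) = c₁ * s' ^ 2 := by linear_combination c₁ * s' ^ 2 * hc₁e
    have e4 := mul_le_mul_of_nonneg_right hc₁1 (sq_nonneg s')
    rw [mul_pow]; linarith
  have hB : (c₁ / 2 * κ) ^ 2 ≤ B := by
    have e1 : (c₁ * κ) ^ 2 ≤ s' ^ 2 := pow_le_pow_left₀ (by positivity) hlow 2
    have e2 : κ * ρ ≤ κ := by nlinarith
    have e3 : 4 * κ ≤ κ * c₁ ^ 2 * κ := mul_le_mul_of_nonneg_right hκ2 (by linarith)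
    nlinarith
  have hBpos : 0 < B := lt_of_lt_of_le (by positivity) hB
  set s := √B with hs
  have hsB : B = s ^ 2 := (Real.sq_sqrt hBpos.le).symm
  have hs0 : 0 < s := Real.sqrt_pos.2 hBpos
  have hsl : c₁ / 2 * κ ≤ s := Real.le_sqrt_of_sq_le hB
  have hss : s ≤ s' := le_of_sq_le_sq (by linarith) (by linarith)
  have hdiff : s' - s ≤ 2 * ρ / c₁ := by
    rw [le_div_iff₀ hc₁0]
    have e1 : (s' - s) * (s' + s) ≤ 2 * κ * ρ := by
      have : (s' - s) * (s' + s) = s' ^ 2 - s ^ 2 := by ring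
      linarith
    have e2 : (s' - s) * (c₁ * κ) ≤ (s' - s) * (s' + s) :=
      mul_le_mul_of_nonneg_left (by linarith) (by linarith)
    have e3 : (s' - s) * c₁ * κ ≤ 2 * ρ * κ := by linarith
    exact le_of_mul_le_mul_right e3 (by linarith)
  have hsqrt : √s' ≤ K * √κ := by
    rw [Real.sqrt_le_left (by positivity), mul_pow, Real.sq_sqrt (by linarith)]
    have : K * κ ≤ K ^ 2 * κ := mul_le_mul_of_nonneg_right (by nlinarith) (by linarith)
    linarith
  have hsκ : √κ ≤ κ := Real.sqrt_le_iff.2 ⟨by linarith, by nlinarith⟩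
  have hκρ : ρ ≤ κ * ρ := le_mul_of_one_le_left hρ.le hκ1
  have hκρ1 : κ * ρ ≤ κ := mul_le_of_le_one_right (by linarith) hρ1
  have hAd : -(A * s') ≤ -(A * s) + 2 * M / c₁ * (κ * ρ) := by
    have e1 := hAs (s' - s) (by linarith)
    have e2 := mul_le_mul_of_nonneg_left hdiff hM
    have e3 : M * (2 * ρ / c₁) = 2 * M / c₁ * ρ := by ring
    have e4 : 2 * M / c₁ * ρ ≤ 2 * M / c₁ * (κ * ρ) := mul_le_mul_of_nonneg_left hκρ (by positivity)
    linarith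
  have hmain : κ ^ 2 ≤ Θ * s ^ 2 - A * s + C * K * √κ + (2 + 2 * M / c₁) * (κ * ρ) := by
    have e1 := mul_le_mul_of_nonneg_left hsqrt hC.le
    have e2 : Θ * s' ^ 2 ≤ Θ * s ^ 2 + 2 * (κ * ρ) := by
      have a1 : s' ^ 2 ≤ s ^ 2 + 2 * (κ * ρ) := by linarith
      have a2 := mul_le_mul_of_nonneg_left a1 hΘ.le
      have a3 : 0 ≤ κ * ρ := by positivity
      nlinarith
    linarith
  have hsK : s ≤ K * κ := hss.trans h2
  have hκρ0 : 0 ≤ κ * ρ := by positivity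
  refine ⟨s, hs0, hsB, ?_, ?_, ?_, ?_⟩
  · exact (mul_le_mul_of_nonneg_right (min_le_left _ _) (by linarith)).trans hsl
  · have := mul_nonneg hD0.le (by linarith : 0 ≤ κ)
    linarith
  · have e1 : C * K * √κ ≤ (K + D) * √κ := mul_le_mul_of_nonneg_right (by linarith) (Real.sqrt_nonneg _)
    have e2 : (2 + 2 * M / c₁) * (κ * ρ) ≤ (K + D) * (κ * ρ) := mul_le_mul_of_nonneg_right (by linarith) hκρ0
    linarith
  · have e0 : min (c₁ / 2) ((1 - Θ) / 2) * κ ^ 2 ≤ (1 - Θ) / 2 * κ ^ 2 :=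
      mul_le_mul_of_nonneg_right (min_le_right _ _) (sq_nonneg _)
    have e1 : κ ^ 2 ≤ Θ * s ^ 2 + D * κ := by
      have a1 := hAs s hs0.le
      have a2 := mul_le_mul_of_nonneg_left hsK hM
      have a3 := mul_le_mul_of_nonneg_left hsκ (by positivity : 0 ≤ C * K)
      have a4 := mul_le_mul_of_nonneg_left hκρ1 (by positivity : 0 ≤ 2 + 2 * M / c₁)
      have : D * κ = M * (K * κ) + C * K * κ + (2 + 2 * M / c₁) * κ := by rw [hD]; ring
      linarith
    have e2 : 2 * (D * κ) ≤ κ ^ 2 * (1 - Θ) := by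
      have := mul_le_mul_of_nonneg_right hκ3 (by linarith : 0 ≤ κ)
      linarith
    have e3 : (1 + Θ) / 2 * κ ^ 2 ≤ Θ * s ^ 2 := by linarith
    have e4 : Θ * ((3 - Θ) / 2 * κ ^ 2) ≤ Θ * s ^ 2 := by
      refine le_trans ?_ e3
      have : Θ * ((3 - Θ) / 2) ≤ (1 + Θ) / 2 := by nlinarith [sq_nonneg (1 - Θ)]
      have := mul_le_mul_of_nonneg_right this (sq_nonneg κ)
      linarith
    have := le_of_mul_le_mul_left e4 hΘ
    linarith

/-- Normal states are unstable in weak fields. -/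
lemma NormalMin.field_lower {Ω : Set Plane} (hbd : Bornology.IsBounded Ω) (hv : 0 < ∫ _x in Ω, (1 : ℝ)) :
    ∃ c > 0, ∀ κ > 0, ∀ H > 0, NormalMin Ω κ H → c * κ ≤ κ * H := by
  set K := ∫ x in Ω, ((x.1 / 2) ^ 2 + (x.2 / 2) ^ 2) with hK
  set V := ∫ _x in Ω, (1 : ℝ) with hV
  have hK0 : 0 ≤ K := integral_nonneg fun x => by positivity
  have h1 : ContDiff ℝ 1 fun x : Plane => -(x.2 / 2) := by fun_prop
  have h2 : ContDiff ℝ 1 fun x : Plane => x.1 / 2 := by fun_prop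
  have hc : ∀ x, curlf (fun x : Plane => -(x.2 / 2)) (fun x : Plane => x.1 / 2) x = 1 := fun x => by
    have f1 : HasFDerivAt (fun x : Plane => x.1) (ContinuousLinearMap.fst ℝ ℝ ℝ) x := hasFDerivAt_fst
    have f2 : HasFDerivAt (fun x : Plane => x.2) (ContinuousLinearMap.snd ℝ ℝ ℝ) x := hasFDerivAt_snd
    have e1 := (f1.mul_const (1 / 2 : ℝ)).fderiv
    have e2 := ((f2.mul_const (1 / 2 : ℝ)).neg).fderiv
    simp only [curlf, d1, d2]
    have g1 : (fun x : Plane => x.1 / 2) = fun y => y.1 * (1 / 2) := by ext; ring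
    have g2 : (fun x : Plane => -(x.2 / 2)) = -fun y : Plane => y.2 * (1 / 2) := by ext; simp; ring
    rw [g1, g2, e1, e2]
    simp; norm_num
  refine ⟨√(V / (K + 1)), Real.sqrt_pos.2 (by positivity), fun κ hκ H hH h => ?_⟩
  have := h.linear hbd (a := fun _ => 1) contDiff_const h1 h2 hc
  have e : ∀ x, dsq (κ * H) (fun x : Plane => -(x.2 / 2)) (fun x : Plane => x.1 / 2) (fun _ => 1) (fun _ => 0) x =
      (κ * H) ^ 2 * ((x.1 / 2) ^ 2 + (x.2 / 2) ^ 2) := fun x => by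
    have z1 : d1 (fun _ : Plane => (0 : ℝ)) x = 0 := d1_const _ _
    have z2 : d2 (fun _ : Plane => (0 : ℝ)) x = 0 := d2_const _ _
    have z3 : d1 (fun _ : Plane => (1 : ℝ)) x = 0 := d1_const _ _
    have z4 : d2 (fun _ : Plane => (1 : ℝ)) x = 0 := d2_const _ _
    simp only [dsq, z1, z2, z3, z4]; ring
  simp only [e, one_pow, integral_const_mul] at this
  have h3 : κ ^ 2 * V ≤ (κ * H) ^ 2 * (K + 1) := by nlinarith [sq_nonneg (κ * H)]
  refine le_of_sq_le_sq ?_ (by positivity)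
  rw [mul_pow, Real.sq_sqrt (by positivity), div_mul_eq_mul_div, div_le_iff₀ (by positivity)]
  linarith

theorem Fit.field_bounds {Ω : Set Plane} {Q : Tube Ω} {g : Geo Ω} (F : Fit Q g) (m : Model) :
    ∃ C > 0, ∃ c > 0, ∃ κ₀ > 0, ∀ κ ≥ κ₀, ∀ H : ℝ, 0 < HC3low Ω κ - H → HC3low Ω κ - H ≤ 1 →
      ∃ s > 0, κ * H = s ^ 2 ∧ c * κ ≤ s ∧ s ≤ C * κ ∧
        κ ^ 2 ≤ m.Θ * s ^ 2 - m.C₁ * g.km * s + C * √κ + C * (κ * (HC3low Ω κ - H)) ∧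
        c * κ ^ 2 ≤ s ^ 2 - κ ^ 2 := by
  obtain ⟨C, hC, S, hS, htr⟩ := F.exists_trial m
  obtain ⟨κ₁, hκ₁, hnm⟩ := g.normalMin_large m
  have hΘ := m.Θ_pos
  have hv : 0 < ∫ _x in Ω, (1 : ℝ) := by
    obtain ⟨a, -, -, -, -, -, -, -, hp, -⟩ := htr S le_rfl
    by_contra hn
    have h0 : volume Ω = 0 := by
      by_contra h0
      apply hn
      have : volume Ω ≠ ⊤ := Q.bdd.measure_lt_top.ne
      simp only [integral_const, smul_eq_mul, mul_one]
      rw [measureReal_restrict_apply_univ]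
      exact ENNReal.toReal_pos h0 this
    rw [Measure.restrict_eq_zero.2 h0] at hp
    simp at hp
  obtain ⟨c₀, hc₀, hlow⟩ := NormalMin.field_lower Q.bdd hv
  obtain ⟨C', hC', c, hc, κ₂, hκ₂, har⟩ := field_arith hΘ m.Θ_lt (A := m.C₁ * g.km) le_rfl hC
    (K := 1 + 2 / m.Θ) (by have := div_pos two_pos hΘ; linarith)
  refine ⟨C', hC', c, hc, κ₁ + κ₂ + 1 + S ^ 2 / c₀, by positivity, fun κ hκ H hρ hρ1 => ?_⟩
  have hp : 0 ≤ S ^ 2 / c₀ := by positivity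
  have hκ1 : 1 ≤ κ := by linarith
  have hκ0 : 0 < κ := by linarith
  have hne : {H : ℝ | 0 < H ∧ NormalMin Ω κ H}.Nonempty :=
    ⟨2 * κ / m.Θ, by positivity, hnm κ (by linarith)⟩
  have hbd : BddBelow {H : ℝ | 0 < H ∧ NormalMin Ω κ H} := ⟨0, fun H h => h.1.le⟩
  have hle : HC3low Ω κ ≤ 2 * κ / m.Θ := csInf_le hbd ⟨by positivity, hnm κ (by linarith)⟩
  obtain ⟨H', ⟨hH'0, hN⟩, hH'⟩ := exists_lt_of_csInf_lt hne
    (show sInf {H : ℝ | 0 < H ∧ NormalMin Ω κ H} < HC3low Ω κ + (HC3low Ω κ - H) by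
      show HC3low Ω κ < _; linarith)
  have hH'1 : HC3low Ω κ ≤ H' := csInf_le hbd ⟨hH'0, hN⟩
  set s' := √(κ * H') with hs'
  have hsq : s' ^ 2 = κ * H' := Real.sq_sqrt (by positivity)
  have hsS : S ≤ s' := by
    refine Real.le_sqrt_of_sq_le ?_
    have h1 := hlow κ hκ0 H' hH'0 hN
    have h2 : S ^ 2 / c₀ ≤ κ := by linarith
    rw [div_le_iff₀ hc₀] at h2
    linarith
  obtain ⟨a, A₁, A₂, ha, -, h1, h2, hcu, hpos, hT⟩ := htr s' hsS
  have hlin := hN.linear Q.bdd ha h1 h2 hcu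
  rw [hsq.symm] at hlin
  have hk := le_of_mul_le_mul_right (hlin.trans hT) hpos
  have hs'K : s' ≤ (1 + 2 / m.Θ) * κ := by
    refine Real.sqrt_le_iff.2 ⟨by positivity, ?_⟩
    have e1 : H' ≤ (1 + 2 / m.Θ) * κ := by
      have : 2 * κ / m.Θ = 2 / m.Θ * κ := by ring
      linarith
    have e2 : κ ≤ (1 + 2 / m.Θ) * κ := by
      have := mul_pos (div_pos two_pos hΘ) hκ0
      linarith
    rw [sq]; exact mul_le_mul e2 e1 hH'0.le (by positivity)
  have e0 : m.C₁ * g.km * s' = m.C₁ * s' * g.km := by ring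
  obtain ⟨s, hs0, hB, r⟩ := har κ (by linarith) (HC3low Ω κ - H) hρ hρ1 s' (κ * H) (hS.trans hsS)
    (by rw [e0]; linarith) hs'K (by rw [hsq]; nlinarith) (by rw [hsq]; nlinarith)
  exact ⟨s, hs0, hB, r⟩

lemma eq_zero_of_quartic {X Y Z W : ℝ} (h : ∀ ε : ℝ, 0 ≤ ε * X + ε ^ 2 * Y + ε ^ 3 * Z + ε ^ 4 * W) :
    X = 0 := by
  have hd : HasDerivAt (fun ε : ℝ => ε * X + ε ^ 2 * Y + ε ^ 3 * Z + ε ^ 4 * W) X 0 := by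
    have h1 := (((hasDerivAt_id (0 : ℝ)).mul_const X).fun_add
      ((hasDerivAt_pow 2 (0 : ℝ)).mul_const Y)).fun_add ((hasDerivAt_pow 3 (0 : ℝ)).mul_const Z) |>.fun_add
      ((hasDerivAt_pow 4 (0 : ℝ)).mul_const W)
    exact h1.congr_deriv (by simp)
  have hm : IsLocalMin (fun ε : ℝ => ε * X + ε ^ 2 * Y + ε ^ 3 * Z + ε ^ 4 * W) 0 :=
    Eventually.of_forall fun ε => by simpa using h ε
  exact hm.hasDerivAt_eq_zero hd

/-- Supercurrent components. -/
def cur1 (B : ℝ) (A₁ a b : Plane → ℝ) (x : Plane) : ℝ :=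
  (d1 b x - B * A₁ x * a x) * a x - (d1 a x + B * A₁ x * b x) * b x

def cur2 (B : ℝ) (A₂ a b : Plane → ℝ) (x : Plane) : ℝ :=
  (d2 b x - B * A₂ x * a x) * a x - (d2 a x + B * A₂ x * b x) * b x

lemma cur1_cont {B : ℝ} {A₁ a b : Plane → ℝ} (h1 : ContDiff ℝ 1 A₁)
    (ha : ContDiff ℝ 1 a) (hb : ContDiff ℝ 1 b) : Continuous (cur1 B A₁ a b) := by
  have := d1_cont ha; have := d1_cont hb; have := ha.continuous; have := hb.continuous
  have := h1.continuous
  unfold cur1; fun_prop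

lemma cur2_cont {B : ℝ} {A₂ a b : Plane → ℝ} (h1 : ContDiff ℝ 1 A₂)
    (ha : ContDiff ℝ 1 a) (hb : ContDiff ℝ 1 b) : Continuous (cur2 B A₂ a b) := by
  have := d2_cont ha; have := d2_cont hb; have := ha.continuous; have := hb.continuous
  have := h1.continuous
  unfold cur2; fun_prop

lemma cur_sq_le (B : ℝ) (A₁ A₂ a b : Plane → ℝ) (x : Plane) :
    cur1 B A₁ a b x ^ 2 + cur2 B A₂ a b x ^ 2 ≤ (a x ^ 2 + b x ^ 2) * dsq B A₁ A₂ a b x := by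
  unfold cur1 cur2 dsq
  set p := d1 a x + B * A₁ x * b x
  set q := d1 b x - B * A₁ x * a x
  set r := d2 a x + B * A₂ x * b x
  set t := d2 b x - B * A₂ x * a x
  nlinarith [sq_nonneg (p * a x + q * b x), sq_nonneg (r * a x + t * b x)]

lemma real_current_sq_le (B : ℝ) (A₁ A₂ a b : Plane → ℝ) (x : Plane) :
    (a x * d1 a x + b x * d1 b x) ^ 2 + (a x * d2 a x + b x * d2 b x) ^ 2 ≤
      (a x ^ 2 + b x ^ 2) * dsq B A₁ A₂ a b x := by
  have e1 : a x * d1 a x + b x * d1 b x =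
    a x * (d1 a x + B * A₁ x * b x) + b x * (d1 b x - B * A₁ x * a x) := by ring
  have e2 : a x * d2 a x + b x * d2 b x =
    a x * (d2 a x + B * A₂ x * b x) + b x * (d2 b x - B * A₂ x * a x) := by ring
  rw [e1, e2]
  unfold dsq
  set p := d1 a x + B * A₁ x * b x
  set q := d1 b x - B * A₁ x * a x
  set r := d2 a x + B * A₂ x * b x
  set t := d2 b x - B * A₂ x * a x
  nlinarith [sq_nonneg (p * b x - q * a x), sq_nonneg (r * b x - t * a x)]

namespace RMin
variable {Ω : Set Plane} {κ H : ℝ} {A₁ A₂ a b : Plane → ℝ}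

/-- The equation for the order parameter tested against real multiples of itself. -/
lemma equation (R : RMin Ω κ H A₁ A₂ a b) (hbd : Bornology.IsBounded Ω) {φ : Plane → ℝ}
    (hφ : ContDiff ℝ 1 φ) :
    ∫ x in Ω, (φ x * dsq (κ * H) A₁ A₂ a b x + (d1 φ x * (a x * d1 a x + b x * d1 b x) +
      d2 φ x * (a x * d2 a x + b x * d2 b x)) -
      κ ^ 2 * φ x * ((a x ^ 2 + b x ^ 2) * (1 - (a x ^ 2 + b x ^ 2)))) = 0 := by
  have ha := R.a_smooth; have hb := R.b_smooth; have h1 := R.A₁_smooth; have h2 := R.A₂_smooth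
  have ca := ha.continuous; have cb := hb.continuous; have cφ := hφ.continuous
  have cd := dsq_cont (B := κ * H) h1 h2 ha hb
  have k1 := d1_cont ha; have k2 := d2_cont ha; have k3 := d1_cont hb; have k4 := d2_cont hb
  have k5 := d1_cont hφ; have k6 := d2_cont hφ
  set F := fun x => φ x * dsq (κ * H) A₁ A₂ a b x + (d1 φ x * (a x * d1 a x + b x * d1 b x) +
      d2 φ x * (a x * d2 a x + b x * d2 b x)) -
      κ ^ 2 * φ x * ((a x ^ 2 + b x ^ 2) * (1 - (a x ^ 2 + b x ^ 2))) with hF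
  set F2 := fun x => φ x ^ 2 * dsq (κ * H) A₁ A₂ a b x + (d1 φ x ^ 2 + d2 φ x ^ 2) * (a x ^ 2 + b x ^ 2) +
      2 * φ x * (d1 φ x * (a x * d1 a x + b x * d1 b x) + d2 φ x * (a x * d2 a x + b x * d2 b x)) -
      κ ^ 2 * φ x ^ 2 * (a x ^ 2 + b x ^ 2) + 3 * κ ^ 2 * φ x ^ 2 * (a x ^ 2 + b x ^ 2) ^ 2 with hF2
  set F3 := fun x => 2 * κ ^ 2 * φ x ^ 3 * (a x ^ 2 + b x ^ 2) ^ 2 with hF3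
  set F4 := fun x => κ ^ 2 / 2 * φ x ^ 4 * (a x ^ 2 + b x ^ 2) ^ 2 with hF4
  have i0 : IntegrableOn (enDens κ H A₁ A₂ a b) Ω := intOn_of_cont hbd (enDens_cont ha hb h1 h2)
  have i1 : IntegrableOn F Ω := intOn_of_cont hbd (by simp only [hF]; fun_prop)
  have i2 : IntegrableOn F2 Ω := intOn_of_cont hbd (by simp only [hF2]; fun_prop)
  have i3 : IntegrableOn F3 Ω := intOn_of_cont hbd (by simp only [hF3]; fun_prop)
  have i4 : IntegrableOn F4 Ω := intOn_of_cont hbd (by simp only [hF4]; fun_prop)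
  have key : ∀ ε : ℝ, 0 ≤ ε * (2 * ∫ x in Ω, F x) + ε ^ 2 * (∫ x in Ω, F2 x) +
      ε ^ 3 * (∫ x in Ω, F3 x) + ε ^ 4 * ∫ x in Ω, F4 x := fun ε => by
    have hθ : ContDiff ℝ 1 fun x => 1 + ε * φ x := by fun_prop
    have hm := R.min _ _ A₁ A₂ (hθ.mul ha) (hθ.mul hb) h1 h2
    have e : En Ω κ H A₁ A₂ (fun x => (1 + ε * φ x) * a x) (fun x => (1 + ε * φ x) * b x) =
        ∫ x in Ω, (enDens κ H A₁ A₂ a b x + (2 * ε) * F x + ε ^ 2 * F2 x + ε ^ 3 * F3 x + ε ^ 4 * F4 x) := by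
      refine integral_congr_ae (ae_of_all _ fun x => ?_)
      have z1 : d1 (fun y => 1 + ε * φ y) x = ε * d1 φ x := by
        rw [d1_add (by fun_prop) ((cdAt hφ x).const_mul ε), d1_const, d1_mul (by fun_prop) (cdAt hφ x),
          d1_const]; ring
      have z2 : d2 (fun y => 1 + ε * φ y) x = ε * d2 φ x := by
        rw [d2_add (by fun_prop) ((cdAt hφ x).const_mul ε), d2_const, d2_mul (by fun_prop) (cdAt hφ x),
          d2_const]; ring
      have := dsq_mul (κ * H) (A₁ := A₁) (A₂ := A₂) (cdAt hθ x) (cdAt ha x) (cdAt hb x)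
      simp only [enDens]
      rw [this, z1, z2]
      simp only [hF, hF2, hF3, hF4]
      ring
    have s1 := integral_add i0 (i1.const_mul (2 * ε))
    have s2 := integral_add (i0.add (i1.const_mul (2 * ε))) (i2.const_mul (ε ^ 2))
    have s3 := integral_add ((i0.add (i1.const_mul (2 * ε))).add (i2.const_mul (ε ^ 2))) (i3.const_mul (ε ^ 3))
    have s4 := integral_add (((i0.add (i1.const_mul (2 * ε))).add (i2.const_mul (ε ^ 2))).add
      (i3.const_mul (ε ^ 3))) (i4.const_mul (ε ^ 4))
    simp only [Pi.add_apply] at s1 s2 s3 s4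
    rw [e, s4, s3, s2, s1, integral_const_mul, integral_const_mul, integral_const_mul,
      integral_const_mul] at hm
    unfold En at hm
    linarith
  have := eq_zero_of_quartic key
  linarith

/-- The equation for the magnetic potential. -/
lemma current (R : RMin Ω κ H A₁ A₂ a b) (hbd : Bornology.IsBounded Ω) (hB : κ * H ≠ 0) {Y₁ Y₂ : Plane → ℝ}
    (hY1 : ContDiff ℝ 1 Y₁) (hY2 : ContDiff ℝ 1 Y₂) :
    κ * H * ∫ x in Ω, (curlf A₁ A₂ x - 1) * (d1 Y₁ x + d2 Y₂ x) =
      ∫ x in Ω, (cur2 (κ * H) A₂ a b x * Y₁ x - cur1 (κ * H) A₁ a b x * Y₂ x) := by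
  have ha := R.a_smooth; have hb := R.b_smooth; have h1 := R.A₁_smooth; have h2 := R.A₂_smooth
  have ca := ha.continuous; have cb := hb.continuous
  have cc := curlf_cont h1 h2
  have k1 := d1_cont hY1; have k2 := d2_cont hY2
  have cY1 := hY1.continuous; have cY2 := hY2.continuous
  have j1 := cur1_cont (B := κ * H) h1 ha hb; have j2 := cur2_cont (B := κ * H) h2 ha hb
  set F := fun x => (curlf A₁ A₂ x - 1) * (d1 Y₁ x + d2 Y₂ x) with hF
  set F' := fun x => cur2 (κ * H) A₂ a b x * Y₁ x - cur1 (κ * H) A₁ a b x * Y₂ x with hF'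
  set F2 := fun x => (κ * H) ^ 2 * ((Y₁ x ^ 2 + Y₂ x ^ 2) * (a x ^ 2 + b x ^ 2) +
    (d1 Y₁ x + d2 Y₂ x) ^ 2) with hF2
  have i0 : IntegrableOn (enDens κ H A₁ A₂ a b) Ω := intOn_of_cont hbd (enDens_cont ha hb h1 h2)
  have i1 : IntegrableOn F Ω := intOn_of_cont hbd (by simp only [hF]; fun_prop)
  have i1' : IntegrableOn F' Ω := intOn_of_cont hbd (by simp only [hF']; fun_prop)
  have i2 : IntegrableOn F2 Ω := intOn_of_cont hbd (by simp only [hF2]; fun_prop)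
  have key : ∀ ε : ℝ, 0 ≤ ε * (2 * (κ * H) ^ 2 * (∫ x in Ω, F x) - 2 * (κ * H) * ∫ x in Ω, F' x) +
      ε ^ 2 * (∫ x in Ω, F2 x) + ε ^ 3 * 0 + ε ^ 4 * 0 := fun ε => by
    have g1 : ContDiff ℝ 1 fun x => A₁ x - ε * Y₂ x := by fun_prop
    have g2 : ContDiff ℝ 1 fun x => A₂ x + ε * Y₁ x := by fun_prop
    have hm := R.min a b _ _ ha hb g1 g2
    have e : En Ω κ H (fun x => A₁ x - ε * Y₂ x) (fun x => A₂ x + ε * Y₁ x) a b =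
        ∫ x in Ω, (enDens κ H A₁ A₂ a b x + (2 * ε * (κ * H) ^ 2) * F x + (-(2 * ε * (κ * H))) * F' x +
          ε ^ 2 * F2 x) := by
      refine integral_congr_ae (ae_of_all _ fun x => ?_)
      have z1 : d2 (fun y => A₁ y - ε * Y₂ y) x = d2 A₁ x - ε * d2 Y₂ x := by
        rw [d2_sub (cdAt h1 x) ((cdAt hY2 x).const_mul ε), d2_mul (by fun_prop) (cdAt hY2 x),
          d2_const]; ring
      have z2 : d1 (fun y => A₂ y + ε * Y₁ y) x = d1 A₂ x + ε * d1 Y₁ x := by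
        rw [d1_add (cdAt h2 x) ((cdAt hY1 x).const_mul ε), d1_mul (by fun_prop) (cdAt hY1 x),
          d1_const]; ring
      simp only [enDens, dsq, curlf, hF, hF', hF2, cur1, cur2, z1, z2]
      ring
    have s1 := integral_add i0 (i1.const_mul (2 * ε * (κ * H) ^ 2))
    have s2 := integral_add (i0.add (i1.const_mul (2 * ε * (κ * H) ^ 2))) (i1'.const_mul (-(2 * ε * (κ * H))))
    have s3 := integral_add ((i0.add (i1.const_mul (2 * ε * (κ * H) ^ 2))).add
      (i1'.const_mul (-(2 * ε * (κ * H))))) (i2.const_mul (ε ^ 2))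
    simp only [Pi.add_apply] at s1 s2 s3
    rw [e, s3, s2, s1, integral_const_mul, integral_const_mul, integral_const_mul] at hm
    unfold En at hm
    linarith
  have h0 := eq_zero_of_quartic key
  have h3 : (κ * H) * (κ * H * (∫ x in Ω, F x) - ∫ x in Ω, F' x) = 0 := by linarith
  have := (mul_eq_zero.1 h3).resolve_left hB
  linarith

/-- A minimizer has nonpositive energy. -/
lemma energy_bound (R : RMin Ω κ H A₁ A₂ a b) (hbd : Bornology.IsBounded Ω) :
    (κ * H) ^ 2 * ∫ x in Ω, (curlf A₁ A₂ x - 1) ^ 2 ≤ κ ^ 2 * ∫ x in Ω, (a x ^ 2 + b x ^ 2) := by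
  have ha := R.a_smooth; have hb := R.b_smooth; have h1 := R.A₁_smooth; have h2 := R.A₂_smooth
  have ca := ha.continuous; have cb := hb.continuous
  have cc := curlf_cont h1 h2
  have hz : ContDiff ℝ 1 fun _ : Plane => (0 : ℝ) := contDiff_const
  have hx : ContDiff ℝ 1 fun x : Plane => x.1 := contDiff_fst
  have hm := R.min (fun _ => 0) (fun _ => 0) (fun _ => 0) (fun x => x.1) hz hz hz hx
  have e : En Ω κ H (fun _ => 0) (fun x => x.1) (fun _ => 0) (fun _ => 0) = 0 := by
    have : ∀ x, enDens κ H (fun _ => 0) (fun x => x.1) (fun _ => 0) (fun _ => 0) x = 0 := fun x => by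
      have z1 : d1 (fun _ : Plane => (0 : ℝ)) x = 0 := d1_const _ _
      have z2 : d2 (fun _ : Plane => (0 : ℝ)) x = 0 := d2_const _ _
      have z3 : d1 (fun y : Plane => y.1) x = 1 := by
        unfold d1; rw [(hasFDerivAt_fst (𝕜 := ℝ) (p := x)).fderiv]; rfl
      simp only [enDens, dsq, curlf, z1, z2, z3]; ring
    simp [En, this]
  rw [e] at hm
  have i0 : IntegrableOn (enDens κ H A₁ A₂ a b) Ω := intOn_of_cont hbd (enDens_cont ha hb h1 h2)
  rw [← integral_const_mul, ← integral_const_mul]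
  have i1 : IntegrableOn (fun x => (κ * H) ^ 2 * (curlf A₁ A₂ x - 1) ^ 2) Ω :=
    intOn_of_cont hbd (by fun_prop)
  have i2 : IntegrableOn (fun x => κ ^ 2 * (a x ^ 2 + b x ^ 2)) Ω := intOn_of_cont hbd (by fun_prop)
  have e2 := integral_sub i1 i2
  have : ∫ x in Ω, ((κ * H) ^ 2 * (curlf A₁ A₂ x - 1) ^ 2 - κ ^ 2 * (a x ^ 2 + b x ^ 2)) ≤
      ∫ x in Ω, enDens κ H A₁ A₂ a b x := by
    refine integral_mono (i1.sub i2) i0 fun x => ?_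
    have := dsq_nonneg (κ * H) A₁ A₂ a b x
    have : 0 ≤ κ ^ 2 / 2 * (a x ^ 2 + b x ^ 2) ^ 2 := by positivity
    simp only [enDens]
    nlinarith
  unfold En at hm
  linarith

end RMin

lemma step_pos {s : ℝ} (h : 1 < s) : 0 < step s := Real.smoothTransition.pos_of_pos (by linarith)

namespace RMin
variable {Ω : Set Plane} {κ H : ℝ} {A₁ A₂ a b : Plane → ℝ}

lemma le_one (R : RMin Ω κ H A₁ A₂ a b) (ho : IsOpen Ω) (hbd : Bornology.IsBounded Ω) (hκ : κ ≠ 0) :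
    ∀ x ∈ Ω, a x ^ 2 + b x ^ 2 ≤ 1 := by
  have ha := R.a_smooth; have hb := R.b_smooth; have h1 := R.A₁_smooth; have h2 := R.A₂_smooth
  have ca := ha.continuous; have cb := hb.continuous
  have cd := dsq_cont (B := κ * H) h1 h2 ha hb
  have k1 := d1_cont ha; have k2 := d2_cont ha; have k3 := d1_cont hb; have k4 := d2_cont hb
  have hw : ContDiff ℝ 1 fun x => a x ^ 2 + b x ^ 2 := by fun_prop
  have hs : ContDiff ℝ 1 step := step_contDiff (n := 1)
  have cs := hs.continuous
  have hφ : ContDiff ℝ 1 fun x => step (a x ^ 2 + b x ^ 2) := hs.comp hw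
  have e := R.equation hbd hφ
  have dw1 : ∀ x, d1 (fun y => a y ^ 2 + b y ^ 2) x = 2 * (a x * d1 a x + b x * d1 b x) := fun x => by
    rw [d1_add ((cdAt ha x).fun_pow 2) ((cdAt hb x).fun_pow 2), d1_comp (hasDerivAt_pow 2 (a x)) (cdAt ha x),
      d1_comp (hasDerivAt_pow 2 (b x)) (cdAt hb x)]
    push_cast; ring
  have dw2 : ∀ x, d2 (fun y => a y ^ 2 + b y ^ 2) x = 2 * (a x * d2 a x + b x * d2 b x) := fun x => by
    rw [d2_add ((cdAt ha x).fun_pow 2) ((cdAt hb x).fun_pow 2), d2_comp (hasDerivAt_pow 2 (a x)) (cdAt ha x),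
      d2_comp (hasDerivAt_pow 2 (b x)) (cdAt hb x)]
    push_cast; ring
  set G := fun x => κ ^ 2 * (step (a x ^ 2 + b x ^ 2) * ((a x ^ 2 + b x ^ 2) * ((a x ^ 2 + b x ^ 2) - 1))) with hG
  have cG : Continuous G := by simp only [hG]; fun_prop
  have hG0 : ∀ x, 0 ≤ G x := fun x => by
    simp only [hG]
    have hp : 0 ≤ a x ^ 2 + b x ^ 2 := by positivity
    rcases le_or_gt (a x ^ 2 + b x ^ 2) 1 with h | h
    · rw [step_zero h]; simp
    · exact mul_nonneg (sq_nonneg _) (mul_nonneg (step_nonneg _) (mul_nonneg hp (by linarith)))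
  have hle : ∫ x in Ω, G x ≤ 0 := by
    rw [← e]
    refine integral_mono (intOn_of_cont hbd cG) (intOn_of_cont hbd ?_) fun x => ?_
    · have := d1_cont hφ; have := d2_cont hφ
      fun_prop
    · simp only
      rw [d1_comp (step_hasDerivAt _) (cdAt hw x), d2_comp (step_hasDerivAt _) (cdAt hw x), dw1, dw2]
      have t1 := mul_nonneg (step_nonneg (a x ^ 2 + b x ^ 2)) (dsq_nonneg (κ * H) A₁ A₂ a b x)
      have t2 := mul_nonneg (step_deriv_nonneg (a x ^ 2 + b x ^ 2))
        (add_nonneg (sq_nonneg (a x * d1 a x + b x * d1 b x)) (sq_nonneg (a x * d2 a x + b x * d2 b x)))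
      simp only [hG]
      nlinarith
  have hz : ∫ x in Ω, G x = 0 := le_antisymm hle (integral_nonneg hG0)
  have hae := (integral_eq_zero_iff_of_nonneg hG0 (intOn_of_cont hbd cG)).1 hz
  have hE := Measure.eqOn_open_of_ae_eq hae ho cG.continuousOn continuousOn_const
  intro x hx
  by_contra hn
  rw [not_le] at hn
  have h0 : G x = 0 := hE hx
  have : 0 < G x := mul_pos (by positivity) (mul_pos (step_pos hn) (mul_pos (by linarith) (by linarith)))
  linarith

/-- Weighted energy identity. -/
lemma weighted_energy (R : RMin Ω κ H A₁ A₂ a b) (hbd : Bornology.IsBounded Ω) {f : Plane → ℝ}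
    (hf : ContDiff ℝ 1 f) :
    ∫ x in Ω, dsq (κ * H) A₁ A₂ (fun x => f x * a x) (fun x => f x * b x) x =
      ∫ x in Ω, ((d1 f x ^ 2 + d2 f x ^ 2) * (a x ^ 2 + b x ^ 2) +
        κ ^ 2 * (f x ^ 2 * ((a x ^ 2 + b x ^ 2) * (1 - (a x ^ 2 + b x ^ 2))))) := by
  have ha := R.a_smooth; have hb := R.b_smooth; have h1 := R.A₁_smooth; have h2 := R.A₂_smooth
  have ca := ha.continuous; have cb := hb.continuous; have cf := hf.continuous
  have cd := dsq_cont (B := κ * H) h1 h2 ha hb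
  have k1 := d1_cont ha; have k2 := d2_cont ha; have k3 := d1_cont hb; have k4 := d2_cont hb
  have k5 := d1_cont hf; have k6 := d2_cont hf
  have hf2 : ContDiff ℝ 1 fun x => f x ^ 2 := hf.pow 2
  have e := R.equation hbd hf2
  rw [← sub_eq_zero, ← integral_sub (intOn_of_cont hbd (dsq_cont h1 h2 (by fun_prop) (by fun_prop)))
    (intOn_of_cont hbd (by fun_prop)), ← e]
  refine integral_congr_ae (ae_of_all _ fun x => ?_)
  simp only
  rw [dsq_mul _ (cdAt hf x) (cdAt ha x) (cdAt hb x), d1_comp (hasDerivAt_pow 2 (f x)) (cdAt hf x),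
    d2_comp (hasDerivAt_pow 2 (f x)) (cdAt hf x)]
  push_cast; ring

/-- Caccioppoli-type inequality. -/
lemma weighted_gradient (R : RMin Ω κ H A₁ A₂ a b) (hbd : Bornology.IsBounded Ω) {f : Plane → ℝ}
    (hf : ContDiff ℝ 1 f) {M : ℝ} (hM : ∀ x ∈ Ω, d1 f x ^ 2 + d2 f x ^ 2 ≤ M * f x ^ 2) (ho : IsOpen Ω) :
    ∫ x in Ω, f x ^ 2 * dsq (κ * H) A₁ A₂ a b x ≤
      (2 * κ ^ 2 + 4 * M) * ∫ x in Ω, f x ^ 2 * (a x ^ 2 + b x ^ 2) := by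
  have ha := R.a_smooth; have hb := R.b_smooth; have h1 := R.A₁_smooth; have h2 := R.A₂_smooth
  have ca := ha.continuous; have cb := hb.continuous; have cf := hf.continuous
  have cd := dsq_cont (B := κ * H) h1 h2 ha hb
  have k1 := d1_cont ha; have k2 := d2_cont ha; have k3 := d1_cont hb; have k4 := d2_cont hb
  have k5 := d1_cont hf; have k6 := d2_cont hf
  have hf2 : ContDiff ℝ 1 fun x => f x ^ 2 := hf.pow 2
  have k7 := d1_cont hf2; have k8 := d2_cont hf2
  have e := R.equation hbd hf2
  have i1 : IntegrableOn (fun x => f x ^ 2 * dsq (κ * H) A₁ A₂ a b x) Ω := intOn_of_cont hbd (by fun_prop)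
  have i2 : IntegrableOn (fun x => (κ ^ 2 + 2 * M) * (f x ^ 2 * (a x ^ 2 + b x ^ 2))) Ω :=
    intOn_of_cont hbd (by fun_prop)
  have s := integral_sub (i1.const_mul (1 / 2)) i2
  rw [integral_const_mul, integral_const_mul] at s
  suffices hs : ∫ x in Ω, (1 / 2 * (f x ^ 2 * dsq (κ * H) A₁ A₂ a b x) -
      (κ ^ 2 + 2 * M) * (f x ^ 2 * (a x ^ 2 + b x ^ 2))) ≤ 0 by linarith
  rw [← e]
  refine setIntegral_mono_on ((i1.const_mul _).sub i2) (intOn_of_cont hbd (by fun_prop)) ho.measurableSet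
    fun x hx => ?_
  rw [d1_comp (hasDerivAt_pow 2 (f x)) (cdAt hf x), d2_comp (hasDerivAt_pow 2 (f x)) (cdAt hf x)]
  have hr := real_current_sq_le (κ * H) A₁ A₂ a b x
  have hd := dsq_nonneg (κ * H) A₁ A₂ a b x
  have hm := hM x hx
  have hw : 0 ≤ a x ^ 2 + b x ^ 2 := by positivity
  simp only [Nat.cast_ofNat, Nat.add_one_sub_one, pow_one]
  generalize a x * d1 a x + b x * d1 b x = p at *
  generalize a x * d2 a x + b x * d2 b x = q at *
  generalize dsq (κ * H) A₁ A₂ a b x = D at *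
  generalize a x ^ 2 + b x ^ 2 = w at *
  generalize d1 f x = u at *
  generalize d2 f x = v at *
  generalize f x = F at *
  have t1 : (u * p + v * q) ^ 2 ≤ (M * F ^ 2) * (w * D) := by
    calc (u * p + v * q) ^ 2 ≤ (u ^ 2 + v ^ 2) * (p ^ 2 + q ^ 2) := by nlinarith [sq_nonneg (u * q - v * p)]
      _ ≤ _ := mul_le_mul hm hr (by positivity) ((by positivity : 0 ≤ u ^ 2 + v ^ 2).trans hm)
  have hMF : 0 ≤ M * F ^ 2 := (by positivity : 0 ≤ u ^ 2 + v ^ 2).trans hm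
  have t3 : -(F * (u * p + v * q)) ≤ F ^ 2 * (M * w) + F ^ 2 * D / 4 := by
    by_cases hF : F = 0
    · simp [hF]
    have hF2 : 0 < F ^ 2 := by positivity
    have hu : 0 ≤ M := nonneg_of_mul_nonneg_left hMF hF2
    have t4 : (F * (u * p + v * q)) ^ 2 ≤ F ^ 2 * F ^ 2 * (M * (w * D)) := by
      rw [mul_pow]; nlinarith
    have t5 : |F * (u * p + v * q)| ≤ F ^ 2 * (M * w + D / 4) := by
      refine sq_le_sq₀ (abs_nonneg _) ?_ |>.1 ?_
      · have := mul_nonneg hu hw; positivity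
      · rw [sq_abs]
        refine t4.trans ?_
        have := mul_le_mul_of_nonneg_left (by nlinarith [sq_nonneg (M * w - D / 4)] : M * (w * D) ≤ (M * w + D / 4) ^ 2)
          (by positivity : 0 ≤ F ^ 2 * F ^ 2)
        linarith
    have := neg_abs_le (F * (u * p + v * q))
    nlinarith
  have t6 : 0 ≤ κ ^ 2 * F ^ 2 * w ^ 2 := by positivity
  linarith

end RMin

section

open scoped Convolution

/-- Smoothed version of `β`. -/
def mollify (ρ : ContDiffBump (0 : Plane)) (β : Plane → ℝ) : Plane → ℝ :=
  ρ.normed volume ⋆[ContinuousLinearMap.lsmul ℝ ℝ, volume] β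

lemma mollify_contDiff (ρ : ContDiffBump (0 : Plane)) {β : Plane → ℝ} (hβ : Continuous β) :
    ContDiff ℝ 1 (mollify ρ β) :=
  ρ.hasCompactSupport_normed.contDiff_convolution_left (n := 1) _ ρ.contDiff_normed hβ.locallyIntegrable

lemma mollify_fderiv (ρ : ContDiffBump (0 : Plane)) {β G : Plane → ℝ} (hβ : Continuous β) {Ω : Set Plane}
    {v : Plane} (hw : ∀ φ : Plane → ℝ, ContDiff ℝ 1 φ → HasCompactSupport φ → tsupport φ ⊆ Ω →
      ∫ x, β x * fderiv ℝ φ x v = -∫ x, G x * φ x) {x : Plane}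
    (hx : Metric.closedBall x ρ.rOut ⊆ Ω) : fderiv ℝ (mollify ρ β) x v = mollify ρ G x := by
  have hρ : ContDiff ℝ 1 (ρ.normed volume) := ρ.contDiff_normed
  have hd := ρ.hasCompactSupport_normed.hasFDerivAt_convolution_left (μ := volume)
    (ContinuousLinearMap.lsmul ℝ ℝ) hρ hβ.locallyIntegrable x
  have e1 : fderiv ℝ (mollify ρ β) x v = ∫ t, β t * fderiv ℝ (ρ.normed volume) (x - t) v := by
    unfold mollify
    rw [hd.fderiv, convolution_eq_swap, ContinuousLinearMap.integral_apply]
    · refine integral_congr_ae (ae_of_all _ fun t => ?_)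
      simp [mul_comm]
    · have hc : HasCompactSupport (fderiv ℝ (ρ.normed volume)) := ρ.hasCompactSupport_normed.fderiv ℝ
      have := (hc.convolutionExists_left (μ := volume)
        (ContinuousLinearMap.precompL Plane (ContinuousLinearMap.lsmul ℝ ℝ))
        (hρ.continuous_fderiv one_ne_zero) hβ.locallyIntegrable x).integrable_swap
      exact this
  have hsm : ContDiff ℝ 1 fun t => ρ.normed volume (x - t) := hρ.comp (contDiff_const.sub contDiff_id)
  have hts : tsupport (fun t => ρ.normed volume (x - t)) ⊆ Metric.closedBall x ρ.rOut := by
    refine closure_minimal (fun t ht => ?_) Metric.isClosed_closedBall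
    have h2 : x - t ∈ Function.support (ρ.normed volume) := ht
    rw [ρ.support_normed_eq, Metric.mem_ball, dist_zero_right] at h2
    rw [Metric.mem_closedBall, dist_comm, dist_eq_norm]
    exact h2.le
  have hcs : HasCompactSupport fun t => ρ.normed volume (x - t) :=
    (isCompact_closedBall x ρ.rOut).of_isClosed_subset (isClosed_tsupport _) hts
  have e2 := hw _ hsm hcs (hts.trans hx)
  have e3 : ∀ t, fderiv ℝ (fun t => ρ.normed volume (x - t)) t v = -fderiv ℝ (ρ.normed volume) (x - t) v :=
    fun t => by
      have h1 : HasFDerivAt (fun t : Plane => x - t) (-ContinuousLinearMap.id ℝ Plane) t :=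
        (hasFDerivAt_id t).const_sub x
      have h2 := (hρ.differentiable one_ne_zero (x - t)).hasFDerivAt.comp t h1
      have h3 : fderiv ℝ (fun t => ρ.normed volume (x - t)) t = _ := h2.fderiv
      rw [h3]; simp
  simp only [e3, mul_neg, integral_neg, neg_inj] at e2
  rw [e1, e2]
  unfold mollify
  rw [convolution_eq_swap]
  refine integral_congr_ae (ae_of_all _ fun t => ?_)
  simp [mul_comm]

lemma mollify_dist_le (ρ : ContDiffBump (0 : Plane)) {β : Plane → ℝ} (hβ : Continuous β) {x : Plane} {M : ℝ}
    (hM : ∀ y ∈ Metric.ball x ρ.rOut, |β y| ≤ M) : |mollify ρ β x| ≤ 3 * M := by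
  have h := ρ.dist_normed_convolution_le (μ := volume) (x₀ := x) (ε := 2 * M) hβ.aestronglyMeasurable
    (fun y hy => by
      have h1 := hM y hy
      have h2 := hM x (Metric.mem_ball_self ρ.rOut_pos)
      rw [Real.dist_eq]
      have := abs_sub (β y) (β x)
      linarith)
  rw [Real.dist_eq] at h
  have h2 := hM x (Metric.mem_ball_self ρ.rOut_pos)
  have h3 := abs_add_le ((ρ.normed volume ⋆[ContinuousLinearMap.lsmul ℝ ℝ, volume] β) x - β x) (β x)
  rw [sub_add_cancel] at h3
  unfold mollify
  linarith

/-- Chain rule for the square of a function with a continuous weak derivative. -/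
lemma weak_square {β G : Plane → ℝ} (hβ : Continuous β) (hG : Continuous G) {Ω : Set Plane} (ho : IsOpen Ω)
    {v : Plane} (hw : ∀ φ : Plane → ℝ, ContDiff ℝ 1 φ → HasCompactSupport φ → tsupport φ ⊆ Ω →
      ∫ x, β x * fderiv ℝ φ x v = -∫ x, G x * φ x) {Z : Plane → ℝ} (hZ : ContDiff ℝ 1 Z)
    (hZc : HasCompactSupport Z) (hZs : tsupport Z ⊆ Ω) :
    ∫ x, (2 * (β x * G x * Z x) + β x ^ 2 * fderiv ℝ Z x v) = 0 := by
  obtain ⟨δ, hδ, hδΩ⟩ := hZc.isCompact.exists_cthickening_subset_open ho hZs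
  set K := Metric.cthickening δ (tsupport Z) with hK
  have hKc : IsCompact K := hZc.isCompact.cthickening
  obtain ⟨M₁, hM₁⟩ := hKc.bddAbove_image hβ.abs.continuousOn
  obtain ⟨M₂, hM₂⟩ := hKc.bddAbove_image hG.abs.continuousOn
  have hr : ∀ n : ℕ, 0 < δ / ((n : ℝ) + 1) := fun n => by positivity
  let ρ : ℕ → ContDiffBump (0 : Plane) := fun n =>
    ⟨δ / ((n : ℝ) + 1) / 2, δ / ((n : ℝ) + 1), half_pos (hr n), half_lt_self (hr n)⟩
  have hrδ : ∀ n, (ρ n).rOut ≤ δ := fun n => by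
    show δ / ((n : ℝ) + 1) ≤ δ
    exact div_le_self hδ.le (by have : (0 : ℝ) ≤ n := n.cast_nonneg; linarith)
  have hρ0 : Tendsto (fun n => (ρ n).rOut) atTop (𝓝 0) := by
    show Tendsto (fun n : ℕ => δ / ((n : ℝ) + 1)) atTop (𝓝 0)
    exact tendsto_const_nhds.div_atTop (tendsto_natCast_atTop_atTop.atTop_add tendsto_const_nhds)
  have hball : ∀ n, ∀ x ∈ tsupport Z, Metric.closedBall x (ρ n).rOut ⊆ K := fun n x hx =>
    (Metric.closedBall_subset_closedBall (hrδ n)).trans (Metric.closedBall_subset_cthickening hx δ)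
  have hZ0 : ∀ x, x ∉ tsupport Z → Z x = 0 := fun x hx => image_eq_zero_of_notMem_tsupport hx
  have hdZ0 : ∀ x, x ∉ tsupport Z → fderiv ℝ Z x = 0 := fun x hx =>
    fderiv_of_notMem_tsupport ℝ hx
  have cZ := hZ.continuous
  have cdZ : Continuous fun x => fderiv ℝ Z x v := (hZ.continuous_fderiv one_ne_zero).clm_apply continuous_const
  have hdc : HasCompactSupport fun x => fderiv ℝ Z x v := hZc.fderiv_apply ℝ v
  have key : ∀ n, ∫ x, (β x * (mollify (ρ n) β x * fderiv ℝ Z x v) + β x * (mollify (ρ n) G x * Z x) +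
      G x * (mollify (ρ n) β x * Z x)) = 0 := fun n => by
    have hm := mollify_contDiff (ρ n) hβ
    have hmG := (mollify_contDiff (ρ n) hG).continuous
    have e := hw _ (hm.mul hZ) hZc.mul_left ((tsupport_mul_subset_right).trans hZs)
    have e2 : ∀ x, fderiv ℝ (fun y => mollify (ρ n) β y * Z y) x v =
        mollify (ρ n) β x * fderiv ℝ Z x v + mollify (ρ n) G x * Z x := fun x => by
      rw [fderiv_fun_mul (hm.differentiable one_ne_zero x) (hZ.differentiable one_ne_zero x)]
      simp only [add_apply, smul_apply, smul_eq_mul]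
      by_cases hx : x ∈ tsupport Z
      · rw [mollify_fderiv (ρ n) hβ hw ((hball n x hx).trans hδΩ)]; ring
      · rw [hZ0 x hx]; ring
    have cm := hm.continuous
    rw [← sub_eq_zero, sub_neg_eq_add, ← integral_add] at e
    · rw [← e]
      refine integral_congr_ae (ae_of_all _ fun x => ?_)
      simp only [e2 x]; ring
    · have : (fun x => β x * fderiv ℝ (fun y => mollify (ρ n) β y * Z y) x v) = fun x =>
          β x * (mollify (ρ n) β x * fderiv ℝ Z x v + mollify (ρ n) G x * Z x) := by
        funext x; rw [← e2]
      rw [this]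
      refine Continuous.integrable_of_hasCompactSupport (by fun_prop) ?_
      exact (hdc.mul_left.add hZc.mul_left).mul_left
    · refine Continuous.integrable_of_hasCompactSupport (by fun_prop) ?_
      exact hZc.mul_left.mul_left
  have hlim : Tendsto (fun n => ∫ x, (β x * (mollify (ρ n) β x * fderiv ℝ Z x v) +
      β x * (mollify (ρ n) G x * Z x) + G x * (mollify (ρ n) β x * Z x))) atTop
      (𝓝 (∫ x, (β x * (β x * fderiv ℝ Z x v) + β x * (G x * Z x) + G x * (β x * Z x)))) := by
    refine tendsto_integral_of_dominated_convergence (fun x => |β x| * (3 * M₁ * |fderiv ℝ Z x v|) +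
      |β x| * (3 * M₂ * |Z x|) + |G x| * (3 * M₁ * |Z x|)) (fun n => ?_) ?_ (fun n => ae_of_all _ fun x => ?_)
      (ae_of_all _ fun x => ?_)
    · have := (mollify_contDiff (ρ n) hβ).continuous
      have := (mollify_contDiff (ρ n) hG).continuous
      exact Continuous.aestronglyMeasurable (by fun_prop)
    · refine Continuous.integrable_of_hasCompactSupport (by fun_prop) ?_
      have h1 : HasCompactSupport fun x => |Z x| := hZc.comp_left (g := fun t : ℝ => |t|) abs_zero
      have h2 : HasCompactSupport fun x => |fderiv ℝ Z x v| := hdc.comp_left (g := fun t : ℝ => |t|) abs_zero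
      exact (h2.mul_left.mul_left.add h1.mul_left.mul_left).add h1.mul_left.mul_left
    · by_cases hx : x ∈ tsupport Z
      · have b1 := mollify_dist_le (ρ n) hβ (x := x) (M := M₁) fun y hy =>
          hM₁ ⟨y, hball n x hx (Metric.ball_subset_closedBall hy), rfl⟩
        have b2 := mollify_dist_le (ρ n) hG (x := x) (M := M₂) fun y hy =>
          hM₂ ⟨y, hball n x hx (Metric.ball_subset_closedBall hy), rfl⟩
        refine (norm_add₃_le).trans (add_le_add (add_le_add ?_ ?_) ?_)
        all_goals
          rw [Real.norm_eq_abs, abs_mul, abs_mul]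
          gcongr
      · simp [hZ0 x hx, hdZ0 x hx]
    · have t1 := ContDiffBump.convolution_tendsto_right_of_continuous (μ := volume) hρ0 hβ x
      have t2 := ContDiffBump.convolution_tendsto_right_of_continuous (μ := volume) hρ0 hG x
      exact (((t1.mul_const _).const_mul _).add ((t2.mul_const _).const_mul _)).add
        ((t1.mul_const _).const_mul _)
  simp only [key] at hlim
  have := tendsto_nhds_unique hlim tendsto_const_nhds
  rw [← this]
  refine integral_congr_ae (ae_of_all _ fun x => ?_)
  ring

end

lemma setIntegral_test {Ω : Set Plane} {g φ : Plane → ℝ} {h : Plane → ℝ}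
    (hs : tsupport φ ⊆ Ω) {v : Plane} (hg : ∀ x, φ x = 0 → fderiv ℝ φ x = 0 → g x = h x * fderiv ℝ φ x v) :
    ∫ x, g x = ∫ x in Ω, g x := by
  refine (setIntegral_eq_integral_of_forall_compl_eq_zero fun x hx => ?_).symm
  have hx' : x ∉ tsupport φ := fun h => hx (hs h)
  have h1 : fderiv ℝ φ x = 0 := image_eq_zero_of_notMem_tsupport fun h => hx' (tsupport_fderiv_subset ℝ h)
  rw [hg x (image_eq_zero_of_notMem_tsupport hx') h1, h1]; simp

namespace Wall
variable {Ω : Set Plane} {T : Plane → ℝ}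

lemma tendsto_cut_mul (W : Wall Ω T) {F : Plane → ℝ} (hF : Continuous F) :
    Tendsto (fun n : ℕ => ∫ x in Ω, cut Ω T (1 / ((n : ℝ) + 1)) x * F x) atTop (𝓝 (∫ x in Ω, F x)) := by
  obtain ⟨M, hM0, hM⟩ := bound_of_cont W.bdd hF
  have hfin : IsFiniteMeasure (volume.restrict Ω) :=
    ⟨by simpa using W.bdd.measure_lt_top⟩
  have hpos : ∀ n : ℕ, (0 : ℝ) < 1 / ((n : ℝ) + 1) := fun n => Nat.one_div_pos_of_nat
  refine tendsto_integral_of_dominated_convergence (fun _ => M)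
    (fun n => ((W.cut_contDiff (hpos n)).continuous.mul hF).aestronglyMeasurable)
    (integrable_const _) (fun n => ?_) ?_
  · refine (ae_restrict_iff' W.isOpen.measurableSet).2 (ae_of_all _ fun x hx => ?_)
    rw [cut_of_mem hx, Real.norm_eq_abs, abs_mul, abs_of_nonneg (step_nonneg _)]
    have := hM x (subset_closure hx)
    nlinarith [step_le_one (T x / (1 / ((n : ℝ) + 1))), step_nonneg (T x / (1 / ((n : ℝ) + 1))), abs_nonneg (F x)]
  · refine (ae_restrict_iff' W.isOpen.measurableSet).2 (ae_of_all _ fun x hx => ?_)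
    have hT := W.pos x hx
    apply tendsto_const_nhds.congr'
    have : ∀ᶠ n : ℕ in atTop, 2 / T x < (n : ℝ) :=
      (tendsto_natCast_atTop_atTop (R := ℝ)).eventually (eventually_gt_atTop _)
    filter_upwards [this] with n hn
    rw [div_lt_iff₀ hT] at hn
    have h2 : 2 < T x / (1 / ((n : ℝ) + 1)) := by
      rw [div_div_eq_mul_div, div_one]; nlinarith
    rw [cut_of_mem hx, step_one h2.le, one_mul]

/-- The boundary layers carry bounded mass. -/
lemma layer_le (W : Wall Ω T) (hT : ContDiff ℝ 2 T) : ∃ D, ∀ ε > 0,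
    ∫ x in Ω, deriv step (T x / ε) / ε * (d1 T x ^ 2 + d2 T x ^ 2) ≤ D := by
  have hd : ∀ v : Plane, ContDiff ℝ 1 fun x => fderiv ℝ T x v := fun v =>
    (hT.fderiv_right (m := 1) (by norm_num)).clm_apply contDiff_const
  have h1 : ContDiff ℝ 1 (d1 T) := hd _
  have h2 : ContDiff ℝ 1 (d2 T) := hd _
  refine ⟨∫ x in Ω, |d1 (d1 T) x + d2 (d2 T) x|, fun ε hε => ?_⟩
  have e := W.cut_div h1 h2 hε
  have k1 := d1_cont h1; have k2 := d2_cont h2; have k3 := h1.continuous; have k4 := h2.continuous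
  have k5 := (W.cut_contDiff hε).continuous
  have k6 := W.smooth.continuous
  have k7 := step_deriv_cont
  have i1 : IntegrableOn (fun x => cut Ω T ε x * (d1 (d1 T) x + d2 (d2 T) x)) Ω :=
    intOn_of_cont W.bdd (by fun_prop)
  have i2 : IntegrableOn (fun x => deriv step (T x / ε) / ε * (d1 T x * d1 T x + d2 T x * d2 T x)) Ω :=
    intOn_of_cont W.bdd (by fun_prop)
  rw [integral_add i1 i2] at e
  have e2 : ∫ x in Ω, deriv step (T x / ε) / ε * (d1 T x ^ 2 + d2 T x ^ 2) =
      ∫ x in Ω, deriv step (T x / ε) / ε * (d1 T x * d1 T x + d2 T x * d2 T x) := by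
    simp only [sq]
  have e3 : -∫ x in Ω, cut Ω T ε x * (d1 (d1 T) x + d2 (d2 T) x) ≤
      ∫ x in Ω, |d1 (d1 T) x + d2 (d2 T) x| := by
    rw [← integral_neg]
    refine setIntegral_mono_on i1.neg (intOn_of_cont W.bdd (by fun_prop)) W.isOpen.measurableSet
      fun x hx => ?_
    rw [cut_of_mem hx]
    have := neg_abs_le (d1 (d1 T) x + d2 (d2 T) x)
    nlinarith [step_le_one (T x / ε), step_nonneg (T x / ε), abs_nonneg (d1 (d1 T) x + d2 (d2 T) x)]
  linarith

/-- Divergence identity for the square of a field whose weak gradient is continuous and which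
satisfies a homogeneous Dirichlet condition in the weak sense. -/
lemma square_div (W : Wall Ω T) (hT : ContDiff ℝ 2 T) {t₁ : ℝ} (ht₁ : 0 < t₁)
    (hg : ∀ x ∈ Ω, T x < t₁ → d1 T x ^ 2 + d2 T x ^ 2 = 1) {β G₁ G₂ : Plane → ℝ}
    (hβ : Continuous β) (hG1 : Continuous G₁) (hG2 : Continuous G₂)
    (hw : ∀ Y₁ Y₂ : Plane → ℝ, ContDiff ℝ 1 Y₁ → ContDiff ℝ 1 Y₂ →
      ∫ x in Ω, β x * (d1 Y₁ x + d2 Y₂ x) = -∫ x in Ω, (G₁ x * Y₁ x + G₂ x * Y₂ x))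
    {Z₁ Z₂ : Plane → ℝ} (hZ1 : ContDiff ℝ 1 Z₁) (hZ2 : ContDiff ℝ 1 Z₂) :
    ∫ x in Ω, (2 * (β x * (G₁ x * Z₁ x + G₂ x * Z₂ x)) + β x ^ 2 * (d1 Z₁ x + d2 Z₂ x)) = 0 := by
  have hbd := W.bdd
  have hcT := W.smooth
  have cT := hcT.continuous; have cT1 := d1_cont hcT; have cT2 := d2_cont hcT
  have cZ1 := hZ1.continuous; have cZ2 := hZ2.continuous
  have cd1 := d1_cont hZ1; have cd2 := d2_cont hZ2
  have csd := step_deriv_cont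
  set F := fun x => 2 * (β x * (G₁ x * Z₁ x + G₂ x * Z₂ x)) + β x ^ 2 * (d1 Z₁ x + d2 Z₂ x) with hF
  have cF : Continuous F := by simp only [hF]; fun_prop
  set N : ℝ → Plane → ℝ := fun ε x => deriv step (T x / ε) / ε * (Z₁ x * d1 T x + Z₂ x * d2 T x) with hN
  have cN : ∀ ε, Continuous (N ε) := fun ε => by simp only [hN]; fun_prop
  -- the identity for fields cut off near the wall
  have hcut : ∀ ε > 0, ∫ x in Ω, cut Ω T ε x * F x = -∫ x in Ω, β x ^ 2 * N ε x := fun ε hε => by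
    have hc := W.cut_contDiff hε
    have cc := hc.continuous
    have hcs := W.cut_hasCompactSupport ε
    have hts : tsupport (cut Ω T ε) ⊆ Ω := fun x hx => by
      by_contra h
      exact (notMem_tsupport_iff_eventuallyEq.2 (W.cut_nhds_zero hε h)) hx
    have e1 := weak_square hβ hG1 W.isOpen (v := ((1 : ℝ), (0 : ℝ))) (fun φ hφ _ hφs => by
      rw [setIntegral_test (h := β) (v := (1, 0)) hφs fun _ _ _ => rfl,
        setIntegral_test (h := fun _ => 0) (v := 0) hφs fun _ h _ => by simp [h]]
      have := hw φ (fun _ => 0) hφ contDiff_const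
      simpa [d2_const, d1] using this)
      (hc.mul hZ1) hcs.mul_right ((tsupport_mul_subset_left).trans hts)
    have e2 := weak_square hβ hG2 W.isOpen (v := ((0 : ℝ), (1 : ℝ))) (fun φ hφ _ hφs => by
      rw [setIntegral_test (h := β) (v := (0, 1)) hφs fun _ _ _ => rfl,
        setIntegral_test (h := fun _ => 0) (v := 0) hφs fun _ h _ => by simp [h]]
      have := hw (fun _ => 0) φ contDiff_const hφ
      simpa [d1_const, d2] using this)
      (hc.mul hZ2) hcs.mul_right ((tsupport_mul_subset_left).trans hts)
    rw [setIntegral_test (h := fun x => β x ^ 2) (v := (1, 0)) ((tsupport_mul_subset_left).trans hts)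
      fun x h _ => by rw [h]; ring] at e1
    rw [setIntegral_test (h := fun x => β x ^ 2) (v := (0, 1)) ((tsupport_mul_subset_left).trans hts)
      fun x h _ => by rw [h]; ring] at e2
    have l1 := d1_cont (hc.mul hZ1); have l2 := d2_cont (hc.mul hZ2)
    have e3 : ∫ x in Ω, (2 * (β x * G₁ x * (cut Ω T ε x * Z₁ x)) +
        β x ^ 2 * d1 (fun y => cut Ω T ε y * Z₁ y) x) = 0 := e1
    have e4 : ∫ x in Ω, (2 * (β x * G₂ x * (cut Ω T ε x * Z₂ x)) +
        β x ^ 2 * d2 (fun y => cut Ω T ε y * Z₂ y) x) = 0 := e2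
    have cNε := cN ε
    rw [eq_neg_iff_add_eq_zero, ← integral_add (intOn_of_cont hbd (by fun_prop))
      (intOn_of_cont hbd (by fun_prop))]
    rw [← add_zero (0 : ℝ)]; nth_rewrite 1 [← e3]; rw [← e4, ← integral_add
      (intOn_of_cont hbd (by fun_prop)) (intOn_of_cont hbd (by fun_prop))]
    refine setIntegral_congr_fun W.isOpen.measurableSet fun x hx => ?_
    simp only [hF, hN]
    rw [d1_mul (cdAt hc x) (cdAt hZ1 x), d2_mul (cdAt hc x) (cdAt hZ2 x), W.cut_d1 hx, W.cut_d2 hx]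
    ring
  have hpos : ∀ n : ℕ, (0 : ℝ) < 1 / ((n : ℝ) + 1) := fun n => Nat.one_div_pos_of_nat
  -- smooth approximations of the field do not see the boundary layer
  have happ : ∀ b : Plane → ℝ, ContDiff ℝ 1 b →
      Tendsto (fun n : ℕ => ∫ x in Ω, β x * b x * N (1 / ((n : ℝ) + 1)) x) atTop (𝓝 0) := fun b hb => by
    have cb := hb.continuous
    have hb1 := hb.mul hZ1; have hb2 := hb.mul hZ2
    have l1 := d1_cont hb1; have l2 := d2_cont hb2
    set E := fun x => β x * (d1 (fun y => b y * Z₁ y) x + d2 (fun y => b y * Z₂ y) x) +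
      b x * (G₁ x * Z₁ x + G₂ x * Z₂ x) with hE
    have cE : Continuous E := by simp only [hE]; fun_prop
    have ht := (tendsto_const_nhds (x := ∫ x in Ω, E x) (f := atTop)).sub (W.tendsto_cut_mul cE)
    rw [sub_self] at ht
    refine ht.congr fun n => ?_
    set ε := 1 / ((n : ℝ) + 1)
    have hε : 0 < ε := hpos n
    have hc := W.cut_contDiff hε
    have cc := hc.continuous
    have hc1 : ContDiff ℝ 1 fun x => 1 - cut Ω T ε x := contDiff_const.sub hc
    have hY1 : ContDiff ℝ 1 fun x => (1 - cut Ω T ε x) * (b x * Z₁ x) := hc1.mul hb1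
    have hY2 : ContDiff ℝ 1 fun x => (1 - cut Ω T ε x) * (b x * Z₂ x) := hc1.mul hb2
    have h := hw _ _ hY1 hY2
    have l3 := d1_cont hY1; have l4 := d2_cont hY2
    have cNε := cN ε
    rw [eq_neg_iff_add_eq_zero, ← integral_add (intOn_of_cont hbd (by fun_prop))
      (intOn_of_cont hbd (by fun_prop))] at h
    rw [← integral_sub (intOn_of_cont hbd cE) (intOn_of_cont hbd (by fun_prop)), ← sub_eq_zero,
      ← integral_sub (intOn_of_cont hbd (by fun_prop)) (intOn_of_cont hbd (by fun_prop)), ← h]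
    refine setIntegral_congr_fun W.isOpen.measurableSet fun x hx => ?_
    simp only [hE, hN]
    have z1 : d1 (fun y => 1 - cut Ω T ε y) x = -d1 (cut Ω T ε) x := by
      rw [d1_sub (by fun_prop) (cdAt hc x), d1_const, zero_sub]
    have z2 : d2 (fun y => 1 - cut Ω T ε y) x = -d2 (cut Ω T ε) x := by
      rw [d2_sub (by fun_prop) (cdAt hc x), d2_const, zero_sub]
    rw [d1_mul (cdAt hc1 x) (cdAt hb1 x), d2_mul (cdAt hc1 x) (cdAt hb2 x), z1, z2, W.cut_d1 hx, W.cut_d2 hx]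
    ring
  obtain ⟨D, hD⟩ := W.layer_le hT
  obtain ⟨M, hM0, hM⟩ := bound_of_cont hbd (f := fun x => |β x| * (|Z₁ x| + |Z₂ x|)) (by fun_prop)
  have hD0 : 0 ≤ D := le_trans (integral_nonneg fun x => by
    have := step_deriv_nonneg (T x / 1); simp only [Pi.zero_apply]; positivity) (hD 1 one_pos)
  have hFt := W.tendsto_cut_mul cF
  have key : ∀ δ > 0, |∫ x in Ω, F x| ≤ δ * (M * D) := fun δ hδ => by
    obtain ⟨b, hb, hbδ, -⟩ := hβ.exists_contDiff_approx (n := 1) (ε := fun _ => δ) continuous_const fun _ => hδ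
    have cb := hb.continuous
    have hlim := (happ b hb).abs.add_const (δ * (M * D))
    rw [abs_zero, zero_add] at hlim
    refine le_of_tendsto_of_tendsto hFt.abs hlim ?_
    have hev : ∀ᶠ n : ℕ in atTop, 2 / t₁ < (n : ℝ) :=
      (tendsto_natCast_atTop_atTop (R := ℝ)).eventually (eventually_gt_atTop _)
    filter_upwards [hev] with n hn
    have hε : 0 < 1 / ((n : ℝ) + 1) := hpos n
    have hεt : 2 * (1 / ((n : ℝ) + 1)) < t₁ := by
      rw [div_lt_iff₀ ht₁] at hn
      rw [mul_one_div, div_lt_iff₀ (by positivity)]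
      linarith
    generalize 1 / ((n : ℝ) + 1) = ε at *
    have cNε := cN ε
    rw [hcut ε hε, abs_neg]
    have i1 : IntegrableOn (fun x => β x * b x * N ε x) Ω := intOn_of_cont hbd (by fun_prop)
    have i2 : IntegrableOn (fun x => β x ^ 2 * N ε x) Ω := intOn_of_cont hbd (by fun_prop)
    have hdiff : |(∫ x in Ω, β x ^ 2 * N ε x) - ∫ x in Ω, β x * b x * N ε x| ≤ δ * (M * D) := by
      rw [← integral_sub i2 i1]
      refine (abs_integral_le_integral_abs).trans ?_
      calc _ ≤ ∫ x in Ω, δ * M * (deriv step (T x / ε) / ε * (d1 T x ^ 2 + d2 T x ^ 2)) := by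
            refine setIntegral_mono_on (intOn_of_cont hbd (by fun_prop)) (intOn_of_cont hbd (by fun_prop))
              W.isOpen.measurableSet fun x hx => ?_
            have hs0 := step_deriv_nonneg (T x / ε)
            by_cases h : 2 < T x / ε
            · simp only [hN]; rw [step_deriv_zero_right h]; simp
            · rw [not_lt, div_le_iff₀ hε] at h
              have hg1 := hg x hx (by linarith)
              have a1 : |d1 T x| ≤ 1 := by
                rw [← sq_le_one_iff_abs_le_one]; nlinarith [sq_nonneg (d2 T x)]
              have a2 : |d2 T x| ≤ 1 := by
                rw [← sq_le_one_iff_abs_le_one]; nlinarith [sq_nonneg (d1 T x)]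
              rw [hg1, mul_one]
              have hbx : |β x - b x| ≤ δ := by
                have := (hbδ x).le; rwa [Real.dist_eq, abs_sub_comm] at this
              have hMx := (le_abs_self _).trans (hM x (subset_closure hx))
              have hz : |Z₁ x * d1 T x + Z₂ x * d2 T x| ≤ |Z₁ x| + |Z₂ x| := by
                refine (abs_add_le _ _).trans ?_
                rw [abs_mul, abs_mul]
                exact add_le_add (mul_le_of_le_one_right (abs_nonneg _) a1)
                  (mul_le_of_le_one_right (abs_nonneg _) a2)
              have e : β x ^ 2 * N ε x - β x * b x * N ε x =
                  (β x - b x) * (β x * (Z₁ x * d1 T x + Z₂ x * d2 T x)) * (deriv step (T x / ε) / ε) := by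
                simp only [hN]; ring
              rw [e, abs_mul, abs_mul, abs_mul, abs_of_nonneg (div_nonneg hs0 hε.le)]
              refine mul_le_mul_of_nonneg_right ?_ (div_nonneg hs0 hε.le)
              refine mul_le_mul hbx ?_ (by positivity) hδ.le
              exact le_trans (mul_le_mul_of_nonneg_left hz (abs_nonneg _)) hMx
        _ ≤ δ * (M * D) := by
            rw [integral_const_mul, mul_assoc]
            exact mul_le_mul_of_nonneg_left (mul_le_mul_of_nonneg_left (hD ε hε) hM0.le) hδ.le
    have := abs_sub_abs_le_abs_sub (∫ x in Ω, β x ^ 2 * N ε x) (∫ x in Ω, β x * b x * N ε x)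
    linarith
  have hlim : Tendsto (fun δ : ℝ => δ * (M * D)) (𝓝[>] 0) (𝓝 0) := by
    have : Tendsto (fun δ : ℝ => δ * (M * D)) (𝓝 0) (𝓝 (0 * (M * D))) :=
      (continuous_id.mul continuous_const).tendsto 0
    rw [zero_mul] at this
    exact this.mono_left nhdsWithin_le_nhds
  have := ge_of_tendsto hlim (eventually_nhdsWithin_of_forall fun δ hδ => key δ hδ)
  exact abs_nonpos_iff.1 this

end Wall

/-- A globally smooth and positive substitute for `t + δ`. -/
def tau (δ t : ℝ) : ℝ := t + √(t ^ 2 + δ ^ 2)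

lemma tau_pos {δ : ℝ} (hδ : 0 < δ) (t : ℝ) : 0 < tau δ t := by
  have h : |t| < √(t ^ 2 + δ ^ 2) := Real.lt_sqrt_of_sq_lt (by rw [sq_abs]; nlinarith)
  have := neg_abs_le t
  unfold tau; linarith

lemma tau_bounds {δ t : ℝ} (hδ : 0 < δ) (ht : 0 ≤ t) : t ≤ tau δ t ∧ δ ≤ tau δ t ∧ tau δ t ≤ 2 * t + δ := by
  have h1 : δ ≤ √(t ^ 2 + δ ^ 2) := Real.le_sqrt_of_sq_le (by nlinarith)
  have h2 : √(t ^ 2 + δ ^ 2) ≤ t + δ := Real.sqrt_le_iff.2 ⟨by linarith, by nlinarith⟩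
  unfold tau
  exact ⟨by linarith, by linarith, by linarith⟩

lemma tau_contDiff {δ : ℝ} (hδ : 0 < δ) {n : ℕ∞} : ContDiff ℝ n (tau δ) := by
  unfold tau
  exact contDiff_id.add (ContDiff.sqrt (by fun_prop) fun t => by positivity)

lemma tau_hasDerivAt {δ : ℝ} (hδ : 0 < δ) {t : ℝ} (ht : 0 ≤ t) : ∃ e, 1 ≤ e ∧ HasDerivAt (tau δ) e t := by
  have hp : t ^ 2 + δ ^ 2 ≠ 0 := by positivity
  refine ⟨_, ?_, (hasDerivAt_id t).fun_add (((hasDerivAt_pow 2 t).add_const (δ ^ 2)).sqrt hp)⟩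
  have : 0 ≤ ((2 : ℕ) : ℝ) * t ^ (2 - 1) / (2 * √(t ^ 2 + δ ^ 2)) := by simp; positivity
  linarith

lemma hardy_weight {δ t₂ : ℝ} (hδ : 0 < δ) (ht₂ : 0 < t₂) {t : ℝ} (ht : 0 ≤ t) :
    ∃ e, e ≤ -((1 - step (t / t₂)) ^ 2 / tau δ t ^ 2) ∧ (2 * t₂ ≤ t → e = 0) ∧
      HasDerivAt (fun t => (1 - step (t / t₂)) ^ 2 / tau δ t) e t := by
  obtain ⟨e, he, hd⟩ := tau_hasDerivAt hδ ht
  have hs : HasDerivAt (fun t => 1 - step (t / t₂)) (-(deriv step (t / t₂) / t₂)) t := by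
    have := ((step_hasDerivAt (t / t₂)).comp t ((hasDerivAt_id t).div_const t₂)).const_sub 1
    refine this.congr_deriv ?_
    ring
  have hτ := tau_pos hδ t
  have hτ0 : tau δ t ≠ 0 := hτ.ne'
  refine ⟨_, ?_, fun (h : 2 * t₂ ≤ t) => ?_, (hs.fun_pow 2).fun_div hd hτ0⟩
  · have h1 := step_deriv_nonneg (t / t₂)
    have h2 : 0 ≤ 1 - step (t / t₂) := by linarith [step_le_one (t / t₂)]
    rw [← neg_div (tau δ t ^ 2)]
    rw [div_le_div_iff_of_pos_right (pow_pos hτ 2)]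
    have h3 : 0 ≤ deriv step (t / t₂) / t₂ := by positivity
    generalize deriv step (t / t₂) / t₂ = p at *
    generalize 1 - step (t / t₂) = q at *
    have h4 : 0 ≤ q * p * tau δ t := by positivity
    have h5 : 0 ≤ q ^ 2 * (e - 1) := mul_nonneg (by positivity) (by linarith)
    push_cast
    nlinarith
  · have : step (t / t₂) = 1 := step_one (by rw [le_div_iff₀ ht₂]; exact h)
    rw [this]; simp

lemma hardy_pointwise {β f χ τ e p q u v f1 f2 l1 l2 D : ℝ} (hτ : 0 < τ) (hf : 0 ≤ f)
    (hgr : p ^ 2 + q ^ 2 = 1) (hfx : f1 * p + f2 * q ≤ 0) (hL : l1 + l2 ≤ D) (hDτ : D * τ ≤ 1 / 2)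
    (hχ : χ ^ 2 ≤ 1) (he : e ≤ -(χ ^ 2 / τ ^ 2)) :
    2 * (β * (u * (f ^ 2 * (χ ^ 2 / τ) * p) + v * (f ^ 2 * (χ ^ 2 / τ) * q))) +
      β ^ 2 * ((2 * f * f1 * (χ ^ 2 / τ) + f ^ 2 * (e * p)) * p + f ^ 2 * (χ ^ 2 / τ) * l1 +
        ((2 * f * f2 * (χ ^ 2 / τ) + f ^ 2 * (e * q)) * q + f ^ 2 * (χ ^ 2 / τ) * l2)) ≤
      4 * ((u ^ 2 + v ^ 2) * f ^ 2) - 1 / 4 * (β ^ 2 * (f ^ 2 * χ ^ 2 / τ ^ 2)) := by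
  set y := f * χ / τ with hy
  have e1 : f ^ 2 * χ ^ 2 / τ ^ 2 = y ^ 2 := by rw [hy]; field_simp
  have e2 : f ^ 2 * (χ ^ 2 / τ) = y ^ 2 * τ := by rw [hy]; field_simp
  have e3 : f ^ 2 * (χ ^ 2 / τ ^ 2) = y ^ 2 := by rw [hy]; field_simp
  have hdiv : (2 * f * f1 * (χ ^ 2 / τ) + f ^ 2 * (e * p)) * p + f ^ 2 * (χ ^ 2 / τ) * l1 +
      ((2 * f * f2 * (χ ^ 2 / τ) + f ^ 2 * (e * q)) * q + f ^ 2 * (χ ^ 2 / τ) * l2) ≤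
      -(1 / 2) * y ^ 2 := by
    have r1 : 2 * f * (χ ^ 2 / τ) * (f1 * p + f2 * q) ≤ 0 :=
      mul_nonpos_of_nonneg_of_nonpos (by positivity) hfx
    have r2 : f ^ 2 * e ≤ -y ^ 2 := by
      rw [← e3, ← mul_neg]; exact mul_le_mul_of_nonneg_left he (by positivity)
    have r3 : y ^ 2 * τ * (l1 + l2) ≤ y ^ 2 * (1 / 2) := by
      rw [mul_assoc]
      refine mul_le_mul_of_nonneg_left ?_ (by positivity)
      exact le_trans (mul_le_mul_of_nonneg_left hL hτ.le) (by rw [mul_comm]; exact hDτ)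
    calc _ = 2 * f * (χ ^ 2 / τ) * (f1 * p + f2 * q) + f ^ 2 * e * (p ^ 2 + q ^ 2) +
          f ^ 2 * (χ ^ 2 / τ) * (l1 + l2) := by ring
      _ ≤ _ := by rw [hgr, e2]; linarith
  have hb := mul_le_mul_of_nonneg_left hdiv (sq_nonneg β)
  have hcs : (u * p + v * q) ^ 2 ≤ u ^ 2 + v ^ 2 := by
    calc _ ≤ (u * p + v * q) ^ 2 + (u * q - v * p) ^ 2 := by linarith [sq_nonneg (u * q - v * p)]
      _ = (u ^ 2 + v ^ 2) * (p ^ 2 + q ^ 2) := by ring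
      _ = _ := by rw [hgr, mul_one]
  have hyf : f * χ = y * τ := by rw [hy]; field_simp
  have h4 : (f * χ * (u * p + v * q)) ^ 2 ≤ (u ^ 2 + v ^ 2) * f ^ 2 := by
    rw [mul_pow, mul_pow]
    calc _ ≤ f ^ 2 * 1 * (u ^ 2 + v ^ 2) := by gcongr
      _ = _ := by ring
  have h5 : 2 * (β * (u * (f ^ 2 * (χ ^ 2 / τ) * p) + v * (f ^ 2 * (χ ^ 2 / τ) * q))) =
      2 * (β * y) * (f * χ * (u * p + v * q)) := by rw [e2, hyf]; ring
  have h6 := sq_nonneg (β * y / 2 - 2 * (f * χ * (u * p + v * q)))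
  rw [e1, h5]
  clear_value y
  generalize f * χ * (u * p + v * q) = r at *
  linarith

set_option maxHeartbeats 1000000 in
/-- Weighted Hardy inequality at the wall. -/
theorem Geo.hardy {Ω : Set Plane} (g : Geo Ω) : ∃ t₂ > 0, 8 * t₂ ≤ g.t₁ ∧ ∀ δ > 0, δ ≤ t₂ →
    ∀ f β G₁ G₂ : Plane → ℝ, ContDiff ℝ 1 f → Continuous β → Continuous G₁ → Continuous G₂ →
    (∀ Y₁ Y₂ : Plane → ℝ, ContDiff ℝ 1 Y₁ → ContDiff ℝ 1 Y₂ →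
      ∫ x in Ω, β x * (d1 Y₁ x + d2 Y₂ x) = -∫ x in Ω, (G₁ x * Y₁ x + G₂ x * Y₂ x)) →
    (∀ x ∈ Ω, 0 ≤ f x) →
    (∀ x ∈ Ω, g.T x < g.t₁ → d1 f x * d1 g.T x + d2 f x * d2 g.T x ≤ 0) →
    (∀ x ∈ Ω, t₂ ≤ g.T x → f x = 1) →
    ∫ x in Ω, β x ^ 2 * (f x ^ 2 / tau δ (g.T x) ^ 2) ≤
      16 * (∫ x in Ω, (G₁ x ^ 2 + G₂ x ^ 2) * f x ^ 2) + 1 / t₂ ^ 2 * ∫ x in Ω, β x ^ 2 := by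
  have hbd := g.wall.bdd
  have hd : ∀ v : Plane, ContDiff ℝ 1 fun x => fderiv ℝ g.T x v := fun v =>
    (g.T_smooth.fderiv_right (m := 1) (by norm_num)).clm_apply contDiff_const
  have hT1 : ContDiff ℝ 1 (d1 g.T) := hd _
  have hT2 : ContDiff ℝ 1 (d2 g.T) := hd _
  have hT := g.wall.smooth
  obtain ⟨D, hD0, hD⟩ := bound_of_cont hbd ((d1_cont hT1).add (d2_cont hT2))
  have ht₁ := g.t₁_pos
  obtain ⟨t₂, ht₂, h8, hDt⟩ : ∃ t₂ > 0, 8 * t₂ ≤ g.t₁ ∧ D * (5 * t₂) ≤ 1 / 2 := by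
    refine ⟨min (g.t₁ / 8) (1 / (10 * D)), lt_min (by positivity) (by positivity), ?_, ?_⟩
    · linarith [min_le_left (g.t₁ / 8) (1 / (10 * D))]
    · calc _ ≤ D * (5 * (1 / (10 * D))) := by gcongr; exact min_le_right _ _
        _ = 1 / 2 := by field_simp; norm_num
  refine ⟨t₂, ht₂, h8, fun δ hδ hδt f β G₁ G₂ hf hβ hG1 hG2 hw hf0 hfT hf1 => ?_⟩
  set Φ : ℝ → ℝ := fun t => (1 - step (t / t₂)) ^ 2 / tau δ t with hΦ
  have hτc : ContDiff ℝ 1 (tau δ) := tau_contDiff hδ (n := 1)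
  have hsc : ContDiff ℝ 1 step := step_contDiff (n := 1)
  have hΦc : ContDiff ℝ 1 Φ := by
    refine ContDiff.div ?_ hτc fun t => (tau_pos hδ t).ne'
    exact (contDiff_const.sub (hsc.comp (contDiff_id.div_const t₂))).pow 2
  have hΦT : ContDiff ℝ 1 fun x => Φ (g.T x) := hΦc.comp hT
  have hu : ContDiff ℝ 1 fun x => f x ^ 2 * Φ (g.T x) := (hf.pow 2).mul hΦT
  have key := g.wall.square_div g.T_smooth ht₁ g.grad hβ hG1 hG2 hw (hu.mul hT1) (hu.mul hT2)
  have cf := hf.continuous; have cT := hT.continuous; have cT1 := hT1.continuous; have cT2 := hT2.continuous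
  have cu := hu.continuous
  have k1 := d1_cont (hu.mul hT1); have k2 := d2_cont (hu.mul hT2)
  have cτ : Continuous fun x => tau δ (g.T x) := hτc.continuous.comp cT
  have cτ0 : ∀ x, tau δ (g.T x) ^ 2 ≠ 0 := fun x => pow_ne_zero _ (tau_pos hδ _).ne'
  have cs := hsc.continuous
  have i0 : IntegrableOn (fun x => (G₁ x ^ 2 + G₂ x ^ 2) * f x ^ 2) Ω := intOn_of_cont hbd (by fun_prop)
  have i1 : IntegrableOn (fun x => β x ^ 2 * (f x ^ 2 * (1 - step (g.T x / t₂)) ^ 2 / tau δ (g.T x) ^ 2)) Ω :=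
    intOn_of_cont hbd (by fun_prop (disch := exact cτ0))
  have i2 : IntegrableOn (fun x => β x ^ 2) Ω := intOn_of_cont hbd (by fun_prop)
  have i3 : IntegrableOn (fun x => β x ^ 2 * (f x ^ 2 / tau δ (g.T x) ^ 2)) Ω :=
    intOn_of_cont hbd (by fun_prop (disch := exact cτ0))
  have step1 : ∫ x in Ω, β x ^ 2 * (f x ^ 2 * (1 - step (g.T x / t₂)) ^ 2 / tau δ (g.T x) ^ 2) ≤
      16 * ∫ x in Ω, (G₁ x ^ 2 + G₂ x ^ 2) * f x ^ 2 := by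
    have s := integral_sub (i0.const_mul 4) (i1.const_mul (1 / 4))
    rw [integral_const_mul, integral_const_mul] at s
    suffices h : (0 : ℝ) ≤ ∫ x in Ω, (4 * ((G₁ x ^ 2 + G₂ x ^ 2) * f x ^ 2) -
        1 / 4 * (β x ^ 2 * (f x ^ 2 * (1 - step (g.T x / t₂)) ^ 2 / tau δ (g.T x) ^ 2))) by linarith
    rw [← key]
    refine setIntegral_mono_on (intOn_of_cont hbd (by fun_prop)) ((i0.const_mul 4).sub (i1.const_mul (1 / 4)))
      g.wall.isOpen.measurableSet fun x hx => ?_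
    have hTx := g.wall.pos x hx
    obtain ⟨e, he, he0, hde⟩ := hardy_weight hδ ht₂ hTx.le
    have z1 : d1 (fun y => f y ^ 2 * Φ (g.T y)) x =
        2 * f x * d1 f x * Φ (g.T x) + f x ^ 2 * (e * d1 g.T x) := by
      rw [d1_mul ((cdAt hf x).fun_pow 2) (cdAt hΦT x), d1_comp (hasDerivAt_pow 2 (f x)) (cdAt hf x),
        d1_comp hde (cdAt hT x)]
      push_cast; ring
    have z2 : d2 (fun y => f y ^ 2 * Φ (g.T y)) x =
        2 * f x * d2 f x * Φ (g.T x) + f x ^ 2 * (e * d2 g.T x) := by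
      rw [d2_mul ((cdAt hf x).fun_pow 2) (cdAt hΦT x), d2_comp (hasDerivAt_pow 2 (f x)) (cdAt hf x),
        d2_comp hde (cdAt hT x)]
      push_cast; ring
    rw [d1_mul (cdAt hu x) (cdAt hT1 x), d2_mul (cdAt hu x) (cdAt hT2 x), z1, z2]
    have hτ := tau_pos hδ (g.T x)
    have hτb := tau_bounds hδ hTx.le
    have hDx := hD x (subset_closure hx)
    simp only [Pi.add_apply] at hDx
    have hΦx : Φ (g.T x) = (1 - step (g.T x / t₂)) ^ 2 / tau δ (g.T x) := rfl
    by_cases hc : 2 * t₂ ≤ g.T x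
    · have h1 : step (g.T x / t₂) = 1 := step_one (by rw [le_div_iff₀ ht₂]; exact hc)
      rw [he0 hc, hΦx, h1]
      simp only [sub_self, ne_eq, OfNat.ofNat_ne_zero, not_false_eq_true, zero_pow, zero_div, mul_zero,
        zero_mul, add_zero, sub_zero]
      positivity
    · rw [not_le] at hc
      have hTt : g.T x < g.t₁ := by linarith
      have hgr := g.grad x hx hTt
      have hfx := hfT x hx hTt
      have hfp := hf0 x hx
      have hL := (le_abs_self _).trans hDx
      rw [hΦx]
      have hχ : (1 - step (g.T x / t₂)) ^ 2 ≤ 1 := by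
        nlinarith [step_le_one (g.T x / t₂), step_nonneg (g.T x / t₂)]
      have hDτ : D * tau δ (g.T x) ≤ 1 / 2 := by
        refine le_trans (mul_le_mul_of_nonneg_left ?_ hD0.le) hDt
        linarith [hτb.2.2]
      exact le_trans (le_of_eq (by ring)) (hardy_pointwise (β := β x) (u := G₁ x) (v := G₂ x) hτ hfp hgr
        hfx hL hDτ hχ he)
  calc _ ≤ ∫ x in Ω, (β x ^ 2 * (f x ^ 2 * (1 - step (g.T x / t₂)) ^ 2 / tau δ (g.T x) ^ 2) +
        1 / t₂ ^ 2 * β x ^ 2) := by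
        refine setIntegral_mono_on i3 (i1.add (i2.const_mul _)) g.wall.isOpen.measurableSet fun x hx => ?_
        have hTx := g.wall.pos x hx
        have hτ := tau_pos hδ (g.T x)
        have hτb := tau_bounds hδ hTx.le
        by_cases h : g.T x ≤ t₂
        · rw [step_zero (by rw [div_le_one ht₂]; exact h)]
          have : 0 ≤ 1 / t₂ ^ 2 * β x ^ 2 := by positivity
          simpa using this
        · rw [not_le] at h
          rw [hf1 x hx h.le]
          have : 0 ≤ β x ^ 2 * (1 ^ 2 * (1 - step (g.T x / t₂)) ^ 2 / tau δ (g.T x) ^ 2) := by positivity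
          have h2 : (1 : ℝ) ^ 2 / tau δ (g.T x) ^ 2 ≤ 1 / t₂ ^ 2 := by
            rw [one_pow]
            have : t₂ ≤ tau δ (g.T x) := h.le.trans hτb.1
            gcongr
          nlinarith [sq_nonneg (β x)]
    _ ≤ _ := by
        rw [integral_add i1 (i2.const_mul _), integral_const_mul]
        linarith

namespace Geo
variable {Ω : Set Plane} (g : Geo Ω)

/-- The curvature defect cut off away from the wall. -/
def wt (t₂ : ℝ) (x : Plane) : ℝ := (g.km - g.k x) * (1 - step (2 / t₂ * g.T x))

/-- The curvature defect with a wider cut-off. -/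
def wide (t₂ : ℝ) (x : Plane) : ℝ := (g.km - g.k x) * (1 - step (1 / t₂ * g.T x))

lemma wt_smooth (t₂ : ℝ) : ContDiff ℝ 1 (g.wt t₂) := by
  have h1 := g.k_smooth
  have h2 : ContDiff ℝ 1 fun x => step (2 / t₂ * g.T x) :=
    (step_contDiff (n := 1)).comp (contDiff_const.mul g.wall.smooth)
  unfold wt; fun_prop

lemma wide_cont (t₂ : ℝ) : Continuous (g.wide t₂) := by
  have h1 := g.k_smooth.continuous
  have h2 : Continuous fun x => step (1 / t₂ * g.T x) :=
    (step_contDiff (n := 1)).continuous.comp (continuous_const.mul g.wall.smooth.continuous)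
  unfold wide; fun_prop

lemma wt_eq {t₂ : ℝ} (ht₂ : 0 < t₂) {x : Plane} (h : g.T x ≤ t₂ / 2) : g.wt t₂ x = g.km - g.k x := by
  unfold wt
  rw [step_zero, sub_zero, mul_one]
  rw [div_mul_eq_mul_div, div_le_one ht₂]; linarith

lemma wt_zero {t₂ : ℝ} (ht₂ : 0 < t₂) {x : Plane} (h : t₂ ≤ g.T x) : g.wt t₂ x = 0 := by
  unfold wt
  rw [step_one, sub_self, mul_zero]
  rw [div_mul_eq_mul_div, le_div_iff₀ ht₂]; linarith

lemma wide_eq {t₂ : ℝ} (ht₂ : 0 < t₂) {x : Plane} (h : g.T x ≤ t₂) : g.wide t₂ x = g.km - g.k x := by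
  unfold wide
  rw [step_zero, sub_zero, mul_one]
  rw [div_mul_eq_mul_div, div_le_one ht₂]; linarith

lemma wide_zero {t₂ : ℝ} (ht₂ : 0 < t₂) {x : Plane} (h : 2 * t₂ ≤ g.T x) : g.wide t₂ x = 0 := by
  unfold wide
  rw [step_one, sub_self, mul_zero]
  rw [div_mul_eq_mul_div, le_div_iff₀ ht₂]; linarith

lemma wt_nonneg {t₂ : ℝ} (ht₂ : 0 < t₂) (h8 : 8 * t₂ ≤ g.t₁) {x : Plane} (hx : x ∈ Ω) : 0 ≤ g.wt t₂ x := by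
  by_cases h : t₂ ≤ g.T x
  · rw [g.wt_zero ht₂ h]
  · exact mul_nonneg (by linarith [g.k_le x hx (by linarith)]) (by linarith [step_le_one (2 / t₂ * g.T x)])

lemma wide_nonneg {t₂ : ℝ} (ht₂ : 0 < t₂) (h8 : 8 * t₂ ≤ g.t₁) {x : Plane} (hx : x ∈ Ω) :
    0 ≤ g.wide t₂ x := by
  by_cases h : 2 * t₂ ≤ g.T x
  · rw [g.wide_zero ht₂ h]
  · exact mul_nonneg (by linarith [g.k_le x hx (by linarith)]) (by linarith [step_le_one (1 / t₂ * g.T x)])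

lemma wt_le_wide {t₂ : ℝ} (ht₂ : 0 < t₂) (h8 : 8 * t₂ ≤ g.t₁) {x : Plane} (hx : x ∈ Ω) :
    g.wt t₂ x ≤ g.wide t₂ x := by
  by_cases h : t₂ ≤ g.T x
  · rw [g.wt_zero ht₂ h]; exact g.wide_nonneg ht₂ h8 hx
  · rw [g.wide_eq ht₂ (by linarith)]
    exact mul_le_of_le_one_right (by linarith [g.k_le x hx (by linarith)])
      (by linarith [step_nonneg (2 / t₂ * g.T x)])

lemma wt_d (t₂ : ℝ) (x : Plane) :
    d1 (g.wt t₂) x = -d1 g.k x * (1 - step (2 / t₂ * g.T x)) -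
      (g.km - g.k x) * (deriv step (2 / t₂ * g.T x) * (2 / t₂)) * d1 g.T x ∧
    d2 (g.wt t₂) x = -d2 g.k x * (1 - step (2 / t₂ * g.T x)) -
      (g.km - g.k x) * (deriv step (2 / t₂ * g.T x) * (2 / t₂)) * d2 g.T x := by
  have h1 := cdAt g.k_smooth x
  have hs : HasDerivAt (fun t => 1 - step (2 / t₂ * t)) (-(deriv step (2 / t₂ * g.T x) * (2 / t₂))) (g.T x) := by
    have := ((step_hasDerivAt (2 / t₂ * g.T x)).comp (g.T x)
      ((hasDerivAt_id (g.T x)).const_mul (2 / t₂))).const_sub 1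
    refine this.congr_deriv ?_
    ring
  have hc : ContDiff ℝ 1 fun x => 1 - step (2 / t₂ * g.T x) :=
    contDiff_const.sub ((step_contDiff (n := 1)).comp (contDiff_const.mul g.wall.smooth))
  have e1 := d1_comp hs (cdAt g.wall.smooth x)
  have e2 := d2_comp hs (cdAt g.wall.smooth x)
  have hk : DifferentiableAt ℝ (fun y => g.km - g.k y) x := h1.const_sub _
  constructor
  · show d1 (fun y => (g.km - g.k y) * (1 - step (2 / t₂ * g.T y))) x = _
    rw [d1_mul hk (cdAt hc x), e1, d1_sub (by fun_prop) h1, d1_const]; ring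
  · show d2 (fun y => (g.km - g.k y) * (1 - step (2 / t₂ * g.T y))) x = _
    rw [d2_mul hk (cdAt hc x), e2, d2_sub (by fun_prop) h1, d2_const]; ring

lemma wt_grad {t₂ : ℝ} (ht₂ : 0 < t₂) (h8 : 8 * t₂ ≤ g.t₁) : ∃ C > 0, ∀ x ∈ Ω,
    d1 (g.wt t₂) x ^ 2 + d2 (g.wt t₂) x ^ 2 ≤ C * g.wide t₂ x := by
  obtain ⟨K, hK0, hK⟩ := step_deriv_bound
  obtain ⟨M, hM0, hM⟩ := bound_of_cont g.wall.bdd (f := fun x => g.km - g.k x)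
    (continuous_const.sub g.k_smooth.continuous)
  have hCk := g.Ck_pos
  refine ⟨2 * g.Ck + 2 * (M * (K * (2 / t₂)) ^ 2), by positivity, fun x hx => ?_⟩
  by_cases h : g.T x ≤ t₂
  · have hT : g.T x < g.t₁ := by linarith
    rw [(g.wt_d t₂ x).1, (g.wt_d t₂ x).2, g.wide_eq ht₂ h]
    have hg := g.grad x hx hT
    have hd := g.dk x hx hT
    have hk := g.k_le x hx hT
    have hMx := (le_abs_self _).trans (hM x (subset_closure hx))
    have hKx := hK (2 / t₂ * g.T x)
    have hs0 := step_nonneg (2 / t₂ * g.T x)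
    have hs1 := step_le_one (2 / t₂ * g.T x)
    have hp : 0 < 2 / t₂ := by positivity
    have hq : (deriv step (2 / t₂ * g.T x) * (2 / t₂)) ^ 2 ≤ (K * (2 / t₂)) ^ 2 := by
      rw [mul_pow, mul_pow]
      have : deriv step (2 / t₂ * g.T x) ^ 2 ≤ K ^ 2 := by rw [← sq_abs]; gcongr
      gcongr
    have hχ : (1 - step (2 / t₂ * g.T x)) ^ 2 ≤ 1 := by nlinarith
    generalize deriv step (2 / t₂ * g.T x) * (2 / t₂) = q at *
    generalize 1 - step (2 / t₂ * g.T x) = χ at *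
    generalize (K * (2 / t₂)) ^ 2 = N at *
    have hD0 : 0 ≤ g.km - g.k x := by linarith
    generalize g.km - g.k x = D at *
    generalize d1 g.k x = k1 at *
    generalize d2 g.k x = k2 at *
    generalize d1 g.T x = p1 at *
    generalize d2 g.T x = p2 at *
    have r1 : (k1 ^ 2 + k2 ^ 2) * χ ^ 2 ≤ g.Ck * D := (mul_le_of_le_one_right (by positivity) hχ).trans hd
    have r2 : D ^ 2 * q ^ 2 ≤ D * (M * N) := by
      rw [sq D, mul_assoc]
      exact mul_le_mul_of_nonneg_left (mul_le_mul hMx hq (by positivity) hM0.le) hD0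
    calc _ ≤ 2 * ((k1 ^ 2 + k2 ^ 2) * χ ^ 2) + 2 * (D ^ 2 * q ^ 2 * (p1 ^ 2 + p2 ^ 2)) := by
          nlinarith [sq_nonneg (k1 * χ - D * q * p1), sq_nonneg (k2 * χ - D * q * p2)]
      _ ≤ _ := by rw [hg]; linarith
  · rw [not_le] at h
    have h2 : 2 < 2 / t₂ * g.T x := by
      rw [div_mul_eq_mul_div, lt_div_iff₀ ht₂]; linarith
    rw [(g.wt_d t₂ x).1, (g.wt_d t₂ x).2, step_deriv_zero_right h2, step_one h2.le]
    have := g.wide_nonneg ht₂ h8 hx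
    simp only [sub_self, mul_zero, zero_mul, ne_eq, OfNat.ofNat_ne_zero, not_false_eq_true, zero_pow,
      add_zero]
    positivity

lemma wt_normal {t₂ : ℝ} (ht₂ : 0 < t₂) {x : Plane} (hx : x ∈ Ω) (hT : g.T x < g.t₁) :
    d1 (g.wt t₂) x * d1 g.T x + d2 (g.wt t₂) x * d2 g.T x ≤ 0 := by
  rw [(g.wt_d t₂ x).1, (g.wt_d t₂ x).2]
  have hg := g.grad x hx hT
  have ho := g.orth x hx hT
  have hk := g.k_le x hx hT
  have hs := step_deriv_nonneg (2 / t₂ * g.T x)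
  have : 0 ≤ (g.km - g.k x) * (deriv step (2 / t₂ * g.T x) * (2 / t₂)) :=
    mul_nonneg (by linarith) (by positivity)
  calc _ = -(1 - step (2 / t₂ * g.T x)) * (d1 g.k x * d1 g.T x + d2 g.k x * d2 g.T x) -
        (g.km - g.k x) * (deriv step (2 / t₂ * g.T x) * (2 / t₂)) * (d1 g.T x ^ 2 + d2 g.T x ^ 2) := by ring
    _ ≤ 0 := by rw [ho, hg]; linarith

/-- The exponential weight. -/
def ewt (t₂ l : ℝ) (x : Plane) : ℝ := Real.exp (l * g.wt t₂ x)

lemma ewt_smooth (t₂ l : ℝ) : ContDiff ℝ 1 (g.ewt t₂ l) :=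
  Real.contDiff_exp.comp (contDiff_const.mul (g.wt_smooth t₂))

lemma ewt_d (t₂ l : ℝ) (x : Plane) : d1 (g.ewt t₂ l) x = l * g.ewt t₂ l x * d1 (g.wt t₂) x ∧
    d2 (g.ewt t₂ l) x = l * g.ewt t₂ l x * d2 (g.wt t₂) x := by
  have h : HasDerivAt (fun t => Real.exp (l * t)) (l * g.ewt t₂ l x) (g.wt t₂ x) := by
    have := (((hasDerivAt_id (g.wt t₂ x)).const_mul l)).exp
    refine this.congr_deriv ?_
    simp only [id, ewt]; ring
  exact ⟨d1_comp h (cdAt (g.wt_smooth t₂) x), d2_comp h (cdAt (g.wt_smooth t₂) x)⟩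

lemma ewt_pos (t₂ l : ℝ) (x : Plane) : 0 < g.ewt t₂ l x := Real.exp_pos _

lemma one_le_ewt {t₂ l : ℝ} (ht₂ : 0 < t₂) (h8 : 8 * t₂ ≤ g.t₁) (hl : 0 ≤ l) {x : Plane} (hx : x ∈ Ω) :
    1 ≤ g.ewt t₂ l x :=
  Real.one_le_exp (mul_nonneg hl (g.wt_nonneg ht₂ h8 hx))

lemma ewt_grad {t₂ : ℝ} (ht₂ : 0 < t₂) (h8 : 8 * t₂ ≤ g.t₁) : ∃ C > 0, ∀ l : ℝ, ∀ x ∈ Ω,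
    d1 (g.ewt t₂ l) x ^ 2 + d2 (g.ewt t₂ l) x ^ 2 ≤ C * l ^ 2 * g.wide t₂ x * g.ewt t₂ l x ^ 2 := by
  obtain ⟨C, hC, h⟩ := g.wt_grad ht₂ h8
  refine ⟨C, hC, fun l x hx => ?_⟩
  rw [(g.ewt_d t₂ l x).1, (g.ewt_d t₂ l x).2]
  have := mul_le_mul_of_nonneg_left (h x hx) (show 0 ≤ l ^ 2 * g.ewt t₂ l x ^ 2 by positivity)
  calc _ = l ^ 2 * g.ewt t₂ l x ^ 2 * (d1 (g.wt t₂) x ^ 2 + d2 (g.wt t₂) x ^ 2) := by ring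
    _ ≤ _ := this
    _ = _ := by ring

lemma ewt_normal {t₂ l : ℝ} (ht₂ : 0 < t₂) (hl : 0 ≤ l) {x : Plane} (hx : x ∈ Ω) (hT : g.T x < g.t₁) :
    d1 (g.ewt t₂ l) x * d1 g.T x + d2 (g.ewt t₂ l) x * d2 g.T x ≤ 0 := by
  rw [(g.ewt_d t₂ l x).1, (g.ewt_d t₂ l x).2]
  calc _ = l * g.ewt t₂ l x * (d1 (g.wt t₂) x * d1 g.T x + d2 (g.wt t₂) x * d2 g.T x) := by ring
    _ ≤ 0 := mul_nonpos_of_nonneg_of_nonpos (mul_nonneg hl (g.ewt_pos _ _ _).le) (g.wt_normal ht₂ hx hT)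

end Geo

lemma exists_tau_cont {Ω : Set Plane} (g : Geo Ω) {δ : ℝ} (hδ : 0 < δ) : Continuous fun x => tau δ (g.T x) :=
  (tau_contDiff hδ (n := 1)).continuous.comp g.wall.smooth.continuous

/-- Weighted decay of the induced field of a minimizer. -/
theorem Geo.field_decay {Ω : Set Plane} (g : Geo Ω) : ∃ t₂ > 0, 8 * t₂ ≤ g.t₁ ∧ ∃ C > 0, ∀ κ H : ℝ,
    0 < κ → 1 / κ ≤ t₂ → κ ^ 2 ≤ κ * H → ∀ A₁ A₂ a b : Plane → ℝ, RMin Ω κ H A₁ A₂ a b →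
    ∀ f : Plane → ℝ, ContDiff ℝ 1 f → (∀ x ∈ Ω, 1 ≤ f x) →
    (∀ x ∈ Ω, g.T x < g.t₁ → d1 f x * d1 g.T x + d2 f x * d2 g.T x ≤ 0) →
    (∀ x ∈ Ω, t₂ ≤ g.T x → f x = 1) →
    (∀ x ∈ Ω, d1 f x ^ 2 + d2 f x ^ 2 ≤ κ ^ 2 * f x ^ 2) →
    κ ^ 2 * ∫ x in Ω, (curlf A₁ A₂ x - 1) ^ 2 * (f x ^ 2 / tau (1 / κ) (g.T x) ^ 2) ≤
      C * ∫ x in Ω, f x ^ 2 * (a x ^ 2 + b x ^ 2) := by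
  obtain ⟨t₂, ht₂, h8, hh⟩ := g.hardy
  refine ⟨t₂, ht₂, h8, 96 + 1 / t₂ ^ 2, by positivity, ?_⟩
  intro κ H hκ hκt hB A₁ A₂ a b R f hf hf1 hfn hfe hfg
  have hbd := g.wall.bdd
  have ho := g.wall.isOpen
  have ha := R.a_smooth; have hb := R.b_smooth; have h1 := R.A₁_smooth; have h2 := R.A₂_smooth
  have ca := ha.continuous; have cb := hb.continuous; have cf := hf.continuous
  have cc := curlf_cont h1 h2
  have cd := dsq_cont (B := κ * H) h1 h2 ha hb
  have c1 := cur1_cont (B := κ * H) h1 ha hb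
  have c2 := cur2_cont (B := κ * H) h2 ha hb
  have hκ2 : 0 < κ ^ 2 := by positivity
  have hB0 : 0 < κ * H := hκ2.trans_le hB
  have key := hh (1 / κ) (by positivity) hκt f (fun x => curlf A₁ A₂ x - 1)
    (fun x => -(1 / (κ * H)) * cur2 (κ * H) A₂ a b x) (fun x => 1 / (κ * H) * cur1 (κ * H) A₁ a b x) hf
    (by fun_prop) (by fun_prop) (by fun_prop) ?_ (fun x hx => zero_le_one.trans (hf1 x hx)) hfn hfe
  · set W := ∫ x in Ω, f x ^ 2 * (a x ^ 2 + b x ^ 2) with hW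
    have e1 := R.weighted_gradient hbd hf hfg ho
    have e2 := R.energy_bound hbd
    have e3 : ∫ x in Ω, (a x ^ 2 + b x ^ 2) ≤ W := by
      refine setIntegral_mono_on (intOn_of_cont hbd (by fun_prop)) (intOn_of_cont hbd (by fun_prop))
        ho.measurableSet fun x hx => ?_
      have := hf1 x hx
      exact le_mul_of_one_le_left (by positivity) (one_le_pow₀ this)
    have e4 : ∫ x in Ω, ((-(1 / (κ * H)) * cur2 (κ * H) A₂ a b x) ^ 2 +
        (1 / (κ * H) * cur1 (κ * H) A₁ a b x) ^ 2) * f x ^ 2 ≤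
        (1 / (κ * H)) ^ 2 * ∫ x in Ω, f x ^ 2 * dsq (κ * H) A₁ A₂ a b x := by
      rw [← integral_const_mul]
      refine setIntegral_mono_on (intOn_of_cont hbd (by fun_prop)) (intOn_of_cont hbd (by fun_prop))
        ho.measurableSet fun x hx => ?_
      have r := cur_sq_le (κ * H) A₁ A₂ a b x
      have rl := R.le_one ho hbd hκ.ne' x hx
      have rd := dsq_nonneg (κ * H) A₁ A₂ a b x
      have r2 : cur1 (κ * H) A₁ a b x ^ 2 + cur2 (κ * H) A₂ a b x ^ 2 ≤ dsq (κ * H) A₁ A₂ a b x :=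
        r.trans (mul_le_of_le_one_left rd rl)
      calc _ = (1 / (κ * H)) ^ 2 * (f x ^ 2 * (cur1 (κ * H) A₁ a b x ^ 2 + cur2 (κ * H) A₂ a b x ^ 2)) := by ring
        _ ≤ _ := by gcongr
    have hW0 : 0 ≤ W := setIntegral_nonneg ho.measurableSet fun x _ => by positivity
    have hq : κ ^ 2 * (1 / (κ * H)) ^ 2 * κ ^ 2 ≤ 1 := by
      rw [div_pow, one_pow, mul_one_div, div_mul_eq_mul_div, div_le_one (by positivity)]
      nlinarith
    have hβ : ∫ x in Ω, (curlf A₁ A₂ x - 1) ^ 2 ≤ (1 / (κ * H)) ^ 2 * (κ ^ 2 * W) := by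
      rw [div_pow, one_pow, div_mul_eq_mul_div, one_mul, le_div_iff₀ (by positivity), mul_comm]
      exact e2.trans (by gcongr)
    have hsum := mul_le_mul_of_nonneg_left hq hW0
    calc _ ≤ κ ^ 2 * (16 * ((1 / (κ * H)) ^ 2 * ((2 * κ ^ 2 + 4 * κ ^ 2) * W)) +
          1 / t₂ ^ 2 * ((1 / (κ * H)) ^ 2 * (κ ^ 2 * W))) := by
          refine mul_le_mul_of_nonneg_left (key.trans ?_) hκ2.le
          have := e4.trans (mul_le_mul_of_nonneg_left e1 (by positivity))
          gcongr
      _ = (96 + 1 / t₂ ^ 2) * (W * (κ ^ 2 * (1 / (κ * H)) ^ 2 * κ ^ 2)) := by ring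
      _ ≤ (96 + 1 / t₂ ^ 2) * W := by
          refine mul_le_mul_of_nonneg_left ?_ (by positivity); linarith
  · intro Y₁ Y₂ hY1 hY2
    have e := R.current hbd hB0.ne' hY1 hY2
    have := mul_left_cancel₀ hB0.ne' (a := κ * H)
      (b := ∫ x in Ω, (curlf A₁ A₂ x - 1) * (d1 Y₁ x + d2 Y₂ x))
      (c := 1 / (κ * H) * ∫ x in Ω, (cur2 (κ * H) A₂ a b x * Y₁ x - cur1 (κ * H) A₁ a b x * Y₂ x))
      (by rw [e, ← mul_assoc, mul_one_div_cancel hB0.ne', one_mul])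
    rw [this, ← integral_const_mul, ← integral_neg]
    refine integral_congr_ae (ae_of_all _ fun x => ?_)
    simp only; ring

/-- Linearity of the integral for three terms. -/
lemma integral_lin3 {Ω : Set Plane} {F G h : Plane → ℝ} (hF : IntegrableOn F Ω) (hG : IntegrableOn G Ω)
    (hh : IntegrableOn h Ω) (p q r : ℝ) : IntegrableOn (fun x => p * F x + q * G x + r * h x) Ω ∧
      ∫ x in Ω, (p * F x + q * G x + r * h x) =
        p * (∫ x in Ω, F x) + q * (∫ x in Ω, G x) + r * ∫ x in Ω, h x := by
  have e1 : IntegrableOn (fun x => p * F x + q * G x) Ω := (hF.const_mul p).add (hG.const_mul q)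
  refine ⟨e1.add (hh.const_mul r), ?_⟩
  rw [integral_add e1 (hh.const_mul r), integral_add (hF.const_mul p) (hG.const_mul q),
    integral_const_mul, integral_const_mul, integral_const_mul]

lemma young_field {F T w β τ η N : ℝ} (hw0 : 0 ≤ w) (hw1 : w ≤ 1) (hτ : 0 < τ) (hT : 0 ≤ T) (hN : τ * T ≤ N)
    (hη : 0 < η) :
    |β| * ((F * T) ^ 2 * w) ≤ 1 / (2 * η) * (β ^ 2 * (F ^ 2 / τ ^ 2)) + η / 2 * N ^ 2 * (T ^ 2 * (F ^ 2 * w)) := by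
  have h1 : (τ * T) ^ 2 ≤ N ^ 2 := pow_le_pow_left₀ (by positivity) hN 2
  have h2 : w ^ 2 ≤ w := by nlinarith
  have e : |β| * ((F * T) ^ 2 * w) = (|β| * |F| / τ) * (τ * T * T * |F| * w) := by
    rw [mul_pow, ← sq_abs F]; field_simp
  have y : ∀ p q : ℝ, p * q ≤ 1 / (2 * η) * p ^ 2 + η / 2 * q ^ 2 := fun p q => by
    have : 1 / (2 * η) * p ^ 2 + η / 2 * q ^ 2 - p * q = (p - η * q) ^ 2 / (2 * η) := by field_simp; ring
    have : 0 ≤ (p - η * q) ^ 2 / (2 * η) := by positivity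
    linarith
  rw [e]
  refine (y _ _).trans (add_le_add (le_of_eq ?_) ?_)
  · rw [div_pow, mul_pow, sq_abs, sq_abs]; ring
  · calc η / 2 * (τ * T * T * |F| * w) ^ 2 = η / 2 * ((τ * T) ^ 2 * (T ^ 2 * (|F| ^ 2 * w ^ 2))) := by ring
      _ ≤ η / 2 * (N ^ 2 * (T ^ 2 * (|F| ^ 2 * w))) := by gcongr
      _ = _ := by rw [sq_abs]; ring

lemma moment_pointwise {F T w β τ η N u v p q B κ K C₁ L : ℝ} (hw0 : 0 ≤ w) (hw1 : w ≤ 1) (hτ : 0 < τ)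
    (hT : 0 ≤ T) (hN : τ * T ≤ N) (hη : 0 < η) (hg : u ^ 2 + v ^ 2 ≤ C₁ * κ * F ^ 2) (hL : p ^ 2 + q ^ 2 ≤ L)
    (hB0 : 0 ≤ B) (hBK : B ≤ K * κ ^ 2) :
    ((u * T + F * p) ^ 2 + (v * T + F * q) ^ 2) * w + κ ^ 2 * ((F * T) ^ 2 * (w * (1 - w))) -
        B * (1 + β) * ((F * T) ^ 2 * w) ≤
      (κ ^ 2 - B) * (T ^ 2 * (F ^ 2 * w)) + 2 * C₁ * κ * (T ^ 2 * (F ^ 2 * w)) + 2 * L * (F ^ 2 * w) +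
        K * κ ^ 2 * (1 / (2 * η)) * (β ^ 2 * (F ^ 2 / τ ^ 2)) +
        K * κ ^ 2 * (η / 2 * N ^ 2) * (T ^ 2 * (F ^ 2 * w)) := by
  have y := young_field (β := β) (F := F) hw0 hw1 hτ hT hN hη
  have yb : 0 ≤ |β| * ((F * T) ^ 2 * w) := by positivity
  have h1 : -(B * β * ((F * T) ^ 2 * w)) ≤ K * κ ^ 2 * (1 / (2 * η) * (β ^ 2 * (F ^ 2 / τ ^ 2)) +
      η / 2 * N ^ 2 * (T ^ 2 * (F ^ 2 * w))) := by
    have hb := mul_le_mul_of_nonneg_right (neg_abs_le β) (show 0 ≤ B * ((F * T) ^ 2 * w) by positivity)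
    calc -(B * β * ((F * T) ^ 2 * w)) ≤ B * (|β| * ((F * T) ^ 2 * w)) := by linarith
      _ ≤ K * κ ^ 2 * (|β| * ((F * T) ^ 2 * w)) := mul_le_mul_of_nonneg_right hBK yb
      _ ≤ _ := mul_le_mul_of_nonneg_left y (hB0.trans hBK)
  have h2 : (u * T + F * p) ^ 2 + (v * T + F * q) ^ 2 ≤ 2 * (T ^ 2 * (C₁ * κ * F ^ 2)) + 2 * (F ^ 2 * L) := by
    have r1 := mul_le_mul_of_nonneg_left hg (sq_nonneg T)
    have r2 := mul_le_mul_of_nonneg_left hL (sq_nonneg F)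
    nlinarith [sq_nonneg (u * T - F * p), sq_nonneg (v * T - F * q)]
  have h3 := mul_le_mul_of_nonneg_right h2 hw0
  have h4 : κ ^ 2 * ((F * T) ^ 2 * (w * (1 - w))) ≤ κ ^ 2 * ((F * T) ^ 2 * w) := by
    have : w * (1 - w) ≤ w := by nlinarith
    gcongr
  nlinarith

/-- The second moment of the weighted density of a minimizer in the distance to the wall. -/
theorem Geo.moment {Ω : Set Plane} (g : Geo Ω) {c K C₀ C₁ : ℝ} (hc : 0 < c) (hK : 0 < K) (hC₀ : 0 < C₀)
    (hC₁ : 0 < C₁) : ∃ C > 0, ∃ κ₀ > 0, ∀ κ ≥ κ₀, ∀ H : ℝ, κ * H ≤ K * κ ^ 2 → c * κ ^ 2 ≤ κ * H - κ ^ 2 →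
    ∀ A₁ A₂ a b : Plane → ℝ, RMin Ω κ H A₁ A₂ a b → ∀ f : Plane → ℝ, ContDiff ℝ 1 f →
    (∀ x ∈ Ω, d1 f x ^ 2 + d2 f x ^ 2 ≤ C₁ * κ * f x ^ 2) →
    κ ^ 2 * ∫ x in Ω, (curlf A₁ A₂ x - 1) ^ 2 * (f x ^ 2 / tau (1 / κ) (g.T x) ^ 2) ≤
      C₀ * ∫ x in Ω, f x ^ 2 * (a x ^ 2 + b x ^ 2) →
    κ ^ 2 * ∫ x in Ω, g.T x ^ 2 * (f x ^ 2 * (a x ^ 2 + b x ^ 2)) ≤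
      C * ∫ x in Ω, f x ^ 2 * (a x ^ 2 + b x ^ 2) := by
  have hbd := g.wall.bdd
  have ho := g.wall.isOpen
  have hT := g.wall.smooth
  have cT := hT.continuous
  have k3 := d1_cont hT; have k4 := d2_cont hT
  obtain ⟨L, hL0, hL⟩ := bound_of_cont hbd (f := fun x => d1 g.T x ^ 2 + d2 g.T x ^ 2) (by fun_prop)
  obtain ⟨Tm, hTm0, hTm⟩ := bound_of_cont hbd cT
  set N := (2 * Tm + 1) * Tm with hN
  have hN0 : 0 < N := by positivity
  set η := c / (2 * K * N ^ 2) with hη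
  have hη0 : 0 < η := by positivity
  have hηe : K * (η / 2 * N ^ 2) = c / 4 := by rw [hη]; field_simp; norm_num
  clear_value η N
  refine ⟨2 / c * (2 * L + K * (1 / (2 * η)) * C₀), by positivity, 1 + 8 * C₁ / c, by positivity, ?_⟩
  intro κ hκ H hBK hcB A₁ A₂ a b R f hf hfg hD
  have hκ1 : 1 ≤ κ := le_trans (by linarith [show 0 ≤ 8 * C₁ / c by positivity]) hκ
  have hκ0 : 0 < κ := by linarith
  have hκc : 8 * C₁ ≤ κ * c := (div_le_iff₀ hc).1 (by linarith)
  have ha := R.a_smooth; have hb := R.b_smooth; have h1 := R.A₁_smooth; have h2 := R.A₂_smooth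
  have ca := ha.continuous; have cb := hb.continuous; have cf := hf.continuous
  have cc := curlf_cont h1 h2
  have k1 := d1_cont hf; have k2 := d2_cont hf
  have hδ : 0 < 1 / κ := by positivity
  have cτ := exists_tau_cont g hδ
  have cτ0 : ∀ x, tau (1 / κ) (g.T x) ^ 2 ≠ 0 := fun x => (pow_pos (tau_pos hδ _) 2).ne'
  obtain ⟨Ma, hMa0, hMa⟩ := bound_of_cont hbd (f := fun x => f x * a x) (by fun_prop)
  obtain ⟨Mb, hMb0, hMb⟩ := bound_of_cont hbd (f := fun x => f x * b x) (by fun_prop)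
  have hh : ContDiff ℝ 1 fun x => f x * g.T x := hf.mul hT
  have kh1 := d1_cont hh; have kh2 := d2_cont hh
  have hB0 : 0 ≤ κ * H := by nlinarith [mul_pos hc (pow_pos hκ0 2)]
  have key := g.wall.curl_le (hh.mul ha) (hh.mul hb) R.a_supp.mul_left R.b_supp.mul_left h1 h2 (κ * H)
    (C := Ma + Mb) ?_ ?_
  · have en := R.weighted_energy hbd hh
    have key2 := key.trans_eq en
    rw [← sub_nonneg, ← integral_sub (intOn_of_cont hbd (by fun_prop)) (intOn_of_cont hbd (by fun_prop))] at key2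
    set W := ∫ x in Ω, f x ^ 2 * (a x ^ 2 + b x ^ 2) with hW
    set MT := ∫ x in Ω, g.T x ^ 2 * (f x ^ 2 * (a x ^ 2 + b x ^ 2)) with hMT
    set D := ∫ x in Ω, (curlf A₁ A₂ x - 1) ^ 2 * (f x ^ 2 / tau (1 / κ) (g.T x) ^ 2) with hDD
    have i1 : IntegrableOn (fun x => g.T x ^ 2 * (f x ^ 2 * (a x ^ 2 + b x ^ 2))) Ω :=
      intOn_of_cont hbd (by fun_prop)
    have i2 : IntegrableOn (fun x => f x ^ 2 * (a x ^ 2 + b x ^ 2)) Ω := intOn_of_cont hbd (by fun_prop)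
    have i3 : IntegrableOn (fun x => (curlf A₁ A₂ x - 1) ^ 2 * (f x ^ 2 / tau (1 / κ) (g.T x) ^ 2)) Ω :=
      intOn_of_cont hbd (by fun_prop (disch := exact cτ0))
    have hMT0 : 0 ≤ MT := setIntegral_nonneg ho.measurableSet fun x _ => by positivity
    have up : (0 : ℝ) ≤ ((κ ^ 2 - κ * H) + 2 * C₁ * κ + K * κ ^ 2 * (η / 2 * N ^ 2)) * MT + 2 * L * W +
        K * κ ^ 2 * (1 / (2 * η)) * D := by
      obtain ⟨j, e⟩ := integral_lin3 i1 i2 i3 ((κ ^ 2 - κ * H) + 2 * C₁ * κ + K * κ ^ 2 * (η / 2 * N ^ 2)) (2 * L)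
        (K * κ ^ 2 * (1 / (2 * η)))
      rw [hMT, hW, hDD, ← e]
      refine key2.trans (setIntegral_mono_on (intOn_of_cont hbd (by fun_prop))
        j ho.measurableSet fun x hx => ?_)
      have hTx := (g.wall.pos x hx).le
      have hTmx := (le_abs_self _).trans (hTm x (subset_closure hx))
      have htau := (tau_bounds hδ hTx).2.2
      have hδ1 : 1 / κ ≤ 1 := by rw [div_le_one hκ0]; exact hκ1
      have hNx : tau (1 / κ) (g.T x) * g.T x ≤ N := by
        rw [hN]
        exact mul_le_mul (by linarith) hTmx hTx (by positivity)
      have := moment_pointwise (β := curlf A₁ A₂ x - 1) (by positivity : 0 ≤ a x ^ 2 + b x ^ 2)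
        (R.le_one ho hbd hκ0.ne' x hx) (tau_pos hδ (g.T x)) hTx hNx hη0 (hfg x hx)
        ((le_abs_self _).trans (hL x (subset_closure hx))) hB0 hBK
      rw [d1_mul (cdAt hf x) (cdAt hT x), d2_mul (cdAt hf x) (cdAt hT x)]
      refine le_trans (le_of_eq ?_) (this.trans (le_of_eq ?_)) <;> ring
    have hco : (κ ^ 2 - κ * H) + 2 * C₁ * κ + K * κ ^ 2 * (η / 2 * N ^ 2) ≤ -(c / 2 * κ ^ 2) := by
      have : K * κ ^ 2 * (η / 2 * N ^ 2) = c / 4 * κ ^ 2 := by rw [← hηe]; ring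
      nlinarith
    have h5 := mul_le_mul_of_nonneg_right hco hMT0
    have h6 := mul_le_mul_of_nonneg_left hD (show 0 ≤ K * (1 / (2 * η)) by positivity)
    have h7 : c / 2 * (κ ^ 2 * MT) ≤ (2 * L + K * (1 / (2 * η)) * C₀) * W := by nlinarith
    calc κ ^ 2 * MT = 2 / c * (c / 2 * (κ ^ 2 * MT)) := by field_simp
      _ ≤ 2 / c * ((2 * L + K * (1 / (2 * η)) * C₀) * W) := by gcongr
      _ = _ := by ring
  · intro x hx
    have hTx := (g.wall.pos x hx).le
    have := mul_le_mul_of_nonneg_right (hMa x (subset_closure hx)) hTx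
    rw [mul_right_comm, abs_mul, abs_of_nonneg hTx]
    nlinarith
  · intro x hx
    have hTx := (g.wall.pos x hx).le
    have := mul_le_mul_of_nonneg_right (hMb x (subset_closure hx)) hTx
    rw [mul_right_comm, abs_mul, abs_of_nonneg hTx]
    nlinarith

lemma field_pointwise {F T w β τ δ : ℝ} (hw0 : 0 ≤ w) (hw1 : w ≤ 1) (hτ : 0 < τ)
    (hτT : τ ≤ 2 * T + δ) :
    |β| * (F ^ 2 * w) ≤ 1 / 2 * (β ^ 2 * (F ^ 2 / τ ^ 2)) + 4 * (T ^ 2 * (F ^ 2 * w)) + δ ^ 2 * (F ^ 2 * w) := by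
  have h2 : w ^ 2 ≤ w := by nlinarith
  have h1 : τ ^ 2 ≤ 8 * T ^ 2 + 2 * δ ^ 2 := by
    have := pow_le_pow_left₀ hτ.le hτT 2
    nlinarith [sq_nonneg (2 * T - δ)]
  have e : |β| * (F ^ 2 * w) = (|β| * |F| / τ) * (τ * |F| * w) := by
    rw [← sq_abs F]; field_simp
  have y : ∀ p q : ℝ, p * q ≤ 1 / 2 * p ^ 2 + 1 / 2 * q ^ 2 := fun p q => by nlinarith [sq_nonneg (p - q)]
  rw [e]
  refine (y _ _).trans ?_
  have e1 : (|β| * |F| / τ) ^ 2 = β ^ 2 * (F ^ 2 / τ ^ 2) := by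
    rw [div_pow, mul_pow, sq_abs, sq_abs]; ring
  have e2 : (τ * |F| * w) ^ 2 ≤ (8 * T ^ 2 + 2 * δ ^ 2) * (F ^ 2 * w) := by
    rw [mul_pow, mul_pow, sq_abs, mul_assoc]; gcongr
  rw [e1]; linarith

/-- The induced field is negligible against the weighted density of a minimizer. -/
theorem Geo.field_small {Ω : Set Plane} (g : Geo Ω) : ∃ t₂ > 0, 8 * t₂ ≤ g.t₁ ∧ ∀ c > 0, ∀ K > 0, ∀ C₁ > 0,
    ∃ C > 0, ∃ κ₀ > 0, ∀ κ ≥ κ₀, ∀ H : ℝ, κ * H ≤ K * κ ^ 2 → c * κ ^ 2 ≤ κ * H - κ ^ 2 →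
    ∀ A₁ A₂ a b : Plane → ℝ, RMin Ω κ H A₁ A₂ a b → ∀ f : Plane → ℝ, ContDiff ℝ 1 f → (∀ x ∈ Ω, 1 ≤ f x) →
    (∀ x ∈ Ω, g.T x < g.t₁ → d1 f x * d1 g.T x + d2 f x * d2 g.T x ≤ 0) →
    (∀ x ∈ Ω, t₂ ≤ g.T x → f x = 1) →
    (∀ x ∈ Ω, d1 f x ^ 2 + d2 f x ^ 2 ≤ C₁ * κ * f x ^ 2) →
    κ ^ 2 * ∫ x in Ω, |curlf A₁ A₂ x - 1| * (f x ^ 2 * (a x ^ 2 + b x ^ 2)) ≤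
      C * ∫ x in Ω, f x ^ 2 * (a x ^ 2 + b x ^ 2) := by
  have hbd := g.wall.bdd
  have ho := g.wall.isOpen
  have hT := g.wall.smooth
  have cT := hT.continuous
  obtain ⟨t₂, ht₂, h8, C₀, hC₀, hdec⟩ := g.field_decay
  refine ⟨t₂, ht₂, h8, fun c hc K hK C₁ hC₁ => ?_⟩
  obtain ⟨C, hC, κ₀, hκ₀, hmom⟩ := g.moment hc hK hC₀ hC₁
  refine ⟨1 / 2 * C₀ + 4 * C + 1, by positivity, κ₀ + 1 / t₂ + C₁, by positivity, ?_⟩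
  intro κ hκ H hBK hcB A₁ A₂ a b R f hf hf1 hfn hfe hfg
  have ht₂' : 0 < 1 / t₂ := by positivity
  have hκ0 : 0 < κ := by linarith
  have hκt : 1 / κ ≤ t₂ := by rw [one_div_le hκ0 ht₂]; linarith
  have ha := R.a_smooth; have hb := R.b_smooth; have h1 := R.A₁_smooth; have h2 := R.A₂_smooth
  have ca := ha.continuous; have cb := hb.continuous; have cf := hf.continuous
  have cc := curlf_cont h1 h2
  have hδ : 0 < 1 / κ := by positivity
  have cτ := exists_tau_cont g hδ
  have cτ0 : ∀ x, tau (1 / κ) (g.T x) ^ 2 ≠ 0 := fun x => (pow_pos (tau_pos hδ _) 2).ne'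
  have hD := hdec κ H hκ0 hκt (by nlinarith [mul_pos hc (pow_pos hκ0 2)]) A₁ A₂ a b R f hf hf1 hfn hfe
    fun x hx => (hfg x hx).trans (by rw [sq κ]; gcongr; linarith)
  have hM := hmom κ (by linarith) H hBK hcB A₁ A₂ a b R f hf hfg hD
  set W := ∫ x in Ω, f x ^ 2 * (a x ^ 2 + b x ^ 2) with hW
  set MT := ∫ x in Ω, g.T x ^ 2 * (f x ^ 2 * (a x ^ 2 + b x ^ 2)) with hMT
  set D := ∫ x in Ω, (curlf A₁ A₂ x - 1) ^ 2 * (f x ^ 2 / tau (1 / κ) (g.T x) ^ 2) with hDD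
  have i1 : IntegrableOn (fun x => g.T x ^ 2 * (f x ^ 2 * (a x ^ 2 + b x ^ 2))) Ω :=
    intOn_of_cont hbd (by fun_prop)
  have i2 : IntegrableOn (fun x => f x ^ 2 * (a x ^ 2 + b x ^ 2)) Ω := intOn_of_cont hbd (by fun_prop)
  have i3 : IntegrableOn (fun x => (curlf A₁ A₂ x - 1) ^ 2 * (f x ^ 2 / tau (1 / κ) (g.T x) ^ 2)) Ω :=
    intOn_of_cont hbd (by fun_prop (disch := exact cτ0))
  have up : ∫ x in Ω, |curlf A₁ A₂ x - 1| * (f x ^ 2 * (a x ^ 2 + b x ^ 2)) ≤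
      1 / 2 * D + 4 * MT + (1 / κ) ^ 2 * W := by
    obtain ⟨j, e⟩ := integral_lin3 i3 i1 i2 (1 / 2) 4 ((1 / κ) ^ 2)
    rw [hMT, hW, hDD, ← e]
    refine setIntegral_mono_on (intOn_of_cont hbd (by fun_prop)) j ho.measurableSet fun x hx => ?_
    have hTx := (g.wall.pos x hx).le
    exact field_pointwise (by positivity) (R.le_one ho hbd hκ0.ne' x hx) (tau_pos hδ _)
      (tau_bounds hδ hTx).2.2
  have hk : κ ^ 2 * (1 / κ) ^ 2 = 1 := by rw [← mul_pow, mul_one_div_cancel hκ0.ne', one_pow]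
  calc _ ≤ κ ^ 2 * (1 / 2 * D + 4 * MT + (1 / κ) ^ 2 * W) := by gcongr
    _ = 1 / 2 * (κ ^ 2 * D) + 4 * (κ ^ 2 * MT) + κ ^ 2 * (1 / κ) ^ 2 * W := by ring
    _ ≤ _ := by rw [hk]; linarith

/-- The global potential controls the curvature defect. -/
lemma Geo.glob_ge_wide {Ω : Set Plane} (g : Geo Ω) (m : Model) {t₂ : ℝ} (ht₂ : 0 < t₂) (h8 : 8 * t₂ ≤ g.t₁) :
    ∃ S > 0, ∀ s ≥ S, ∀ c : Plane → ℝ, ∀ x ∈ Ω,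
      m.Θ * s ^ 2 - m.C₁ * s * g.km + m.C₁ * s * g.wide t₂ x - s ^ 2 * |c x - 1| ≤ g.glob m s c x := by
  obtain ⟨K, hK0, hK⟩ := bound_of_cont g.wall.bdd g.k_smooth.continuous
  have hC1 := m.C₁_pos
  have hΘ : 0 < 1 - m.Θ := by linarith [m.Θ_lt]
  refine ⟨m.C₁ * (K + |g.km|) / (1 - m.Θ), by positivity, fun s hs c x hx => ?_⟩
  have hs0 : 0 < s := lt_of_lt_of_le (by positivity) hs
  have hsΘ : m.C₁ * (K + |g.km|) ≤ s * (1 - m.Θ) := (div_le_iff₀ hΘ).1 hs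
  have hG := g.Gt_mem m hs0 hx
  have hβ : -(s ^ 2 * |c x - 1|) ≤ s ^ 2 * g.Gt m s x * (c x - 1) := by
    have h1 : g.Gt m s x * |c x - 1| ≤ |c x - 1| := mul_le_of_le_one_left (abs_nonneg _) hG.2
    have h2 : -(g.Gt m s x * |c x - 1|) ≤ g.Gt m s x * (c x - 1) := by
      rw [← mul_neg]; exact mul_le_mul_of_nonneg_left (neg_abs_le _) hG.1
    have := mul_le_mul_of_nonneg_left ((neg_le_neg h1).trans h2) (sq_nonneg s)
    linarith
  have hk := abs_le.1 (hK x (subset_closure hx))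
  have hkm := neg_abs_le g.km
  have hCs : 0 < m.C₁ * s := mul_pos hC1 hs0
  have hth := g.th_sq x
  suffices h : m.Θ * s ^ 2 - m.C₁ * s * g.km + m.C₁ * s * g.wide t₂ x ≤
      g.th1 x ^ 2 * (m.Θ * s ^ 2 - m.C₁ * s * g.k x) + g.th2 x ^ 2 * s ^ 2 by
    unfold glob; linarith
  have hbulk : 0 ≤ (1 - m.Θ) * s ^ 2 + m.C₁ * s * g.k x := by
    have h1 : m.C₁ * (K + |g.km|) * s ≤ s * (1 - m.Θ) * s := by gcongr
    have h2 := mul_le_mul_of_nonneg_left hk.1 hCs.le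
    have h3 : 0 ≤ m.C₁ * s * |g.km| := by positivity
    linarith
  rw [show g.th1 x ^ 2 = 1 - g.th2 x ^ 2 by linarith]
  have hq := mul_nonneg (sq_nonneg (g.th2 x)) hbulk
  by_cases hT : g.T x ≤ g.t₁ / 4
  · have hd : 0 ≤ g.km - g.k x := by linarith [g.k_le x hx (by linarith [g.t₁_pos])]
    have hw : g.wide t₂ x ≤ g.km - g.k x :=
      mul_le_of_le_one_right hd (by linarith [step_nonneg (1 / t₂ * g.T x)])
    have := mul_le_mul_of_nonneg_left hw hCs.le
    linarith
  · rw [not_le] at hT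
    rw [g.wide_zero ht₂ (by linarith)]
    by_cases hT1 : g.T x < g.t₁
    · have := mul_le_mul_of_nonneg_left (g.k_le x hx hT1) hCs.le
      linarith
    · rw [not_lt] at hT1
      have h0 := g.th1_zero (x := x) (by linarith [g.t₁_pos])
      rw [h0] at hth
      have h2 : g.th2 x ^ 2 = 1 := by linarith
      rw [h2]
      have h1 : m.C₁ * (K + |g.km|) * s ≤ s * (1 - m.Θ) * s := by gcongr
      have h3 : 0 ≤ m.C₁ * s * (K + |g.km| + g.km) := mul_nonneg hCs.le (by linarith)
      linarith

lemma convex_pointwise {X P : ℝ} (hX : 0 ≤ X) :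
    Real.exp X ^ 2 ≤ (X - P) * Real.exp X ^ 2 + Real.exp (3 * (P + 1)) := by
  have e1 : Real.exp (3 * (P + 1)) = Real.exp (P + 1) * Real.exp (P + 1) ^ 2 := by
    rw [← Real.exp_nat_mul, ← Real.exp_add]; congr 1; push_cast; ring
  rw [e1]
  by_cases h : P + 1 ≤ X
  · have : Real.exp X ^ 2 ≤ (X - P) * Real.exp X ^ 2 := le_mul_of_one_le_left (by positivity) (by linarith)
    have : 0 ≤ Real.exp (P + 1) * Real.exp (P + 1) ^ 2 := by positivity
    linarith
  · rw [not_le] at h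
    have h1 : P + 1 ≤ Real.exp (P + 1) := by linarith [Real.add_one_le_exp (P + 1)]
    have h2 : Real.exp X ^ 2 ≤ Real.exp (P + 1) ^ 2 := by gcongr
    have h3 : (P + 1) * Real.exp X ^ 2 ≤ Real.exp (P + 1) * Real.exp (P + 1) ^ 2 := by gcongr
    have h4 : 0 ≤ X * Real.exp X ^ 2 := by positivity
    linarith

set_option maxHeartbeats 1000000 in
/-- Exponential decay in the tangential direction, with a mean value of the exponent. -/
theorem Fit.mean_exponent {Ω : Set Plane} {Q : Tube Ω} {g : Geo Ω} (F : Fit Q g) (m : Model) :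
    ∃ t₂ > 0, 8 * t₂ ≤ g.t₁ ∧ ∃ α > 0, ∃ C > 0, ∃ κ₀ > 0, ∀ κ ≥ κ₀, ∀ H : ℝ, 0 < HC3low Ω κ - H →
      HC3low Ω κ - H ≤ 1 → ∀ A₁ A₂ a b : Plane → ℝ, RMin Ω κ H A₁ A₂ a b →
      α * √κ * (∫ x in Ω, g.wt t₂ x * (g.ewt t₂ (α * √κ) x ^ 2 * (a x ^ 2 + b x ^ 2))) ≤
        C * (1 + √κ * (HC3low Ω κ - H)) * ∫ x in Ω, g.ewt t₂ (α * √κ) x ^ 2 * (a x ^ 2 + b x ^ 2) := by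
  have hbd := g.wall.bdd
  have ho := g.wall.isOpen
  obtain ⟨t₂, ht₂, h8, hsmall⟩ := g.field_small
  obtain ⟨Cf, hCf, c, hc, κ₁, hκ₁, hfield⟩ := F.field_bounds m
  obtain ⟨Cl, hCl, hlow⟩ := g.global_lower m
  obtain ⟨Cg, hCg, hgrad⟩ := g.ewt_grad ht₂ h8
  obtain ⟨S, hS, hglob⟩ := g.glob_ge_wide m ht₂ h8
  have cwide := g.wide_cont t₂
  have cwt := (g.wt_smooth t₂).continuous
  obtain ⟨D, hD0, hD⟩ := bound_of_cont hbd cwide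
  obtain ⟨Cs, hCs, κ₂, hκ₂, hsm⟩ := hsmall c hc (Cf ^ 2) (by positivity) (Cg * D) (by positivity)
  have hC1 := m.C₁_pos
  set α := min 1 (m.C₁ * c / (2 * Cg)) with hα
  have hα0 : 0 < α := lt_min one_pos (by positivity)
  have hα1 : α ≤ 1 := min_le_left _ _
  have hαC : Cg * α ≤ m.C₁ * c / 2 := by
    have : α ≤ m.C₁ * c / (2 * Cg) := min_le_right _ _
    rw [le_div_iff₀ (by positivity)] at this
    linarith
  clear_value α
  have hαα : α ^ 2 ≤ α := by nlinarith
  set E := 2 / (m.C₁ * c) with hE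
  have hE0 : 0 < E := by positivity
  have hEe : E * (m.C₁ * c / 2) = 1 := by rw [hE]; field_simp
  refine ⟨t₂, ht₂, h8, α, hα0, E * (Cf + Cl + Cf ^ 2 * Cs), by positivity, 1 + κ₁ + κ₂ + S / c, by positivity, ?_⟩
  intro κ hκ H hρ0 hρ1 A₁ A₂ a b R
  have hSc : 0 < S / c := by positivity
  have hκ1 : 1 ≤ κ := by linarith
  have hκ0 : 0 < κ := by linarith
  obtain ⟨s, hs0, hB, hcs, hsC, hκ2, hgap⟩ := hfield κ (by linarith) H hρ0 hρ1
  have hsS : S ≤ s := by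
    have : S / c ≤ κ := by linarith
    rw [div_le_iff₀ hc] at this
    linarith
  have hBK : κ * H ≤ Cf ^ 2 * κ ^ 2 := by
    rw [hB, ← mul_pow]; exact pow_le_pow_left₀ hs0.le hsC 2
  set l := α * √κ with hl
  have hl0 : 0 ≤ l := by positivity
  have hl2 : l ^ 2 = α ^ 2 * κ := by rw [hl, mul_pow, Real.sq_sqrt hκ0.le]
  have hf := g.ewt_smooth t₂ l
  have hf1 : ∀ x ∈ Ω, 1 ≤ g.ewt t₂ l x := fun x hx => g.one_le_ewt ht₂ h8 hl0 hx
  have hfg := hgrad l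
  have hsm' := hsm κ (by linarith) H hBK (by rw [hB]; exact hgap) A₁ A₂ a b R (g.ewt t₂ l) hf hf1
    (fun x hx hT => g.ewt_normal ht₂ hl0 hx hT)
    (fun x hx hT => by rw [Geo.ewt, g.wt_zero ht₂ hT, mul_zero, Real.exp_zero]) ?_
  swap
  · intro x hx
    refine (hfg x hx).trans ?_
    have h1 : g.wide t₂ x ≤ D := (le_abs_self _).trans (hD x (subset_closure hx))
    have h0 := g.wide_nonneg ht₂ h8 hx
    have h2 : l ^ 2 ≤ κ := by
      rw [hl2]; exact mul_le_of_le_one_left hκ0.le (by nlinarith)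
    calc Cg * l ^ 2 * g.wide t₂ x * g.ewt t₂ l x ^ 2 ≤ Cg * κ * D * g.ewt t₂ l x ^ 2 := by gcongr
      _ = _ := by ring
  have ha := R.a_smooth; have hb := R.b_smooth; have h1 := R.A₁_smooth; have h2 := R.A₂_smooth
  have ca := ha.continuous; have cb := hb.continuous
  have cc := curlf_cont h1 h2
  generalize hfdef : g.ewt t₂ l = f at *
  have cf := hf.continuous
  have k1 := d1_cont hf; have k2 := d2_cont hf
  have cG := g.glob_cont m (s := s) cc
  have low := hlow s hs0 (fun x => f x * a x) (fun x => f x * b x) A₁ A₂ (hf.mul ha) (hf.mul hb)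
    R.a_supp.mul_left R.b_supp.mul_left h1 h2
  rw [← hB, R.weighted_energy hbd hf, ← sub_nonneg,
    ← integral_sub (intOn_of_cont hbd (by fun_prop)) (intOn_of_cont hbd (by fun_prop))] at low
  have i1 : IntegrableOn (fun x => g.wide t₂ x * (f x ^ 2 * (a x ^ 2 + b x ^ 2))) Ω :=
    intOn_of_cont hbd (by fun_prop)
  have i2 : IntegrableOn (fun x => f x ^ 2 * (a x ^ 2 + b x ^ 2)) Ω := intOn_of_cont hbd (by fun_prop)
  have i3 : IntegrableOn (fun x => |curlf A₁ A₂ x - 1| * (f x ^ 2 * (a x ^ 2 + b x ^ 2))) Ω :=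
    intOn_of_cont hbd (by fun_prop)
  have hwt : ∫ x in Ω, g.wt t₂ x * (f x ^ 2 * (a x ^ 2 + b x ^ 2)) ≤
      ∫ x in Ω, g.wide t₂ x * (f x ^ 2 * (a x ^ 2 + b x ^ 2)) := by
    refine setIntegral_mono_on (intOn_of_cont hbd (by fun_prop)) i1 ho.measurableSet fun x hx => ?_
    have := g.wt_le_wide ht₂ h8 hx
    gcongr
  have hV0 : 0 ≤ ∫ x in Ω, g.wide t₂ x * (f x ^ 2 * (a x ^ 2 + b x ^ 2)) :=
    setIntegral_nonneg ho.measurableSet fun x hx =>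
      mul_nonneg (g.wide_nonneg ht₂ h8 hx) (by positivity)
  have hW0 : 0 ≤ ∫ x in Ω, f x ^ 2 * (a x ^ 2 + b x ^ 2) :=
    setIntegral_nonneg ho.measurableSet fun x _ => by positivity
  have main : (0 : ℝ) ≤ (Cg * l ^ 2 - m.C₁ * s) * (∫ x in Ω, g.wide t₂ x * (f x ^ 2 * (a x ^ 2 + b x ^ 2))) +
      (κ ^ 2 - m.Θ * s ^ 2 + m.C₁ * s * g.km + Cl) * (∫ x in Ω, f x ^ 2 * (a x ^ 2 + b x ^ 2)) +
      s ^ 2 * ∫ x in Ω, |curlf A₁ A₂ x - 1| * (f x ^ 2 * (a x ^ 2 + b x ^ 2)) := by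
    obtain ⟨j, e⟩ := integral_lin3 i1 i2 i3 (Cg * l ^ 2 - m.C₁ * s)
      (κ ^ 2 - m.Θ * s ^ 2 + m.C₁ * s * g.km + Cl) (s ^ 2)
    rw [← e]
    refine low.trans (setIntegral_mono_on (intOn_of_cont hbd (by fun_prop)) j ho.measurableSet fun x hx => ?_)
    have q1 := hfg x hx
    have q2 := hglob s hsS (curlf A₁ A₂) x hx
    have hw : 0 ≤ a x ^ 2 + b x ^ 2 := by positivity
    have q3 := mul_le_mul_of_nonneg_right q1 hw
    have q4 := mul_le_mul_of_nonneg_right q2 (show 0 ≤ f x ^ 2 * (a x ^ 2 + b x ^ 2) by positivity)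
    have q5 : 0 ≤ κ ^ 2 * (f x ^ 2 * (a x ^ 2 + b x ^ 2) ^ 2) := by positivity
    rw [mul_pow, mul_pow]
    linarith
  generalize (∫ x in Ω, g.wide t₂ x * (f x ^ 2 * (a x ^ 2 + b x ^ 2))) = V at *
  generalize (∫ x in Ω, f x ^ 2 * (a x ^ 2 + b x ^ 2)) = W at *
  generalize (∫ x in Ω, |curlf A₁ A₂ x - 1| * (f x ^ 2 * (a x ^ 2 + b x ^ 2))) = Y at *
  generalize (∫ x in Ω, g.wt t₂ x * (f x ^ 2 * (a x ^ 2 + b x ^ 2))) = U at *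
  have hY : s ^ 2 * Y ≤ Cf ^ 2 * Cs * W := by
    have hY0 : 0 ≤ κ ^ 2 * Y ∨ κ ^ 2 * Y ≤ 0 := le_total _ _
    have hs2 : s ^ 2 ≤ Cf ^ 2 * κ ^ 2 := by rw [← hB]; exact hBK
    rcases hY0 with h | h
    · have hYn : 0 ≤ Y := nonneg_of_mul_nonneg_right h (by positivity)
      calc s ^ 2 * Y ≤ Cf ^ 2 * κ ^ 2 * Y := by gcongr
        _ = Cf ^ 2 * (κ ^ 2 * Y) := by ring
        _ ≤ Cf ^ 2 * (Cs * W) := by gcongr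
        _ = _ := by ring
    · have hYn : Y ≤ 0 := by
        by_contra hy
        have : 0 < κ ^ 2 * Y := mul_pos (by positivity) (not_le.1 hy)
        linarith
      exact (mul_nonpos_of_nonneg_of_nonpos (by positivity) hYn).trans (by positivity)
  have hVc : Cg * l ^ 2 - m.C₁ * s ≤ -(m.C₁ * c / 2 * κ) := by
    rw [hl2]
    have e1 : Cg * (α ^ 2 * κ) ≤ m.C₁ * c / 2 * κ := by
      rw [← mul_assoc]
      refine mul_le_mul_of_nonneg_right ?_ hκ0.le
      exact (mul_le_mul_of_nonneg_left hαα hCg.le).trans hαC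
    have e2 := mul_le_mul_of_nonneg_left hcs hC1.le
    linarith
  have hV := mul_le_mul_of_nonneg_right hVc hV0
  have hsq : √κ * √κ = κ := Real.mul_self_sqrt hκ0.le
  have hsq1 : 1 ≤ √κ := Real.one_le_sqrt.2 hκ1
  generalize HC3low Ω κ - H = ρ at *
  have hWc : κ ^ 2 - m.Θ * s ^ 2 + m.C₁ * s * g.km + Cl + Cf ^ 2 * Cs ≤
      (Cf + Cl + Cf ^ 2 * Cs) * (√κ + κ * ρ) := by
    have e1 : 1 ≤ √κ + κ * ρ := by
      have : 0 ≤ κ * ρ := by positivity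
      linarith
    have e2 : Cl + Cf ^ 2 * Cs ≤ (Cl + Cf ^ 2 * Cs) * (√κ + κ * ρ) := le_mul_of_one_le_right (by positivity) e1
    linarith
  have hW := mul_le_mul_of_nonneg_right hWc hW0
  have fin : m.C₁ * c / 2 * (κ * V) ≤ (Cf + Cl + Cf ^ 2 * Cs) * (√κ + κ * ρ) * W := by linarith
  have fin2 : κ * V ≤ E * ((Cf + Cl + Cf ^ 2 * Cs) * (√κ + κ * ρ) * W) := by
    calc κ * V = E * (m.C₁ * c / 2) * (κ * V) := by rw [hEe, one_mul]
      _ = E * (m.C₁ * c / 2 * (κ * V)) := by ring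
      _ ≤ _ := by gcongr
  have fin3 : √κ * (√κ * V) ≤ √κ * (E * (Cf + Cl + Cf ^ 2 * Cs) * (1 + √κ * ρ) * W) := by
    calc √κ * (√κ * V) = κ * V := by rw [← mul_assoc, hsq]
      _ ≤ _ := fin2
      _ = E * (Cf + Cl + Cf ^ 2 * Cs) * (√κ + √κ * √κ * ρ) * W := by rw [hsq]; ring
      _ = _ := by ring
  have fin4 := le_of_mul_le_mul_left fin3 (by linarith)
  calc l * U ≤ l * V := by gcongr
    _ = α * (√κ * V) := by rw [hl]; ring
    _ ≤ 1 * (√κ * V) := by gcongr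
    _ ≤ _ := by rw [one_mul]; exact fin4

lemma Tube.isOpen_dist_lt {Ω : Set Plane} (Q : Tube Ω) (r : ℝ) : IsOpen {x | distBdry Ω x < r} := by
  have : {x | distBdry Ω x < r} = ⋃ y ∈ frontier Ω, {x | Real.sqrt (esq (x - y)) < r} := by
    ext x
    simp only [mem_ofPred_eq, mem_iUnion, exists_prop]
    constructor
    · intro h
      have hne : ((fun y => Real.sqrt (esq (x - y))) '' frontier Ω).Nonempty :=
        ⟨_, mem_image_of_mem _ (Q.P.range_eq ▸ mem_range_self 0)⟩
      obtain ⟨_, ⟨y, hy, rfl⟩, hlt⟩ := exists_lt_of_csInf_lt hne h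
      exact ⟨y, hy, hlt⟩
    · rintro ⟨y, hy, h⟩
      exact (distBdry_le hy).trans_lt h
  rw [this]
  refine isOpen_biUnion fun y _ => isOpen_lt ?_ continuous_const
  unfold esq; fun_prop

/-- Exponential decay in the tangential direction. -/
theorem Fit.weighted_mass {Ω : Set Plane} {Q : Tube Ω} {g : Geo Ω} (F : Fit Q g) :
    ∃ t₂ > 0, 8 * t₂ ≤ g.t₁ ∧ ∃ α > 0, ∃ C > 0, ∃ κ₀ > 0, ∀ κ ≥ κ₀, ∀ H : ℝ, 0 < HC3low Ω κ - H →
      HC3low Ω κ - H ≤ 1 → ∀ A₁ A₂ a b : Plane → ℝ, RMin Ω κ H A₁ A₂ a b →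
      (∫ x in Ω, g.ewt t₂ (α * √κ) x ^ 2 * (a x ^ 2 + b x ^ 2)) ≤
        Real.exp (C * (1 + √κ * (HC3low Ω κ - H))) * ∫ x in Ω, (a x ^ 2 + b x ^ 2) := by
  obtain ⟨m⟩ := exists_model
  have hbd := g.wall.bdd
  have ho := g.wall.isOpen
  obtain ⟨t₂, ht₂, h8, α, hα, C, hC, κ₀, hκ₀, h⟩ := F.mean_exponent m
  refine ⟨t₂, ht₂, h8, α, hα, 3 * (C + 1), by positivity, κ₀, hκ₀, fun κ hκ H hρ0 hρ1 A₁ A₂ a b R => ?_⟩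
  have hm := h κ hκ H hρ0 hρ1 A₁ A₂ a b R
  have ca := R.a_smooth.continuous; have cb := R.b_smooth.continuous
  have cf := (g.ewt_smooth t₂ (α * √κ)).continuous
  have cw := (g.wt_smooth t₂).continuous
  generalize HC3low Ω κ - H = ρ at *
  have hp : 0 ≤ √κ * ρ := by positivity
  set P := C * (1 + √κ * ρ) with hP
  have i1 : IntegrableOn (fun x => g.wt t₂ x * (g.ewt t₂ (α * √κ) x ^ 2 * (a x ^ 2 + b x ^ 2))) Ω :=
    intOn_of_cont hbd (by fun_prop)
  have i2 : IntegrableOn (fun x => g.ewt t₂ (α * √κ) x ^ 2 * (a x ^ 2 + b x ^ 2)) Ω :=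
    intOn_of_cont hbd (by fun_prop)
  have i3 : IntegrableOn (fun x => a x ^ 2 + b x ^ 2) Ω := intOn_of_cont hbd (by fun_prop)
  have key : (∫ x in Ω, g.ewt t₂ (α * √κ) x ^ 2 * (a x ^ 2 + b x ^ 2)) ≤
      α * √κ * (∫ x in Ω, g.wt t₂ x * (g.ewt t₂ (α * √κ) x ^ 2 * (a x ^ 2 + b x ^ 2))) +
      -P * (∫ x in Ω, g.ewt t₂ (α * √κ) x ^ 2 * (a x ^ 2 + b x ^ 2)) +
      Real.exp (3 * (P + 1)) * ∫ x in Ω, (a x ^ 2 + b x ^ 2) := by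
    obtain ⟨j, e⟩ := integral_lin3 i1 i2 i3 (α * √κ) (-P) (Real.exp (3 * (P + 1)))
    rw [← e]
    refine setIntegral_mono_on i2 j ho.measurableSet fun x hx => ?_
    have c := convex_pointwise (X := α * √κ * g.wt t₂ x) (P := P)
      (mul_nonneg (by positivity) (g.wt_nonneg ht₂ h8 hx))
    have := mul_le_mul_of_nonneg_right c (show 0 ≤ a x ^ 2 + b x ^ 2 by positivity)
    unfold Geo.ewt
    linarith
  have hw0 : 0 ≤ ∫ x in Ω, (a x ^ 2 + b x ^ 2) := setIntegral_nonneg ho.measurableSet fun x _ => by positivity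
  refine le_trans (by linarith) (mul_le_mul_of_nonneg_right (Real.exp_le_exp.2 ?_) hw0)
  · rw [hP]; linarith

lemma Fit.weight_le {Ω : Set Plane} {Q : Tube Ω} {g : Geo Ω} (F : Fit Q g) {t₂ α : ℝ} (ht₂ : 0 < t₂)
    (h8 : 8 * t₂ ≤ g.t₁) {χ : ℝ → ℝ} (hχ_mem : ∀ x, χ x ∈ Icc (0 : ℝ) 1)
    (hχ_supp : Function.support χ ⊆ Ioo (-2 : ℝ) 2) {κ : ℝ} (hκ : 4 / t₂ ≤ κ ^ ((1 : ℝ) / 4)) {x : Plane}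
    (hx : x ∈ Ω) (hd : distBdry Ω x < Q.t₀) {s : ℝ} (hs : Q.P.Phi (s, distBdry Ω x) = x) :
    χ (κ ^ ((1 : ℝ) / 4) * distBdry Ω x) ^ 2 *
      Real.exp (2 * α * √κ * (kmaxOf Q.P.γ - curvOf Q.P.γ s)) ≤ g.ewt t₂ (α * √κ) x ^ 2 := by
  by_cases h0 : χ (κ ^ ((1 : ℝ) / 4) * distBdry Ω x) = 0
  · rw [h0]; simp [sq_nonneg]
  have hs2 := (hχ_supp (Function.mem_support.2 h0)).2
  have hd0 := Q.dist_pos hx hd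
  have hdt : distBdry Ω x ≤ t₂ / 2 := by
    have h1 : 4 / t₂ * distBdry Ω x ≤ 2 := (mul_le_mul_of_nonneg_right hκ hd0.le).trans hs2.le
    rw [div_mul_eq_mul_div, div_le_iff₀ ht₂] at h1
    linarith
  have hxc := subset_closure hx
  have hT := F.T_of_lt hxc (by linarith)
  have hk := F.k_eq x hxc (by linarith)
  have hc : curvOf Q.P.γ (Q.foot x) = curvOf Q.P.γ s :=
    Q.curv_congr ⟨hd0.le, hd⟩ ⟨hd0.le, hd⟩ ((Q.Phi_foot hxc hd).trans hs.symm)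
  have hw := g.wt_eq ht₂ (x := x) (by rw [hT]; exact hdt)
  rw [F.km, hk, hc] at hw
  have hχ := hχ_mem (κ ^ ((1 : ℝ) / 4) * distBdry Ω x)
  rw [Geo.ewt, hw, ← Real.exp_nat_mul]
  refine (mul_le_of_le_one_left (Real.exp_pos _).le (pow_le_one₀ hχ.1 hχ.2)).trans (le_of_eq ?_)
  congr 1; push_cast; ring

end SC

open SC in
/-- Tangential Agmon estimates for minimizers of the Ginzburg–Landau
functional just below the critical field: with `ρ(κ) = H_{C3}(κ) - H(κ) → 0⁺`, every
minimizer `(ψ, A)` at `(κ, H(κ))` satisfies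
`∫ χ₁(κ^{1/4}t(x))² e^{2α√κ K(s(x))} |ψ|² ≤ C e^{Cρ√κ} ∫ |ψ|²` with `K = k_max - k`. -/
theorem tangential_agmon_nonlinear
    (Ω : Set SC.Plane) (hΩ_open : IsOpen Ω) (hΩ_bdd : Bornology.IsBounded Ω)
    (hΩ_sc : SimplyConnectedSpace ↥Ω) (P : SC.BoundaryParam Ω)
    (t₀ : ℝ) (ht₀ : 0 < t₀)
    (hinj : Set.InjOn (fun p : ℝ × ℝ => P.γ p.1 + p.2 • SC.nuVec P.γ p.1)
      (Set.Ico 0 P.L ×ˢ Set.Ico 0 t₀))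
    (himage : (fun p : ℝ × ℝ => P.γ p.1 + p.2 • SC.nuVec P.γ p.1) ''
        (Set.Ico 0 P.L ×ˢ Set.Ico 0 t₀) = {x ∈ closure Ω | SC.distBdry Ω x < t₀})
    (hdist : ∀ p ∈ Set.Ico (0 : ℝ) P.L ×ˢ Set.Ico (0 : ℝ) t₀,
      SC.distBdry Ω (P.γ p.1 + p.2 • SC.nuVec P.γ p.1) = p.2)
    (χ₁ : ℝ → ℝ) (hχ_smooth : ContDiff ℝ (⊤ : ℕ∞) χ₁)
    (hχ_mem : ∀ x, χ₁ x ∈ Set.Icc (0 : ℝ) 1)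
    (hχ_one : ∀ x ∈ Set.Icc (-1 : ℝ) 1, χ₁ x = 1)
    (hχ_supp : Function.support χ₁ ⊆ Set.Ioo (-2 : ℝ) 2)
    (H : ℝ → ℝ) (κ₁ : ℝ) (hρ_pos : ∀ κ ≥ κ₁, 0 < SC.HC3low Ω κ - H κ)
    (hρ_lim : Filter.Tendsto (fun κ => SC.HC3low Ω κ - H κ) Filter.atTop (nhds 0)) :
    ∃ α > 0, ∃ C > 0, ∀ κ > C, ∀ ψ A, SC.IsGLMin Ω κ (H κ) ψ A →
      ∀ σ : SC.Plane → ℝ,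
        (∀ x ∈ Ω, SC.distBdry Ω x < t₀ →
          σ x ∈ Set.Ico 0 P.L ∧
          P.γ (σ x) + (SC.distBdry Ω x) • SC.nuVec P.γ (σ x) = x) →
        (∫ x in {x ∈ Ω | SC.distBdry Ω x < t₀},
            (χ₁ (κ ^ ((1 : ℝ) / 4) * SC.distBdry Ω x)) ^ 2 *
              Real.exp (2 * α * Real.sqrt κ * (SC.kmaxOf P.γ - SC.curvOf P.γ (σ x))) *
              ‖ψ x‖ ^ 2)
          ≤ C * Real.exp (C * (SC.HC3low Ω κ - H κ) * Real.sqrt κ) *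
              ∫ x in Ω, ‖ψ x‖ ^ 2 := by
  let Q : Tube Ω := ⟨P, t₀, hΩ_open, hΩ_bdd, ht₀, hinj, himage, hdist⟩
  obtain ⟨g, F⟩ := Q.exists_fit
  obtain ⟨t₂, ht₂, h8, α, hα, C, hC, κ₀, hκ₀, h⟩ := F.weighted_mass
  obtain ⟨κ₂, hκ₂⟩ := eventually_atTop.1 (hρ_lim.eventually (eventually_le_nhds zero_lt_one))
  refine ⟨α, hα, Real.exp C + C + κ₀ + |κ₁| + |κ₂| + (4 / t₂) ^ 4, by positivity, ?_⟩
  intro κ hκ ψ A hmin σ hσ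
  have p1 := Real.exp_pos C
  have p2 := abs_nonneg κ₁
  have p3 := abs_nonneg κ₂
  have p4 : 0 < (4 / t₂) ^ 4 := by positivity
  have hρ0 := hρ_pos κ (by linarith [le_abs_self κ₁])
  have hρ1 := hκ₂ κ (by linarith [le_abs_self κ₂])
  obtain ⟨A₁, A₂, a, b, R, hψ⟩ := hmin.exists_RMin hΩ_open hΩ_bdd
  have hm := h κ (by linarith) (H κ) hρ0 hρ1 A₁ A₂ a b R
  have hκt : 4 / t₂ ≤ κ ^ ((1 : ℝ) / 4) := by
    rw [← Real.rpow_natCast] at p4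
    have h1 : ((4 / t₂) ^ 4 : ℝ) ^ ((1 : ℝ) / 4) ≤ κ ^ ((1 : ℝ) / 4) :=
      Real.rpow_le_rpow (by positivity) (by push_cast at p4 ⊢; linarith) (by norm_num)
    rwa [← Real.rpow_natCast, ← Real.rpow_mul (by positivity), show ((4 : ℕ) : ℝ) * (1 / 4) = 1 by norm_num,
      Real.rpow_one] at h1
  have ca := R.a_smooth.continuous; have cb := R.b_smooth.continuous
  have cf := (g.ewt_smooth t₂ (α * √κ)).continuous
  have i2 : IntegrableOn (fun x => g.ewt t₂ (α * √κ) x ^ 2 * (a x ^ 2 + b x ^ 2)) Ω :=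
    intOn_of_cont hΩ_bdd (by fun_prop)
  have eψ : ∫ x in Ω, ‖ψ x‖ ^ 2 = ∫ x in Ω, (a x ^ 2 + b x ^ 2) :=
    setIntegral_congr_fun hΩ_open.measurableSet hψ
  have hw0 : 0 ≤ ∫ x in Ω, (a x ^ 2 + b x ^ 2) :=
    setIntegral_nonneg hΩ_open.measurableSet fun x _ => by positivity
  have hS : MeasurableSet {x ∈ Ω | distBdry Ω x < t₀} := (hΩ_open.inter (Q.isOpen_dist_lt t₀)).measurableSet
  have hSΩ : {x ∈ Ω | distBdry Ω x < t₀} ⊆ Ω := fun x hx => hx.1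
  rw [eψ]
  set ρ := HC3low Ω κ - H κ
  have hfin : Real.exp (C * (1 + √κ * ρ)) ≤ (Real.exp C + C + κ₀ + |κ₁| + |κ₂| + (4 / t₂) ^ 4) *
      Real.exp ((Real.exp C + C + κ₀ + |κ₁| + |κ₂| + (4 / t₂) ^ 4) * ρ * √κ) := by
    rw [mul_add, mul_one, Real.exp_add]
    have hr : 0 ≤ ρ * √κ := by positivity
    refine mul_le_mul (by linarith) (Real.exp_le_exp.2 ?_) (Real.exp_pos _).le (by positivity)
    calc C * (√κ * ρ) = C * (ρ * √κ) := by ring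
      _ ≤ (Real.exp C + C + κ₀ + |κ₁| + |κ₂| + (4 / t₂) ^ 4) * (ρ * √κ) :=
        mul_le_mul_of_nonneg_right (by linarith) hr
      _ = _ := by ring
  refine le_trans ?_ (mul_le_mul_of_nonneg_right hfin hw0)
  by_cases hI : IntegrableOn (fun x => (χ₁ (κ ^ ((1 : ℝ) / 4) * distBdry Ω x)) ^ 2 *
      Real.exp (2 * α * √κ * (kmaxOf P.γ - curvOf P.γ (σ x))) * ‖ψ x‖ ^ 2) {x ∈ Ω | distBdry Ω x < t₀}
  · refine le_trans ?_ hm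
    refine le_trans (setIntegral_mono_on hI (i2.mono_set hSΩ) hS fun x hx => ?_)
      (setIntegral_mono_set i2 (ae_of_all _ fun x => ?_) hSΩ.eventuallyLE)
    · rw [hψ x hx.1]
      exact mul_le_mul_of_nonneg_right
        (F.weight_le ht₂ h8 hχ_mem hχ_supp hκt hx.1 hx.2 (hσ x hx.1 hx.2).2) (by positivity)
    · show (0 : ℝ) ≤ _
      positivity
  · rw [integral_undef hI]; positivity
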